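/- Let q = p^e be a prime power, G = SL(4,q), F the field with p elements, and M a finite-dimensional irreducible FG-module. Then dim H^2(G,M) < 2·dim M. -/

import Mathlib

set_option linter.unusedSectionVars false

namespace SL4

open Module

section RelDim

variable {k C C' : Type} [Field k] [AddCommGroup C'] [Module k C'] [FiniteDimensional k C']
  [AddCommGroup C] [Module k C] [FiniteDimensional k C]

/-- The dimension of `(Z + B) / B`. -/
noncomputable def relDim (Z B : Submodule k C) : ℕ := finrank k (Z.map B.mkQ)

lemma relDim_le_of_le_sup {Z Z' B : Submodule k C} (h : Z ≤ Z' ⊔ B) :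
    relDim Z B ≤ relDim Z' B := by
  apply Submodule.finrank_mono
  refine (Submodule.map_mono h).trans ?_
  rw [Submodule.map_sup, sup_le_iff]
  refine ⟨le_rfl, ?_⟩
  rintro _ ⟨b, hb, rfl⟩
  have : B.mkQ b = 0 := by simpa using hb
  rw [this]; exact zero_mem _

lemma relDim_eq_zero {Z B : Submodule k C} (h : Z ≤ B) : relDim Z B = 0 := by
  have : Z.map B.mkQ = ⊥ := by
    rw [eq_bot_iff]
    rintro _ ⟨b, hb, rfl⟩
    simpa using h hb
  rw [relDim, this, finrank_bot]

lemma relDim_le_add_ker (Φ : C →ₗ[k] C') (Z B : Submodule k C) (W : Submodule k C')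
    (hW : ∀ c ∈ Z, Φ c ∈ W) :
    relDim Z B ≤ finrank k W + relDim (Z ⊓ LinearMap.ker Φ) B := by
  obtain ⟨Y, hY⟩ := Submodule.exists_isCompl ((Z ⊓ LinearMap.ker Φ).comap Z.subtype)
  have e1 : Z = (Z ⊓ LinearMap.ker Φ) ⊔ Y.map Z.subtype := by
    have := congrArg (Submodule.map Z.subtype) hY.sup_eq_top
    rw [Submodule.map_sup, Submodule.map_comap_subtype, Submodule.map_subtype_top] at this
    rwa [inf_eq_right.2 (inf_le_left : Z ⊓ LinearMap.ker Φ ≤ Z), eq_comm] at this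
  have hinj : Function.Injective ((Φ ∘ₗ Z.subtype).domRestrict Y) := by
    rw [injective_iff_map_eq_zero]
    intro y hy
    have : (y : Z) ∈ (Z ⊓ LinearMap.ker Φ).comap Z.subtype := ⟨y.1.2, by simpa using hy⟩
    have := (Submodule.disjoint_def.1 hY.disjoint) _ this y.2
    exact Subtype.ext this
  have h1 : finrank k Y ≤ finrank k W :=
    LinearMap.finrank_le_finrank_of_injective
      (f := ((Φ ∘ₗ Z.subtype).domRestrict Y).codRestrict W (fun y => hW _ y.1.2))
      (fun a b h => hinj (congrArg Subtype.val h))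
  calc relDim Z B ≤ finrank k ((Z ⊓ LinearMap.ker Φ).map B.mkQ ⊔ (Y.map Z.subtype).map B.mkQ :
        Submodule k (C ⧸ B)) := by
        apply Submodule.finrank_mono
        rw [← Submodule.map_sup, ← e1]
    _ ≤ _ := Submodule.finrank_add_le_finrank_add_finrank _ _
    _ ≤ _ := by
      have := Submodule.finrank_map_le B.mkQ (Y.map Z.subtype)
      have := Submodule.finrank_map_le Z.subtype Y
      unfold relDim
      omega

lemma relDim_le_add (Ψ : C →ₗ[k] C') (Z B Z' : Submodule k C) (Z₁ B₁ : Submodule k C')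
    (h1 : ∀ c ∈ Z, Ψ c ∈ Z₁) (h2 : ∀ c ∈ Z, Ψ c ∈ B₁ → c ∈ Z' ⊔ B) :
    relDim Z B ≤ relDim Z₁ B₁ + relDim Z' B := by
  refine (relDim_le_add_ker (B₁.mkQ ∘ₗ Ψ) Z B (Z₁.map B₁.mkQ) ?_).trans ?_
  · intro c hc; exact ⟨_, h1 c hc, rfl⟩
  · refine add_le_add le_rfl (relDim_le_of_le_sup ?_)
    rintro c ⟨hc, hc'⟩
    exact h2 c hc (by simpa using hc')

lemma relDim_le_of_comap (Ψ : C →ₗ[k] C') (Z B : Submodule k C) (Z₁ B₁ : Submodule k C')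
    (h1 : ∀ c ∈ Z, Ψ c ∈ Z₁) (h2 : ∀ c ∈ Z, Ψ c ∈ B₁ → c ∈ B) :
    relDim Z B ≤ relDim Z₁ B₁ := by
  have := relDim_le_add Ψ Z B ⊥ Z₁ B₁ h1 (fun c hc h => by simpa using h2 c hc h)
  rwa [relDim_eq_zero (bot_le : (⊥ : Submodule k C) ≤ B), add_zero] at this

end RelDim

section Cochains

variable {k H N : Type} [Field k] [Group H] [AddCommGroup N] [Module k N]

/-- The inhomogeneous coboundary of a one-cochain. -/
def d1 (ρ : Representation k H N) : (H → N) →ₗ[k] (H → H → N) where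
  toFun f g h := ρ g (f h) - f (g * h) + f g
  map_add' f f' := by ext; simp; abel
  map_smul' a f := by ext; simp [smul_sub]

@[simp] lemma d1_apply (ρ : Representation k H N) (f : H → N) (g h : H) :
    d1 ρ f g h = ρ g (f h) - f (g * h) + f g := rfl

/-- Inhomogeneous two-cocycles. -/
def Z2 (ρ : Representation k H N) : Submodule k (H → H → N) where
  carrier := {c | ∀ g h j, ρ g (c h j) + c g (h * j) = c (g * h) j + c g h}
  zero_mem' := by simp
  add_mem' {a b} ha hb g h j := by
    have h1 := ha g h j
    have h2 := hb g h j
    simp only [Pi.add_apply, map_add]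
    calc _ = (ρ g (a h j) + a g (h * j)) + (ρ g (b h j) + b g (h * j)) := by abel
      _ = _ := by rw [h1, h2]; abel
  smul_mem' r a ha g h j := by
    simp only [Pi.smul_apply, map_smul, ← smul_add, ha g h j]

/-- Inhomogeneous two-coboundaries. -/
def B2 (ρ : Representation k H N) : Submodule k (H → H → N) := LinearMap.range (d1 ρ)

lemma d1_mem_B2 (ρ : Representation k H N) (f : H → N) : d1 ρ f ∈ B2 ρ := ⟨f, rfl⟩

lemma rho_mul (ρ : Representation k H N) (g h : H) (x : N) : ρ (g * h) x = ρ g (ρ h x) := by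
  rw [map_mul]; rfl

lemma B2_le_Z2 (ρ : Representation k H N) : B2 ρ ≤ Z2 ρ := by
  rintro _ ⟨f, rfl⟩ g h j
  simp only [d1_apply, map_add, map_sub, rho_mul, mul_assoc]
  abel

variable {S : Type} [Group S]

/-- Pullback of two-cochains along a homomorphism. -/
def pull (k : Type) [Field k] {N : Type} [AddCommGroup N] [Module k N] (σ : S →* H) :
    (H → H → N) →ₗ[k] (S → S → N) where
  toFun c s t := c (σ s) (σ t)
  map_add' _ _ := rfl
  map_smul' _ _ := rfl

@[simp] lemma pull_apply (σ : S →* H) (c : H → H → N) (s t : S) :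
    pull k σ c s t = c (σ s) (σ t) := rfl

lemma pull_Z2 {ρ : Representation k H N} (σ : S →* H) {c : H → H → N} (hc : c ∈ Z2 ρ) :
    pull k σ c ∈ Z2 (ρ.comp σ) := by
  intro g h j
  simpa using hc (σ g) (σ h) (σ j)

lemma pull_d1 (ρ : Representation k H N) (σ : S →* H) (f : H → N) :
    pull k σ (d1 ρ f) = d1 (ρ.comp σ) (f ∘ σ) := by
  ext g h; simp

lemma pull_B2 {ρ : Representation k H N} (σ : S →* H) {c : H → H → N} (hc : c ∈ B2 ρ) :
    pull k σ c ∈ B2 (ρ.comp σ) := by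
  obtain ⟨f, rfl⟩ := hc
  exact ⟨f ∘ σ, (pull_d1 ρ σ f).symm⟩

/-- Two-cocycles whose pullback along `σ` is a coboundary. -/
def Zr (σ : S →* H) (ρ : Representation k H N) : Submodule k (H → H → N) :=
  Z2 ρ ⊓ (B2 (ρ.comp σ)).comap (pull k σ)

lemma mem_Zr {σ : S →* H} {ρ : Representation k H N} {c : H → H → N} :
    c ∈ Zr σ ρ ↔ c ∈ Z2 ρ ∧ pull k σ c ∈ B2 (ρ.comp σ) := Iff.rfl

lemma B2_le_Zr (σ : S →* H) (ρ : Representation k H N) : B2 ρ ≤ Zr σ ρ :=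
  fun _ hc => ⟨B2_le_Z2 ρ hc, pull_B2 σ hc⟩

lemma Zr_trivial (ρ : Representation k H N) : Zr (1 : Unit →* H) ρ = Z2 ρ := by
  refine inf_eq_left.2 fun c _ => ⟨fun _ => c 1 1, ?_⟩
  ext; simp

lemma one_left {ρ : Representation k H N} {c : H → H → N} (hc : c ∈ Z2 ρ) (h : H) :
    c 1 h = c 1 1 := by
  have := hc 1 1 h
  simpa using this

lemma one_right {ρ : Representation k H N} {c : H → H → N} (hc : c ∈ Z2 ρ) (h : H) :
    c h 1 = ρ h (c 1 1) := by
  have := hc h 1 1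
  simp at this
  exact this.symm

end Cochains

section Transfer

variable {k H N : Type} [Field k] [Group H] [AddCommGroup N] [Module k N] {S : Type} [Group S]

/-- A cocycle whose restriction to a subgroup of invertible index is a coboundary is itself a
coboundary. -/
lemma mem_B2_of_restrict (σ : S →* H) (hσ : Function.Injective σ)
    (hi : (σ.range.index : k) ≠ 0) (ρ : Representation k H N) {c : H → H → N}
    (hc : c ∈ Z2 ρ) (hr : pull k σ c ∈ B2 (ρ.comp σ)) : c ∈ B2 ρ := by
  classical
  have hfin : σ.range.FiniteIndex := ⟨fun h => hi (by rw [h]; simp)⟩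
  obtain ⟨f, hf⟩ := hr
  have hf' : ∀ s t, c (σ s) (σ t) = ρ (σ s) (f t) - f (s * t) + f s := by
    intro s t; rw [← pull_apply (k := k) σ c s t, ← hf]; simp
  let rep : H → H := fun h => (QuotientGroup.mk (s := σ.range) h).out
  have hrep : ∀ h, ∃ s, rep h * σ s = h := by
    intro h
    have : (rep h)⁻¹ * h ∈ σ.range := by
      rw [← QuotientGroup.eq]; exact Quotient.out_eq _
    obtain ⟨s, hs⟩ := this
    exact ⟨s, by rw [hs]; group⟩
  choose pt hpt using hrep
  have hrepS : ∀ h s, rep (h * σ s) = rep h := by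
    intro h s
    have : (QuotientGroup.mk (s := σ.range) (h * σ s)) = QuotientGroup.mk h := by
      rw [QuotientGroup.eq]; simp
    simp only [rep, this]
  have hptS : ∀ h s, pt (h * σ s) = pt h * s := by
    intro h s
    apply hσ
    have h1 := hpt (h * σ s)
    rw [hrepS] at h1
    rw [map_mul]
    apply mul_left_cancel (a := rep h)
    rw [h1, ← mul_assoc, hpt]
  let F : H → N := fun h => ρ (rep h) (f (pt h)) - c (rep h) (σ (pt h))
  -- correct `c` so that it vanishes on pairs `(h, σ s)`
  have hF : ∀ h s, c h (σ s) = ρ h (f s) - F (h * σ s) + F h := by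
    intro h s
    have e1 := hc (rep h) (σ (pt h)) (σ s)
    rw [hpt] at e1
    simp only [F, hrepS, hptS, map_mul]
    rw [hf'] at e1
    have e2 : ρ (rep h) (ρ (σ (pt h)) (f s)) = ρ h (f s) := by
      rw [← rho_mul, hpt]
    simp only [map_add, map_sub, e2] at e1
    linear_combination (norm := module) -e1
  let e := c - d1 ρ F
  have he : e ∈ Z2 ρ := sub_mem hc (B2_le_Z2 ρ (d1_mem_B2 ρ F))
  have heS : ∀ h s, e h (σ s) = ρ h (f s - F (σ s)) := by
    intro h s
    simp only [e, Pi.sub_apply, d1_apply, hF h s, map_sub]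
    abel
  have heS' : ∀ g h s, e g (h * σ s) = e g h := by
    intro g h s
    have := he g h (σ s)
    rw [heS, heS, ← rho_mul] at this
    exact add_left_cancel this
  have : Fintype (H ⧸ σ.range) := Subgroup.fintypeQuotientOfFiniteIndex
  have hlift : ∀ g h, e g (QuotientGroup.mk (s := σ.range) h).out = e g h := by
    intro g h
    conv_rhs => rw [← hpt h]
    rw [heS']
  let E : H → N := fun g => ∑ t : H ⧸ σ.range, e g t.out
  have hE : d1 ρ E = (σ.range.index : k) • e := by
    ext g h
    have h1 : E g = ∑ t : H ⧸ σ.range, e g (h * t.out) := by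
      change ∑ t : H ⧸ σ.range, e g t.out = _
      rw [← (MulAction.bijective h).sum_comp (fun t : H ⧸ σ.range => e g t.out)]
      refine Finset.sum_congr rfl fun t _ => ?_
      rw [← hlift g (h * t.out)]
      congr 2
      conv_lhs => rw [← Quotient.out_eq t]
      rfl
    rw [d1_apply, h1]
    simp only [E, map_sum]
    rw [← Finset.sum_sub_distrib, ← Finset.sum_add_distrib]
    have h2 : ∀ t : H ⧸ σ.range, ρ g (e h t.out) - e (g * h) t.out + e g (h * t.out) = e g h := by
      intro t
      have := he g h t.out
      linear_combination (norm := module) this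
    simp only [h2, Finset.sum_const, Finset.card_univ, Pi.smul_apply]
    rw [← Nat.card_eq_fintype_card, ← Subgroup.index, Nat.cast_smul_eq_nsmul]
  have : c = d1 ρ ((σ.range.index : k)⁻¹ • E + F) := by
    rw [map_add, map_smul, hE, smul_smul, inv_mul_cancel₀ hi, one_smul]
    simp [e]
  rw [this]; exact d1_mem_B2 _ _

lemma relDim_le_of_restrict [Finite H] [Finite S] [FiniteDimensional k N] (σ : S →* H)
    (hσ : Function.Injective σ) (hi : (σ.range.index : k) ≠ 0) (ρ : Representation k H N) :
    relDim (Z2 ρ) (B2 ρ) ≤ relDim (Z2 (ρ.comp σ)) (B2 (ρ.comp σ)) :=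
  relDim_le_of_comap (pull k σ) _ _ _ _ (fun _ hc => pull_Z2 σ hc)
    (fun _ hc h => mem_B2_of_restrict σ hσ hi ρ hc h)

end Transfer

section Filtration

variable {k C C' : Type} [Field k] [AddCommGroup C] [Module k C] [FiniteDimensional k C]
  [AddCommGroup C'] [Module k C'] [FiniteDimensional k C']

lemma relDim_map_le (ι : C →ₗ[k] C') (Z B : Submodule k C) (B' : Submodule k C')
    (h : B.map ι ≤ B') : relDim (Z.map ι) B' ≤ relDim Z B := by
  have h' : B ≤ B'.comap ι := Submodule.map_le_iff_le_comap.1 h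
  have : (Z.map ι).map B'.mkQ = (Z.map B.mkQ).map (B.mapQ B' ι h') := by
    rw [← Submodule.map_comp, ← Submodule.map_comp, Submodule.mapQ_mkQ]
  rw [relDim, this]
  exact Submodule.finrank_map_le _ _

variable {H N S : Type} [Group H] [Finite H] [AddCommGroup N] [Module k N] [FiniteDimensional k N]
  [Group S]

/-- Push two-cochains forward along a linear map. -/
def push (H : Type) {N N' : Type} [AddCommGroup N] [Module k N] [AddCommGroup N'] [Module k N']
    (φ : N →ₗ[k] N') : (H → H → N) →ₗ[k] (H → H → N') where
  toFun c g h := φ (c g h)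
  map_add' _ _ := by ext; simp
  map_smul' _ _ := by ext; simp

@[simp] lemma push_apply {N' : Type} [AddCommGroup N'] [Module k N'] (φ : N →ₗ[k] N')
    (c : H → H → N) (g h : H) : push H φ c g h = φ (c g h) := rfl

lemma relDim_filtration (σ : S →* H) (ρ : Representation k H N)
    (hσ : ∀ s x, ρ (σ s) x = x) (W : Submodule k N) (hW : ∀ g, W ≤ W.comap (ρ g)) :
    relDim (Zr σ ρ) (B2 ρ) ≤
      relDim (Zr σ (ρ.quotient W hW)) (B2 (ρ.quotient W hW)) +
      relDim (Zr σ (ρ.subrepresentation W hW)) (B2 (ρ.subrepresentation W hW)) := by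
  refine (relDim_le_add (push H W.mkQ) _ _ ((Zr σ (ρ.subrepresentation W hW)).map
    (push H W.subtype)) (Zr σ (ρ.quotient W hW)) (B2 (ρ.quotient W hW)) ?_ ?_).trans
    (add_le_add le_rfl (relDim_map_le _ _ _ _ ?_))
  · rintro c ⟨hc, f, hf⟩
    refine ⟨?_, W.mkQ ∘ f, ?_⟩
    · intro g h j
      have := congrArg W.mkQ (hc g h j)
      simpa using this
    · ext s t
      have := congrArg W.mkQ (congrFun (congrFun hf s) t)
      simpa using this
  · rintro c ⟨hc, f, hf⟩ ⟨e, he⟩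
    choose e' he' using fun h => W.mkQ_surjective (e h)
    have key : ∀ g h, c g h - d1 ρ e' g h ∈ W := by
      intro g h
      have := congrFun (congrFun he g) h
      rw [← Submodule.Quotient.mk_eq_zero, ← W.mkQ_apply, map_sub, sub_eq_zero]
      rw [push_apply] at this
      rw [← this]
      simp [← he']
    obtain ⟨r, hr⟩ := W.subtype.exists_leftInverse_of_injective W.ker_subtype
    have hr' : ∀ w ∈ W, ((r w : W) : N) = w := fun w hw => by
      have := LinearMap.congr_fun hr ⟨w, hw⟩
      exact congrArg Subtype.val this
    let c1 : H → H → W := fun g h => ⟨_, key g h⟩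
    rw [Submodule.mem_sup]
    refine ⟨push H W.subtype c1, ⟨c1, ⟨?_, r ∘ (f - e' ∘ σ), ?_⟩, rfl⟩, d1 ρ e', ⟨e', rfl⟩, ?_⟩
    · intro g h j
      apply Subtype.ext
      exact (sub_mem hc (B2_le_Z2 ρ (d1_mem_B2 ρ e'))) g h j
    · ext s t
      have h1 := congrFun (congrFun hf s) t
      have h2 : c (σ s) (σ t) - d1 ρ e' (σ s) (σ t) =
          (f - e' ∘ σ) t - (f - e' ∘ σ) (s * t) + (f - e' ∘ σ) s := by
        rw [pull_apply] at h1
        rw [← h1]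
        simp [hσ]; abel
      simp only [d1_apply, pull_apply, c1, AddMemClass.coe_add, AddSubgroupClass.coe_sub]
      rw [MonoidHom.comp_apply, Representation.subrepresentation_apply]
      simp only [Function.comp_apply, LinearMap.coe_restrict_apply, hσ]
      rw [← AddSubgroupClass.coe_sub, ← Submodule.coe_add, ← map_sub, ← map_add]
      have h3 := h2
      simp only [Function.comp_apply, Pi.sub_apply] at h3 ⊢
      rw [← h3]
      have h4 := hr' _ (key (σ s) (σ t))
      simp only [d1_apply, hσ] at h4 ⊢
      exact h4
    · ext g h; simp [c1]
  · rintro _ ⟨_, ⟨f, rfl⟩, rfl⟩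
    refine ⟨fun h => (f h : N), ?_⟩
    ext g h
    simp

lemma relDim_le_cost (σ : S →* H)
    (cost : ∀ (N : Type) [AddCommGroup N] [Module k N], Representation k H N → ℕ)
    (hadd : ∀ (N : Type) [AddCommGroup N] [Module k N] [FiniteDimensional k N]
      (ρ : Representation k H N) (W : Submodule k N) (hW : ∀ g, W ≤ W.comap (ρ g)),
      cost _ (ρ.quotient W hW) + cost _ (ρ.subrepresentation W hW) ≤ cost N ρ)
    (hgood : ∀ (N : Type) [AddCommGroup N] [Module k N] [FiniteDimensional k N] [Nontrivial N]
      (ρ : Representation k H N), (∀ s x, ρ (σ s) x = x) →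
      ∃ (W : Submodule k N) (hW : ∀ g, W ≤ W.comap (ρ g)), W ≠ ⊥ ∧
        relDim (Zr σ (ρ.subrepresentation W hW)) (B2 (ρ.subrepresentation W hW)) ≤
          cost _ (ρ.subrepresentation W hW))
    (ρ : Representation k H N) (hσ : ∀ s x, ρ (σ s) x = x) :
    relDim (Zr σ ρ) (B2 ρ) ≤ cost N ρ := by
  obtain ⟨n, hn⟩ : ∃ n, finrank k N = n := ⟨_, rfl⟩
  induction n using Nat.strong_induction_on generalizing N with
  | _ n ih =>
  rcases subsingleton_or_nontrivial N with h | h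
  · rw [relDim_eq_zero]
    · exact Nat.zero_le _
    · intro c _
      rw [Subsingleton.elim c 0]
      exact zero_mem _
  · obtain ⟨W, hW, hne, hle⟩ := hgood N ρ hσ
    refine (relDim_filtration σ ρ hσ W hW).trans (le_trans (add_le_add ?_ hle) (hadd N ρ W hW))
    refine ih (finrank k (N ⧸ W)) ?_ _ ?_ rfl
    · have h1 := W.finrank_quotient_add_finrank
      have h2 : 0 < finrank k W := by
        rw [Nat.pos_iff_ne_zero, Ne, Submodule.finrank_eq_zero]; exact hne
      omega
    · intro s x
      obtain ⟨x, rfl⟩ := W.mkQ_surjective x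
      simp [hσ]

end Filtration

section Weights

variable {k N Θ : Type} [Field k] [Group Θ] [AddCommGroup N] [Module k N]

/-- The `χ`-isotypic subspace. -/
def wt (ρ : Representation k Θ N) (χ : Θ →* kˣ) : Submodule k N where
  carrier := {v | ∀ t, ρ t v = (χ t : k) • v}
  zero_mem' := by simp
  add_mem' {a b} ha hb t := by rw [map_add, ha t, hb t, smul_add]
  smul_mem' r a ha t := by rw [map_smul, ha t, smul_comm]

lemma mem_wt {ρ : Representation k Θ N} {χ : Θ →* kˣ} {v : N} :
    v ∈ wt ρ χ ↔ ∀ t, ρ t v = (χ t : k) • v := Iff.rfl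

lemma sum_finrank_wt_le [FiniteDimensional k N] (ρ : Representation k Θ N) {ι : Type} [Fintype ι]
    (χ : ι → (Θ →* kˣ)) (hχ : Function.Injective χ) :
    ∑ i, finrank k (wt ρ (χ i)) ≤ finrank k N := by
  classical
  let L : (∀ i, wt ρ (χ i)) →ₗ[k] N := ∑ i, (wt ρ (χ i)).subtype ∘ₗ LinearMap.proj i
  have hL : Function.Injective L := by
    rw [injective_iff_map_eq_zero]
    intro v hv
    have hli : LinearIndependent k (fun i => ((Units.coeHom k).comp (χ i) : Θ → k)) := by
      refine (linearIndependent_monoidHom Θ k).comp (fun i => (Units.coeHom k).comp (χ i)) ?_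
      intro i j hij
      apply hχ
      ext t
      exact DFunLike.congr_fun hij t
    ext i
    refine (Module.forall_dual_apply_eq_zero_iff k _).1 fun φ => ?_
    refine Fintype.linearIndependent_iff.1 hli (fun i => φ (v i)) ?_ i
    ext t
    have h1 : φ (ρ t (L v)) = 0 := by rw [hv]; simp
    simp only [L, LinearMap.coe_sum, Finset.sum_apply, LinearMap.comp_apply, map_sum] at h1
    simp only [LinearMap.proj_apply, Submodule.subtype_apply] at h1
    rw [Pi.zero_apply, ← h1]
    simp only [Finset.sum_apply, Pi.smul_apply]
    refine Finset.sum_congr rfl fun i _ => ?_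
    rw [(v i).2 t, map_smul]
    simp [mul_comm]
  have := LinearMap.finrank_le_finrank_of_injective hL
  rwa [Module.finrank_pi_fintype] at this

variable {H : Type} [Group H]

lemma wt_superadditive [Finite Θ] [FiniteDimensional k N] (hΘ : (Nat.card Θ : k) ≠ 0)
    (θ : Θ →* H) (χ : Θ →* kˣ) (ρ : Representation k H N) (W : Submodule k N)
    (hW : ∀ g, W ≤ W.comap (ρ g)) :
    finrank k (wt ((ρ.quotient W hW).comp θ) χ) + finrank k (wt ((ρ.subrepresentation W hW).comp θ) χ)
      = finrank k (wt (ρ.comp θ) χ) := by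
  have := Fintype.ofFinite Θ
  let f : wt (ρ.comp θ) χ →ₗ[k] wt ((ρ.quotient W hW).comp θ) χ :=
    (W.mkQ.domRestrict _).codRestrict _ (by
      intro v t
      have := v.2 t
      simp only [MonoidHom.comp_apply] at this
      simp [this])
  have hf : Function.Surjective f := by
    rintro ⟨v, hv⟩
    obtain ⟨v, rfl⟩ := W.mkQ_surjective v
    refine ⟨⟨(Nat.card Θ : k)⁻¹ • ∑ t, ((χ t)⁻¹ : k) • ρ (θ t) v, ?_⟩, ?_⟩
    · intro u
      rw [map_smul, smul_comm]
      refine congrArg (fun x : N => (Nat.card Θ : k)⁻¹ • x) ?_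
      rw [map_sum, Finset.smul_sum]
      rw [← Equiv.sum_comp (Equiv.mulLeft u) (fun t => (χ u : k) • ((χ t : k)⁻¹ • ρ (θ t) v))]
      refine Finset.sum_congr rfl fun t _ => ?_
      simp only [MonoidHom.comp_apply, map_smul, Equiv.coe_mulLeft, map_mul, smul_smul,
        Units.val_mul, mul_inv_rev]
      rw [mul_comm ((χ t : k)⁻¹), ← mul_assoc, mul_inv_cancel₀ (Units.ne_zero _), one_mul]
      rfl
    · apply Subtype.ext
      change W.mkQ ((Nat.card Θ : k)⁻¹ • ∑ t, ((χ t)⁻¹ : k) • ρ (θ t) v) = W.mkQ v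
      have h1 : ∀ t, W.mkQ (ρ (θ t) v) = (χ t : k) • W.mkQ v := fun t => by
        rw [← hv t]; simp
      rw [map_smul, map_sum]
      simp only [map_smul, h1, smul_smul]
      simp only [ne_eq, Units.ne_zero, not_false_eq_true, inv_mul_cancel₀, one_smul,
        Finset.sum_const, Finset.card_univ]
      rw [← Nat.card_eq_fintype_card, ← Nat.cast_smul_eq_nsmul k, smul_smul, inv_mul_cancel₀ hΘ,
        one_smul]
  rw [← LinearMap.finrank_range_add_finrank_ker f, LinearMap.range_eq_top.2 hf, finrank_top]
  congr 1
  let e : (LinearMap.ker f : Submodule k (wt (ρ.comp θ) χ)) ≃ₗ[k] wt ((ρ.subrepresentation W hW).comp θ) χ :=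
  { toFun := fun v => ⟨⟨v.1.1, by
        have h : f v.1 = 0 := v.2
        exact (Submodule.Quotient.mk_eq_zero W).1 (show ((f v.1 : wt ((ρ.quotient W hW).comp θ) χ) : N ⧸ W) = 0 by
          rw [h]; rfl)⟩, fun t => Subtype.ext (v.1.2 t)⟩
    invFun := fun w => ⟨⟨w.1.1, fun t => congrArg Subtype.val (w.2 t)⟩, by
        apply Subtype.ext
        exact (Submodule.Quotient.mk_eq_zero W).2 w.1.2⟩
    map_add' := fun _ _ => rfl
    map_smul' := fun _ _ => rfl
    left_inv := fun _ => rfl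
    right_inv := fun _ => rfl }
  exact e.symm.finrank_eq

end Weights

section Averaging

variable {k H N Θ S : Type} [Field k] [Group H] [AddCommGroup N] [Module k N] [Group Θ] [Group S]

/-- Conjugation of a two-cochain by a group element. -/
def cj (ρ : Representation k H N) (t : H) (c : H → H → N) : H → H → N :=
  fun g h => ρ t (c (t⁻¹ * g * t) (t⁻¹ * h * t))

lemma cj_eq {ρ : Representation k H N} {c : H → H → N} (hc : c ∈ Z2 ρ) (t : H) :
    cj ρ t c = c + d1 ρ (fun g => c t (t⁻¹ * g * t) - c g t) := by
  ext g h
  have e1 := hc t (t⁻¹ * g * t) (t⁻¹ * h * t)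
  have e2 := hc g t (t⁻¹ * h * t)
  have e3 := hc g h t
  have a1 : t * (t⁻¹ * g * t) = g * t := by group
  have a2 : t * (t⁻¹ * h * t) = h * t := by group
  have a3 : t⁻¹ * g * t * (t⁻¹ * h * t) = t⁻¹ * (g * h) * t := by group
  rw [a1, a3] at e1
  rw [a2] at e2
  simp only [cj, Pi.add_apply, d1_apply, map_sub]
  linear_combination (norm := module) e1 - e2 + e3

/-- `Θ`-equivariant two-cocycles that vanish on the image of `σ`. -/
def Z0 (σ : S →* H) (θ : Θ →* H) (ρ : Representation k H N) : Submodule k (H → H → N) where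
  carrier := {c | c ∈ Z2 ρ ∧ (∀ t g h, c (θ t * g * (θ t)⁻¹) (θ t * h * (θ t)⁻¹) = ρ (θ t) (c g h)) ∧
    ∀ s s', c (σ s) (σ s') = 0}
  zero_mem' := ⟨zero_mem _, by simp, by simp⟩
  add_mem' := by
    rintro a b ⟨h1, h2, h3⟩ ⟨h1', h2', h3'⟩
    exact ⟨add_mem h1 h1', fun t g h => by simp [h2, h2'], fun s s' => by simp [h3, h3']⟩
  smul_mem' := by
    rintro r a ⟨h1, h2, h3⟩
    exact ⟨Submodule.smul_mem _ r h1, fun t g h => by simp [h2], fun s s' => by simp [h3]⟩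

lemma Zr_le_Z0_sup_B2 [Finite Θ] (hΘ : (Nat.card Θ : k) ≠ 0) (σ : S →* H)
    (hσ : Function.Injective σ) (θ : Θ →* H)
    (hn : ∀ t s, ∃ s', σ s' = θ t * σ s * (θ t)⁻¹) (ρ : Representation k H N) :
    Zr σ ρ ≤ Z0 σ θ ρ ⊔ B2 ρ := by
  classical
  have := Fintype.ofFinite Θ
  rintro c ⟨hc, f, hf⟩
  choose act hact using hn
  have act_mul : ∀ t u s, act t (act u s) = act (t * u) s := by
    intro t u s; apply hσ; simp only [hact, map_mul]; group
  have act_hom : ∀ t s s', act t (s * s') = act t s * act t s' := by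
    intro t s s'; apply hσ; simp only [hact, map_mul]; group
  have hf' : ∀ s t, c (σ s) (σ t) = ρ (σ s) (f t) - f (s * t) + f s := by
    intro s t; rw [← pull_apply (k := k) σ c s t, ← hf]; simp
  let c' : H → H → N := (Nat.card Θ : k)⁻¹ • ∑ t, cj ρ (θ t) c
  have hc' : c' = c + d1 ρ ((Nat.card Θ : k)⁻¹ • ∑ t, fun g => c (θ t) ((θ t)⁻¹ * g * θ t) - c g (θ t)) := by
    simp only [c', cj_eq hc, Finset.sum_add_distrib, Finset.sum_const, Finset.card_univ, smul_add]
    rw [← Nat.card_eq_fintype_card, ← Nat.cast_smul_eq_nsmul k, smul_smul, inv_mul_cancel₀ hΘ,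
      one_smul, map_smul, map_sum]
  have happ : ∀ g h, c' g h = (Nat.card Θ : k)⁻¹ • ∑ t, ρ (θ t) (c ((θ t)⁻¹ * g * θ t) ((θ t)⁻¹ * h * θ t)) := by
    intro g h
    simp [c', cj, Finset.sum_apply]
  let f' : S → N := fun s => (Nat.card Θ : k)⁻¹ • ∑ t, ρ (θ t) (f (act t⁻¹ s))
  have hff : ∀ s s', c' (σ s) (σ s') = ρ (σ s) (f' s') - f' (s * s') + f' s := by
    intro s s'
    rw [happ]
    simp only [f', map_smul, ← smul_sub, ← smul_add, map_sum, ← Finset.sum_sub_distrib,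
      ← Finset.sum_add_distrib]
    congr 1
    refine Finset.sum_congr rfl fun t _ => ?_
    have h1 : ∀ s, (θ t)⁻¹ * σ s * θ t = σ (act t⁻¹ s) := by
      intro s; rw [hact]; simp
    have h2 : θ t * σ (act t⁻¹ s) = σ s * θ t := by rw [← h1]; group
    rw [h1, h1, hf', map_add, map_sub, ← rho_mul, ← act_hom, h2, ← rho_mul]
  let F : H → N := fun h => if hh : ∃ s, σ s = h then f' hh.choose else 0
  have hFσ : ∀ s, F (σ s) = f' s := by
    intro s
    have hh : ∃ s', σ s' = σ s := ⟨s, rfl⟩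
    simp only [F, dif_pos hh]
    rw [hσ hh.choose_spec]
  have hFt : ∀ u h, F (θ u * h * (θ u)⁻¹) = ρ (θ u) (F h) := by
    intro u h
    by_cases hh : ∃ s, σ s = h
    · obtain ⟨s, rfl⟩ := hh
      rw [← hact, hFσ, hFσ]
      simp only [f', map_smul, map_sum, ← rho_mul]
      congr 1
      rw [← Equiv.sum_comp (Equiv.mulLeft u)]
      refine Finset.sum_congr rfl fun t _ => ?_
      simp [act_mul]
    · have hh' : ¬ ∃ s, σ s = θ u * h * (θ u)⁻¹ := by
        rintro ⟨s, hs⟩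
        refine hh ⟨act u⁻¹ s, ?_⟩
        rw [hact, hs]; simp; group
      simp only [F, dif_neg hh, dif_neg hh', map_zero]
  rw [Submodule.mem_sup]
  have hcm : c' ∈ Z2 ρ := by rw [hc']; exact add_mem hc (B2_le_Z2 ρ (d1_mem_B2 ρ _))
  refine ⟨c' - d1 ρ F, ⟨sub_mem hcm (B2_le_Z2 ρ (d1_mem_B2 ρ F)), ?_, ?_⟩, c - (c' - d1 ρ F), ?_, by abel⟩
  · intro u g h
    have e1 : c' (θ u * g * (θ u)⁻¹) (θ u * h * (θ u)⁻¹) = ρ (θ u) (c' g h) := by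
      simp only [happ, map_smul, map_sum, ← rho_mul]
      congr 1
      rw [← Equiv.sum_comp (Equiv.mulLeft u)]
      refine Finset.sum_congr rfl fun t _ => ?_
      simp only [Equiv.coe_mulLeft, map_mul, mul_inv_rev]
      congr 2 <;> group
    have e2 : θ u * g * (θ u)⁻¹ * (θ u * h * (θ u)⁻¹) = θ u * (g * h) * (θ u)⁻¹ := by group
    simp only [Pi.sub_apply, d1_apply, e1, e2, hFt, map_sub, map_add]
    rw [← rho_mul, ← rho_mul, inv_mul_cancel_right]
  · intro s s'
    simp only [Pi.sub_apply, d1_apply, ← map_mul, hFσ, hff, sub_self]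
  · rw [hc']
    have this : ∀ x y : H → H → N, c - (c + x - y) = y - x := fun x y => by abel
    rw [this, ← map_sub]
    exact d1_mem_B2 _ _

end Averaging

section Frobenius

variable {p : ℕ} [Fact p.Prime] {K : Type} [Field K] [Finite K] [Algebra (ZMod p) K]
  {N : Type} [AddCommGroup N] [Module K N]

/-- The degree of `K` over its prime field. -/
noncomputable abbrev deg (p : ℕ) [Fact p.Prime] (K : Type) [Field K] [Algebra (ZMod p) K] : ℕ :=
  finrank (ZMod p) K

lemma frob_unique (n : Fin (deg p K) → N) (h : ∀ a : K, ∑ i : Fin (deg p K), a ^ p ^ (i : ℕ) • n i = 0) :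
    n = 0 := by
  have hli : LinearIndependent K
      (fun i : Fin (deg p K) => (powMonoidHom (p ^ (i : ℕ)) : K →* K) : Fin (deg p K) → (K → K)) := by
    refine (linearIndependent_monoidHom K K).comp
      (fun i : Fin (deg p K) => (powMonoidHom (p ^ (i : ℕ)) : K →* K)) ?_
    intro i j hij
    apply (FiniteField.bijective_frobeniusAlgEquivOfAlgebraic_pow (ZMod p) K).1
    ext a
    have := DFunLike.congr_fun hij a
    simpa [FiniteField.coe_frobeniusAlgEquivOfAlgebraic_iterate, ZMod.card] using this
  funext i
  refine (Module.forall_dual_apply_eq_zero_iff K _).1 fun φ => ?_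
  refine Fintype.linearIndependent_iff.1 hli (fun i => φ (n i)) ?_ i
  ext a
  have := congrArg φ (h a)
  simp only [map_sum, map_smul, map_zero] at this
  rw [Pi.zero_apply, ← this]
  simp [mul_comm]

variable [FiniteDimensional K N]

lemma frob_expand (f : K → N) (hf : ∀ a b, f (a + b) = f a + f b) :
    ∃ n : Fin (deg p K) → N, ∀ a, f a = ∑ i : Fin (deg p K), a ^ p ^ (i : ℕ) • n i := by
  have : CharP K p := (Algebra.charP_iff (ZMod p) K p).1 inferInstance
  have : ExpChar K p := ExpChar.prime Fact.out
  let _ : Module (ZMod p) N := Module.compHom N (algebraMap (ZMod p) K)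
  have : IsScalarTower (ZMod p) K N := IsScalarTower.of_algebraMap_smul fun _ _ => rfl
  have : SMulCommClass (ZMod p) K N := inferInstance
  let L : (Fin (deg p K) → N) →ₗ[K] (K →ₗ[ZMod p] N) :=
    { toFun := fun n => (AddMonoidHom.toZModLinearMap p
        { toFun := fun a => ∑ i : Fin (deg p K), a ^ p ^ (i : ℕ) • n i
          map_zero' := by simp [Nat.Prime.ne_zero Fact.out]
          map_add' := fun a b => by
            simp only [add_pow_expChar_pow, add_smul, Finset.sum_add_distrib] })
      map_add' := fun n n' => by
        ext a; simp [smul_add, Finset.sum_add_distrib]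
      map_smul' := fun r n => by
        ext a; simp [Finset.smul_sum, smul_comm r] }
  have hL : Function.Injective L := by
    rw [injective_iff_map_eq_zero]
    intro n hn
    apply frob_unique
    intro a
    exact LinearMap.congr_fun hn a
  have hs : Function.Surjective L := by
    refine (LinearMap.injective_iff_surjective_of_finrank_eq_finrank ?_).1 hL
    rw [Module.finrank_linearMap, Module.finrank_pi_fintype]
    simp
  obtain ⟨n, hn⟩ := hs (AddMonoidHom.toZModLinearMap p (AddMonoidHom.mk' f hf))
  exact ⟨n, fun a => (LinearMap.congr_fun hn a).symm⟩

lemma frob_expand₂ (f : K → K → N) (h1 : ∀ a b c, f (a + b) c = f a c + f b c)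
    (h2 : ∀ a b c, f a (b + c) = f a b + f a c) :
    ∃ n : Fin (deg p K) × Fin (deg p K) → N,
      ∀ a b, f a b = ∑ x : Fin (deg p K) × Fin (deg p K), (a ^ p ^ (x.1 : ℕ) * b ^ p ^ (x.2 : ℕ)) • n x := by
  obtain ⟨F, hF⟩ := frob_expand (p := p) (N := K → N) f (fun a b => funext fun c => h1 a b c)
  have hF' : ∀ a b, f a b = ∑ i : Fin (deg p K), a ^ p ^ (i : ℕ) • F i b := fun a b => by
    rw [hF a]; simp
  have hadd : ∀ i b c, F i (b + c) = F i b + F i c := by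
    intro i b c
    have := frob_unique (p := p) (K := K) (fun i => F i (b + c) - F i b - F i c) (fun a => by
      simp only [smul_sub, Finset.sum_sub_distrib, ← hF', h2]; abel)
    have := congrFun this i
    rw [Pi.zero_apply, sub_sub, sub_eq_zero] at this
    exact this
  choose n hn using fun i => frob_expand (p := p) (F i) (hadd i)
  refine ⟨fun x => n x.1 x.2, fun a b => ?_⟩
  rw [hF', Fintype.sum_prod_type]
  refine Finset.sum_congr rfl fun i _ => ?_
  rw [hn, Finset.smul_sum]
  simp [smul_smul]

lemma frob_unique₂ (n : Fin (deg p K) × Fin (deg p K) → N)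
    (h : ∀ a b : K, ∑ x : Fin (deg p K) × Fin (deg p K), (a ^ p ^ (x.1 : ℕ) * b ^ p ^ (x.2 : ℕ)) • n x = 0) : n = 0 := by
  funext ⟨i, j⟩
  have := frob_unique (p := p) (K := K) (N := K → N) (fun i b => ∑ j : Fin (deg p K), b ^ p ^ (j : ℕ) • n (i, j))
    (fun a => by
      ext b
      rw [Pi.zero_apply, ← h a b, Fintype.sum_prod_type]
      simp [Finset.smul_sum, smul_smul])
  have := frob_unique (p := p) (K := K) (fun j => n (i, j)) (fun b => congrFun (congrFun this i) b)
  exact congrFun this j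

end Frobenius

section Bounds

variable {p : ℕ} [Fact p.Prime] {K : Type} [Field K] [Finite K] [Algebra (ZMod p) K]
  {N : Type} [AddCommGroup N] [Module K N] [FiniteDimensional K N] {Θ : Type} [Group Θ]

lemma finrank_le_sum {C ι : Type} [AddCommGroup C] [Module K C]
    [Fintype ι] (W : Submodule K C) (w : ι → Submodule K N) (E : ι → N →ₗ[K] C)
    (h : ∀ f ∈ W, ∃ n : ι → N, (∀ i, n i ∈ w i) ∧ f = ∑ i, E i (n i)) :
    finrank K W ≤ ∑ i, finrank K (w i) := by
  let L : (∀ i, w i) →ₗ[K] C := ∑ i, E i ∘ₗ (w i).subtype ∘ₗ LinearMap.proj i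
  have hW : W ≤ LinearMap.range L := by
    intro f hf
    obtain ⟨n, hn, rfl⟩ := h f hf
    exact ⟨fun i => ⟨n i, hn i⟩, by simp [L]⟩
  rw [← Module.finrank_pi_fintype]
  exact (Submodule.finrank_mono hW).trans (LinearMap.finrank_range_le L)

/-- Additive maps from a root group to `N` that are equivariant under the torus. -/
def addW (ρ : Representation K Θ N) (α : Θ →* Kˣ) : Submodule K (K → N) where
  carrier := {f | (∀ a b, f (a + b) = f a + f b) ∧ ∀ t a, f (α t * a) = ρ t (f a)}
  zero_mem' := by simp
  add_mem' := by
    rintro f g ⟨h1, h2⟩ ⟨h1', h2'⟩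
    exact ⟨fun a b => by simp only [Pi.add_apply, h1, h1']; abel, fun t a => by simp [h2, h2']⟩
  smul_mem' := by
    rintro r f ⟨h1, h2⟩
    exact ⟨fun a b => by simp only [Pi.smul_apply, h1, smul_add], fun t a => by simp [h2]⟩

/-- Biadditive equivariant maps on a pair of root groups. -/
def biW (ρ : Representation K Θ N) (α β : Θ →* Kˣ) : Submodule K (K → K → N) where
  carrier := {f | (∀ a b c, f (a + b) c = f a c + f b c) ∧ (∀ a b c, f a (b + c) = f a b + f a c) ∧
    ∀ t a b, f (α t * a) (β t * b) = ρ t (f a b)}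
  zero_mem' := by simp
  add_mem' := by
    rintro f g ⟨h1, h2, h3⟩ ⟨h1', h2', h3'⟩
    exact ⟨fun a b c => by simp only [Pi.add_apply, h1, h1']; abel,
      fun a b c => by simp only [Pi.add_apply, h2, h2']; abel, fun t a b => by simp [h3, h3']⟩
  smul_mem' := by
    rintro r f ⟨h1, h2, h3⟩
    exact ⟨fun a b c => by simp only [Pi.smul_apply, h1, smul_add],
      fun a b c => by simp only [Pi.smul_apply, h2, smul_add], fun t a b => by simp [h3]⟩

/-- Alternating biadditive equivariant maps on a root group. -/
def altW (ρ : Representation K Θ N) (α : Θ →* Kˣ) : Submodule K (K → K → N) where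
  carrier := {f | f ∈ biW ρ α α ∧ ∀ a, f a a = 0}
  zero_mem' := ⟨zero_mem _, by simp⟩
  add_mem' := by
    rintro f g ⟨h1, h2⟩ ⟨h1', h2'⟩
    exact ⟨add_mem h1 h1', fun a => by simp [h2, h2']⟩
  smul_mem' := by
    rintro r f ⟨h1, h2⟩
    exact ⟨Submodule.smul_mem _ r h1, fun a => by simp [h2]⟩

lemma finrank_addW_le (ρ : Representation K Θ N) (α : Θ →* Kˣ) :
    finrank K (addW ρ α) ≤ ∑ i : Fin (deg p K), finrank K (wt ρ (α ^ p ^ (i : ℕ))) := by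
  refine finrank_le_sum _ _ (fun i => LinearMap.pi fun a => a ^ p ^ (i : ℕ) • LinearMap.id) ?_
  rintro f ⟨h1, h2⟩
  obtain ⟨n, hn⟩ := frob_expand (p := p) f h1
  refine ⟨n, fun i t => ?_, ?_⟩
  · have := frob_unique (p := p) (K := K)
      (fun i => ρ t (n i) - ((α ^ p ^ (i : ℕ)) t : K) • n i) (fun a => by
        have := h2 t a
        rw [hn, hn, map_sum] at this
        simp only [smul_sub, Finset.sum_sub_distrib, sub_eq_zero]
        simp only [map_smul] at this
        rw [← this]
        refine Finset.sum_congr rfl fun i _ => ?_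
        simp [smul_smul, mul_pow, mul_comm])
    exact sub_eq_zero.1 (congrFun this i)
  · ext a; rw [hn]; simp

lemma biW_expand {ρ : Representation K Θ N} {α β : Θ →* Kˣ} {f : K → K → N} (hf : f ∈ biW ρ α β) :
    ∃ n : Fin (deg p K) × Fin (deg p K) → N,
      (∀ x, n x ∈ wt ρ (α ^ p ^ (x.1 : ℕ) * β ^ p ^ (x.2 : ℕ))) ∧
      ∀ a b, f a b = ∑ x : Fin (deg p K) × Fin (deg p K), (a ^ p ^ (x.1 : ℕ) * b ^ p ^ (x.2 : ℕ)) • n x := by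
  obtain ⟨h1, h2, h3⟩ := hf
  obtain ⟨n, hn⟩ := frob_expand₂ (p := p) f h1 h2
  refine ⟨n, fun i t => ?_, hn⟩
  have := frob_unique₂ (p := p) (K := K)
    (fun x => ρ t (n x) - ((α ^ p ^ (x.1 : ℕ) * β ^ p ^ (x.2 : ℕ)) t : K) • n x) (fun a b => by
      have := h3 t a b
      rw [hn, hn, map_sum] at this
      simp only [smul_sub, Finset.sum_sub_distrib, sub_eq_zero]
      simp only [map_smul] at this
      rw [← this]
      refine Finset.sum_congr rfl fun i _ => ?_
      simp only [smul_smul, mul_pow, MonoidHom.mul_apply, MonoidHom.pow_apply, Units.val_mul,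
        Units.val_pow_eq_pow_val]
      congr 1; ring)
  exact sub_eq_zero.1 (congrFun this i)

lemma finrank_biW_le (ρ : Representation K Θ N) (α β : Θ →* Kˣ) :
    finrank K (biW ρ α β) ≤ ∑ x : Fin (deg p K) × Fin (deg p K),
      finrank K (wt ρ (α ^ p ^ (x.1 : ℕ) * β ^ p ^ (x.2 : ℕ))) := by
  refine finrank_le_sum _ _ (fun x => LinearMap.pi fun a => LinearMap.pi fun b =>
    (a ^ p ^ (x.1 : ℕ) * b ^ p ^ (x.2 : ℕ)) • LinearMap.id) ?_
  intro f hf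
  obtain ⟨n, h1, h2⟩ := biW_expand (p := p) hf
  refine ⟨n, h1, ?_⟩
  ext a b; rw [h2]; simp

lemma exists_sq_add (p : ℕ) [Fact p.Prime] [Algebra (ZMod p) K] (n : Fin (deg p K) → N)
    (h : ∀ a : K, ∑ i : Fin (deg p K), (a ^ p ^ (i : ℕ) * a ^ p ^ (i : ℕ)) • n i = 0) : n = 0 := by
  have : CharP K p := (Algebra.charP_iff (ZMod p) K p).1 inferInstance
  have : ExpChar K p := ExpChar.prime Fact.out
  have hsq : ∀ a : K, ∑ i : Fin (deg p K), (a * a) ^ p ^ (i : ℕ) • n i = 0 := fun a => by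
    simpa only [mul_pow] using h a
  have hadd : ∀ a b : K, ∑ i : Fin (deg p K), (a + b) ^ p ^ (i : ℕ) • n i =
      ∑ i : Fin (deg p K), a ^ p ^ (i : ℕ) • n i + ∑ i : Fin (deg p K), b ^ p ^ (i : ℕ) • n i := fun a b => by
    simp only [add_pow_expChar_pow, add_smul, Finset.sum_add_distrib]
  apply frob_unique (p := p) (K := K)
  intro a
  by_cases h2 : (2 : K) = 0
  · have h2' : ringChar K = 2 := by
      have : CharP K 2 := by
        apply CharTwo.of_one_ne_zero_of_two_eq_zero one_ne_zero h2
      exact (ringChar.eq_iff).2 this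
    obtain ⟨b, rfl⟩ := FiniteField.isSquare_of_char_two h2' a
    exact hsq b
  · have e1 : a + ((a * 2⁻¹ ) * (a * 2⁻¹) + 1 * 1) = (a * 2⁻¹ + 1) * (a * 2⁻¹ + 1) := by
      field_simp; ring
    have e2 := hsq (a * 2⁻¹ + 1)
    rw [← e1, hadd, hadd, hsq, hsq, add_zero, add_zero] at e2
    exact e2

lemma finrank_altW_le (ρ : Representation K Θ N) (α : Θ →* Kˣ) :
    finrank K (altW ρ α) ≤ ∑ x : {x : Fin (deg p K) × Fin (deg p K) // x.1 < x.2},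
      finrank K (wt ρ (α ^ p ^ (x.1.1 : ℕ) * α ^ p ^ (x.1.2 : ℕ))) := by
  classical
  refine finrank_le_sum _ _ (fun x => LinearMap.pi fun a => LinearMap.pi fun b =>
    (a ^ p ^ (x.1.1 : ℕ) * b ^ p ^ (x.1.2 : ℕ) - a ^ p ^ (x.1.2 : ℕ) * b ^ p ^ (x.1.1 : ℕ)) •
      LinearMap.id) ?_
  rintro f ⟨hf, hf0⟩
  obtain ⟨n, h1, h2⟩ := biW_expand (p := p) hf
  have hanti : ∀ a b, f a b = - f b a := by
    intro a b
    have := hf0 (a + b)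
    rw [hf.1, hf.2.1, hf.2.1, hf0, hf0, zero_add, add_zero] at this
    exact eq_neg_of_add_eq_zero_left this
  have hn : ∀ i j, n (i, j) = - n (j, i) := by
    intro i j
    have := frob_unique₂ (p := p) (K := K) (fun x => n x + n (x.2, x.1)) (fun a b => by
      simp only [smul_add, Finset.sum_add_distrib]
      rw [← h2, ← Equiv.sum_comp (Equiv.prodComm _ _)]
      have := h2 b a
      simp only [Equiv.prodComm_apply, Prod.swap] 
      rw [hanti, this, ← Finset.sum_neg_distrib, ← Finset.sum_add_distrib]
      refine Finset.sum_eq_zero fun x _ => ?_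
      simp [mul_comm])
    exact eq_neg_of_add_eq_zero_left (congrFun this (i, j))
  have hsplit : ∀ a b, f a b = ∑ i : Fin (deg p K), (a ^ p ^ (i : ℕ) * b ^ p ^ (i : ℕ)) • n (i, i) +
      ∑ x : {x : Fin (deg p K) × Fin (deg p K) // x.1 < x.2},
      (a ^ p ^ (x.1.1 : ℕ) * b ^ p ^ (x.1.2 : ℕ) - a ^ p ^ (x.1.2 : ℕ) * b ^ p ^ (x.1.1 : ℕ)) • n x.1 := by
    intro a b
    rw [h2]
    set g : Fin (deg p K) × Fin (deg p K) → N :=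
      fun x => (a ^ p ^ (x.1 : ℕ) * b ^ p ^ (x.2 : ℕ)) • n x with hg
    have e1 : ∀ x, g x = (if x.1 = x.2 then g x else 0) + ((if x.1 < x.2 then g x else 0) +
        (if x.2 < x.1 then g x else 0)) := by
      intro x
      rcases lt_trichotomy x.1 x.2 with h | h | h
      · simp [h, h.ne, h.not_gt]
      · simp [h]
      · simp [h, h.ne', h.not_gt]
    have e2 : ∑ x : Fin (deg p K) × Fin (deg p K), (if x.2 < x.1 then g x else 0) = ∑ x : Fin (deg p K) × Fin (deg p K), (if x.1 < x.2 then g x.swap else 0) := by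
      rw [← Equiv.sum_comp (Equiv.prodComm _ _)]
      rfl
    rw [Finset.sum_congr rfl fun x _ => e1 x, Finset.sum_add_distrib, Finset.sum_add_distrib, e2,
      ← Finset.sum_add_distrib]
    congr 1
    · rw [Fintype.sum_prod_type]
      simp [hg]
    · rw [← Finset.sum_subtype (Finset.univ.filter
        fun x : Fin (deg p K) × Fin (deg p K) => x.1 < x.2) (by simp)
        (fun x => (a ^ p ^ (x.1 : ℕ) * b ^ p ^ (x.2 : ℕ) -
          a ^ p ^ (x.2 : ℕ) * b ^ p ^ (x.1 : ℕ)) • n x), Finset.sum_filter]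
      refine Finset.sum_congr rfl fun x _ => ?_
      split_ifs with h
      · simp only [hg, Prod.swap]
        rw [hn x.2 x.1]
        module
      · simp
  have hdiag := exists_sq_add p (fun i => n (i, i)) (fun a => by
    have := hsplit a a
    rw [hf0] at this
    rw [this, left_eq_add]
    refine Finset.sum_eq_zero fun x _ => ?_
    rw [mul_comm, sub_self, zero_smul])
  refine ⟨fun x => n x.1, fun x => h1 x.1, ?_⟩
  ext a b
  rw [hsplit]
  have : ∀ i, n (i, i) = 0 := fun i => congrFun hdiag i
  simp [this]

end Bounds

section Twisted

variable {N Q : Type} [AddCommGroup N] [AddCommGroup Q]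

/-- The underlying type of the extension of `Q` by `N` attached to a two-cocycle. -/
@[ext] structure TwExt (c : Q → Q → N) where
  /-- the fibre coordinate -/
  fib : N
  /-- the base coordinate -/
  base : Q

instance (c : Q → Q → N) : Add (TwExt c) :=
  ⟨fun e e' => ⟨e.fib + e'.fib + c e.base e'.base, e.base + e'.base⟩⟩

instance (c : Q → Q → N) : Zero (TwExt c) := ⟨⟨-c 0 0, 0⟩⟩

instance (c : Q → Q → N) : Neg (TwExt c) := ⟨fun e => ⟨-e.fib - c (-e.base) e.base - c 0 0, -e.base⟩⟩

lemma cocycle_zero {c : Q → Q → N}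
    (hc : ∀ x y z, c y z + c x (y + z) = c (x + y) z + c x y) (x : Q) : c 0 x = c 0 0 := by
  simpa using hc 0 0 x

/-- The abelian extension of `Q` by `N` attached to a symmetric two-cocycle. -/
@[reducible] def twGroup (c : Q → Q → N) (hc : ∀ x y z, c y z + c x (y + z) = c (x + y) z + c x y)
    (hs : ∀ x y, c x y = c y x) : AddCommGroup (TwExt c) :=
  { nsmul := nsmulRec
    zsmul := zsmulRec
    add_assoc := fun e e' e'' => by
      refine TwExt.ext ?_ (add_assoc _ _ _)
      change e.fib + e'.fib + c e.base e'.base + e''.fib + c (e.base + e'.base) e''.base =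
        e.fib + (e'.fib + e''.fib + c e'.base e''.base) + c e.base (e'.base + e''.base)
      linear_combination (norm := abel) -hc e.base e'.base e''.base
    zero_add := fun e => by
      refine TwExt.ext ?_ (zero_add _)
      change -c 0 0 + e.fib + c 0 e.base = e.fib
      rw [cocycle_zero hc e.base]; abel
    add_zero := fun e => by
      refine TwExt.ext ?_ (add_zero _)
      change e.fib + -c 0 0 + c e.base 0 = e.fib
      rw [hs e.base, cocycle_zero hc e.base]; abel
    neg_add_cancel := fun e => by
      refine TwExt.ext ?_ (neg_add_cancel _)
      change -e.fib - c (-e.base) e.base - c 0 0 + e.fib + c (-e.base) e.base = -c 0 0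
      abel
    add_comm := fun e e' => by
      refine TwExt.ext ?_ (add_comm _ _)
      change e.fib + e'.fib + c e.base e'.base = e'.fib + e.fib + c e'.base e.base
      rw [hs e.base]; abel }

variable (p : ℕ) [Fact p.Prime]

lemma twGroup_nsmul (c : Q → Q → N) (hc : ∀ x y z, c y z + c x (y + z) = c (x + y) z + c x y)
    (hs : ∀ x y, c x y = c y x) (k : ℕ) (e : TwExt c) :
    letI := twGroup c hc hs
    k • e = ⟨k • e.fib + ∑ i ∈ Finset.range k, c (i • e.base) e.base - c 0 0, k • e.base⟩ := by
  let _ := twGroup c hc hs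
  induction k with
  | zero =>
    rw [zero_nsmul]
    refine TwExt.ext ?_ (zero_nsmul _).symm
    change - c 0 0 = _
    simp
  | succ k ih =>
    rw [succ_nsmul, ih]
    refine TwExt.ext ?_ (succ_nsmul _ _).symm
    change k • e.fib + ∑ i ∈ Finset.range k, c (i • e.base) e.base - c 0 0 + e.fib +
      c (k • e.base) e.base = _
    simp only [succ_nsmul, Finset.sum_range_succ]
    abel

lemma sum_cocycle_add (c : Q → Q → N)
    (hc : ∀ x y z, c y z + c x (y + z) = c (x + y) z + c x y) (hs : ∀ x y, c x y = c y x)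
    (hN : ∀ n : N, p • n = 0) (hQ : ∀ x : Q, p • x = 0) (x y : Q) :
    ∑ i ∈ Finset.range p, c (i • (x + y)) (x + y) =
      ∑ i ∈ Finset.range p, c (i • x) x + ∑ i ∈ Finset.range p, c (i • y) y := by
  let _ := twGroup c hc hs
  have h := nsmul_add (⟨0, x⟩ : TwExt c) ⟨0, y⟩ p
  rw [twGroup_nsmul c hc hs, twGroup_nsmul c hc hs, twGroup_nsmul c hc hs] at h
  have h' := congrArg TwExt.fib h
  simp only [hN, hQ] at h'
  change 0 + ∑ i ∈ Finset.range p, c (i • (x + y)) (x + y) - c 0 0 =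
    (0 + ∑ i ∈ Finset.range p, c (i • x) x - c 0 0) +
    (0 + ∑ i ∈ Finset.range p, c (i • y) y - c 0 0) + c 0 0 at h'
  linear_combination (norm := abel) h'

lemma exists_addHom_section {E R : Type} [AddCommGroup E] [AddCommGroup R] [Module (ZMod p) E]
    [Module (ZMod p) R] (f : E →+ R) (hf : Function.Surjective f) :
    ∃ s : R →+ E, ∀ x, f (s x) = x := by
  obtain ⟨s, hs⟩ := LinearMap.exists_rightInverse_of_surjective
    (AddMonoidHom.toZModLinearMap p f) (LinearMap.range_eq_top.2 hf)
  exact ⟨s.toAddMonoidHom, fun x => LinearMap.congr_fun hs x⟩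

lemma exists_split (c : Q → Q → N)
    (hc : ∀ x y z, c y z + c x (y + z) = c (x + y) z + c x y) (hs : ∀ x y, c x y = c y x)
    (hN : ∀ n : N, p • n = 0) (hQ : ∀ x : Q, p • x = 0)
    (hp : ∀ x, ∑ i ∈ Finset.range p, c (i • x) x = 0) :
    ∃ f : Q → N, ∀ x y, c x y = f y - f (x + y) + f x := by
  let _ := twGroup c hc hs
  have hE : ∀ e : TwExt c, p • e = 0 := fun e => by
    rw [twGroup_nsmul c hc hs, hN, hQ, hp]
    refine TwExt.ext ?_ rfl
    change (0 : N) + 0 - c 0 0 = - c 0 0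
    abel
  let mE : Module (ZMod p) (TwExt c) := AddCommGroup.zmodModule hE
  let mQ : Module (ZMod p) Q := AddCommGroup.zmodModule hQ
  let π : TwExt c →+ Q := { toFun := TwExt.base, map_zero' := rfl, map_add' := fun _ _ => rfl }
  obtain ⟨s, hs'⟩ := exists_addHom_section p π
    (fun x => ⟨⟨0, x⟩, rfl⟩)
  have hb : ∀ x, (s x).base = x := hs'
  refine ⟨fun x => - (s x).fib, fun x y => ?_⟩
  have h := congrArg TwExt.fib (map_add s x y)
  change (s (x + y)).fib = (s x).fib + (s y).fib + c (s x).base (s y).base at h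
  rw [hb, hb] at h
  simp only [h]; abel

end Twisted

section Functionals

variable {k H N : Type} [Field k] [Group H] [AddCommGroup N] [Module k N]

/-- The commutator form of a two-cochain. -/
def bet (c : H → H → N) (x y : H) : N := c x y - c y x

/-- The `p`-power functional of a two-cochain. -/
def pif (p : ℕ) (c : H → H → N) (x : H) : N := ∑ i ∈ Finset.range p, c (x ^ i) x

/-- The mixed functional of a two-cochain. -/
def del (c : H → H → N) (l u : H) : N := c l u - c (l * u * l⁻¹) l

lemma bet_self (c : H → H → N) (x : H) : bet c x x = 0 := sub_self _

lemma bet_swap (c : H → H → N) (x y : H) : bet c x y = - bet c y x := (neg_sub _ _).symm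

variable {ρ : Representation k H N} {c : H → H → N}

lemma triv_conj {x : H} (hx : ∀ v, ρ x v = v) (g : H) (v : N) : ρ (g * x * g⁻¹) v = v := by
  rw [rho_mul, rho_mul, hx, ← rho_mul, mul_inv_cancel, map_one]; rfl

lemma cj_conj (g x y : H) : cj ρ g c (g * x * g⁻¹) (g * y * g⁻¹) = ρ g (c x y) := by
  have : ∀ z, g⁻¹ * (g * z * g⁻¹) * g = z := fun z => by group
  rw [cj, this, this]

lemma bet_conj (hc : c ∈ Z2 ρ) {x y : H} (hxy : x * y = y * x) (hx : ∀ v, ρ x v = v)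
    (hy : ∀ v, ρ y v = v) (g : H) :
    bet c (g * x * g⁻¹) (g * y * g⁻¹) = ρ g (bet c x y) := by
  have e := cj_eq hc g
  have e1 := congrFun (congrFun e (g * x * g⁻¹)) (g * y * g⁻¹)
  have e2 := congrFun (congrFun e (g * y * g⁻¹)) (g * x * g⁻¹)
  rw [cj_conj] at e1 e2
  have e3 : g * x * g⁻¹ * (g * y * g⁻¹) = g * y * g⁻¹ * (g * x * g⁻¹) := by
    have : g * x * g⁻¹ * (g * y * g⁻¹) = g * (x * y) * g⁻¹ := by group
    rw [this, hxy]; group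
  simp only [Pi.add_apply, d1_apply, triv_conj hx, triv_conj hy, e3] at e1 e2
  rw [bet, bet, map_sub, e1, e2]
  abel

lemma bet_mul_left (hc : c ∈ Z2 ρ) {x x' y : H} (h : x * y = y * x) (h' : x' * y = y * x')
    (hx : ∀ v, ρ x v = v) (hy : ∀ v, ρ y v = v) :
    bet c (x * x') y = bet c x y + bet c x' y := by
  have e1 := hc x x' y
  have e2 := hc y x x'
  have e3 := hc x y x'
  rw [hx] at e1 e3
  rw [hy] at e2
  rw [h'] at e1
  rw [h] at e3
  simp only [bet]
  linear_combination (norm := abel) -e1 - e2 + e3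

lemma bet_mul_right (hc : c ∈ Z2 ρ) {x x' y : H} (h : x * y = y * x) (h' : x' * y = y * x')
    (hx : ∀ v, ρ x v = v) (hy : ∀ v, ρ y v = v) :
    bet c y (x * x') = bet c y x + bet c y x' := by
  rw [bet_swap, bet_mul_left hc h h' hx hy, bet_swap c x, bet_swap c x']; abel

lemma triv_pow {x : H} (hx : ∀ v, ρ x v = v) (i : ℕ) (v : N) : ρ (x ^ i) v = v := by
  have : ρ x = 1 := LinearMap.ext hx
  rw [map_pow, this, one_pow]; rfl

lemma pif_conj (p : ℕ) [CharP k p] (hc : c ∈ Z2 ρ) {x : H} (hx : ∀ v, ρ x v = v) (hp : x ^ p = 1)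
    (g : H) : pif p c (g * x * g⁻¹) = ρ g (pif p c x) := by
  have e : ∀ i, ρ g (c (x ^ i) x) = c ((g * x * g⁻¹) ^ i) (g * x * g⁻¹) + _ := fun i => by
    rw [conj_pow, ← cj_conj, cj_eq hc g]
    rfl
  simp only [pif, map_sum]
  simp only [e, Finset.sum_add_distrib, left_eq_add]
  set f : H → N := fun h => c g (g⁻¹ * h * g) - c h g
  have : ∀ i, d1 ρ f (g * x ^ i * g⁻¹) (g * x * g⁻¹) =
      f (g * x * g⁻¹) - (f (g * x ^ (i + 1) * g⁻¹) - f (g * x ^ i * g⁻¹)) := fun i => by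
    have : g * x ^ i * g⁻¹ * (g * x * g⁻¹) = g * x ^ (i + 1) * g⁻¹ := by rw [pow_succ]; group
    rw [d1_apply, triv_conj (triv_pow hx i), this]; abel
  simp only [this]
  rw [Finset.sum_sub_distrib, Finset.sum_range_sub (fun i => f (g * x ^ i * g⁻¹)), hp]
  simp only [Finset.sum_const, Finset.card_range, pow_zero, sub_self, sub_zero]
  rw [← Nat.cast_smul_eq_nsmul k, CharP.cast_eq_zero, zero_smul]

lemma del_mul_right (hc : c ∈ Z2 ρ) {l u v : H} (hu : ∀ n, ρ u n = n)
    (h0 : c u v = 0) (h0' : c (l * u * l⁻¹) (l * v * l⁻¹) = 0) :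
    del c l (u * v) = del c l u + del c l v := by
  have e1 := hc l u v
  have e2 := hc (l * u * l⁻¹) l v
  have e3 := hc (l * u * l⁻¹) (l * v * l⁻¹) l
  rw [triv_conj hu] at e2 e3
  have a1 : l * u * l⁻¹ * l = l * u := by group
  have a2 : l * v * l⁻¹ * l = l * v := by group
  have a3 : l * u * l⁻¹ * (l * v * l⁻¹) = l * (u * v) * l⁻¹ := by group
  rw [h0, map_zero] at e1
  rw [a1] at e2
  rw [a2, a3, h0'] at e3
  simp only [del]
  linear_combination (norm := abel) e1 - e2 + e3

lemma del_mul_left (hc : c ∈ Z2 ρ) {l l' u : H} (hu : ∀ n, ρ u n = n) :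
    del c (l * l') u = ρ l (del c l' u) + del c l (l' * u * l'⁻¹) := by
  have e1 := hc l l' u
  have e2 := hc (l * l' * u * (l * l')⁻¹) l l'
  have e3 := hc l (l' * u * l'⁻¹) l'
  have a0 : l * l' * u * (l * l')⁻¹ = l * (l' * u * l'⁻¹) * l⁻¹ := by group
  rw [triv_conj hu, a0] at e2
  have a1 : l * (l' * u * l'⁻¹) * l⁻¹ * l = l * (l' * u * l'⁻¹) := by group
  have a2 : l' * u * l'⁻¹ * l' = l' * u := by group
  rw [a1] at e2
  rw [a2] at e3
  simp only [del, map_sub]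
  rw [a0]
  linear_combination (norm := abel) -e1 - e2 + e3

end Functionals

section Splitting

variable {k H N : Type} [Field k] [Group H] [AddCommGroup N] [Module k N]
  (p : ℕ) [Fact p.Prime] [CharP k p] {Q : Type} [AddCommGroup Q]
  {ρ : Representation k H N} {c : H → H → N}

lemma pif_add (σ : Multiplicative Q →* H) (hσ : ∀ x v, ρ (σ x) v = v) (hc : c ∈ Z2 ρ)
    (hQ : ∀ x : Q, p • x = 0)
    (hb : ∀ x y, bet c (σ x) (σ y) = 0) (x y : Multiplicative Q) :
    pif p c (σ (x * y)) = pif p c (σ x) + pif p c (σ y) := by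
  have := sum_cocycle_add p (fun x y : Q => c (σ (.ofAdd x)) (σ (.ofAdd y)))
    (fun x y z => by simpa [hσ] using hc (σ (.ofAdd x)) (σ (.ofAdd y)) (σ (.ofAdd z)))
    (fun x y => sub_eq_zero.1 (hb _ _))
    (fun n => by rw [← Nat.cast_smul_eq_nsmul k, CharP.cast_eq_zero, zero_smul]) hQ x.toAdd y.toAdd
  simp only [ofAdd_nsmul, ofAdd_add, ofAdd_toAdd, map_pow] at this
  simpa only [pif, ← map_pow] using this

lemma pull_mem_B2_of_functionals (σ : Multiplicative Q →* H) (hσ : ∀ x v, ρ (σ x) v = v)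
    (hc : c ∈ Z2 ρ) (hQ : ∀ x : Q, p • x = 0) (hb : ∀ x y, bet c (σ x) (σ y) = 0)
    (hp : ∀ x, pif p c (σ x) = 0) : pull k σ c ∈ B2 (ρ.comp σ) := by
  obtain ⟨f, hf⟩ := exists_split p (fun x y : Q => c (σ (.ofAdd x)) (σ (.ofAdd y)))
    (fun x y z => by simpa [hσ] using hc (σ (.ofAdd x)) (σ (.ofAdd y)) (σ (.ofAdd z)))
    (fun x y => sub_eq_zero.1 (hb _ _))
    (fun n => by rw [← Nat.cast_smul_eq_nsmul k, CharP.cast_eq_zero, zero_smul]) hQ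
    (fun x => by simpa [pif] using hp (.ofAdd x))
  refine ⟨fun x => f x.toAdd, ?_⟩
  ext x y
  have := hf x.toAdd y.toAdd
  simp only [ofAdd_toAdd] at this
  simp [hσ, this]

/-- A cocycle on a semidirect product that is trivial on both factors and whose mixed functional
vanishes is a coboundary. -/
lemma mem_B2_of_semidirect {S L : Type} [Group S] [Group L] (σ : S →* H) (lam : L →* H)
    (hdec : Function.Bijective fun x : S × L => σ x.1 * lam x.2)
    (hσ : ∀ x v, ρ (σ x) v = v) (hn : ∀ l u, ∃ u', σ u' = lam l * σ u * (lam l)⁻¹)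
    (hc : c ∈ Z2 ρ) (h0 : ∀ u v, c (σ u) (σ v) = 0) (hl : pull k lam c ∈ B2 (ρ.comp lam))
    (hd : ∀ l u, del c (lam l) (σ u) = 0) : c ∈ B2 ρ := by
  obtain ⟨g, hg⟩ := hl
  let e := Equiv.ofBijective _ hdec
  have he : ∀ u l, e.symm (σ u * lam l) = (u, l) := fun u l => e.symm_apply_apply (u, l)
  refine ⟨fun h => g (e.symm h).2 - c (σ (e.symm h).1) (lam (e.symm h).2), ?_⟩
  funext h h'
  obtain ⟨⟨u, l⟩, rfl⟩ := hdec.2 h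
  obtain ⟨⟨v, m⟩, rfl⟩ := hdec.2 h'
  obtain ⟨w, hw⟩ := hn l v
  have hmul : σ u * lam l * (σ v * lam m) = σ (u * w) * lam (l * m) := by
    rw [map_mul, hw, map_mul]; group
  have hg' := congrFun (congrFun hg l) m
  simp only [d1_apply, pull_apply, MonoidHom.comp_apply] at hg'
  have hd' : c (lam l) (σ v) = c (σ w) (lam l) := by
    have := hd l v
    rw [del, ← hw, sub_eq_zero] at this
    exact this
  simp only [d1_apply, hmul, he]
  have e1 := hc (σ u) (lam l) (σ v * lam m)
  have e2 := hc (lam l) (σ v) (lam m)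
  have e3 := hc (σ w) (lam l) (lam m)
  have e4 := hc (σ u) (σ w) (lam l * lam m)
  have a1 : lam l * σ v = σ w * lam l := by rw [hw]; group
  have a2 : lam l * (σ v * lam m) = σ w * (lam l * lam m) := by rw [← mul_assoc, a1, mul_assoc]
  rw [hσ, a2] at e1
  rw [a1, hd'] at e2
  rw [hσ] at e3 e4
  rw [h0] at e4
  rw [rho_mul, hσ, map_sub, map_mul, map_mul]
  linear_combination (norm := abel) hg' + e1 - e2 + e3 - e4

end Splitting

section Elements

variable {K : Type} [Field K]

/-- The special linear group of degree four. -/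
abbrev G (K : Type) [Field K] := Matrix.SpecialLinearGroup (Fin 4) K

/-- The elementary matrix `1 + s E_{ab}`, and `1` when `a = b`. -/
def X (a b : Fin 4) (s : K) : G K :=
  if h : a ≠ b then Matrix.SpecialLinearGroup.transvection h s else 1

lemma X_coe {a b : Fin 4} (h : a ≠ b) (s : K) :
    (X a b s : Matrix (Fin 4) (Fin 4) K) = 1 + Matrix.single a b s := by
  rw [X, dif_pos h]; rfl

@[simp] lemma X_zero (a b : Fin 4) : X a b (0 : K) = 1 := by
  by_cases h : a ≠ b
  · ext; simp [X_coe h]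
  · rw [X, dif_neg h]

lemma X_add (a b : Fin 4) (s t : K) : X a b (s + t) = X a b s * X a b t := by
  by_cases h : a ≠ b
  · simp only [X, dif_pos h]
    exact Matrix.SpecialLinearGroup.transvection_add h s t
  · simp only [X, dif_neg h, mul_one]

lemma X_inv (a b : Fin 4) (s : K) : (X a b s)⁻¹ = X a b (-s) :=
  inv_eq_of_mul_eq_one_right (by rw [← X_add, add_neg_cancel, X_zero])

lemma X_comm {a b c d : Fin 4} (h1 : b ≠ c) (h2 : d ≠ a) (s t : K) :
    X a b s * X c d t = X c d t * X a b s := by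
  by_cases h : a ≠ b
  · by_cases h' : c ≠ d
    · apply Subtype.ext
      simp only [Matrix.SpecialLinearGroup.coe_mul, X_coe h, X_coe h', mul_add, add_mul, mul_one,
        one_mul, Matrix.single_mul_single_of_ne _ _ _ _ h1,
        Matrix.single_mul_single_of_ne _ _ _ _ h2]
      abel
    · simp [X, h']
  · simp [X, h]

lemma X_conj_left {a b c : Fin 4} (h1 : a ≠ b) (h2 : b ≠ c) (h3 : a ≠ c) (s t : K) :
    X a b s * X b c t * (X a b s)⁻¹ = X a c (s * t) * X b c t := by
  rw [mul_inv_eq_iff_eq_mul]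
  apply Subtype.ext
  simp only [Matrix.SpecialLinearGroup.coe_mul, X_coe h1, X_coe h2, X_coe h3, mul_add, add_mul,
    mul_one, one_mul, Matrix.single_mul_single_same, Matrix.single_mul_single_of_ne _ _ _ _ h2.symm,
    Matrix.single_mul_single_of_ne _ _ _ _ h3.symm, zero_mul]
  abel

lemma X_conj_right {a b c : Fin 4} (h1 : a ≠ b) (h2 : b ≠ c) (h3 : a ≠ c) (s t : K) :
    X b c s * X a b t * (X b c s)⁻¹ = X a c (-(t * s)) * X a b t := by
  rw [mul_inv_eq_iff_eq_mul]
  apply Subtype.ext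
  simp only [Matrix.SpecialLinearGroup.coe_mul, X_coe h1, X_coe h2, X_coe h3, mul_add, add_mul,
    mul_one, one_mul, Matrix.single_mul_single_same, Matrix.single_mul_single_of_ne _ _ _ _ h2.symm,
    Matrix.single_mul_single_of_ne _ _ _ _ h3.symm, zero_mul]
  rw [add_assoc, add_assoc, add_assoc, add_left_cancel_iff]
  have : Matrix.single a c (-(t * s)) = - Matrix.single a c (t * s) := by
    rw [← Matrix.single_neg]
  rw [this]
  simp only [add_zero]
  abel

/-- The diagonal torus, in coordinates. -/
def Tor (K : Type) [Field K] : Subgroup (Fin 4 → Kˣ) where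
  carrier := {d | ∏ i, d i = 1}
  one_mem' := by simp
  mul_mem' {a b} ha hb := by
    simp only [Set.mem_ofPred_eq, Pi.mul_apply, Finset.prod_mul_distrib] at *
    rw [ha, hb, one_mul]
  inv_mem' {a} ha := by
    simp only [Set.mem_ofPred_eq, Pi.inv_apply, Finset.prod_inv_distrib] at *
    rw [ha, inv_one]

/-- Diagonal matrices of determinant one. -/
def tau : Tor K →* G K where
  toFun d := ⟨Matrix.diagonal fun i => (d.1 i : K), by
    rw [Matrix.det_diagonal, ← Units.coe_prod, show ∏ i, d.1 i = 1 from d.2, Units.val_one]⟩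
  map_one' := by apply Subtype.ext; simp
  map_mul' d e := by
    apply Subtype.ext
    simp only [Subgroup.coe_mul, Pi.mul_apply, Units.val_mul]
    exact (Matrix.diagonal_mul_diagonal _ _).symm

lemma tau_coe (d : Tor K) : (tau d : Matrix (Fin 4) (Fin 4) K) = Matrix.diagonal fun i => (d.1 i : K) :=
  rfl

/-- The character of the torus with exponent vector `v`. -/
def chi (v : Fin 4 → ℤ) : Tor K →* Kˣ where
  toFun d := ∏ i, d.1 i ^ v i
  map_one' := by simp
  map_mul' d e := by simp [mul_zpow, Finset.prod_mul_distrib]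

lemma chi_apply (v : Fin 4 → ℤ) (d : Tor K) : chi v d = ∏ i, d.1 i ^ v i := rfl

lemma chi_add (v w : Fin 4 → ℤ) : (chi (v + w) : Tor K →* Kˣ) = chi v * chi w := by
  ext d; simp [chi_apply, zpow_add, Finset.prod_mul_distrib]

lemma chi_nsmul (n : ℕ) (v : Fin 4 → ℤ) : (chi (n • v) : Tor K →* Kˣ) = chi v ^ n := by
  ext d; simp [chi_apply, mul_comm (n : ℤ), zpow_mul, Finset.prod_pow]

/-- The exponent vector of the root `e_a - e_b`. -/
def rt (a b : Fin 4) : Fin 4 → ℤ := Pi.single a 1 - Pi.single b 1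

lemma chi_rt (a b : Fin 4) (d : Tor K) : chi (rt a b) d = d.1 a * (d.1 b)⁻¹ := by
  have h : ∀ c : Fin 4, ∏ i, d.1 i ^ (Pi.single c (1 : ℤ) : Fin 4 → ℤ) i = d.1 c := fun c => by
    rw [Finset.prod_eq_single c]
    · simp
    · intro b _ hb; simp [hb]
    · simp
  simp only [chi_apply, rt, Pi.sub_apply, zpow_sub, Finset.prod_mul_distrib, Finset.prod_inv_distrib, h]

lemma tau_conj_X (a b : Fin 4) (d : Tor K) (s : K) :
    tau d * X a b s * (tau d)⁻¹ = X a b (chi (rt a b) d * s) := by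
  by_cases h : a ≠ b
  · rw [mul_inv_eq_iff_eq_mul, chi_rt]
    apply Subtype.ext
    ext i j
    simp only [Matrix.SpecialLinearGroup.coe_mul, X_coe h, tau_coe, Matrix.diagonal_mul,
      Matrix.mul_diagonal, Matrix.add_apply, Matrix.single_apply, Matrix.one_apply]
    by_cases h1 : a = i ∧ b = j
    · obtain ⟨rfl, rfl⟩ := h1
      simp only [h, if_false, zero_add, and_self, if_true, Units.val_mul, Units.val_inv_eq_inv_val]
      field_simp
    · by_cases h2 : i = j
      · subst h2
        simp [h1, mul_comm]
      · simp [h1, h2]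
  · simp [X, h]

lemma chi_shift {v w : Fin 4 → ℤ} {c : ℤ} (h : ∀ i, v i = w i + c) :
    (chi v : Tor K →* Kˣ) = chi w := by
  ext d
  simp only [chi_apply, h, zpow_add, Finset.prod_mul_distrib, Finset.prod_zpow,
    show ∏ i, d.1 i = 1 from d.2]
  simp

variable [Finite K]

lemma chi_congr {v w : Fin 4 → ℤ} {c : ℤ} (h : ∀ i, ((Nat.card K - 1 : ℕ) : ℤ) ∣ v i - (w i + c)) :
    (chi v : Tor K →* Kˣ) = chi w := by
  rw [← chi_shift (K := K) (v := fun i => w i + c) (w := w) (c := c) fun i => rfl]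
  refine MonoidHom.ext fun d => ?_
  simp only [chi_apply]
  refine Finset.prod_congr rfl fun i _ => ?_
  obtain ⟨z, hz⟩ := h i
  rw [eq_add_of_sub_eq hz]
  have : d.1 i ^ (Nat.card K - 1) = 1 := by
    rw [← Nat.card_units]; exact pow_card_eq_one'
  rw [zpow_add, zpow_mul, zpow_natCast, this, one_zpow, one_mul]

lemma dvd_of_chi_eq {v w : Fin 4 → ℤ} (h : (chi v : Tor K →* Kˣ) = chi w) (a b : Fin 4) :
    ((Nat.card K - 1 : ℕ) : ℤ) ∣ (v a - v b) - (w a - w b) := by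
  obtain ⟨z, hz⟩ := IsCyclic.exists_generator (α := Kˣ)
  by_cases hab : a = b
  · simp [hab]
  have hmem : (Pi.mulSingle a z * Pi.mulSingle b z⁻¹ : Fin 4 → Kˣ) ∈ Tor K := by
    change ∏ i, _ = 1
    simp only [Pi.mul_apply, Finset.prod_mul_distrib]
    rw [Finset.prod_pi_mulSingle', Finset.prod_pi_mulSingle']
    simp
  have hval : ∀ v : Fin 4 → ℤ, chi v (⟨_, hmem⟩ : Tor K) = z ^ (v a - v b) := by
    intro v
    rw [chi_apply]
    simp only [Pi.mul_apply, mul_zpow, Finset.prod_mul_distrib]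
    rw [Finset.prod_eq_single a, Finset.prod_eq_single b, zpow_sub]
    · simp
    · intro i _ hi; simp [hi]
    · simp
    · intro i _ hi; simp [hi]
    · simp
  have e := DFunLike.congr_fun h ⟨_, hmem⟩
  rw [hval, hval] at e
  rw [← Nat.card_units, ← orderOf_eq_card_of_forall_mem_zpowers hz]
  rw [orderOf_dvd_iff_zpow_eq_one, zpow_sub, e, mul_inv_cancel]

lemma card_Tor_ne_zero (p : ℕ) [Fact p.Prime] [CharP K p] : (Nat.card (Tor K) : K) ≠ 0 := by
  rw [Ne, CharP.cast_eq_zero_iff K p]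
  intro h
  have h1 : Nat.card (Tor K) ∣ Nat.card (Fin 4 → Kˣ) := Subgroup.card_subgroup_dvd_card _
  rw [Nat.card_fun, Nat.card_units] at h1
  have h2 := (Fact.out : p.Prime).dvd_of_dvd_pow (h.trans h1)
  have h3 : p ∣ Nat.card K := by
    have := Fintype.ofFinite K
    rw [Nat.card_eq_fintype_card]
    exact (CharP.cast_eq_zero_iff K p _).1 (FiniteField.cast_card_eq_zero K)
  have h4 : 0 < Nat.card K := Nat.card_pos
  have := (Nat.dvd_sub h3 h2)
  rw [Nat.sub_sub_self h4] at this
  exact (Fact.out : p.Prime).one_lt.ne' (Nat.dvd_one.1 this)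

end Elements

section Families

variable {K H Θ N : Type} [Field K] [Group H] [Group Θ] [AddCommGroup N] [Module K N]
  {ρ : Representation K H N} {θ : Θ →* H} {c : H → H → N}

/-- A one-parameter family of group elements on which a torus acts through a character. -/
structure RootFam (θ : Θ →* H) (x : K → H) (α : Θ →* Kˣ) : Prop where
  add : ∀ a b, x (a + b) = x a * x b
  conj : ∀ t a, θ t * x a * (θ t)⁻¹ = x (α t * a)

lemma RootFam.zero {x : K → H} {α : Θ →* Kˣ} (h : RootFam θ x α) : x 0 = 1 := by
  have := h.add 0 0
  rwa [add_zero, left_eq_mul] at this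

lemma RootFam.pow {x : K → H} {α : Θ →* Kˣ} (h : RootFam θ x α) (a : K) (n : ℕ) :
    x a ^ n = x (n • a) := by
  induction n with
  | zero => simp [h.zero]
  | succ n ih => rw [pow_succ, ih, succ_nsmul, h.add]

lemma RootFam.comm {x : K → H} {α : Θ →* Kˣ} (h : RootFam θ x α) (a b : K) :
    x a * x b = x b * x a := by rw [← h.add, ← h.add, add_comm]

/-- A one-parameter family as a homomorphism. -/
def RootFam.hom {x : K → H} {α : Θ →* Kˣ} (h : RootFam θ x α) : Multiplicative K →* H where
  toFun a := x a.toAdd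
  map_one' := h.zero
  map_mul' _ _ := h.add _ _

/-- The commutator form on a pair of families. -/
def betL (K : Type) [Field K] {N : Type} [AddCommGroup N] [Module K N] (x y : K → H) :
    (H → H → N) →ₗ[K] (K → K → N) where
  toFun c a b := bet c (x a) (y b)
  map_add' c c' := by ext; simp only [bet, Pi.add_apply]; abel
  map_smul' r c := by ext; simp [bet, smul_sub]

/-- The power functional on a family. -/
def pifL (p : ℕ) (K : Type) [Field K] {N : Type} [AddCommGroup N] [Module K N] (x : K → H) :
    (H → H → N) →ₗ[K] (K → N) where
  toFun c a := pif p c (x a)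
  map_add' c c' := by ext; simp [pif, Finset.sum_add_distrib]
  map_smul' r c := by ext; simp [pif, Finset.smul_sum]

/-- The mixed functional on a pair of families. -/
def delL (K : Type) [Field K] {N : Type} [AddCommGroup N] [Module K N] (x y : K → H) :
    (H → H → N) →ₗ[K] (K → K → N) where
  toFun c a b := del c (x a) (y b)
  map_add' c c' := by ext; simp only [del, Pi.add_apply]; abel
  map_smul' r c := by ext; simp [del, smul_sub]

@[simp] lemma betL_apply (x y : K → H) (a b : K) : betL K x y c a b = bet c (x a) (y b) := rfl
@[simp] lemma pifL_apply (p : ℕ) (x : K → H) (a : K) : pifL p K x c a = pif p c (x a) := rfl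
@[simp] lemma delL_apply (x y : K → H) (a b : K) : delL K x y c a b = del c (x a) (y b) := rfl

variable {x y z : K → H} {α β : Θ →* Kˣ}

lemma betL_mem (hc : c ∈ Z2 ρ) (hx : RootFam θ x α) (hy : RootFam θ y β)
    (hxy : ∀ a b, x a * y b = y b * x a) (tx : ∀ a v, ρ (x a) v = v) (ty : ∀ a v, ρ (y a) v = v) :
    betL K x y c ∈ biW (ρ.comp θ) α β := by
  refine ⟨fun a b d => ?_, fun a b d => ?_, fun t a b => ?_⟩
  · simp only [betL_apply, hx.add]
    exact bet_mul_left hc (hxy _ _) (hxy _ _) (tx _) (ty _)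
  · simp only [betL_apply, hy.add]
    exact bet_mul_right hc (hxy _ _).symm (hxy _ _).symm (ty _) (tx _)
  · simp only [betL_apply, ← hx.conj, ← hy.conj]
    exact bet_conj hc (hxy _ _) (tx _) (ty _) _

lemma betL_mem_altW (hc : c ∈ Z2 ρ) (hx : RootFam θ x α) (tx : ∀ a v, ρ (x a) v = v) :
    betL K x x c ∈ altW (ρ.comp θ) α :=
  ⟨betL_mem hc hx hx hx.comm tx tx, fun _ => bet_self _ _⟩

variable {p : ℕ} [Fact p.Prime] [CharP K p]

lemma pifL_mem (hc : c ∈ Z2 ρ) (hx : RootFam θ x α) (tx : ∀ a v, ρ (x a) v = v)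
    (hb : ∀ a b, bet c (x a) (x b) = 0) : pifL p K x c ∈ addW (ρ.comp θ) α := by
  refine ⟨fun a b => ?_, fun t a => ?_⟩
  · have := pif_add p hx.hom (fun x v => tx _ v) hc
      (fun x => by rw [← Nat.cast_smul_eq_nsmul K, CharP.cast_eq_zero, zero_smul])
      (fun _ _ => hb _ _) (.ofAdd a) (.ofAdd b)
    exact this
  · simp only [pifL_apply, ← hx.conj]
    refine pif_conj p hc (tx _) ?_ _
    rw [hx.pow, ← Nat.cast_smul_eq_nsmul K, CharP.cast_eq_zero, zero_smul, hx.zero]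

lemma del_conj {S : Type} [Group S] {σ : S →* H} (hc : c ∈ Z0 σ θ ρ) (t : Θ) (l u : H) :
    del c (θ t * l * (θ t)⁻¹) (θ t * u * (θ t)⁻¹) = ρ (θ t) (del c l u) := by
  have : θ t * l * (θ t)⁻¹ * (θ t * u * (θ t)⁻¹) * (θ t * l * (θ t)⁻¹)⁻¹ =
    θ t * (l * u * l⁻¹) * (θ t)⁻¹ := by group
  rw [del, this, hc.2.1, hc.2.1, del, map_sub]

lemma c_one_one {S : Type} [Group S] {σ : S →* H} (hc : c ∈ Z0 σ θ ρ) : c 1 1 = 0 := by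
  simpa using hc.2.2 1 1

lemma del_mem {S : Type} [Group S] {σ : S →* H} (hc : c ∈ Z0 σ θ ρ)
    (hx : RootFam θ x α) (hy : RootFam θ y β) (hyσ : ∀ b, y b ∈ σ.range)
    (hn : ∀ a s, ∃ s', σ s' = x a * σ s * (x a)⁻¹)
    (hxy : ∀ a b, ∃ s, σ s ∈ Set.range z ∧ x a * y b * (x a)⁻¹ = σ s * y b)
    (hz : ∀ a b, del c (x a) (z b) = 0)
    (tx : ∀ a v, ρ (x a) v = v) (tσ : ∀ a v, ρ (σ a) v = v) :
    delL K x y c ∈ biW (ρ.comp θ) α β := by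
  have h0 : ∀ s s', c (σ s) (σ s') = 0 := hc.2.2
  have h1 : ∀ a s s', c (x a * σ s * (x a)⁻¹) (x a * σ s' * (x a)⁻¹) = 0 := fun a s s' => by
    obtain ⟨u, hu⟩ := hn a s
    obtain ⟨u', hu'⟩ := hn a s'
    rw [← hu, ← hu', h0]
  choose r hr using hyσ
  refine ⟨fun a b d => ?_, fun a b d => ?_, fun t a b => ?_⟩
  · obtain ⟨s, ⟨e, he⟩, hs⟩ := hxy b d
    simp only [delL_apply, hx.add]
    rw [del_mul_left hc.1 (by intro n; rw [← hr]; exact tσ _ _), tx, hs, ← hr, del_mul_right hc.1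
      (tσ _) (h0 _ _) (h1 _ _ _), ← he, hz, zero_add, add_comm]
  · simp only [delL_apply, hy.add]
    rw [← hr, ← hr, del_mul_right hc.1 (tσ _) (h0 _ _) (h1 _ _ _)]
  · simp only [delL_apply, ← hx.conj, ← hy.conj]
    exact del_conj hc _ _ _

lemma del_mem_of_comm {S : Type} [Group S] {σ : S →* H} (hc : c ∈ Z0 σ θ ρ)
    (hx : RootFam θ x α) (hy : RootFam θ y β) (hyσ : ∀ b, y b ∈ σ.range)
    (hn : ∀ a s, ∃ s', σ s' = x a * σ s * (x a)⁻¹)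
    (hxy : ∀ a b, x a * y b = y b * x a)
    (tx : ∀ a v, ρ (x a) v = v) (tσ : ∀ a v, ρ (σ a) v = v) :
    delL K x y c ∈ biW (ρ.comp θ) α β := by
  refine del_mem (z := fun _ => 1) hc hx hy hyσ hn (fun a b => ⟨1, ⟨0, by simp⟩, ?_⟩) ?_ tx tσ
  · rw [hxy]; simp
  · intro a b
    have h1 := one_right hc.1 (x a)
    have h2 := one_left hc.1 (x a)
    simp [del, h1, h2, c_one_one hc]

end Families

section Generators

variable {k H N : Type} [Field k] [Group H] [AddCommGroup N] [Module k N]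
  {ρ : Representation k H N} {c : H → H → N}

lemma bet_one_left (hc : c ∈ Z2 ρ) {y : H} (hy : ∀ v, ρ y v = v) : bet c 1 y = 0 := by
  rw [bet, one_left hc y, one_right hc y, hy, sub_self]

lemma bet_closure {Q : Type} [AddCommGroup Q] (σ : Multiplicative Q →* H)
    (hσ : ∀ x v, ρ (σ x) v = v) (hc : c ∈ Z2 ρ) (A : Set (Multiplicative Q))
    (hA : Submonoid.closure A = ⊤)
    (hb : ∀ x ∈ A, ∀ y ∈ A, bet c (σ x) (σ y) = 0) (x y) : bet c (σ x) (σ y) = 0 := by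
  have hcomm : ∀ x y, σ x * σ y = σ y * σ x := fun x y => by
    rw [← map_mul, ← map_mul, mul_comm]
  have h1 : ∀ x ∈ A, ∀ y, bet c (σ x) (σ y) = 0 := by
    intro x hx y
    induction y using Submonoid.induction_of_closure_eq_top_left hA with
    | one => rw [map_one, bet_swap, bet_one_left hc (hσ _), neg_zero]
    | mul_left a ha z hz =>
      rw [map_mul, bet_mul_right hc (hcomm _ _) (hcomm _ _) (hσ _) (hσ _), hb _ hx _ ha, hz, zero_add]
  induction x using Submonoid.induction_of_closure_eq_top_left hA with
  | one => rw [map_one, bet_one_left hc (hσ _)]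
  | mul_left a ha z hz =>
    rw [map_mul, bet_mul_left hc (hcomm _ _) (hcomm _ _) (hσ _) (hσ _), h1 _ ha, hz, zero_add]

lemma pull_mem_B2_of_generators (p : ℕ) [Fact p.Prime] [CharP k p] {Q : Type} [AddCommGroup Q]
    (σ : Multiplicative Q →* H) (hσ : ∀ x v, ρ (σ x) v = v) (hc : c ∈ Z2 ρ)
    (hQ : ∀ x : Q, p • x = 0) (A : Set (Multiplicative Q)) (hA : Submonoid.closure A = ⊤)
    (hb : ∀ x ∈ A, ∀ y ∈ A, bet c (σ x) (σ y) = 0)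
    (hp : ∀ x ∈ A, pif p c (σ x) = 0) : pull k σ c ∈ B2 (ρ.comp σ) := by
  have hb' := bet_closure σ hσ hc A hA hb
  refine pull_mem_B2_of_functionals p σ hσ hc hQ hb' fun x => ?_
  have hadd := pif_add p σ hσ hc hQ hb'
  induction x using Submonoid.induction_of_closure_eq_top_left hA with
  | one =>
    have := hadd 1 1
    rwa [mul_one, left_eq_add] at this
  | mul_left a ha z hz => rw [hadd, hp _ ha, hz, zero_add]

lemma del_closure {S L : Type} [Group S] [Group L] {σ : S →* H} {lam : L →* H}
    (hσ : ∀ x v, ρ (σ x) v = v)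
    (hn : ∀ l u, ∃ u', σ u' = lam l * σ u * (lam l)⁻¹)
    (hc : c ∈ Z2 ρ) (h0 : ∀ u v, c (σ u) (σ v) = 0) (A : Set L) (hA : Submonoid.closure A = ⊤)
    (D : Set S) (hD : Submonoid.closure D = ⊤)
    (hd : ∀ l ∈ A, ∀ u ∈ D, del c (lam l) (σ u) = 0) (l : L) (u : S) :
    del c (lam l) (σ u) = 0 := by
  have h11 : c 1 1 = 0 := by simpa using h0 1 1
  have h1 : ∀ l ∈ A, ∀ u, del c (lam l) (σ u) = 0 := by
    intro l hl u
    induction u using Submonoid.induction_of_closure_eq_top_left hD with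
    | one => rw [map_one, del, mul_one, mul_inv_cancel, one_left hc, one_right hc, h11]; simp
    | mul_left a ha z hz =>
      obtain ⟨u, hu⟩ := hn l a
      obtain ⟨u', hu'⟩ := hn l z
      rw [map_mul, del_mul_right hc (hσ _) (h0 _ _) (by rw [← hu, ← hu', h0]), hz, hd _ hl _ ha,
        add_zero]
  induction l using Submonoid.induction_of_closure_eq_top_left hA generalizing u with
  | one => rw [map_one, del, one_left hc (σ u), one_mul, inv_one, mul_one, one_right hc (σ u), h11]; simp
  | mul_left a ha z hz =>
    obtain ⟨u', hu'⟩ := hn z u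
    rw [map_mul, del_mul_left hc (hσ _), hz, ← hu', h1 _ ha, map_zero, add_zero]

/-- Combine two commuting homomorphisms from additive groups. -/
def prodHom {A B : Type} [AddCommGroup A] [AddCommGroup B] (f : Multiplicative A →* H)
    (g : Multiplicative B →* H) (h : ∀ a b, f a * g b = g b * f a) :
    Multiplicative (A × B) →* H where
  toFun x := f (.ofAdd x.toAdd.1) * g (.ofAdd x.toAdd.2)
  map_one' := by simp
  map_mul' x y := by
    simp only [toAdd_mul, Prod.fst_add, Prod.snd_add, ofAdd_add, map_mul]
    exact Commute.mul_mul_mul_comm (h _ _) _ _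

lemma closure_prod {A B : Type} [AddCommGroup A] [AddCommGroup B] (s : Set (Multiplicative A))
    (t : Set (Multiplicative B)) (hs : Submonoid.closure s = ⊤) (ht : Submonoid.closure t = ⊤) :
    Submonoid.closure ((fun a : Multiplicative A => (.ofAdd (a.toAdd, 0) : Multiplicative (A × B))) '' s ∪
      (fun b : Multiplicative B => (.ofAdd (0, b.toAdd) : Multiplicative (A × B))) '' t) = ⊤ := by
  rw [eq_top_iff]
  set M := Submonoid.closure ((fun a : Multiplicative A => (.ofAdd (a.toAdd, 0) : Multiplicative (A × B))) '' s ∪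
      (fun b : Multiplicative B => (.ofAdd (0, b.toAdd) : Multiplicative (A × B))) '' t)
  let i : Multiplicative A →* Multiplicative (A × B) := AddMonoidHom.toMultiplicative (AddMonoidHom.inl A B)
  let j : Multiplicative B →* Multiplicative (A × B) := AddMonoidHom.toMultiplicative (AddMonoidHom.inr A B)
  have h1 : ⊤ ≤ M.comap i := by
    rw [← hs, Submonoid.closure_le]
    exact fun a ha => Submonoid.subset_closure (Or.inl ⟨a, ha, rfl⟩)
  have h2 : ⊤ ≤ M.comap j := by
    rw [← ht, Submonoid.closure_le]
    exact fun a ha => Submonoid.subset_closure (Or.inr ⟨a, ha, rfl⟩)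
  intro x _
  have : x = i (.ofAdd x.toAdd.1) * j (.ofAdd x.toAdd.2) := by
    change x = Multiplicative.ofAdd (x.toAdd.1 + 0, 0 + x.toAdd.2)
    rw [add_zero, zero_add]; rfl
  rw [this]
  exact mul_mem (h1 trivial) (h2 trivial)

end Generators

section Subgroups

variable {K : Type} [Field K]

/-- The subgroup preserving the flag defined by `f`. -/
def Par (f : Fin 4 → ℕ) : Subgroup (G K) where
  carrier := {g | ∀ i j, f j < f i → g.1 i j = 0 ∧ (g⁻¹).1 i j = 0}
  one_mem' i j h := by
    have : i ≠ j := by rintro rfl; exact lt_irrefl _ h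
    simp [this]
  mul_mem' {a b} ha hb i j h := by
    have key : ∀ a b : Matrix (Fin 4) (Fin 4) K, (∀ i j, f j < f i → a i j = 0) →
        (∀ i j, f j < f i → b i j = 0) → (a * b) i j = 0 := fun a b ha hb => by
      rw [Matrix.mul_apply]
      refine Finset.sum_eq_zero fun k _ => ?_
      rcases lt_or_ge (f k) (f i) with h1 | h1
      · rw [ha _ _ h1, zero_mul]
      · rw [hb _ _ (h.trans_le h1), mul_zero]
    refine ⟨key _ _ (fun i j h => (ha i j h).1) (fun i j h => (hb i j h).1), ?_⟩
    rw [mul_inv_rev]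
    exact key _ _ (fun i j h => (hb i j h).2) (fun i j h => (ha i j h).2)
  inv_mem' {a} ha i j h := by
    rw [inv_inv]
    exact (ha i j h).symm

/-- The upper unitriangular subgroup. -/
def Uni (K : Type) [Field K] : Subgroup (G K) where
  carrier := {g | ∀ i j, j ≤ i → g.1 i j = (1 : Matrix _ _ K) i j ∧ (g⁻¹).1 i j = (1 : Matrix _ _ K) i j}
  one_mem' i j h := by simp
  mul_mem' {a b} ha hb i j h := by
    have key : ∀ a b : Matrix (Fin 4) (Fin 4) K, (∀ i j, j ≤ i → a i j = (1 : Matrix _ _ K) i j) →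
        (∀ i j, j ≤ i → b i j = (1 : Matrix _ _ K) i j) → (a * b) i j = (1 : Matrix _ _ K) i j :=
      fun a b ha hb => by
        rw [Matrix.mul_apply, Finset.sum_eq_single i]
        · rw [ha _ _ le_rfl, hb _ _ h, Matrix.one_apply_eq, one_mul]
        · intro k _ hk
          rcases lt_or_gt_of_ne hk with h1 | h1
          · rw [ha _ _ h1.le, Matrix.one_apply_ne h1.ne', zero_mul]
          · rw [hb _ _ (h.trans h1.le), Matrix.one_apply_ne (h.trans_lt h1).ne', mul_zero]
        · simp
    refine ⟨key _ _ (fun i j h => (ha i j h).1) (fun i j h => (hb i j h).1), ?_⟩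
    rw [mul_inv_rev]
    exact key _ _ (fun i j h => (hb i j h).2) (fun i j h => (ha i j h).2)
  inv_mem' {a} ha i j h := by
    rw [inv_inv]
    exact (ha i j h).symm

lemma Uni_le_Par {f : Fin 4 → ℕ} (hf : Monotone f) : Uni K ≤ Par f := by
  intro g hg i j h
  have h1 : j < i := not_le.1 fun h' => (hf h').not_gt h
  have := hg i j h1.le
  rwa [Matrix.one_apply_ne h1.ne'] at this

lemma Par_mono {f f' : Fin 4 → ℕ} (h : ∀ i j, f' j < f' i → f j < f i) : (Par f : Subgroup (G K)) ≤ Par f' :=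
  fun _ hg i j hij => hg i j (h i j hij)

lemma X_mem_Par {f : Fin 4 → ℕ} {a b : Fin 4} (h : f a ≤ f b) (s : K) : X a b s ∈ Par f := by
  by_cases hab : a ≠ b
  · have key : ∀ s : K, ∀ i j, f j < f i → (X a b s).1 i j = 0 := by
      intro s i j hij
      have h1 : i ≠ j := by rintro rfl; exact lt_irrefl _ hij
      have h2 : ¬ (a = i ∧ b = j) := by rintro ⟨rfl, rfl⟩; exact absurd h (not_le.2 hij)
      rw [X_coe hab, Matrix.add_apply, Matrix.one_apply_ne h1, Matrix.single_apply, if_neg h2, add_zero]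
    exact fun i j hij => ⟨key s i j hij, by rw [X_inv]; exact key _ i j hij⟩
  · rw [X, dif_neg hab]; exact one_mem _

lemma X_mem_Uni {a b : Fin 4} (h : a < b) (s : K) : X a b s ∈ Uni K := by
  have key : ∀ s : K, ∀ i j, j ≤ i → (X a b s).1 i j = (1 : Matrix _ _ K) i j := by
    intro s i j hij
    have h2 : ¬ (a = i ∧ b = j) := by rintro ⟨rfl, rfl⟩; exact absurd h (not_lt.2 hij)
    rw [X_coe h.ne, Matrix.add_apply, Matrix.single_apply, if_neg h2, add_zero]
  exact fun i j hij => ⟨key s i j hij, by rw [X_inv]; exact key _ i j hij⟩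

lemma tau_mem_Par (f : Fin 4 → ℕ) (d : Tor K) : tau d ∈ Par f := by
  have key : ∀ d : Tor K, ∀ i j, f j < f i → (tau d).1 i j = 0 := by
    intro d i j hij
    have h1 : i ≠ j := by rintro rfl; exact lt_irrefl _ hij
    exact Matrix.diagonal_apply_ne _ h1
  exact fun i j hij => ⟨key d i j hij, by rw [← map_inv]; exact key _ i j hij⟩

/-- The root homomorphism. -/
def hX (a b : Fin 4) : Multiplicative K →* G K where
  toFun s := X a b s.toAdd
  map_one' := X_zero a b
  map_mul' _ _ := X_add a b _ _

/-- The unipotent radical of the middle maximal parabolic. -/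
def sQ : Multiplicative (K × K × K × K) →* G K :=
  prodHom (hX 0 2) (prodHom (hX 0 3) (prodHom (hX 1 2) (hX 1 3)
    (fun _ _ => X_comm (by decide) (by decide) _ _))
    (fun a b => Commute.mul_right (X_comm (by decide) (by decide) _ _)
      (X_comm (by decide) (by decide) _ _)))
    (fun a b => Commute.mul_right (X_comm (by decide) (by decide) _ _)
      (Commute.mul_right (X_comm (by decide) (by decide) _ _)
      (X_comm (by decide) (by decide) _ _)))

/-- The two commuting simple root groups inside the Levi factor. -/
def sS : Multiplicative (K × K) →* G K :=
  prodHom (hX 0 1) (hX 2 3) (fun _ _ => X_comm (by decide) (by decide) _ _)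

lemma sQ_apply (a b c d : K) : sQ (.ofAdd (a, b, c, d)) = X 0 2 a * (X 0 3 b * (X 1 2 c * X 1 3 d)) := rfl

lemma sS_apply (a b : K) : sS (.ofAdd (a, b)) = X 0 1 a * X 2 3 b := rfl

lemma sQ_coe (a b c d : K) : (sQ (.ofAdd (a, b, c, d))).1 =
    !![1, 0, a, b; 0, 1, c, d; 0, 0, 1, 0; 0, 0, 0, 1] := by
  rw [sQ_apply]
  simp only [Matrix.SpecialLinearGroup.coe_mul, X_coe (show (0 : Fin 4) ≠ 2 by decide),
    X_coe (show (0 : Fin 4) ≠ 3 by decide), X_coe (show (1 : Fin 4) ≠ 2 by decide),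
    X_coe (show (1 : Fin 4) ≠ 3 by decide)]
  ext i j
  fin_cases i <;> fin_cases j <;>
    simp [Matrix.mul_apply, Fin.sum_univ_four, Matrix.single_apply, Matrix.one_apply]

lemma sS_coe (a b : K) : (sS (.ofAdd (a, b))).1 =
    !![1, a, 0, 0; 0, 1, 0, 0; 0, 0, 1, b; 0, 0, 0, 1] := by
  rw [sS_apply]
  simp only [Matrix.SpecialLinearGroup.coe_mul, X_coe (show (0 : Fin 4) ≠ 1 by decide),
    X_coe (show (2 : Fin 4) ≠ 3 by decide)]
  ext i j
  fin_cases i <;> fin_cases j <;>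
    simp [Matrix.mul_apply, Fin.sum_univ_four, Matrix.single_apply, Matrix.one_apply]

lemma sQ_mem_Uni (x) : (sQ x : G K) ∈ Uni K :=
  mul_mem (X_mem_Uni (a := 0) (b := 2) (by decide) _) (mul_mem (X_mem_Uni (a := 0) (b := 3) (by decide) _)
    (mul_mem (X_mem_Uni (a := 1) (b := 2) (by decide) _) (X_mem_Uni (a := 1) (b := 3) (by decide) _)))

lemma sS_mem_Uni (x) : (sS x : G K) ∈ Uni K :=
  mul_mem (X_mem_Uni (a := 0) (b := 1) (by decide) _) (X_mem_Uni (a := 2) (b := 3) (by decide) _)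

lemma sQ_injective : Function.Injective (sQ : Multiplicative (K × K × K × K) →* G K) := by
  intro x y h
  have h' := congrArg Subtype.val h
  change (sQ (.ofAdd (x.toAdd.1, x.toAdd.2.1, x.toAdd.2.2.1, x.toAdd.2.2.2))).1 =
    (sQ (.ofAdd (y.toAdd.1, y.toAdd.2.1, y.toAdd.2.2.1, y.toAdd.2.2.2))).1 at h'
  rw [sQ_coe, sQ_coe] at h'
  have e1 := congrFun (congrFun h' 0) 2
  have e2 := congrFun (congrFun h' 0) 3
  have e3 := congrFun (congrFun h' 1) 2
  have e4 := congrFun (congrFun h' 1) 3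
  simp at e1 e2 e3 e4
  exact Prod.ext e1 (Prod.ext e2 (Prod.ext e3 e4))

lemma sQ_sS_coe (x : K × K × K × K) (y : K × K) : (sQ (.ofAdd x) * sS (.ofAdd y)).1 =
    !![1, y.1, x.1, x.2.1 + x.1 * y.2; 0, 1, x.2.2.1, x.2.2.2 + x.2.2.1 * y.2; 0, 0, 1, y.2; 0, 0, 0, 1] := by
  obtain ⟨a, b, c, d⟩ := x
  obtain ⟨s, t⟩ := y
  rw [Matrix.SpecialLinearGroup.coe_mul, sQ_coe, sS_coe]
  ext i j
  fin_cases i <;> fin_cases j <;> simp [Matrix.mul_apply, Fin.sum_univ_four, add_comm]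

lemma sQ_sS_bijective : Function.Bijective
    fun x : Multiplicative (K × K × K × K) × Multiplicative (K × K) =>
      (sQ.codRestrict (Uni K) sQ_mem_Uni x.1) * (sS.codRestrict (Uni K) sS_mem_Uni x.2) := by
  constructor
  · rintro ⟨x, y⟩ ⟨x', y'⟩ h
    have h' := congrArg (fun g : Uni K => g.1.1) h
    change (sQ (.ofAdd x.toAdd) * sS (.ofAdd y.toAdd)).1 = (sQ (.ofAdd x'.toAdd) * sS (.ofAdd y'.toAdd)).1 at h'
    rw [sQ_sS_coe, sQ_sS_coe] at h'
    have e0 := congrFun (congrFun h' 0) 1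
    have e5 := congrFun (congrFun h' 2) 3
    have e1 := congrFun (congrFun h' 0) 2
    have e2 := congrFun (congrFun h' 0) 3
    have e3 := congrFun (congrFun h' 1) 2
    have e4 := congrFun (congrFun h' 1) 3
    simp at e0 e1 e2 e3 e4 e5
    rw [e1, e5, add_left_inj] at e2
    rw [e3, e5, add_left_inj] at e4
    exact Prod.ext (Prod.ext e1 (Prod.ext e2 (Prod.ext e3 e4))) (Prod.ext e0 e5)
  · rintro ⟨g, hg⟩
    refine ⟨(.ofAdd (g.1 0 2, g.1 0 3 - g.1 0 2 * g.1 2 3, g.1 1 2, g.1 1 3 - g.1 1 2 * g.1 2 3),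
      .ofAdd (g.1 0 1, g.1 2 3)), ?_⟩
    apply Subtype.ext
    apply Subtype.ext
    refine (sQ_sS_coe _ _).trans ?_
    have := fun i j h => (hg i j h).1
    ext i j
    fin_cases i <;> fin_cases j <;> simp <;> (rw [this _ _ (by decide)]; simp)

section Card
variable [Finite K]

lemma card_Uni : Nat.card (Uni K) = Nat.card K ^ 6 := by
  rw [← Nat.card_eq_of_bijective _ sQ_sS_bijective, Nat.card_prod]
  have h1 : Nat.card (Multiplicative (K × K × K × K)) = Nat.card (K × K × K × K) := rfl
  have h2 : Nat.card (Multiplicative (K × K)) = Nat.card (K × K) := rfl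
  rw [h1, h2]
  simp only [Nat.card_prod]
  ring

lemma index_Uni (p : ℕ) [Fact p.Prime] [CharP K p] : ¬ p ∣ (Uni K).index := by
  classical
  have := Fintype.ofFinite K
  intro hd
  have hp : p ∣ Nat.card K := by
    rw [Nat.card_eq_fintype_card]
    exact (CharP.cast_eq_zero_iff K p _).1 (FiniteField.cast_card_eq_zero K)
  have hq : 0 < Nat.card K := Nat.card_pos
  have h1 : Nat.card (G K) ∣ Nat.card (GL (Fin 4) K) := by
    have hinj : Function.Injective (Matrix.SpecialLinearGroup.toGL : G K →* GL (Fin 4) K) :=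
      Matrix.SpecialLinearGroup.toGL_injective
    exact Subgroup.card_dvd_of_injective _ hinj
  rw [Matrix.card_GL_field, ← (Uni K).card_mul_index, card_Uni, ← Nat.card_eq_fintype_card] at h1
  set q := Nat.card K
  have e : ∏ i : Fin 4, (q ^ 4 - q ^ (i : ℕ)) = q ^ 6 * ((q ^ 4 - 1) * (q ^ 3 - 1) * (q ^ 2 - 1) * (q - 1)) := by
    have e1 : ∀ i j : ℕ, q ^ (i + j) - q ^ i = q ^ i * (q ^ j - 1) := fun i j => by
      rw [Nat.mul_sub, mul_one, pow_add]
    rw [Fin.prod_univ_four]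
    simp only [Fin.val_zero, Fin.val_one, Fin.val_two, show ((3 : Fin 4) : ℕ) = 3 from rfl]
    rw [show q ^ 4 - q ^ 0 = q ^ 0 * (q ^ 4 - 1) from e1 0 4, show q ^ 4 - q ^ 1 = q ^ 1 * (q ^ 3 - 1) from e1 1 3,
      show q ^ 4 - q ^ 2 = q ^ 2 * (q ^ 2 - 1) from e1 2 2, show q ^ 4 - q ^ 3 = q ^ 3 * (q ^ 1 - 1) from e1 3 1]
    simp only [pow_one, pow_zero]
    ring
  rw [e] at h1
  have h2 := hd.trans (Nat.dvd_of_mul_dvd_mul_left (pow_pos hq 6) h1)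
  have h3 : ∀ n, 0 < n → ¬ p ∣ q ^ n - 1 := fun n hn h => by
    have h4 := Nat.dvd_sub (dvd_pow hp hn.ne') h
    rw [Nat.sub_sub_self (Nat.one_le_pow _ _ hq)] at h4
    exact (Fact.out : p.Prime).one_lt.ne' (Nat.dvd_one.1 h4)
  have hP : Prime p := (Fact.out : p.Prime).prime
  rcases hP.dvd_or_dvd h2 with h2 | h2
  · rcases hP.dvd_or_dvd h2 with h2 | h2
    · rcases hP.dvd_or_dvd h2 with h2 | h2
      · exact h3 _ (by norm_num) h2
      · exact h3 _ (by norm_num) h2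
    · exact h3 _ (by norm_num) h2
  · exact h3 1 (by norm_num) (by simpa using h2)

lemma index_ne_zero_of_Uni_le (p : ℕ) [Fact p.Prime] [CharP K p] {A B : Subgroup (G K)} (h : Uni K ≤ A)
    (hB : A ≤ B) : ((Subgroup.inclusion hB).range.index : K) ≠ 0 := by
  rw [Ne, CharP.cast_eq_zero_iff K p]
  intro hd
  apply index_Uni (K := K) p
  rw [Subgroup.inclusion_range] at hd
  refine hd.trans ?_
  rw [← Subgroup.relIndex_mul_index (h.trans hB), ← Subgroup.relIndex_mul_relIndex _ _ _ h hB]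
  exact (Dvd.intro_left _ rfl : A.relIndex B ∣ _).trans (Dvd.intro _ rfl)

end Card

end Subgroups

section Radical

variable {K N : Type} [Field K] [AddCommGroup N]

lemma biadditive_vanish_aux {Q : Type} [AddCommGroup Q] (e0 e1 e2 e3 : K → Q)
    (dec : ∀ x, ∃ a b c d, x = e0 a + (e1 b + (e2 c + e3 d))) (g01 g10 g23 g32 : Q → Q)
    (a1 : ∀ s, g01 (e1 s) = e1 s) (a2 : ∀ s, g01 (e2 s) = e0 s + e2 s)
    (b0 : ∀ s, g10 (e0 s) = e0 s + e2 s) (b1 : ∀ s, g10 (e1 s) = e1 s + e3 s)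
    (b2 : ∀ s, g10 (e2 s) = e2 s)
    (c0 : ∀ s, g23 (e0 s) = e0 s - e1 s) (c1 : ∀ s, g23 (e1 s) = e1 s)
    (c2 : ∀ s, g23 (e2 s) = e2 s - e3 s)
    (d0 : ∀ s, g32 (e0 s) = e0 s) (d1 : ∀ s, g32 (e1 s) = e1 s - e0 s)
    (d2 : ∀ s, g32 (e2 s) = e2 s) (d3 : ∀ s, g32 (e3 s) = e3 s - e2 s)
    (b : Q → Q → N)
    (hl : ∀ x y z, b (x + y) z = b x z + b y z) (hr : ∀ x y z, b x (y + z) = b x y + b x z)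
    (hs : ∀ x y, b x y = - b y x)
    (h01 : ∀ x y, b x y = 0 → b (g01 x) (g01 y) = 0) (h10 : ∀ x y, b x y = 0 → b (g10 x) (g10 y) = 0)
    (h23 : ∀ x y, b x y = 0 → b (g23 x) (g23 y) = 0) (h32 : ∀ x y, b x y = 0 → b (g32 x) (g32 y) = 0)
    (h0 : ∀ s t, b (e1 s) (e2 t) = 0) (x y) : b x y = 0 := by
  have hln : ∀ x y z, b (x - y) z = b x z - b y z := fun x y z => by
    have := hl (x - y) y z; rw [sub_add_cancel] at this; rw [this, add_sub_cancel_right]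
  have hrn : ∀ x y z, b x (y - z) = b x y - b x z := fun x y z => by
    have := hr x (y - z) z; rw [sub_add_cancel] at this; rw [this, add_sub_cancel_right]
  have H10 : ∀ s t, b (e1 s) (e0 t) = 0 := fun s t => by
    simpa [a1, a2, hr, h0] using h01 _ _ (h0 s t)
  have H13 : ∀ s t, b (e1 s) (e3 t) = 0 := fun s t => by
    simpa [c1, c2, hrn, h0] using h23 _ _ (h0 s t)
  have H02 : ∀ s t, b (e0 s) (e2 t) = 0 := fun s t => by
    simpa [d1, d2, hln, h0] using h32 _ _ (h0 s t)
  have H32 : ∀ s t, b (e3 s) (e2 t) = 0 := fun s t => by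
    simpa [b1, b2, hl, h0] using h10 _ _ (h0 s t)
  have H23 : ∀ s t, b (e2 s) (e3 t) = 0 := fun s t => by rw [hs, H32, neg_zero]
  have H03 : ∀ s t, b (e0 s) (e3 t) = 0 := fun s t => by
    simpa [d1, d3, hln, hrn, h0, H13, H02] using h32 _ _ (H13 s t)
  have H11 : ∀ s t, b (e1 s) (e1 t) = 0 := fun s t => by
    simpa [c1, c0, hrn, H10] using h23 _ _ (H10 s t)
  have H00 : ∀ s t, b (e0 s) (e0 t) = 0 := fun s t => by
    simpa [d1, d0, hln, H10] using h32 _ _ (H10 s t)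
  have H20 : ∀ s t, b (e2 s) (e0 t) = 0 := fun s t => by rw [hs, H02, neg_zero]
  have H31 : ∀ s t, b (e3 s) (e1 t) = 0 := fun s t => by rw [hs, H13, neg_zero]
  have H22 : ∀ s t, b (e2 s) (e2 t) = 0 := fun s t => by
    simpa [b0, hl, hr, H00, H02, H20] using h10 _ _ (H00 s t)
  have H33 : ∀ s t, b (e3 s) (e3 t) = 0 := fun s t => by
    simpa [b1, hl, hr, H11, H13, H31] using h10 _ _ (H11 s t)
  have H01 : ∀ s t, b (e0 s) (e1 t) = 0 := fun s t => by rw [hs, H10, neg_zero]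
  have H21 : ∀ s t, b (e2 s) (e1 t) = 0 := fun s t => by rw [hs, h0, neg_zero]
  have H30 : ∀ s t, b (e3 s) (e0 t) = 0 := fun s t => by rw [hs, H03, neg_zero]
  obtain ⟨x1, x2, x3, x4, rfl⟩ := dec x
  obtain ⟨y1, y2, y3, y4, rfl⟩ := dec y
  simp only [hl, hr, h0, H10, H13, H02, H32, H23, H03, H11, H00, H20, H31, H22, H33, H01, H21, H30, add_zero]

lemma biadditive_vanish (b : K × K × K × K → K × K × K × K → N)
    (hl : ∀ x y z, b (x + y) z = b x z + b y z) (hr : ∀ x y z, b x (y + z) = b x y + b x z)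
    (hs : ∀ x y, b x y = - b y x)
    (h01 : ∀ x y, b x y = 0 → b (x.1 + x.2.2.1, x.2.1 + x.2.2.2, x.2.2.1, x.2.2.2)
      (y.1 + y.2.2.1, y.2.1 + y.2.2.2, y.2.2.1, y.2.2.2) = 0)
    (h10 : ∀ x y, b x y = 0 → b (x.1, x.2.1, x.1 + x.2.2.1, x.2.1 + x.2.2.2)
      (y.1, y.2.1, y.1 + y.2.2.1, y.2.1 + y.2.2.2) = 0)
    (h23 : ∀ x y, b x y = 0 → b (x.1, x.2.1 - x.1, x.2.2.1, x.2.2.2 - x.2.2.1)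
      (y.1, y.2.1 - y.1, y.2.2.1, y.2.2.2 - y.2.2.1) = 0)
    (h32 : ∀ x y, b x y = 0 → b (x.1 - x.2.1, x.2.1, x.2.2.1 - x.2.2.2, x.2.2.2)
      (y.1 - y.2.1, y.2.1, y.2.2.1 - y.2.2.2, y.2.2.2) = 0)
    (h0 : ∀ s t, b (0, s, 0, 0) (0, 0, t, 0) = 0) (x y) : b x y = 0 := by
  refine biadditive_vanish_aux (fun s : K => (s, 0, 0, 0)) (fun s => (0, s, 0, 0)) (fun s => (0, 0, s, 0))
    (fun s => (0, 0, 0, s)) (fun x => ⟨x.1, x.2.1, x.2.2.1, x.2.2.2, by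
      refine Prod.ext ?_ (Prod.ext ?_ (Prod.ext ?_ ?_)) <;> simp⟩)
    (fun x => (x.1 + x.2.2.1, x.2.1 + x.2.2.2, x.2.2.1, x.2.2.2))
    (fun x => (x.1, x.2.1, x.1 + x.2.2.1, x.2.1 + x.2.2.2))
    (fun x => (x.1, x.2.1 - x.1, x.2.2.1, x.2.2.2 - x.2.2.1))
    (fun x => (x.1 - x.2.1, x.2.1, x.2.2.1 - x.2.2.2, x.2.2.2))
    ?_ ?_ ?_ ?_ ?_ ?_ ?_ ?_ ?_ ?_ ?_ ?_ b hl hr hs h01 h10 h23 h32 h0 x y <;> intro s <;> simp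

lemma additive_vanish_aux {Q : Type} [AddCommGroup Q] (e0 e1 e2 e3 : K → Q)
    (dec : ∀ x, ∃ a b c d, x = e0 a + (e1 b + (e2 c + e3 d))) (g10 g32 : Q → Q)
    (b1 : ∀ s, g10 (e1 s) = e1 s + e3 s) (d1 : ∀ s, g32 (e1 s) = e1 s - e0 s)
    (d3 : ∀ s, g32 (e3 s) = e3 s - e2 s) (b : Q → N) (hl : ∀ x y, b (x + y) = b x + b y)
    (h10 : ∀ x, b x = 0 → b (g10 x) = 0) (h32 : ∀ x, b x = 0 → b (g32 x) = 0)
    (h0 : ∀ s, b (e1 s) = 0) (x) : b x = 0 := by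
  have hln : ∀ x y, b (x - y) = b x - b y := fun x y => by
    have := hl (x - y) y; rw [sub_add_cancel] at this; rw [this, add_sub_cancel_right]
  have H3 : ∀ s, b (e3 s) = 0 := fun s => by simpa [b1, hl, h0] using h10 _ (h0 s)
  have H0 : ∀ s, b (e0 s) = 0 := fun s => by simpa [d1, hln, h0] using h32 _ (h0 s)
  have H2 : ∀ s, b (e2 s) = 0 := fun s => by simpa [d3, hln, H3] using h32 _ (H3 s)
  obtain ⟨x1, x2, x3, x4, rfl⟩ := dec x
  simp only [hl, H3, H0, H2, h0, add_zero]

lemma additive_vanish (b : K × K × K × K → N) (hl : ∀ x y, b (x + y) = b x + b y)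
    (h10 : ∀ x, b x = 0 → b (x.1, x.2.1, x.1 + x.2.2.1, x.2.1 + x.2.2.2) = 0)
    (h32 : ∀ x, b x = 0 → b (x.1 - x.2.1, x.2.1, x.2.2.1 - x.2.2.2, x.2.2.2) = 0)
    (h0 : ∀ s, b (0, s, 0, 0) = 0) (x) : b x = 0 := by
  refine additive_vanish_aux (fun s : K => (s, 0, 0, 0)) (fun s => (0, s, 0, 0)) (fun s => (0, 0, s, 0))
    (fun s => (0, 0, 0, s)) (fun x => ⟨x.1, x.2.1, x.2.2.1, x.2.2.2, by
      refine Prod.ext ?_ (Prod.ext ?_ (Prod.ext ?_ ?_)) <;> simp⟩)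
    (fun x => (x.1, x.2.1, x.1 + x.2.2.1, x.2.1 + x.2.2.2))
    (fun x => (x.1 - x.2.1, x.2.1, x.2.2.1 - x.2.2.2, x.2.2.2))
    ?_ ?_ ?_ b hl h10 h32 h0 x <;> intro s <;> simp

lemma sQ_conj_of {g : G K} {x y : K × K × K × K} (h : g.1 * (sQ (.ofAdd x)).1 = (sQ (.ofAdd y)).1 * g.1) :
    g * sQ (.ofAdd x) * g⁻¹ = sQ (.ofAdd y) := by
  rw [mul_inv_eq_iff_eq_mul]
  exact Subtype.ext h

lemma sQ_conj01 (s : K) (x : K × K × K × K) : X 0 1 s * sQ (.ofAdd x) * (X 0 1 s)⁻¹ =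
    sQ (.ofAdd (x.1 + s * x.2.2.1, x.2.1 + s * x.2.2.2, x.2.2.1, x.2.2.2)) := by
  obtain ⟨a, b, c, d⟩ := x
  apply sQ_conj_of
  rw [sQ_coe, sQ_coe, X_coe (by decide)]
  ext i j
  fin_cases i <;> fin_cases j <;>
    simp [Matrix.mul_apply, Fin.sum_univ_four, Matrix.single_apply, Matrix.one_apply]

lemma sQ_conj10 (s : K) (x : K × K × K × K) : X 1 0 s * sQ (.ofAdd x) * (X 1 0 s)⁻¹ =
    sQ (.ofAdd (x.1, x.2.1, s * x.1 + x.2.2.1, s * x.2.1 + x.2.2.2)) := by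
  obtain ⟨a, b, c, d⟩ := x
  apply sQ_conj_of
  rw [sQ_coe, sQ_coe, X_coe (by decide)]
  ext i j
  fin_cases i <;> fin_cases j <;>
    simp [Matrix.mul_apply, Fin.sum_univ_four, Matrix.single_apply, Matrix.one_apply]

lemma sQ_conj23 (s : K) (x : K × K × K × K) : X 2 3 s * sQ (.ofAdd x) * (X 2 3 s)⁻¹ =
    sQ (.ofAdd (x.1, x.2.1 - x.1 * s, x.2.2.1, x.2.2.2 - x.2.2.1 * s)) := by
  obtain ⟨a, b, c, d⟩ := x
  apply sQ_conj_of
  rw [sQ_coe, sQ_coe, X_coe (by decide)]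
  ext i j
  fin_cases i <;> fin_cases j <;>
    simp [Matrix.mul_apply, Fin.sum_univ_four, Matrix.single_apply, Matrix.one_apply]

lemma sQ_conj32 (s : K) (x : K × K × K × K) : X 3 2 s * sQ (.ofAdd x) * (X 3 2 s)⁻¹ =
    sQ (.ofAdd (x.1 - x.2.1 * s, x.2.1, x.2.2.1 - x.2.2.2 * s, x.2.2.2)) := by
  obtain ⟨a, b, c, d⟩ := x
  apply sQ_conj_of
  rw [sQ_coe, sQ_coe, X_coe (by decide)]
  ext i j
  fin_cases i <;> fin_cases j <;>
    simp [Matrix.mul_apply, Fin.sum_univ_four, Matrix.single_apply, Matrix.one_apply]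

end Radical

section Families

variable {K : Type} [Field K]

/-- Root elements of a parabolic subgroup. -/
noncomputable def Y (f : Fin 4 → ℕ) (a b : Fin 4) (s : K) : (Par f : Subgroup (G K)) :=
  open Classical in if h : X a b s ∈ Par f then ⟨X a b s, h⟩ else 1

lemma Y_coe {f : Fin 4 → ℕ} {a b : Fin 4} (h : f a ≤ f b) (s : K) : (Y f a b s : G K) = X a b s := by
  rw [Y, dif_pos (X_mem_Par h s)]

/-- The torus in a parabolic subgroup. -/
def thP (f : Fin 4 → ℕ) : Tor K →* (Par f : Subgroup (G K)) := tau.codRestrict _ (tau_mem_Par f)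

lemma Y_rootFam {f : Fin 4 → ℕ} {a b : Fin 4} (h : f a ≤ f b) :
    RootFam (thP f) (Y (K := K) f a b) (chi (rt a b)) where
  add s t := Subtype.ext (by
    rw [Subgroup.coe_mul, Y_coe h, Y_coe h, Y_coe h, X_add])
  conj t s := Subtype.ext (by
    rw [Subgroup.coe_mul, Subgroup.coe_mul, Subgroup.coe_inv, Y_coe h, Y_coe h]
    exact tau_conj_X a b t s)

lemma Y_comm {f : Fin 4 → ℕ} {a b c d : Fin 4} (h : f a ≤ f b) (h' : f c ≤ f d) (h1 : b ≠ c) (h2 : d ≠ a)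
    (s t : K) : Y f a b s * Y f c d t = Y f c d t * Y f a b s :=
  Subtype.ext (by
    rw [Subgroup.coe_mul, Subgroup.coe_mul, Y_coe h, Y_coe h', X_comm h1 h2])

lemma Y_conj_left {f : Fin 4 → ℕ} {a b c : Fin 4} (h : f a ≤ f b) (h' : f b ≤ f c) (h1 : a ≠ b) (h2 : b ≠ c)
    (h3 : a ≠ c) (s t : K) : Y f a b s * Y f b c t * (Y f a b s)⁻¹ = Y f a c (s * t) * Y f b c t :=
  Subtype.ext (by
    simp only [Subgroup.coe_mul, Subgroup.coe_inv, Y_coe h, Y_coe h', Y_coe (h.trans h'), X_conj_left h1 h2 h3])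

lemma Y_conj_right {f : Fin 4 → ℕ} {a b c : Fin 4} (h : f a ≤ f b) (h' : f b ≤ f c) (h1 : a ≠ b) (h2 : b ≠ c)
    (h3 : a ≠ c) (s t : K) : Y f b c s * Y f a b t * (Y f b c s)⁻¹ = Y f a c (-(t * s)) * Y f a b t :=
  Subtype.ext (by
    simp only [Subgroup.coe_mul, Subgroup.coe_inv, Y_coe h, Y_coe h', Y_coe (h.trans h'), X_conj_right h1 h2 h3])

/-- The radical in a parabolic subgroup. -/
def qP {f : Fin 4 → ℕ} (hf : Monotone f) : Multiplicative (K × K × K × K) →* (Par f : Subgroup (G K)) :=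
  sQ.codRestrict _ fun x => Uni_le_Par hf (sQ_mem_Uni x)

/-- The Levi unipotent in a parabolic subgroup. -/
def sP {f : Fin 4 → ℕ} (hf : Monotone f) : Multiplicative (K × K) →* (Par f : Subgroup (G K)) :=
  sS.codRestrict _ fun x => Uni_le_Par hf (sS_mem_Uni x)

lemma qP_injective {f : Fin 4 → ℕ} (hf : Monotone f) : Function.Injective (qP (K := K) hf) :=
  fun _ _ h => sQ_injective (congrArg Subtype.val h)

lemma Y02 {f : Fin 4 → ℕ} (hf : Monotone f) (s : K) : Y f 0 2 s = qP hf (.ofAdd (s, 0, 0, 0)) :=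
  Subtype.ext (by rw [Y_coe (hf (by decide))]; change _ = sQ _; simp [sQ_apply])
lemma Y03 {f : Fin 4 → ℕ} (hf : Monotone f) (s : K) : Y f 0 3 s = qP hf (.ofAdd (0, s, 0, 0)) :=
  Subtype.ext (by rw [Y_coe (hf (by decide))]; change _ = sQ _; simp [sQ_apply])
lemma Y12 {f : Fin 4 → ℕ} (hf : Monotone f) (s : K) : Y f 1 2 s = qP hf (.ofAdd (0, 0, s, 0)) :=
  Subtype.ext (by rw [Y_coe (hf (by decide))]; change _ = sQ _; simp [sQ_apply])
lemma Y13 {f : Fin 4 → ℕ} (hf : Monotone f) (s : K) : Y f 1 3 s = qP hf (.ofAdd (0, 0, 0, s)) :=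
  Subtype.ext (by rw [Y_coe (hf (by decide))]; change _ = sQ _; simp [sQ_apply])
lemma Y01 {f : Fin 4 → ℕ} (hf : Monotone f) (s : K) : Y f 0 1 s = sP hf (.ofAdd (s, 0)) :=
  Subtype.ext (by rw [Y_coe (hf (by decide))]; change _ = sS _; simp [sS_apply])
lemma Y23 {f : Fin 4 → ℕ} (hf : Monotone f) (s : K) : Y f 2 3 s = sP hf (.ofAdd (0, s)) :=
  Subtype.ext (by rw [Y_coe (hf (by decide))]; change _ = sS _; simp [sS_apply])

/-- The type of the middle maximal parabolic. -/
def fP : Fin 4 → ℕ := ![0, 0, 1, 1]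
/-- The type of the Borel subgroup. -/
def fB : Fin 4 → ℕ := ![0, 1, 2, 3]

lemma fP_mono : Monotone fP := by unfold Monotone fP; decide
lemma fB_mono : Monotone fB := by unfold Monotone fB; decide

variable {N : Type} [AddCommGroup N] [Module K N] {p : ℕ} [Fact p.Prime] [CharP K p]

lemma card_nsmul_eq_zero' {A : Type} [AddCommGroup A] [Module K A] (x : A) : p • x = 0 := by
  rw [← Nat.cast_smul_eq_nsmul K, CharP.cast_eq_zero, zero_smul]

lemma bet_qP_eq_zero {ρ : Representation K (Par fP : Subgroup (G K)) N} (hρ : ∀ x v, ρ (qP fP_mono x) v = v)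
    {c} (hc : c ∈ Z2 ρ) (h1 : ∀ s t, bet c (Y fP 0 3 s) (Y fP 1 2 t) = 0) (x y) :
    bet c (qP fP_mono x) (qP fP_mono y) = 0 := by
  have hcomm : ∀ x y : Multiplicative (K × K × K × K),
      qP fP_mono x * qP fP_mono y = qP fP_mono y * qP fP_mono x := fun x y => by
    rw [← map_mul, mul_comm, map_mul]
  have conj : ∀ (g : (Par fP : Subgroup (G K))) (x y : Multiplicative (K × K × K × K)),
      (g : G K) * sQ x * (g : G K)⁻¹ = sQ y →
      g * qP fP_mono x * g⁻¹ = qP fP_mono y := fun g x y h => Subtype.ext h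
  have hb0 : ∀ (g : (Par fP : Subgroup (G K))) (x y x' y' : Multiplicative (K × K × K × K)),
      (g : G K) * sQ x * (g : G K)⁻¹ = sQ x' → (g : G K) * sQ y * (g : G K)⁻¹ = sQ y' →
      bet c (qP fP_mono x) (qP fP_mono y) = 0 → bet c (qP fP_mono x') (qP fP_mono y') = 0 := by
    intro g x y x' y' hx hy h
    rw [← conj g x x' hx, ← conj g y y' hy, bet_conj hc (hcomm _ _) (hρ _) (hρ _), h, map_zero]
  have e01 : ((Y fP 0 1 (1 : K) : (Par fP : Subgroup (G K))) : G K) = X 0 1 1 := Y_coe (by decide) _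
  have e10 : ((Y fP 1 0 (1 : K) : (Par fP : Subgroup (G K))) : G K) = X 1 0 1 := Y_coe (by decide) _
  have e23 : ((Y fP 2 3 (1 : K) : (Par fP : Subgroup (G K))) : G K) = X 2 3 1 := Y_coe (by decide) _
  have e32 : ((Y fP 3 2 (1 : K) : (Par fP : Subgroup (G K))) : G K) = X 3 2 1 := Y_coe (by decide) _
  refine biadditive_vanish (fun x y => bet c (qP fP_mono (.ofAdd x)) (qP fP_mono (.ofAdd y)))
    ?_ ?_ (fun x y => bet_swap _ _ _) ?_ ?_ ?_ ?_ ?_ x y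
  · intro x y z
    rw [ofAdd_add, map_mul, bet_mul_left hc (hcomm _ _) (hcomm _ _) (hρ _) (hρ _)]
  · intro x y z
    rw [ofAdd_add, map_mul, bet_mul_right hc (hcomm _ _) (hcomm _ _) (hρ _) (hρ _)]
  · intro x y
    refine hb0 (Y fP 0 1 1) _ _ _ _ ?_ ?_ <;> rw [e01, sQ_conj01] <;> simp only [one_mul]
  · intro x y
    refine hb0 (Y fP 1 0 1) _ _ _ _ ?_ ?_ <;> rw [e10, sQ_conj10] <;> simp only [one_mul]
  · intro x y
    refine hb0 (Y fP 2 3 1) _ _ _ _ ?_ ?_ <;> rw [e23, sQ_conj23] <;> simp only [mul_one]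
  · intro x y
    refine hb0 (Y fP 3 2 1) _ _ _ _ ?_ ?_ <;> rw [e32, sQ_conj32] <;> simp only [mul_one]
  · intro s t
    have := h1 s t
    rwa [Y03 fP_mono, Y12 fP_mono] at this

lemma pull_qP_mem_B2 {ρ : Representation K (Par fP : Subgroup (G K)) N} (hρ : ∀ x v, ρ (qP fP_mono x) v = v)
    {c} (hc : c ∈ Z2 ρ) (h1 : ∀ s t, bet c (Y fP 0 3 s) (Y fP 1 2 t) = 0)
    (h2 : ∀ s, pif p c (Y fP 0 3 s) = 0) : pull K (qP fP_mono) c ∈ B2 (ρ.comp (qP fP_mono)) := by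
  have conj : ∀ (g : (Par fP : Subgroup (G K))) (x y : Multiplicative (K × K × K × K)),
      (g : G K) * sQ x * (g : G K)⁻¹ = sQ y →
      g * qP fP_mono x * g⁻¹ = qP fP_mono y := fun g x y h => Subtype.ext h
  have e10 : ((Y fP 1 0 (1 : K) : (Par fP : Subgroup (G K))) : G K) = X 1 0 1 := Y_coe (by decide) _
  have e32 : ((Y fP 3 2 (1 : K) : (Par fP : Subgroup (G K))) : G K) = X 3 2 1 := Y_coe (by decide) _
  have hb := bet_qP_eq_zero hρ hc h1
  have hp0 : ∀ (g : (Par fP : Subgroup (G K))) (x x' : Multiplicative (K × K × K × K)),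
      (g : G K) * sQ x * (g : G K)⁻¹ = sQ x' →
      pif p c (qP fP_mono x) = 0 → pif p c (qP fP_mono x') = 0 := by
    intro g x x' hx h
    have hxp : qP fP_mono x ^ p = 1 := by
      have : x ^ p = 1 := by
        change Multiplicative.ofAdd (p • x.toAdd) = 1
        rw [card_nsmul_eq_zero' (K := K), ofAdd_zero]
      rw [← map_pow, this, map_one]
    rw [← conj g x x' hx, pif_conj p hc (hρ _) hxp, h, map_zero]
  refine pull_mem_B2_of_functionals p _ hρ hc (card_nsmul_eq_zero' (K := K)) hb ?_
  refine additive_vanish (fun x => pif p c (qP fP_mono (.ofAdd x))) ?_ ?_ ?_ ?_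
  · intro x y
    exact pif_add p _ hρ hc (card_nsmul_eq_zero' (K := K)) hb _ _
  · intro x
    refine hp0 (Y fP 1 0 1) _ _ ?_
    rw [e10, sQ_conj10]; simp only [one_mul]
  · intro x
    refine hp0 (Y fP 3 2 1) _ _ ?_
    rw [e32, sQ_conj32]; simp only [mul_one]
  · intro s
    have := h2 s
    rwa [Y03 fP_mono] at this

end Families

section Fixed

variable {K S H N : Type} [Field K] [Finite K] [Group S] [Group H] [AddCommGroup N] [Module K N]
  [FiniteDimensional K N] {p : ℕ} [Fact p.Prime] [CharP K p]

lemma invariants_ne_bot [Nontrivial N] (hS : IsPGroup p S) (ρ : Representation K S N) :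
    ρ.invariants ≠ ⊥ := by
  classical
  have : Finite N := Module.finite_of_finite K
  let _ : MulAction S N :=
    { smul := fun s v => ρ s v
      one_smul := fun v => by change ρ 1 v = v; simp
      mul_smul := fun s t v => by change ρ (s * t) v = ρ s (ρ t v); simp }
  have hsm : ∀ (s : S) (v : N), s • v = ρ s v := fun _ _ => rfl
  have h1 : p ∣ Nat.card N := by
    rw [Module.natCard_eq_pow_finrank (K := K)]
    have : p ∣ Nat.card K := by
      have := Fintype.ofFinite K
      rw [Nat.card_eq_fintype_card]
      exact (CharP.cast_eq_zero_iff K p _).1 (FiniteField.cast_card_eq_zero K)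
    exact dvd_pow this (finrank_pos).ne'
  obtain ⟨b, hb, hne⟩ := hS.exists_fixed_point_of_prime_dvd_card_of_fixed_point N h1
    (a := 0) (fun s => by rw [hsm, map_zero])
  intro h
  have : b ∈ ρ.invariants := fun s => hb s
  rw [h] at this
  exact hne ((Submodule.mem_bot K).1 this).symm

lemma invariants_comp_le {σ : S →* H} (hn : ∀ g s, ∃ s', σ s' = g * σ s * g⁻¹)
    (ρ : Representation K H N) (g : H) :
    Representation.invariants (ρ.comp σ) ≤ (Representation.invariants (ρ.comp σ)).comap (ρ g) := by
  intro v hv s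
  obtain ⟨s', hs'⟩ := hn g⁻¹ s
  have h1 : σ s * g = g * σ s' := by rw [hs']; group
  have h2 := hv s'
  change ρ (σ s') v = v at h2
  change ρ (σ s) (ρ g v) = ρ g v
  rw [← rho_mul, h1, rho_mul, h2]

end Fixed

section Normality

variable {K : Type} [Field K]

lemma conj_strict {f : Fin 4 → ℕ} {g : G K} (hg : g ∈ Par f) {D : Matrix (Fin 4) (Fin 4) K}
    (hD : ∀ l k, f k ≤ f l → D l k = 0) {i j : Fin 4} (hij : f j ≤ f i) :
    (g.1 * D * (g⁻¹).1) i j = 0 := by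
  rw [Matrix.mul_apply]
  refine Finset.sum_eq_zero fun k _ => ?_
  rcases lt_or_ge (f j) (f k) with h | h
  · rw [(hg _ _ h).2, mul_zero]
  · rw [Matrix.mul_apply, Finset.sum_eq_zero, zero_mul]
    intro l _
    rcases lt_or_ge (f l) (f i) with h' | h'
    · rw [(hg _ _ h').1, zero_mul]
    · rw [hD _ _ (h.trans (hij.trans h')), mul_zero]

lemma conj_sub_one (g u : G K) : (g * u * g⁻¹).1 - (1 : Matrix _ _ K) = g.1 * (u.1 - 1) * (g⁻¹).1 := by
  rw [mul_sub, sub_mul, mul_one, ← Matrix.SpecialLinearGroup.coe_mul,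
    ← Matrix.SpecialLinearGroup.coe_mul, ← Matrix.SpecialLinearGroup.coe_mul, mul_inv_cancel,
    Matrix.SpecialLinearGroup.coe_one]

lemma Uni_normal {g : G K} (hg : g ∈ Par fB) {u : G K} (hu : u ∈ Uni K) : g * u * g⁻¹ ∈ Uni K := by
  have hf : ∀ i j, fB j ≤ fB i ↔ j ≤ i := by unfold fB; decide
  have key : ∀ u : G K, u ∈ Uni K → ∀ i j, j ≤ i →
      (g * u * g⁻¹).1 i j = (1 : Matrix _ _ K) i j := by
    intro u hu i j hij
    have h1 : ((g * u * g⁻¹).1 - (1 : Matrix (Fin 4) (Fin 4) K)) i j = 0 := by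
      rw [conj_sub_one]
      refine conj_strict hg (fun l k h => ?_) ((hf i j).2 hij)
      rw [Matrix.sub_apply, (hu l k ((hf l k).1 h)).1, sub_self]
    rwa [Matrix.sub_apply, sub_eq_zero] at h1
  refine fun i j hij => ⟨key u hu i j hij, ?_⟩
  have : (g * u * g⁻¹)⁻¹ = g * u⁻¹ * g⁻¹ := by group
  rw [this]
  exact key _ (inv_mem hu) i j hij

lemma sQ_normal {g : G K} (hg : g ∈ Par fP) (x) : ∃ y, sQ y = g * sQ x * g⁻¹ := by
  obtain ⟨a, b, c, d⟩ := x
  have h : ∀ i j, fP j ≤ fP i → ((g * sQ (.ofAdd (a, b, c, d)) * g⁻¹).1 - (1 : Matrix (Fin 4) (Fin 4) K)) i j = 0 := by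
    intro i j hij
    rw [conj_sub_one]
    refine conj_strict hg (fun l k h => ?_) hij
    rw [sQ_coe]
    revert h
    fin_cases l <;> fin_cases k <;> simp [fP]
  set u := g * sQ (.ofAdd (a, b, c, d)) * g⁻¹ with hu
  refine ⟨.ofAdd (u.1 0 2, u.1 0 3, u.1 1 2, u.1 1 3), Subtype.ext ?_⟩
  change (sQ (.ofAdd (u.1 0 2, u.1 0 3, u.1 1 2, u.1 1 3))).1 = u.1
  rw [sQ_coe]
  ext i j
  have := h i j
  rw [Matrix.sub_apply, sub_eq_zero] at this
  fin_cases i <;> fin_cases j <;> simp [fP, Matrix.one_apply] at this ⊢ <;> simp [this]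

lemma qP_normal {f : Fin 4 → ℕ} (hf : Monotone f) (h : ∀ i j, fP j < fP i → f j < f i)
    (g : (Par f : Subgroup (G K))) (x) : ∃ y, qP hf y = g * qP hf x * g⁻¹ := by
  obtain ⟨y, hy⟩ := sQ_normal (Par_mono h g.2) x
  exact ⟨y, Subtype.ext hy⟩

lemma isPGroup_qQ (p : ℕ) [Fact p.Prime] [CharP K p] {A : Type} [AddCommGroup A] [Module K A] :
    IsPGroup p (Multiplicative A) := fun x => ⟨1, by
  rw [pow_one]
  change Multiplicative.ofAdd (p • x.toAdd) = 1
  rw [card_nsmul_eq_zero' (K := K), ofAdd_zero]⟩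

lemma isPGroup_Uni (p : ℕ) [Fact p.Prime] [Finite K] [CharP K p] : IsPGroup p (Uni K) := by
  have := Fintype.ofFinite K
  obtain ⟨n, hp, hn⟩ := FiniteField.card K p
  refine IsPGroup.of_card (n := n * 6) ?_
  rw [card_Uni, Nat.card_eq_fintype_card, hn, pow_mul]

end Normality

section Cost

variable {K H N : Type} [Field K] [Group H] [AddCommGroup N] [Module K N]

/-- The multiplicity of the weight `v`. -/
noncomputable def mu (θ : Tor K →* H) (ρ : Representation K H N) (v : Fin 4 → ℤ) : ℕ :=
  finrank K (wt (ρ.comp θ) (chi v))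

variable (p : ℕ) [Fact p.Prime] [Algebra (ZMod p) K]

/-- The cost of an additive functional on a root group. -/
noncomputable def cAdd (θ : Tor K →* H) (ρ : Representation K H N) (a b : Fin 4) : ℕ :=
  ∑ i : Fin (deg p K), mu θ ρ (p ^ (i : ℕ) • rt a b)

/-- The cost of a biadditive functional on a pair of root groups. -/
noncomputable def cBi (θ : Tor K →* H) (ρ : Representation K H N) (a b c d : Fin 4) : ℕ :=
  ∑ x : Fin (deg p K) × Fin (deg p K), mu θ ρ (p ^ (x.1 : ℕ) • rt a b + p ^ (x.2 : ℕ) • rt c d)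

/-- The cost of an alternating functional on a root group. -/
noncomputable def cAlt (θ : Tor K →* H) (ρ : Representation K H N) (a b : Fin 4) : ℕ :=
  ∑ x : {x : Fin (deg p K) × Fin (deg p K) // x.1 < x.2},
    mu θ ρ (p ^ (x.1.1 : ℕ) • rt a b + p ^ (x.1.2 : ℕ) • rt a b)

lemma finrank_addW_le_cAdd [Finite K] [FiniteDimensional K N] (θ : Tor K →* H) (ρ : Representation K H N) (a b : Fin 4) :
    finrank K (addW (ρ.comp θ) (chi (rt a b))) ≤ cAdd p θ ρ a b := by
  refine (finrank_addW_le (p := p) _ _).trans (le_of_eq ?_)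
  exact Finset.sum_congr rfl fun i _ => by rw [mu, chi_nsmul]

lemma finrank_biW_le_cBi [Finite K] [FiniteDimensional K N] (θ : Tor K →* H) (ρ : Representation K H N) (a b c d : Fin 4) :
    finrank K (biW (ρ.comp θ) (chi (rt a b)) (chi (rt c d))) ≤ cBi p θ ρ a b c d := by
  refine (finrank_biW_le (p := p) _ _ _).trans (le_of_eq ?_)
  exact Finset.sum_congr rfl fun i _ => by rw [mu, chi_add, chi_nsmul, chi_nsmul]

lemma finrank_altW_le_cAlt [Finite K] [FiniteDimensional K N] (θ : Tor K →* H) (ρ : Representation K H N) (a b : Fin 4) :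
    finrank K (altW (ρ.comp θ) (chi (rt a b))) ≤ cAlt p θ ρ a b := by
  refine (finrank_altW_le (p := p) _ _).trans (le_of_eq ?_)
  exact Finset.sum_congr rfl fun i _ => by rw [mu, chi_add, chi_nsmul, chi_nsmul]

variable [Finite K] [CharP K p] [FiniteDimensional K N] (θ : Tor K →* H) (ρ : Representation K H N)
  (W : Submodule K N) (hW : ∀ g, W ≤ W.comap (ρ g))

include p in
lemma mu_add (v : Fin 4 → ℤ) :
    mu θ (ρ.quotient W hW) v + mu θ (ρ.subrepresentation W hW) v = mu θ ρ v :=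
  wt_superadditive (card_Tor_ne_zero p) θ _ ρ W hW

lemma cAdd_add (a b : Fin 4) :
    cAdd p θ (ρ.quotient W hW) a b + cAdd p θ (ρ.subrepresentation W hW) a b = cAdd p θ ρ a b := by
  simp only [cAdd, ← Finset.sum_add_distrib, mu_add p]

lemma cBi_add (a b c d : Fin 4) :
    cBi p θ (ρ.quotient W hW) a b c d + cBi p θ (ρ.subrepresentation W hW) a b c d
      = cBi p θ ρ a b c d := by
  simp only [cBi, ← Finset.sum_add_distrib, mu_add p]

lemma cAlt_add (a b : Fin 4) :
    cAlt p θ (ρ.quotient W hW) a b + cAlt p θ (ρ.subrepresentation W hW) a b = cAlt p θ ρ a b := by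
  simp only [cAlt, ← Finset.sum_add_distrib, mu_add p]

end Cost

section StageA

variable {K N : Type} [Field K] [Finite K] [AddCommGroup N] [Module K N] [FiniteDimensional K N]
  (p : ℕ) [Fact p.Prime] [Algebra (ZMod p) K] [CharP K p]

lemma relDim_Z2_le_of_radical_trivial {ρ : Representation K (Par fP : Subgroup (G K)) N}
    (hρ : ∀ x v, ρ (qP fP_mono x) v = v) :
    relDim (Z2 ρ) (B2 ρ) ≤ cBi p (thP fP) ρ 0 3 1 2 + cAdd p (thP fP) ρ 0 3 +
      relDim (Zr (qP fP_mono) ρ) (B2 ρ) := by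
  have t03 : ∀ a v, ρ (Y fP 0 3 a) v = v := fun a v => by rw [Y03 fP_mono, hρ]
  have t12 : ∀ a v, ρ (Y fP 1 2 a) v = v := fun a v => by rw [Y12 fP_mono, hρ]
  rw [add_assoc]
  refine (relDim_le_add_ker (betL K (Y fP 0 3) (Y fP 1 2)) _ _
    (biW (ρ.comp (thP fP)) (chi (rt 0 3)) (chi (rt 1 2))) fun c hc => ?_).trans
    (add_le_add (finrank_biW_le_cBi p _ _ 0 3 1 2) ?_)
  · exact betL_mem hc (Y_rootFam (by decide)) (Y_rootFam (by decide))
      (Y_comm (by decide) (by decide) (by decide) (by decide)) t03 t12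
  refine (relDim_le_add_ker (pifL p K (Y fP 0 3)) _ _
    (addW (ρ.comp (thP fP)) (chi (rt 0 3))) fun c hc => ?_).trans
    (add_le_add (finrank_addW_le_cAdd p _ _ 0 3) ?_)
  · refine pifL_mem hc.1 (Y_rootFam (by decide)) t03 fun a b => ?_
    rw [Y03 fP_mono, Y03 fP_mono]
    exact bet_qP_eq_zero hρ hc.1 (fun s t => congrFun (congrFun hc.2 s) t) _ _
  refine relDim_le_of_le_sup (le_trans ?_ le_sup_left)
  rintro c ⟨⟨hc, h1⟩, h2⟩
  exact ⟨hc, pull_qP_mem_B2 hρ hc (fun s t => congrFun (congrFun h1 s) t) (fun s => congrFun h2 s)⟩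

end StageA

section StageB

variable {K N : Type} [Field K] [Finite K] [AddCommGroup N] [Module K N] [FiniteDimensional K N]
  (p : ℕ) [Fact p.Prime] [Algebra (ZMod p) K] [CharP K p]
  {ρ : Representation K (Par fB : Subgroup (G K)) N}

lemma closure_pairs : Submonoid.closure ((fun a : K => (.ofAdd (a, 0) : Multiplicative (K × K))) '' Set.univ ∪
    (fun b : K => (.ofAdd (0, b) : Multiplicative (K × K))) '' Set.univ) = ⊤ :=
  closure_prod (A := K) (B := K) Set.univ Set.univ (by simp) (by simp)

lemma closure_quadruples : Submonoid.closure ({x : Multiplicative (K × K × K × K) | ∃ a : K,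
    x = .ofAdd (a, 0, 0, 0) ∨ x = .ofAdd (0, a, 0, 0) ∨ x = .ofAdd (0, 0, a, 0) ∨ x = .ofAdd (0, 0, 0, a)}) = ⊤ := by
  have h1 := closure_prod (A := K) (B := K) Set.univ Set.univ (by simp) (by simp)
  have h2 := closure_prod (A := K) Set.univ _ (by simp) h1
  have h3 := closure_prod (A := K) Set.univ _ (by simp) h2
  rw [eq_top_iff, ← h3]
  refine Submonoid.closure_mono ?_
  rintro x (⟨a, -, rfl⟩ | ⟨y, ⟨a, -, rfl⟩ | ⟨z, ⟨a, -, rfl⟩ | ⟨a, -, rfl⟩, rfl⟩, rfl⟩)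
  · exact ⟨a.toAdd, .inl rfl⟩
  · exact ⟨a.toAdd, .inr (.inl rfl)⟩
  · exact ⟨a.toAdd, .inr (.inr (.inl rfl))⟩
  · exact ⟨a.toAdd, .inr (.inr (.inr rfl))⟩

lemma pull_sP_mem_B2 {f : Fin 4 → ℕ} (hf : Monotone f) {ρ : Representation K (Par f : Subgroup (G K)) N}
    (hρ : ∀ x v, ρ (sP hf x) v = v) {c} (hc : c ∈ Z2 ρ)
    (h1 : ∀ s t, bet c (Y f 0 1 s) (Y f 2 3 t) = 0) (h2 : ∀ s t, bet c (Y f 0 1 s) (Y f 0 1 t) = 0)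
    (h3 : ∀ s t, bet c (Y f 2 3 s) (Y f 2 3 t) = 0) (h4 : ∀ s, pif p c (Y f 0 1 s) = 0)
    (h5 : ∀ s, pif p c (Y f 2 3 s) = 0) : pull K (sP hf) c ∈ B2 (ρ.comp (sP hf)) := by
  refine pull_mem_B2_of_generators p _ hρ hc (card_nsmul_eq_zero' (K := K)) _ closure_pairs ?_ ?_
  · rintro _ (⟨a, -, rfl⟩ | ⟨a, -, rfl⟩) _ (⟨b, -, rfl⟩ | ⟨b, -, rfl⟩)
    · rw [← Y01, ← Y01]; exact h2 _ _
    · rw [← Y01, ← Y23]; exact h1 _ _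
    · rw [← Y01, ← Y23, bet_swap, h1, neg_zero]
    · rw [← Y23, ← Y23]; exact h3 _ _
  · rintro _ (⟨a, -, rfl⟩ | ⟨a, -, rfl⟩)
    · rw [← Y01]; exact h4 _
    · rw [← Y23]; exact h5 _

lemma fP_fB : ∀ i j, fP j < fP i → fB j < fB i := by unfold fP fB; decide

include p in
lemma mem_B2_of_del_eq_zero (hU : ∀ u : (Par fB : Subgroup (G K)), (u : G K) ∈ Uni K → ∀ v, ρ u v = v)
    {c} (hc : c ∈ Z2 ρ) (h0 : ∀ u v, c (qP fB_mono u) (qP fB_mono v) = 0)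
    (hl : pull K (sP fB_mono) c ∈ B2 (ρ.comp (sP fB_mono)))
    (hd : ∀ l u, del c (sP fB_mono l) (qP fB_mono u) = 0) : c ∈ B2 ρ := by
  set ι : Uni K →* (Par fB : Subgroup (G K)) := Subgroup.inclusion (Uni_le_Par fB_mono)
  refine mem_B2_of_restrict ι (Subgroup.inclusion_injective _)
    (index_ne_zero_of_Uni_le p le_rfl _) ρ hc ?_
  refine mem_B2_of_semidirect (sQ.codRestrict (Uni K) sQ_mem_Uni) (sS.codRestrict (Uni K) sS_mem_Uni)
    sQ_sS_bijective (fun x v => hU _ (sQ_mem_Uni x) v) (fun l u => ?_) (pull_Z2 ι hc) (fun u v => h0 u v) ?_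
    (fun l u => hd l u)
  · obtain ⟨y, hy⟩ := sQ_normal (Par_mono fP_fB (Uni_le_Par fB_mono (sS_mem_Uni l))) u
    exact ⟨y, Subtype.ext hy⟩
  · exact hl

lemma inf_le_inf_sup {V : Type} [AddCommGroup V] [Module K V] {A A' Z B : Submodule K V} (h : A ≤ Z ⊔ B)
    (hB : B ≤ A') : A ⊓ A' ≤ (Z ⊓ A') ⊔ B := by
  rw [sup_comm, ← sup_inf_assoc_of_le _ hB, sup_comm]
  exact le_inf (inf_le_left.trans h) inf_le_right

include p in
lemma Zr_inf_Zr_le : Zr (qP fB_mono) ρ ⊓ Zr (sP fB_mono) ρ ≤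
    (Z0 (qP fB_mono) (thP fB) ρ ⊓ Zr (sP fB_mono) ρ) ⊔ B2 ρ := by
  have hn : ∀ (t : Tor K) (x), ∃ y, qP fB_mono y = thP fB t * qP fB_mono x * (thP fB t)⁻¹ :=
    fun t x => qP_normal fB_mono fP_fB (thP fB t) x
  refine inf_le_inf_sup ?_ (B2_le_Zr _ ρ)
  refine Zr_le_Z0_sup_B2 (card_Tor_ne_zero (K := K) p) _ ?_ (thP fB) ?_ ρ
  · exact qP_injective fB_mono
  · exact hn

/-- Normalised cocycles on which the functionals of the commuting pairs vanish. -/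
noncomputable def ZA (ρ : Representation K (Par fB : Subgroup (G K)) N) :
    Submodule K (↥(Par fB : Subgroup (G K)) → ↥(Par fB : Subgroup (G K)) → N) :=
  Z0 (qP fB_mono) (thP fB) ρ ⊓ Zr (sP fB_mono) ρ ⊓ LinearMap.ker (delL K (Y fB 0 1) (Y fB 0 2)) ⊓
    LinearMap.ker (delL K (Y fB 0 1) (Y fB 0 3)) ⊓ LinearMap.ker (delL K (Y fB 2 3) (Y fB 1 3)) ⊓
    LinearMap.ker (delL K (Y fB 2 3) (Y fB 0 3))

lemma mem_ZA {c} : c ∈ ZA ρ ↔ c ∈ Z0 (qP fB_mono) (thP fB) ρ ∧ c ∈ Zr (sP fB_mono) ρ ∧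
    (∀ s t, del c (Y fB 0 1 s) (Y fB 0 2 t) = 0) ∧ (∀ s t, del c (Y fB 0 1 s) (Y fB 0 3 t) = 0) ∧
    (∀ s t, del c (Y fB 2 3 s) (Y fB 1 3 t) = 0) ∧ (∀ s t, del c (Y fB 2 3 s) (Y fB 0 3 t) = 0) := by
  constructor
  · rintro ⟨⟨⟨⟨⟨h1, h2⟩, h3⟩, h4⟩, h5⟩, h6⟩
    exact ⟨h1, h2, fun s t => congrFun (congrFun h3 s) t, fun s t => congrFun (congrFun h4 s) t,
      fun s t => congrFun (congrFun h5 s) t, fun s t => congrFun (congrFun h6 s) t⟩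
  · rintro ⟨h1, h2, h3, h4, h5, h6⟩
    exact ⟨⟨⟨⟨⟨h1, h2⟩, funext fun s => funext (h3 s)⟩, funext fun s => funext (h4 s)⟩,
      funext fun s => funext (h5 s)⟩, funext fun s => funext (h6 s)⟩

lemma range02 (b : K) : Y fB 0 2 b ∈ (qP (K := K) fB_mono).range := ⟨_, (Y02 fB_mono b).symm⟩
lemma range03 (b : K) : Y fB 0 3 b ∈ (qP (K := K) fB_mono).range := ⟨_, (Y03 fB_mono b).symm⟩
lemma range12 (b : K) : Y fB 1 2 b ∈ (qP (K := K) fB_mono).range := ⟨_, (Y12 fB_mono b).symm⟩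
lemma range13 (b : K) : Y fB 1 3 b ∈ (qP (K := K) fB_mono).range := ⟨_, (Y13 fB_mono b).symm⟩

lemma Y_mem_Uni {a b : Fin 4} (h : a < b) (s : K) : (Y fB a b s : G K) ∈ Uni K := by
  rw [Y_coe (fB_mono h.le)]; exact X_mem_Uni h s

variable (hU : ∀ u : (Par fB : Subgroup (G K)), (u : G K) ∈ Uni K → ∀ v, ρ u v = v)
include hU

lemma relDim_Zr_le_of_unipotent_trivial :
    relDim (Zr (qP fB_mono) ρ) (B2 ρ) ≤ cBi p (thP fB) ρ 0 1 2 3 + (cAlt p (thP fB) ρ 0 1 +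
      (cAlt p (thP fB) ρ 2 3 + (cAdd p (thP fB) ρ 0 1 + (cAdd p (thP fB) ρ 2 3 +
      relDim (Z0 (qP fB_mono) (thP fB) ρ ⊓ Zr (sP fB_mono) ρ) (B2 ρ))))) := by
  have t01 : ∀ a v, ρ (Y fB 0 1 a) v = v := fun a => hU _ (Y_mem_Uni (by decide) a)
  have t23 : ∀ a v, ρ (Y fB 2 3 a) v = v := fun a => hU _ (Y_mem_Uni (by decide) a)
  have r01 := Y_rootFam (K := K) (f := fB) (a := 0) (b := 1) (by decide)
  have r23 := Y_rootFam (K := K) (f := fB) (a := 2) (b := 3) (by decide)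
  refine (relDim_le_add_ker (betL K (Y fB 0 1) (Y fB 2 3)) _ _
    (biW (ρ.comp (thP fB)) (chi (rt 0 1)) (chi (rt 2 3))) fun c hc => ?_).trans
    (add_le_add (finrank_biW_le_cBi p _ _ 0 1 2 3) ?_)
  · exact betL_mem hc.1 r01 r23 (Y_comm (by decide) (by decide) (by decide) (by decide)) t01 t23
  refine (relDim_le_add_ker (betL K (Y fB 0 1) (Y fB 0 1)) _ _
    (altW (ρ.comp (thP fB)) (chi (rt 0 1))) fun c hc => ?_).trans
    (add_le_add (finrank_altW_le_cAlt p _ _ 0 1) ?_)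
  · exact betL_mem_altW hc.1.1 r01 t01
  refine (relDim_le_add_ker (betL K (Y fB 2 3) (Y fB 2 3)) _ _
    (altW (ρ.comp (thP fB)) (chi (rt 2 3))) fun c hc => ?_).trans
    (add_le_add (finrank_altW_le_cAlt p _ _ 2 3) ?_)
  · exact betL_mem_altW hc.1.1.1 r23 t23
  refine (relDim_le_add_ker (pifL p K (Y fB 0 1)) _ _
    (addW (ρ.comp (thP fB)) (chi (rt 0 1))) fun c hc => ?_).trans
    (add_le_add (finrank_addW_le_cAdd p _ _ 0 1) ?_)
  · exact pifL_mem hc.1.1.1.1 r01 t01 fun a b => congrFun (congrFun hc.1.2 a) b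
  refine (relDim_le_add_ker (pifL p K (Y fB 2 3)) _ _
    (addW (ρ.comp (thP fB)) (chi (rt 2 3))) fun c hc => ?_).trans
    (add_le_add (finrank_addW_le_cAdd p _ _ 2 3) ?_)
  · exact pifL_mem hc.1.1.1.1.1 r23 t23 fun a b => congrFun (congrFun hc.1.2 a) b
  refine relDim_le_of_le_sup (le_trans ?_ (Zr_inf_Zr_le p))
  rintro c ⟨⟨⟨⟨⟨hc, h1⟩, h2⟩, h3⟩, h4⟩, h5⟩
  refine ⟨hc, hc.1, pull_sP_mem_B2 p fB_mono (fun x v => hU _ (sS_mem_Uni x) v) hc.1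
    (fun s t => congrFun (congrFun h1 s) t) (fun s t => congrFun (congrFun h2 s) t)
    (fun s t => congrFun (congrFun h3 s) t) (fun s => congrFun h4 s) (fun s => congrFun h5 s)⟩

lemma relDim_le_ZA : relDim (Z0 (qP fB_mono) (thP fB) ρ ⊓ Zr (sP fB_mono) ρ) (B2 ρ) ≤
    cBi p (thP fB) ρ 0 1 0 2 + (cBi p (thP fB) ρ 0 1 0 3 + (cBi p (thP fB) ρ 2 3 1 3 +
      (cBi p (thP fB) ρ 2 3 0 3 + relDim (ZA ρ) (B2 ρ)))) := by
  have t01 : ∀ a v, ρ (Y fB 0 1 a) v = v := fun a => hU _ (Y_mem_Uni (by decide) a)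
  have t23 : ∀ a v, ρ (Y fB 2 3 a) v = v := fun a => hU _ (Y_mem_Uni (by decide) a)
  have tq : ∀ x v, ρ (qP fB_mono x) v = v := fun x => hU _ (sQ_mem_Uni x)
  have r : ∀ a b, a ≤ b → RootFam (thP fB) (Y (K := K) fB a b) (chi (rt a b)) := fun a b h =>
    Y_rootFam (fB_mono h)
  have hn : ∀ {a b : Fin 4} (s : K) (x), ∃ y, qP fB_mono y = Y fB a b s * qP fB_mono x * (Y fB a b s)⁻¹ :=
    fun {a b} s x => qP_normal fB_mono fP_fB (Y fB a b s) x
  have m0 : ∀ e ∈ Z0 (qP fB_mono) (thP fB) ρ, delL K (Y fB 0 1) (Y fB 0 2) e ∈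
      biW (ρ.comp (thP fB)) (chi (rt 0 1)) (chi (rt 0 2)) := fun e he =>
    del_mem_of_comm he (r _ _ (by decide)) (r _ _ (by decide)) range02 hn
      (Y_comm (by decide) (by decide) (by decide) (by decide)) t01 tq
  have m1 : ∀ e ∈ Z0 (qP fB_mono) (thP fB) ρ, delL K (Y fB 0 1) (Y fB 0 3) e ∈
      biW (ρ.comp (thP fB)) (chi (rt 0 1)) (chi (rt 0 3)) := fun e he =>
    del_mem_of_comm he (r _ _ (by decide)) (r _ _ (by decide)) range03 hn
      (Y_comm (by decide) (by decide) (by decide) (by decide)) t01 tq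
  have m2 : ∀ e ∈ Z0 (qP fB_mono) (thP fB) ρ, delL K (Y fB 2 3) (Y fB 1 3) e ∈
      biW (ρ.comp (thP fB)) (chi (rt 2 3)) (chi (rt 1 3)) := fun e he =>
    del_mem_of_comm he (r _ _ (by decide)) (r _ _ (by decide)) range13 hn
      (Y_comm (by decide) (by decide) (by decide) (by decide)) t23 tq
  have m3 : ∀ e ∈ Z0 (qP fB_mono) (thP fB) ρ, delL K (Y fB 2 3) (Y fB 0 3) e ∈
      biW (ρ.comp (thP fB)) (chi (rt 2 3)) (chi (rt 0 3)) := fun e he =>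
    del_mem_of_comm he (r _ _ (by decide)) (r _ _ (by decide)) range03 hn
      (Y_comm (by decide) (by decide) (by decide) (by decide)) t23 tq
  rw [ZA]
  refine (relDim_le_add_ker _ _ _ _ fun c hc => m0 c (Submodule.mem_inf.1 hc).1).trans
    (add_le_add (finrank_biW_le_cBi p _ _ 0 1 0 2) ?_)
  refine (relDim_le_add_ker _ _ _ _ fun c hc => m1 c (Submodule.mem_inf.1 (Submodule.mem_inf.1 hc).1).1).trans
    (add_le_add (finrank_biW_le_cBi p _ _ 0 1 0 3) ?_)
  refine (relDim_le_add_ker _ _ _ _ fun c hc => m2 c (Submodule.mem_inf.1 (Submodule.mem_inf.1 (Submodule.mem_inf.1 hc).1).1).1).trans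
    (add_le_add (finrank_biW_le_cBi p _ _ 2 3 1 3) ?_)
  refine (relDim_le_add_ker _ _ _ _ fun c hc => m3 c (Submodule.mem_inf.1 (Submodule.mem_inf.1 (Submodule.mem_inf.1 (Submodule.mem_inf.1 hc).1).1).1).1).trans
    (add_le_add (finrank_biW_le_cBi p _ _ 2 3 0 3) le_rfl)

lemma relDim_ZA_le : relDim (ZA ρ) (B2 ρ) ≤
    cBi p (thP fB) ρ 0 1 1 2 + (cBi p (thP fB) ρ 0 1 1 3 + (cBi p (thP fB) ρ 2 3 0 2 +
      cBi p (thP fB) ρ 2 3 1 2)) := by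
  have t01 : ∀ a v, ρ (Y fB 0 1 a) v = v := fun a => hU _ (Y_mem_Uni (by decide) a)
  have t23 : ∀ a v, ρ (Y fB 2 3 a) v = v := fun a => hU _ (Y_mem_Uni (by decide) a)
  have tq : ∀ x v, ρ (qP fB_mono x) v = v := fun x => hU _ (sQ_mem_Uni x)
  have r : ∀ a b, a ≤ b → RootFam (thP fB) (Y (K := K) fB a b) (chi (rt a b)) := fun a b h =>
    Y_rootFam (fB_mono h)
  have hn : ∀ {a b : Fin 4} (s : K) (x), ∃ y, qP fB_mono y = Y fB a b s * qP fB_mono x * (Y fB a b s)⁻¹ :=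
    fun s x => qP_normal fB_mono fP_fB _ _
  refine (relDim_le_add_ker (delL K (Y fB 0 1) (Y fB 1 2)) _ _
    (biW (ρ.comp (thP fB)) (chi (rt 0 1)) (chi (rt 1 2))) fun c hc => ?_).trans
    (add_le_add (finrank_biW_le_cBi p _ _ 0 1 1 2) ?_)
  · obtain ⟨h1, h2, h3, h4, h5, h6⟩ := mem_ZA.1 hc
    exact del_mem (z := Y fB 0 2) h1 (r _ _ (by decide)) (r _ _ (by decide)) range12 hn
      (fun a b => ⟨.ofAdd (a * b, 0, 0, 0), ⟨a * b, Y02 fB_mono _⟩, by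
        rw [← Y02, Y_conj_left (by decide) (by decide) (by decide) (by decide) (by decide)]⟩) h3 t01 tq
  refine (relDim_le_add_ker (delL K (Y fB 0 1) (Y fB 1 3)) _ _
    (biW (ρ.comp (thP fB)) (chi (rt 0 1)) (chi (rt 1 3))) fun c hc => ?_).trans
    (add_le_add (finrank_biW_le_cBi p _ _ 0 1 1 3) ?_)
  · obtain ⟨h1, h2, h3, h4, h5, h6⟩ := mem_ZA.1 hc.1
    exact del_mem (z := Y fB 0 3) h1 (r _ _ (by decide)) (r _ _ (by decide)) range13 hn
      (fun a b => ⟨.ofAdd (0, a * b, 0, 0), ⟨a * b, Y03 fB_mono _⟩, by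
        rw [← Y03, Y_conj_left (by decide) (by decide) (by decide) (by decide) (by decide)]⟩) h4 t01 tq
  refine (relDim_le_add_ker (delL K (Y fB 2 3) (Y fB 0 2)) _ _
    (biW (ρ.comp (thP fB)) (chi (rt 2 3)) (chi (rt 0 2))) fun c hc => ?_).trans
    (add_le_add (finrank_biW_le_cBi p _ _ 2 3 0 2) ?_)
  · obtain ⟨h1, h2, h3, h4, h5, h6⟩ := mem_ZA.1 hc.1.1
    exact del_mem (z := Y fB 0 3) h1 (r _ _ (by decide)) (r _ _ (by decide)) range02 hn
      (fun a b => ⟨.ofAdd (0, -(b * a), 0, 0), ⟨-(b * a), Y03 fB_mono _⟩, by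
        rw [← Y03, Y_conj_right (by decide) (by decide) (by decide) (by decide) (by decide)]⟩) h6 t23 tq
  refine (relDim_le_add_ker (delL K (Y fB 2 3) (Y fB 1 2)) _ _
    (biW (ρ.comp (thP fB)) (chi (rt 2 3)) (chi (rt 1 2))) fun c hc => ?_).trans
    ((add_le_add (finrank_biW_le_cBi p _ _ 2 3 1 2) (le_of_eq (relDim_eq_zero ?_))).trans_eq (add_zero _))
  · obtain ⟨h1, h2, h3, h4, h5, h6⟩ := mem_ZA.1 hc.1.1.1
    exact del_mem (z := Y fB 1 3) h1 (r _ _ (by decide)) (r _ _ (by decide)) range12 hn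
      (fun a b => ⟨.ofAdd (0, 0, 0, -(b * a)), ⟨-(b * a), Y13 fB_mono _⟩, by
        rw [← Y13, Y_conj_right (by decide) (by decide) (by decide) (by decide) (by decide)]⟩) h5 t23 tq
  rintro c ⟨⟨⟨⟨hc, a1⟩, a2⟩, a3⟩, a4⟩
  obtain ⟨h1, h2, h3, h4, h5, h6⟩ := mem_ZA.1 hc
  have hn' : ∀ l x, ∃ y, qP fB_mono y = sP fB_mono l * qP (K := K) fB_mono x * (sP fB_mono l)⁻¹ :=
    fun l x => qP_normal fB_mono fP_fB _ _
  refine mem_B2_of_del_eq_zero p hU h1.1 h1.2.2 h2.2 fun l u => ?_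
  refine del_closure tq hn' h1.1 h1.2.2 _ closure_pairs _ closure_quadruples ?_ l u
  rintro _ (⟨a, -, rfl⟩ | ⟨a, -, rfl⟩) u ⟨b, rfl | rfl | rfl | rfl⟩
  · rw [← Y01, ← Y02]; exact h3 a b
  · rw [← Y01, ← Y03]; exact h4 a b
  · rw [← Y01, ← Y12]; exact congrFun (congrFun a1 a) b
  · rw [← Y01, ← Y13]; exact congrFun (congrFun a2 a) b
  · rw [← Y23, ← Y02]; exact congrFun (congrFun a3 a) b
  · rw [← Y23, ← Y03]; exact h6 a b
  · rw [← Y23, ← Y12]; exact congrFun (congrFun a4 a) b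
  · rw [← Y23, ← Y13]; exact h5 a b

lemma le_ZA_of_char_two [CharP K 2] : Z0 (qP fB_mono) (thP fB) ρ ⊓ Zr (sP fB_mono) ρ ≤ ZA ρ := by
  rintro c ⟨h1, h2⟩
  have tq : ∀ x v, ρ (qP fB_mono x) v = v := fun x => hU _ (sQ_mem_Uni x)
  have h11 : c 1 1 = 0 := by simpa using h1.2.2 1 1
  have d1 : ∀ u, del c 1 u = 0 := fun u => by
    simp only [del, one_mul, mul_one, inv_one]
    rw [one_left h1.1 u, h11, one_right h1.1 u, h11, map_zero, sub_zero]
  have key : ∀ (l : ↥(Par fB : Subgroup (G K))) (u v : Multiplicative (K × K × K × K)),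
      (∀ x, ρ l x = x) → l * l = 1 →
      l * qP fB_mono u * l⁻¹ = qP fB_mono v * qP fB_mono u → del c l (qP fB_mono v) = 0 := by
    intro l u v hl hl2 hu
    obtain ⟨v', hv'⟩ := qP_normal fB_mono fP_fB l v
    obtain ⟨u', hu'⟩ := qP_normal fB_mono fP_fB l u
    have e1 := del_mul_left h1.1 (l := l) (l' := l) (tq u)
    rw [hl2, d1, hl, hu, del_mul_right h1.1 (tq v) (h1.2.2 _ _) (by rw [← hv', ← hu', h1.2.2]),
      add_left_comm, ← two_smul K (del c l (qP fB_mono u)), CharTwo.two_eq_zero, zero_smul, add_zero] at e1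
    exact e1.symm
  have sq : ∀ (a b : Fin 4) (h : fB a ≤ fB b) (s : K), Y fB a b s * Y fB a b s = 1 := fun a b h s => by
    rw [← (Y_rootFam h).add, CharTwo.add_self_eq_zero, (Y_rootFam h).zero]
  have z : ∀ (a b : Fin 4) (h : fB a ≤ fB b), Y fB a b (0 : K) = 1 := fun a b h => (Y_rootFam h).zero
  have t01 : ∀ a v, ρ (Y fB 0 1 a) v = v := fun a => hU _ (Y_mem_Uni (by decide) a)
  have t23 : ∀ a v, ρ (Y fB 2 3 a) v = v := fun a => hU _ (Y_mem_Uni (by decide) a)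
  refine mem_ZA.2 ⟨h1, h2, fun s t => ?_, fun s t => ?_, fun s t => ?_, fun s t => ?_⟩ <;>
    rcases eq_or_ne s 0 with rfl | hs
  · rw [z _ _ (by decide), d1]
  · rw [Y02 fB_mono]
    refine key _ (.ofAdd (0, 0, s⁻¹ * t, 0)) _ (t01 s) (sq _ _ (by decide) _) ?_
    rw [← Y02, ← Y12, Y_conj_left (by decide) (by decide) (by decide) (by decide) (by decide),
      mul_inv_cancel_left₀ hs]
  · rw [z _ _ (by decide), d1]
  · rw [Y03 fB_mono]
    refine key _ (.ofAdd (0, 0, 0, s⁻¹ * t)) _ (t01 s) (sq _ _ (by decide) _) ?_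
    rw [← Y03, ← Y13, Y_conj_left (by decide) (by decide) (by decide) (by decide) (by decide),
      mul_inv_cancel_left₀ hs]
  · rw [z _ _ (by decide), d1]
  · rw [Y13 fB_mono]
    refine key _ (.ofAdd (0, 0, -t * s⁻¹, 0)) _ (t23 s) (sq _ _ (by decide) _) ?_
    rw [← Y13, ← Y12, Y_conj_right (by decide) (by decide) (by decide) (by decide) (by decide),
      inv_mul_cancel_right₀ hs, neg_neg]
  · rw [z _ _ (by decide), d1]
  · rw [Y03 fB_mono]
    refine key _ (.ofAdd (-t * s⁻¹, 0, 0, 0)) _ (t23 s) (sq _ _ (by decide) _) ?_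
    rw [← Y03, ← Y02, Y_conj_right (by decide) (by decide) (by decide) (by decide) (by decide),
      inv_mul_cancel_right₀ hs, neg_neg]

end StageB

section Filtration

variable {K H S R N : Type} [Field K] [Finite K] [Group H] [Finite H] [Group S] [Finite S] [Group R]
  [AddCommGroup N] [Module K N] [FiniteDimensional K N]

lemma relDim_le_cost_of_pgroup (p : ℕ) [Fact p.Prime] [CharP K p] (σ : S →* H) (τ : R →* H) (hR : IsPGroup p R)
    [Finite R] (hn : ∀ g r, ∃ r', τ r' = g * τ r * g⁻¹)
    (cost : ∀ (N : Type) [AddCommGroup N] [Module K N], Representation K H N → ℕ)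
    (hadd : ∀ (N : Type) [AddCommGroup N] [Module K N] [FiniteDimensional K N]
      (ρ : Representation K H N) (W : Submodule K N) (hW : ∀ g, W ≤ W.comap (ρ g)),
      cost _ (ρ.quotient W hW) + cost _ (ρ.subrepresentation W hW) ≤ cost N ρ)
    (hgood : ∀ (N : Type) [AddCommGroup N] [Module K N] [FiniteDimensional K N]
      (ρ : Representation K H N), (∀ s x, ρ (σ s) x = x) → (∀ r x, ρ (τ r) x = x) →
        relDim (Zr σ ρ) (B2 ρ) ≤ cost N ρ)
    (ρ : Representation K H N) (hσ : ∀ s x, ρ (σ s) x = x) :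
    relDim (Zr σ ρ) (B2 ρ) ≤ cost N ρ := by
  refine relDim_le_cost σ cost hadd ?_ ρ hσ
  intro N _ _ _ _ ρ hσ
  refine ⟨_, invariants_comp_le hn ρ, invariants_ne_bot hR _, ?_⟩
  exact hgood _ _ (fun s x => Subtype.ext (hσ s x)) (fun r x => Subtype.ext (x.2 r))

end Filtration

section Parabolic

variable {K N : Type} [Field K] [Finite K] [AddCommGroup N] [Module K N] [FiniteDimensional K N]
  (p : ℕ) [Fact p.Prime] [CharP K p]
include p

/-- It suffices to bound the cohomology of the parabolic on modules with trivial action of the radical. -/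
lemma relDim_Z2_le_of_radical
    (cost : ∀ (N : Type) [AddCommGroup N] [Module K N], Representation K (Par fP : Subgroup (G K)) N → ℕ)
    (hadd : ∀ (N : Type) [AddCommGroup N] [Module K N] [FiniteDimensional K N]
      (ρ : Representation K (Par fP : Subgroup (G K)) N) (W : Submodule K N) (hW : ∀ g, W ≤ W.comap (ρ g)),
      cost _ (ρ.quotient W hW) + cost _ (ρ.subrepresentation W hW) ≤ cost N ρ)
    (hgood : ∀ (N : Type) [AddCommGroup N] [Module K N] [FiniteDimensional K N]
      (ρ : Representation K (Par fP : Subgroup (G K)) N), (∀ x v, ρ (qP fP_mono x) v = v) →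
        relDim (Z2 ρ) (B2 ρ) ≤ cost N ρ)
    (ρ : Representation K (Par fP : Subgroup (G K)) N) : relDim (Z2 ρ) (B2 ρ) ≤ cost N ρ := by
  have hn : ∀ (g : (Par fP : Subgroup (G K))) (x), ∃ y, qP fP_mono y = g * qP fP_mono x * g⁻¹ :=
    fun g x => qP_normal fP_mono (fun _ _ h => h) g x
  have h := relDim_le_cost_of_pgroup p (1 : Unit →* (Par fP : Subgroup (G K))) (qP fP_mono)
    (isPGroup_qQ (K := K) p) hn cost hadd ?_ ρ (fun s x => by simp)
  · rwa [Zr_trivial] at h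
  · intro N _ _ _ ρ _ h2
    rw [Zr_trivial]
    exact hgood _ ρ h2

lemma relDim_Zr_le_of_unipotent
    (cost : ∀ (N : Type) [AddCommGroup N] [Module K N], Representation K (Par fB : Subgroup (G K)) N → ℕ)
    (hadd : ∀ (N : Type) [AddCommGroup N] [Module K N] [FiniteDimensional K N]
      (ρ : Representation K (Par fB : Subgroup (G K)) N) (W : Submodule K N) (hW : ∀ g, W ≤ W.comap (ρ g)),
      cost _ (ρ.quotient W hW) + cost _ (ρ.subrepresentation W hW) ≤ cost N ρ)
    (hgood : ∀ (N : Type) [AddCommGroup N] [Module K N] [FiniteDimensional K N]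
      (ρ : Representation K (Par fB : Subgroup (G K)) N),
      (∀ u : (Par fB : Subgroup (G K)), (u : G K) ∈ Uni K → ∀ v, ρ u v = v) →
        relDim (Zr (qP fB_mono) ρ) (B2 ρ) ≤ cost N ρ)
    (ρ : Representation K (Par fB : Subgroup (G K)) N) (hρ : ∀ x v, ρ (qP fB_mono x) v = v) :
    relDim (Zr (qP fB_mono) ρ) (B2 ρ) ≤ cost N ρ := by
  have hn : ∀ (g : (Par fB : Subgroup (G K))) (u : Uni K), ∃ y : Uni K,
      Subgroup.inclusion (Uni_le_Par fB_mono) y = g * Subgroup.inclusion (Uni_le_Par fB_mono) u * g⁻¹ :=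
    fun g u => ⟨⟨_, Uni_normal g.2 u.2⟩, Subtype.ext rfl⟩
  have h := relDim_le_cost_of_pgroup (K := K) (H := (Par fB : Subgroup (G K))) (N := N) p (qP fB_mono)
    (Subgroup.inclusion (Uni_le_Par fB_mono)) (isPGroup_Uni p) hn cost hadd
  refine h ?_ ρ hρ
  intro N _ _ _ ρ _ h2
  exact hgood _ ρ fun u hu v => h2 ⟨u, hu⟩ v

/-- Restriction from the parabolic to the Borel subgroup. -/
lemma relDim_Zr_le_Borel (ρ : Representation K (Par fP : Subgroup (G K)) N) :
    relDim (Zr (qP fP_mono) ρ) (B2 ρ) ≤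
      relDim (Zr (qP fB_mono) (ρ.comp (Subgroup.inclusion (Par_mono fP_fB))))
        (B2 (ρ.comp (Subgroup.inclusion (Par_mono fP_fB)))) := by
  set ι : (Par fB : Subgroup (G K)) →* (Par fP : Subgroup (G K)) := Subgroup.inclusion (Par_mono fP_fB)
  have hι : ι.comp (qP fB_mono) = qP fP_mono := MonoidHom.ext fun _ => Subtype.ext rfl
  refine relDim_le_of_comap (pull K ι) _ _ _ _ (fun c hc => ?_) (fun c hc h => ?_)
  · refine ⟨pull_Z2 ι hc.1, ?_⟩
    have := hc.2
    rw [← hι] at this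
    exact this
  · exact mem_B2_of_restrict ι (Subgroup.inclusion_injective _)
      (index_ne_zero_of_Uni_le p (Uni_le_Par fB_mono) _) ρ hc.1 h

/-- Restriction from the special linear group to the parabolic subgroup. -/
lemma relDim_le_parabolic (ρ : Representation K (G K) N) :
    relDim (Z2 ρ) (B2 ρ) ≤ relDim (Z2 (ρ.comp (Par fP : Subgroup (G K)).subtype))
      (B2 (ρ.comp (Par fP : Subgroup (G K)).subtype)) := by
  refine relDim_le_of_restrict _ (Subgroup.subtype_injective _) ?_ ρ
  rw [Subgroup.range_subtype, Ne, CharP.cast_eq_zero_iff K p]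
  exact fun hd => index_Uni (K := K) p (hd.trans (Subgroup.index_dvd_of_le (Uni_le_Par fP_mono)))

end Parabolic

section General

variable {K N : Type} [Field K] [Finite K] [AddCommGroup N] [Module K N] [FiniteDimensional K N]
  (p : ℕ) [Fact p.Prime] [Algebra (ZMod p) K] [CharP K p]

/-- The cost of the functionals attached to short chains of roots. -/
noncomputable def cShort {H : Type} [Group H] (θ : Tor K →* H) (ρ : Representation K H N) : ℕ :=
  cBi p θ ρ 0 1 2 3 + cAlt p θ ρ 0 1 + cAlt p θ ρ 2 3 + cAdd p θ ρ 0 1 + cAdd p θ ρ 2 3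

/-- The cost of the functionals attached to forks. -/
noncomputable def cFork {H : Type} [Group H] (θ : Tor K →* H) (ρ : Representation K H N) : ℕ :=
  cBi p θ ρ 0 1 0 2 + cBi p θ ρ 0 1 0 3 + cBi p θ ρ 2 3 1 3 + cBi p θ ρ 2 3 0 3

/-- The cost of the functionals attached to paths. -/
noncomputable def cPath {H : Type} [Group H] (θ : Tor K →* H) (ρ : Representation K H N) : ℕ :=
  cBi p θ ρ 0 1 1 2 + cBi p θ ρ 0 1 1 3 + cBi p θ ρ 2 3 0 2 + cBi p θ ρ 2 3 1 2

open Classical in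
/-- The cost of the functionals at the Borel level. -/
noncomputable def cBorel {H : Type} [Group H] (θ : Tor K →* H) (ρ : Representation K H N) : ℕ :=
  cShort p θ ρ + (if p = 2 then 0 else cFork p θ ρ) + cPath p θ ρ

lemma cBorel_add {H : Type} [Group H] (θ : Tor K →* H) (ρ : Representation K H N) (W : Submodule K N)
    (hW : ∀ g, W ≤ W.comap (ρ g)) :
    cBorel p θ (ρ.quotient W hW) + cBorel p θ (ρ.subrepresentation W hW) = cBorel p θ ρ := by
  simp only [cBorel, cShort, cFork, cPath, ← cBi_add p θ ρ W hW, ← cAlt_add p θ ρ W hW, ← cAdd_add p θ ρ W hW]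
  split_ifs <;> omega

lemma relDim_Zr_le_cBorel {ρ : Representation K (Par fB : Subgroup (G K)) N}
    (hU : ∀ u : (Par fB : Subgroup (G K)), (u : G K) ∈ Uni K → ∀ v, ρ u v = v) :
    relDim (Zr (qP fB_mono) ρ) (B2 ρ) ≤ cBorel p (thP fB) ρ := by
  have h1 := relDim_Zr_le_of_unipotent_trivial p hU
  have h2 := relDim_le_ZA p hU
  have h3 := relDim_ZA_le p hU
  simp only [cBorel, cShort, cFork, cPath]
  split_ifs with h
  · have : CharP K 2 := h ▸ (inferInstance : CharP K p)
    have h4 := relDim_le_of_le_sup (B := B2 ρ) ((le_ZA_of_char_two hU).trans le_sup_left)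
    omega
  · omega

/-- The bound for the dimension of the second cohomology by weight multiplicities. -/
theorem relDim_le_cost_SL (ρ : Representation K (G K) N) :
    relDim (Z2 ρ) (B2 ρ) ≤ cBi p tau ρ 0 3 1 2 + cAdd p tau ρ 0 3 + cBorel p tau ρ := by
  refine (relDim_le_parabolic p ρ).trans ?_
  refine relDim_Z2_le_of_radical p
    (fun N _ _ ρ => cBi p (thP fP) ρ 0 3 1 2 + cAdd p (thP fP) ρ 0 3 + cBorel p (thP fP) ρ)
    (fun N _ _ _ ρ W hW => ?_) (fun N _ _ _ ρ hρ => ?_) (ρ.comp (Par fP : Subgroup (G K)).subtype)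
  · have h1 := cBi_add p (thP fP) ρ W hW 0 3 1 2
    have h2 := cAdd_add p (thP fP) ρ W hW 0 3
    have h3 := cBorel_add p (thP fP) ρ W hW
    omega
  · refine (relDim_Z2_le_of_radical_trivial p hρ).trans (add_le_add_right ?_ _)
    refine (relDim_Zr_le_Borel p ρ).trans ?_
    exact relDim_Zr_le_of_unipotent p (fun N _ _ ρ => cBorel p (thP fB) ρ)
      (fun N _ _ _ ρ W hW => (cBorel_add p _ ρ W hW).le) (fun N _ _ _ ρ hU => relDim_Zr_le_cBorel p hU)
      (ρ.comp (Subgroup.inclusion (Par_mono fP_fB))) (fun x v => hρ x v)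

end General

open TensorProduct

section Weyl

variable {K N : Type} [Field K] [AddCommGroup N] [Module K N] [FiniteDimensional K N]

/-- A signed permutation matrix of determinant one. -/
def wey (σ : Equiv.Perm (Fin 4)) : G K :=
  ⟨Matrix.diagonal (fun i => if i = 0 then ((Equiv.Perm.sign σ : ℤ) : K) else 1) * σ.permMatrix K, by
    rw [Matrix.det_mul, Matrix.det_diagonal, Matrix.det_permutation]
    simp only [Finset.prod_ite_eq', Finset.mem_univ, if_true]
    rw [← Int.cast_mul, ← Units.val_mul, Int.units_mul_self]
    simp⟩

lemma wey_coe (σ : Equiv.Perm (Fin 4)) : ((wey σ : G K) : Matrix (Fin 4) (Fin 4) K) =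
    Matrix.diagonal (fun i => if i = 0 then ((Equiv.Perm.sign σ : ℤ) : K) else 1) * σ.permMatrix K := rfl

lemma wey_tau (σ : Equiv.Perm (Fin 4)) (d d' : Tor K) (h : ∀ i, d'.1 i = d.1 (σ i)) :
    wey σ * tau d = tau d' * wey σ := by
  apply Subtype.ext
  rw [Matrix.SpecialLinearGroup.coe_mul, Matrix.SpecialLinearGroup.coe_mul, wey_coe, tau_coe, tau_coe]
  ext i j
  simp only [ Matrix.mul_diagonal, Matrix.diagonal_mul,
    Equiv.Perm.permMatrix, PEquiv.toMatrix_apply, Equiv.toPEquiv_apply, h]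
  by_cases hj : σ i = j
  · simp [hj, mul_comm]
  · simp [hj]

lemma mu_comp_le (ρ : Representation K (G K) N) (v : Fin 4 → ℤ) (σ : Equiv.Perm (Fin 4)) :
    mu tau ρ v ≤ mu tau ρ (v ∘ σ) := by
  have hinj : Function.Injective (ρ (wey σ)) := fun x y hxy => by
    have := congrArg (ρ (wey σ)⁻¹) hxy
    rwa [← rho_mul, ← rho_mul, inv_mul_cancel, map_one] at this
  refine (LinearEquiv.finrank_eq (Submodule.equivMapOfInjective _ hinj _)).trans_le (Submodule.finrank_mono ?_)
  rintro _ ⟨x, hx, rfl⟩ d'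
  have hd : ((fun i => d'.1 (σ.symm i)) : Fin 4 → Kˣ) ∈ Tor K :=
    (Equiv.prod_comp σ.symm d'.1).trans d'.2
  have h := wey_tau σ ⟨_, hd⟩ d' (fun i => by simp)
  have h2 := hx ⟨_, hd⟩
  rw [MonoidHom.comp_apply] at h2 ⊢
  rw [← rho_mul, ← h, rho_mul, h2, map_smul]
  congr 2
  rw [chi_apply, chi_apply, ← Equiv.prod_comp σ]
  simp

/-- Weight multiplicities are invariant under the Weyl group. -/
lemma mu_comp (ρ : Representation K (G K) N) (v : Fin 4 → ℤ) (σ : Equiv.Perm (Fin 4)) :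
    mu tau ρ (v ∘ σ) = mu tau ρ v := by
  refine le_antisymm ?_ (mu_comp_le ρ v σ)
  simpa [Function.comp_assoc] using mu_comp_le ρ (v ∘ σ) σ.symm

end Weyl

section BaseChange

variable {k K H M : Type} [Field k] [Field K] [Algebra k K] [Group H] [AddCommGroup M] [Module k M]

/-- Extension of scalars of a representation. -/
noncomputable def bc (K : Type) [Field K] [Algebra k K] (ρ : Representation k H M) :
    Representation K H (K ⊗[k] M) where
  toFun g := (ρ g).baseChange K
  map_one' := by rw [map_one]; exact LinearMap.baseChange_id
  map_mul' g h := by rw [map_mul]; exact LinearMap.baseChange_comp _ _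

lemma bc_tmul (ρ : Representation k H M) (g : H) (a : K) (m : M) : bc K ρ g (a ⊗ₜ m) = a ⊗ₜ ρ g m := rfl

/-- Contraction of the scalars by a functional. -/
noncomputable def contr (φ : K →ₗ[k] k) : K ⊗[k] M →ₗ[k] M :=
  (TensorProduct.lid k M).toLinearMap ∘ₗ φ.rTensor M

lemma contr_tmul (φ : K →ₗ[k] k) (a : K) (m : M) : contr φ (a ⊗ₜ m) = φ a • m := by
  simp [contr]

lemma contr_bc (φ : K →ₗ[k] k) (ρ : Representation k H M) (g : H) (x : K ⊗[k] M) :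
    contr φ (bc K ρ g x) = ρ g (contr φ x) := by
  induction x with
  | zero => simp
  | tmul a m => rw [bc_tmul, contr_tmul, contr_tmul, map_smul]
  | add x y hx hy => rw [map_add, map_add, map_add, map_add, hx, hy]

variable [Finite H] [FiniteDimensional k M]

lemma relDim_le_bc (ρ : Representation k H M) :
    relDim (Z2 ρ) (B2 ρ) ≤ relDim (Z2 (bc K ρ)) (B2 (bc K ρ)) := by
  have b := finBasis k ((Z2 ρ).map (B2 ρ).mkQ)
  choose c hc hcb using fun i => (b i).2
  let C : Fin (finrank k ((Z2 ρ).map (B2 ρ).mkQ)) → H → H → K ⊗[k] M := fun i g h => 1 ⊗ₜ c i g h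
  have hC : ∀ i, C i ∈ Z2 (bc K ρ) := fun i g h j => by
    simp only [C, bc_tmul, ← TensorProduct.tmul_add, hc i g h j]
  have hli : LinearIndependent K fun i => (⟨(B2 (bc K ρ)).mkQ (C i), C i, hC i, rfl⟩ :
      (Z2 (bc K ρ)).map (B2 (bc K ρ)).mkQ) := by
    rw [Fintype.linearIndependent_iff]
    intro a ha i
    rw [← Module.forall_dual_apply_eq_zero_iff k]
    intro φ
    have h1 : ∑ i, a i • C i ∈ B2 (bc K ρ) := by
      rw [← Submodule.Quotient.mk_eq_zero, ← Submodule.mkQ_apply, map_sum]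
      simpa using congrArg Subtype.val ha
    obtain ⟨F, hF⟩ := h1
    have h2 : ∑ i, φ (a i) • c i ∈ B2 ρ := by
      refine ⟨fun h => contr φ (F h), ?_⟩
      ext g h
      have h3 := congrArg (contr φ) (congrFun (congrFun hF g) h)
      rw [d1_apply, map_add, map_sub, contr_bc] at h3
      rw [d1_apply, h3]
      simp [C, Finset.sum_apply, TensorProduct.smul_tmul', contr_tmul]
    have h4 : ∑ i, φ (a i) • b i = 0 := by
      apply Subtype.ext
      rw [← Submodule.Quotient.mk_eq_zero, ← Submodule.mkQ_apply, map_sum] at h2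
      simpa [← hcb] using h2
    exact Fintype.linearIndependent_iff.1 b.linearIndependent _ h4 i
  simpa [relDim] using hli.fintype_card_le_finrank

lemma finrank_groupCohomology_le (ρ : Representation k H M) :
    finrank k (groupCohomology (Rep.of ρ) 2) ≤ relDim (Z2 ρ) (B2 ρ) := by
  let u : (H × H → M) →ₗ[k] (H → H → M) :=
    { toFun := fun f g h => f (g, h), map_add' := fun _ _ => rfl, map_smul' := fun _ _ => rfl }
  have hu : ∀ f : groupCohomology.cocycles₂ (Rep.of ρ), u f.1 ∈ Z2 ρ := fun f g h j =>
    ((groupCohomology.mem_cocycles₂_iff (A := Rep.of ρ) f.1).1 f.2 g h j).symm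
  let Ψ : groupCohomology.cocycles₂ (Rep.of ρ) →ₗ[k] (Z2 ρ).map (B2 ρ).mkQ :=
    LinearMap.codRestrict _ ((B2 ρ).mkQ ∘ₗ u ∘ₗ (groupCohomology.cocycles₂ (Rep.of ρ)).subtype)
      fun f => ⟨_, hu f, rfl⟩
  let π : groupCohomology.cocycles₂ (Rep.of ρ) →ₗ[k] groupCohomology (Rep.of ρ) 2 :=
    (groupCohomology.H2π (Rep.of ρ)).hom
  have hπ : Function.Surjective π := fun x =>
    groupCohomology.H2_induction_on x fun y => ⟨y, rfl⟩
  have hker : LinearMap.ker Ψ ≤ LinearMap.ker π := by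
    intro f hf
    refine (groupCohomology.H2π_eq_zero_iff f).2 ?_
    have h1 : (B2 ρ).mkQ (u f.1) = 0 := congrArg Subtype.val hf
    rw [Submodule.mkQ_apply, Submodule.Quotient.mk_eq_zero] at h1
    obtain ⟨F, hF⟩ := h1
    refine ⟨F, funext fun x => ?_⟩
    exact congrFun (congrFun hF x.1) x.2
  have : Finite (H × H) := inferInstance
  have h1 := LinearMap.finrank_range_add_finrank_ker Ψ
  have h2 := LinearMap.finrank_range_add_finrank_ker π
  rw [LinearMap.range_eq_top.2 hπ, finrank_top] at h2
  have h3 := Submodule.finrank_mono hker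
  have h4 := Submodule.finrank_le (LinearMap.range Ψ)
  rw [relDim]
  omega

end BaseChange

section Powers

lemma natCast_inj_of_lt {n a b : ℕ} (ha : a < n) (hb : b < n) (h : (a : ZMod n) = b) : a = b :=
  Nat.ModEq.eq_of_lt_of_lt ((ZMod.natCast_eq_natCast_iff _ _ _).1 h) ha hb

lemma two_mul_ne_zero_of {n a : ℕ} (h0 : 0 < a) (ha : a < n) (hn : 2 * a ≠ n) : 2 * (a : ZMod n) ≠ 0 := by
  intro h
  have h1 : n ∣ 2 * a := by
    rw [← ZMod.natCast_eq_zero_iff]; exact_mod_cast h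
  obtain ⟨z, hz⟩ := h1
  have : z < 2 := by
    by_contra hc
    have : n * 2 ≤ n * z := Nat.mul_le_mul le_rfl (by omega)
    omega
  interval_cases z <;> omega

variable {p e : ℕ}

lemma pow_add_pow_lt (hp : p.Prime) (hq : 5 ≤ p ^ e) {i j : ℕ} (hij : i < j) (hj : j < e) :
    p ^ i + p ^ j < p ^ e - 1 := by
  obtain ⟨f, rfl⟩ : ∃ f, e = f + 2 := ⟨e - 2, by omega⟩
  have h1 : p ^ i ≤ p ^ f := Nat.pow_le_pow_right hp.pos (by omega)
  have h2 : p ^ j ≤ p ^ (f + 1) := Nat.pow_le_pow_right hp.pos (by omega)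
  have hf : 0 < p ^ f := Nat.pow_pos hp.pos
  rw [pow_add] at hq ⊢
  rw [pow_succ] at h2
  obtain rfl | h3 := hp.eq_two_or_odd'
  · omega
  · have h4 : 3 ≤ p := by obtain ⟨k, rfl⟩ := h3; have := hp.two_le; omega
    nlinarith [Nat.mul_le_mul_left (p ^ f * p) h4, Nat.mul_le_mul_left (p ^ f) h4, Nat.sub_add_cancel
      (show 1 ≤ p ^ f * p ^ 2 from Nat.mul_pos hf (pow_pos hp.pos 2))]

lemma pow_lt_pred (hp : p.Prime) (hq : 3 ≤ p ^ e) {i : ℕ} (hi : i < e) : p ^ i < p ^ e - 1 := by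
  have h1 : p ^ (i + 1) ≤ p ^ e := Nat.pow_le_pow_right hp.pos hi
  rw [pow_succ] at h1
  have h2 := Nat.mul_le_mul_left (p ^ i) hp.two_le
  have h3 : 0 < p ^ i := Nat.pow_pos hp.pos
  rcases Nat.eq_zero_or_pos i with rfl | h4
  · simp; omega
  · have h5 : p ^ 1 ≤ p ^ i := Nat.pow_le_pow_right hp.pos h4
    have := hp.two_le
    omega

lemma odd_pow (hp : p.Prime) (h2 : p ≠ 2) (k : ℕ) : p ^ k % 2 = 1 :=
  Nat.odd_iff.1 (((hp.eq_two_or_odd').resolve_left h2).pow)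

lemma two_mul_pow_ne (hp : p.Prime) (hq : 5 ≤ p ^ e) {i : ℕ} (hi : i < e) : 2 * p ^ i ≠ p ^ e - 1 := by
  intro h
  rcases eq_or_ne p 2 with rfl | h2
  · have : 2 ^ e % 2 = 0 := by rw [show e = (e - 1) + 1 by omega, pow_succ]; omega
    omega
  rcases Nat.eq_zero_or_pos i with rfl | h4
  · simp at h; omega
  · have h5 : p ∣ 2 * p ^ i := Dvd.dvd.mul_left (dvd_pow_self p h4.ne') _
    have h6 : p ∣ p ^ e := dvd_pow_self p (by omega)
    rw [h] at h5
    have h7 := Nat.dvd_sub h6 h5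
    rw [Nat.sub_sub_self (by omega)] at h7
    exact hp.one_lt.ne' (Nat.dvd_one.1 h7)

lemma two_mul_pow_add_pow_ne (hp : p.Prime) (hq : p ^ e ≠ 9) {i j : ℕ} (hij : i < j) (hj : j < e) :
    2 * (p ^ i + p ^ j) ≠ p ^ e - 1 := by
  intro h
  have h0 : 0 < p ^ e := Nat.pow_pos hp.pos
  have h6 : p ∣ p ^ e := dvd_pow_self p (by omega)
  rcases eq_or_ne p 2 with rfl | h2
  · omega
  rcases Nat.eq_zero_or_pos i with rfl | h4
  · have h7 : p ^ j ∣ p ^ e := pow_dvd_pow p hj.le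
    have h8 : p ^ j ∣ 3 := by
      have h9 : p ^ e = p ^ j * 2 + 3 := by simp at h; omega
      rw [h9] at h7
      exact (Nat.dvd_add_right (Dvd.intro _ rfl)).1 h7
    have h10 : p ∣ 3 := (dvd_pow_self p (by omega)).trans h8
    obtain rfl := (Nat.prime_dvd_prime_iff_eq hp Nat.prime_three).1 h10
    have h11 : j = 1 := by
      have := Nat.le_of_dvd (by norm_num) h8
      by_contra hc
      have : 3 ^ 2 ≤ 3 ^ j := Nat.pow_le_pow_right (by norm_num) (by omega)
      omega
    subst h11
    omega
  · have h5 : p ∣ 2 * (p ^ i + p ^ j) :=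
      Dvd.dvd.mul_left (dvd_add (dvd_pow_self p h4.ne') (dvd_pow_self p (by omega))) _
    rw [h] at h5
    have h7 := Nat.dvd_sub h6 h5
    rw [Nat.sub_sub_self (by omega)] at h7
    exact hp.one_lt.ne' (Nat.dvd_one.1 h7)

lemma isUnit_pow (hp : p.Prime) (he : 0 < e) (i : ℕ) : IsUnit ((p : ZMod (p ^ e - 1)) ^ i) := by
  have h : (p : ZMod (p ^ e - 1)) ^ e = 1 := by
    have h0 : 1 ≤ p ^ e := Nat.pow_pos hp.pos
    have : ((p ^ e - 1 + 1 : ℕ) : ZMod (p ^ e - 1)) = 1 := by simp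
    rw [Nat.sub_add_cancel h0] at this
    exact_mod_cast this
  exact (IsUnit.of_pow_eq_one h he.ne').pow i

lemma pow_inj (hp : p.Prime) (hq : 3 ≤ p ^ e) {i j : ℕ} (hi : i < e) (hj : j < e)
    (h : (p : ZMod (p ^ e - 1)) ^ i = p ^ j) : i = j := by
  have := natCast_inj_of_lt (pow_lt_pred hp hq hi) (pow_lt_pred hp hq hj) (by exact_mod_cast h)
  exact Nat.pow_right_injective hp.two_le this

lemma two_pow_ne (hp : p.Prime) (hq : 5 ≤ p ^ e) {i : ℕ} (hi : i < e) :
    2 * (p : ZMod (p ^ e - 1)) ^ i ≠ 0 := by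
  exact_mod_cast two_mul_ne_zero_of (Nat.pow_pos hp.pos) (pow_lt_pred hp (by omega) hi) (two_mul_pow_ne hp hq hi)

lemma two_pow_add_pow_ne (hp : p.Prime) (hq : 5 ≤ p ^ e) (h9 : p ^ e ≠ 9) {i j : ℕ} (hij : i < j) (hj : j < e) :
    2 * ((p : ZMod (p ^ e - 1)) ^ i + p ^ j) ≠ 0 := by
  exact_mod_cast two_mul_ne_zero_of (Nat.add_pos_left (Nat.pow_pos hp.pos) _)
    (pow_add_pow_lt hp hq hij hj) (two_mul_pow_add_pow_ne hp h9 hij hj)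

lemma pow_add_pow_ne (hp : p.Prime) (hq : 5 ≤ p ^ e) {i j : ℕ} (hi : i < e) (hj : j < e) :
    (p : ZMod (p ^ e - 1)) ^ i + p ^ j ≠ 0 := by
  have key : ∀ i j, i < j → j < e → (p : ZMod (p ^ e - 1)) ^ i + p ^ j ≠ 0 := by
    intro i j hij hj h
    have := natCast_inj_of_lt (n := p ^ e - 1) (b := 0) (pow_add_pow_lt hp hq hij hj) (by omega)
      (by exact_mod_cast h)
    have := Nat.pow_pos (n := i) hp.pos
    omega
  rcases lt_trichotomy i j with h | rfl | h
  · exact key _ _ h hj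
  · rw [← two_mul]; exact two_pow_ne hp hq hi
  · rw [add_comm]; exact key _ _ h hi

lemma two_pow_inj (hp : p.Prime) (hq : 5 ≤ p ^ e) {i j : ℕ} (hi : i < e) (hj : j < e)
    (h : 2 * (p : ZMod (p ^ e - 1)) ^ i = 2 * p ^ j) : i = j := by
  rcases eq_or_ne p 2 with rfl | h2
  · have hu := isUnit_pow (e := e) hp (by omega) 1
    rw [pow_one] at hu
    exact pow_inj hp (by omega) hi hj (hu.mul_left_cancel (by simpa using h))
  · have h3 : 3 ≤ p := by have := hp.two_le; omega
    have key : ∀ i, i < e → 2 * p ^ i < p ^ e - 1 := fun i hi => by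
      have h1 : p ^ (i + 1) ≤ p ^ e := Nat.pow_le_pow_right hp.pos hi
      rw [pow_succ] at h1
      have h2 := Nat.mul_le_mul_left (p ^ i) h3
      have h4 : 0 < p ^ i := Nat.pow_pos hp.pos
      rcases Nat.eq_zero_or_pos i with rfl | h4
      · simp; omega
      · have h5 : p ^ 1 ≤ p ^ i := Nat.pow_le_pow_right hp.pos h4
        omega
    have := natCast_inj_of_lt (key i hi) (key j hj) (by exact_mod_cast h)
    exact Nat.pow_right_injective hp.two_le (Nat.eq_of_mul_eq_mul_left two_pos this)

lemma star_ne (hp : p.Prime) (hq : 7 ≤ p ^ e) (h9 : p ^ e ≠ 9) {i j : ℕ} (hi : i < e) (hj : j < e) :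
    2 * ((p : ZMod (p ^ e - 1)) ^ i + p ^ j) ≠ 0 := by
  rcases lt_trichotomy i j with h | rfl | h
  · exact two_pow_add_pow_ne hp (by omega) h9 h hj
  · intro h
    rw [← two_mul, ← mul_assoc, (isUnit_pow hp (by omega) i).mul_left_eq_zero] at h
    have h4 : p ^ e - 1 ∣ 4 := by
      rw [← ZMod.natCast_eq_zero_iff]; push_cast; rw [← h]; norm_num
    have := Nat.le_of_dvd (by norm_num) h4
    omega
  · rw [add_comm]; exact two_pow_add_pow_ne hp (by omega) h9 h hi

/-- The exponents of the weights occurring on a root group. -/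
def dval (p e : ℕ) : Fin e ⊕ {x : Fin e × Fin e // x.1 < x.2} → ℕ
  | .inl i => p ^ (i : ℕ)
  | .inr x => p ^ (x.1.1 : ℕ) + p ^ (x.1.2 : ℕ)

lemma dval_lt (hp : p.Prime) (hq : 5 ≤ p ^ e) (x) : dval p e x < p ^ e - 1 := by
  rcases x with i | x
  · exact pow_lt_pred hp (by omega) i.2
  · exact pow_add_pow_lt hp hq x.2 x.1.2.2

lemma dval_injective (hp : p.Prime) : Function.Injective (dval p e) := by
  have hlt : ∀ j k l : ℕ, j < k → k < l → p ^ j + p ^ k < p ^ l := fun j k l h1 h2 => by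
    have h3 : p ^ (k + 1) ≤ p ^ l := Nat.pow_le_pow_right hp.pos h2
    have h4 : p ^ j < p ^ k := Nat.pow_lt_pow_right hp.one_lt h1
    rw [pow_succ] at h3
    have := Nat.mul_le_mul_left (p ^ k) hp.two_le
    omega
  have h1 : ∀ (i j k : ℕ), j < k → p ^ i ≠ p ^ j + p ^ k := fun i j k h h' => by
    rcases lt_or_ge k i with h2 | h2
    · exact (hlt j k i h h2).ne' h'
    · have h3 : p ^ i ≤ p ^ k := Nat.pow_le_pow_right hp.pos h2
      have := Nat.pow_pos (n := j) hp.pos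
      omega
  rintro (i | ⟨⟨j, k⟩, hjk⟩) (i' | ⟨⟨j', k'⟩, hjk'⟩) h <;> simp only [dval] at h
  · rw [Fin.ext (Nat.pow_right_injective hp.two_le h)]
  · exact absurd h (h1 _ _ _ hjk')
  · exact absurd h.symm (h1 _ _ _ hjk)
  · have hk : (k : ℕ) = k' := by
      rcases lt_trichotomy (k : ℕ) k' with h2 | h2 | h2
      · have := hlt j k k' hjk h2
        omega
      · exact h2
      · have := hlt j' k' k hjk' h2
        omega
    rw [hk] at h
    have hj : (j : ℕ) = j' := Nat.pow_right_injective hp.two_le (Nat.add_right_cancel h)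
    obtain rfl := Fin.ext hk
    obtain rfl := Fin.ext hj
    rfl

lemma two_dval_ne (hp : p.Prime) (hq : 5 ≤ p ^ e) (h9 : p ^ e ≠ 9) (x) :
    2 * (dval p e x : ZMod (p ^ e - 1)) ≠ 0 := by
  rcases x with i | x
  · simpa [dval] using two_pow_ne hp hq i.2
  · simpa [dval] using two_pow_add_pow_ne hp hq h9 x.2 x.1.2.2

end Powers

section Counting

/-- A function on weights with the formal properties of the weight multiplicities of a
`D`-dimensional representation. -/
structure IsMult (n D : ℕ) (m : (Fin 4 → ZMod n) → ℕ) : Prop where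
  perm : ∀ (v : Fin 4 → ZMod n) (f : Fin 4 → Fin 4), Function.Bijective f → m (v ∘ f) = m v
  shift : ∀ (v : Fin 4 → ZMod n) (c : ZMod n), m (fun a => v a + c) = m v
  count : ∀ (ι : Type) [Fintype ι] (v : ι → Fin 4 → ZMod n),
    (∀ i j c, (∀ a, v i a = v j a + c) → i = j) → ∑ i, m (v i) ≤ D

variable {n D p e : ℕ} {m : (Fin 4 → ZMod n) → ℕ}

lemma IsMult.count_perm (hm : IsMult n D m) {k : ℕ} {ι : Type} [Fintype ι] (f : Fin k → Fin 4 → Fin 4)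
    (hf : ∀ l, Function.Bijective (f l)) (w : ι → Fin 4 → ZMod n)
    (h : ∀ k l i j c, (∀ a, w i (f k a) = w j (f l a) + c) → k = l ∧ i = j) : k * ∑ i, m (w i) ≤ D := by
  have h1 := hm.count (Fin k × ι) (fun x => w x.2 ∘ f x.1) (fun x y c hxy => by
    have := h x.1 y.1 x.2 y.2 c hxy
    exact Prod.ext this.1 this.2)
  rw [Fintype.sum_prod_type] at h1
  simpa [hm.perm _ _ (hf _)] using h1

/-- Total multiplicity of the Frobenius twists of a root. -/
def sRoot (p e : ℕ) (m : (Fin 4 → ZMod n) → ℕ) : ℕ := ∑ i : Fin e, m ![p ^ (i : ℕ), -p ^ (i : ℕ), 0, 0]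

/-- Total multiplicity of the sums of two distinct twists of a root. -/
def sAlt (p e : ℕ) (m : (Fin 4 → ZMod n) → ℕ) : ℕ :=
  ∑ x : {x : Fin e × Fin e // x.1 < x.2},
    m ![p ^ (x.1.1 : ℕ) + p ^ (x.1.2 : ℕ), -(p ^ (x.1.1 : ℕ) + p ^ (x.1.2 : ℕ)), 0, 0]

/-- Total multiplicity of the sums of twists of orthogonal roots. -/
def sOrth (p e : ℕ) (m : (Fin 4 → ZMod n) → ℕ) : ℕ :=
  ∑ x : Fin e × Fin e, m ![p ^ (x.1 : ℕ), -p ^ (x.1 : ℕ), p ^ (x.2 : ℕ), -p ^ (x.2 : ℕ)]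

/-- Total multiplicity of the sums of twists of composable roots. -/
def sPath (p e : ℕ) (m : (Fin 4 → ZMod n) → ℕ) : ℕ :=
  ∑ x : Fin e × Fin e, m ![p ^ (x.1 : ℕ), p ^ (x.2 : ℕ) - p ^ (x.1 : ℕ), -p ^ (x.2 : ℕ), 0]

/-- Total multiplicity of the sums of twists of roots with the same source. -/
def sFork (p e : ℕ) (m : (Fin 4 → ZMod n) → ℕ) : ℕ :=
  ∑ x : Fin e × Fin e, m ![p ^ (x.1 : ℕ) + p ^ (x.2 : ℕ), -p ^ (x.1 : ℕ), -p ^ (x.2 : ℕ), 0]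

/-- Total multiplicity of the sums of twists of roots with the same target. -/
def sCofork (p e : ℕ) (m : (Fin 4 → ZMod n) → ℕ) : ℕ :=
  ∑ x : Fin e × Fin e, m ![-(p ^ (x.1 : ℕ) + p ^ (x.2 : ℕ)), p ^ (x.1 : ℕ), p ^ (x.2 : ℕ), 0]

/-- The arrangements of a root up to sign. -/
def rootPos : Fin 6 → Fin 4 → Fin 4 :=
  ![![0, 1, 2, 3], ![0, 2, 1, 3], ![0, 2, 3, 1], ![2, 0, 1, 3], ![2, 0, 3, 1], ![2, 3, 0, 1]]

lemma root_distinct {R : Type} [CommRing R] {x y c : R} (hx : 2 * x ≠ 0) {k l : Fin 6}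
    (h : ∀ a, ![x, -x, 0, 0] (rootPos k a) = ![y, -y, 0, 0] (rootPos l a) + c) : k = l ∧ x = y := by
  simp only [Fin.forall_fin_succ, rootPos] at h
  fin_cases k <;> fin_cases l <;> simp at h ⊢ <;> grind

lemma count_root (hp : p.Prime) (hq : 5 ≤ p ^ e) (h9 : p ^ e ≠ 9)
    {m : (Fin 4 → ZMod (p ^ e - 1)) → ℕ} (hm : IsMult (p ^ e - 1) D m) :
    6 * (sRoot p e m + sAlt p e m) ≤ D := by
  have h := hm.count_perm rootPos (by decide) (fun x : Fin e ⊕ {x : Fin e × Fin e // x.1 < x.2} =>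
      ![(dval p e x : ZMod (p ^ e - 1)), -dval p e x, 0, 0]) ?_
  · rw [Fintype.sum_sum_type] at h
    simpa [dval, sRoot, sAlt] using h
  · intro k l x y c hc
    have key := root_distinct (two_dval_ne hp hq h9 x) hc
    exact ⟨key.1, dval_injective hp (natCast_inj_of_lt (dval_lt hp hq x) (dval_lt hp hq y) key.2)⟩

/-- The orientations of a pair of orthogonal roots. -/
def orthPos : Fin 4 → Fin 4 → Fin 4 := ![![0, 1, 2, 3], ![1, 0, 2, 3], ![0, 1, 3, 2], ![1, 0, 3, 2]]

lemma orth_distinct {R : Type} [CommRing R] {x y x' y' c : R} (hx : 2 * (x + x') ≠ 0) (hy : 2 * (y + y') ≠ 0)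
    {k l : Fin 4} (h : ∀ a, ![x, -x, y, -y] (orthPos k a) = ![x', -x', y', -y'] (orthPos l a) + c) :
    k = l ∧ 2 * x = 2 * x' ∧ 2 * y = 2 * y' := by
  simp only [Fin.forall_fin_succ, orthPos] at h
  fin_cases k <;> fin_cases l <;> simp at h ⊢ <;> grind

lemma count_orth (hp : p.Prime) (hq : 7 ≤ p ^ e) (h9 : p ^ e ≠ 9)
    {m : (Fin 4 → ZMod (p ^ e - 1)) → ℕ} (hm : IsMult (p ^ e - 1) D m) :
    4 * sOrth p e m ≤ D := by
  refine hm.count_perm orthPos (by decide) _ ?_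
  rintro k l ⟨i, j⟩ ⟨i', j'⟩ c hc
  obtain ⟨h1, h2, h3⟩ := orth_distinct (star_ne hp hq h9 i.2 i'.2) (star_ne hp hq h9 j.2 j'.2) hc
  have hij := And.intro (two_pow_inj hp (by omega) i.2 i'.2 h2) (two_pow_inj hp (by omega) j.2 j'.2 h3)
  exact ⟨h1, Prod.ext (Fin.ext hij.1) (Fin.ext hij.2)⟩

/-- Six arrangements of the path weights, pairwise inequivalent in characteristic two. -/
def pathPos : Fin 6 → Fin 4 → Fin 4 :=
  ![![0, 2, 1, 3], ![1, 0, 2, 3], ![2, 1, 0, 3], ![2, 0, 3, 1], ![0, 1, 3, 2], ![1, 2, 3, 0]]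

lemma pathPos_bijective : ∀ k, Function.Bijective (pathPos k) := by decide

lemma path_distinct {R : Type} [CommRing R] {x y x' y' : R} (h1 : x + x' ≠ 0)
    (h3 : x + y' ≠ 0) (h4 : y + x' ≠ 0) (hx : x ≠ 0) (hy : y ≠ 0) (hx' : x' ≠ 0) (hy' : y' ≠ 0)
    {k l : Fin 6} (h : ∀ a, ![x, y - x, -y, 0] (pathPos k a) = ![x', y' - x', -y', 0] (pathPos l a)) :
    k = l ∧ x = x' ∧ y = y' := by
  simp only [Fin.forall_fin_succ, pathPos] at h
  fin_cases k <;> fin_cases l <;> simp at h ⊢ <;> grind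

lemma four_mul_eq_zero {R : Type} [CommRing R] {v w : Fin 4 → R} {f g : Fin 4 → Fin 4} {c : R}
    (hf : Function.Bijective f) (hg : Function.Bijective g) (hv : ∑ a, v a = 0) (hw : ∑ a, w a = 0)
    (h : ∀ a, v (f a) = w (g a) + c) : 4 * c = 0 := by
  have h1 := (Equiv.ofBijective f hf).sum_comp v
  have h2 := (Equiv.ofBijective g hg).sum_comp w
  simp only [Equiv.ofBijective_apply, h, Finset.sum_add_distrib] at h1 h2
  rw [h2, hv, hw] at h1
  simpa using h1

lemma count_path_two (hq : 5 ≤ 2 ^ e)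
    {m : (Fin 4 → ZMod (2 ^ e - 1)) → ℕ} (hm : IsMult (2 ^ e - 1) D m) :
    6 * sPath 2 e m ≤ D := by
  have hp := Nat.prime_two
  refine hm.count_perm pathPos pathPos_bijective _ ?_
  rintro k l ⟨i, j⟩ ⟨i', j'⟩ c hc
  have hu := isUnit_pow (e := e) hp (Nat.pos_of_ne_zero (by rintro rfl; omega)) 2
  have h0 : c = 0 := by
    refine (hu.mul_right_eq_zero).1 ?_
    have := four_mul_eq_zero (pathPos_bijective k) (pathPos_bijective l) (by simp [Fin.sum_univ_four])
      (by simp [Fin.sum_univ_four]) hc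
    rw [← this]
    norm_num
  simp only [h0, add_zero] at hc
  have hne : ∀ i : Fin e, ((2 : ℕ) : ZMod (2 ^ e - 1)) ^ (i : ℕ) ≠ 0 := fun i h =>
    two_pow_ne hp hq i.2 (by rw [h, mul_zero])
  obtain ⟨h1, h2, h3⟩ := path_distinct (pow_add_pow_ne hp hq i.2 i'.2)
    (pow_add_pow_ne hp hq i.2 j'.2) (pow_add_pow_ne hp hq j.2 i'.2) (hne _) (hne _) (hne _) (hne _) hc
  have hij := And.intro (pow_inj hp (by omega) i.2 i'.2 h2) (pow_inj hp (by omega) j.2 j'.2 h3)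
  exact ⟨h1, Prod.ext (Fin.ext hij.1) (Fin.ext hij.2)⟩

/-- The sign attached to a boolean. -/
def sgn (R : Type) [Ring R] (b : Bool) : R := if b then 1 else -1

/-- The cyclic rotations of the first three coordinates. -/
def cycPos : Fin 3 → Fin 4 → Fin 4 := ![![0, 1, 2, 3], ![1, 2, 0, 3], ![2, 0, 1, 3]]

lemma triple_distinct {R : Type} [CommRing R] (φ : R →+* ZMod 2) {x y x' y' c : R} (hx : φ x = 1)
    (hy : φ y = 1) (hx' : φ x' = 1) (hy' : φ y' = 1) (h1 : x + x' ≠ 0) (h2 : y + y' ≠ 0) {s t s' t' : Bool}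
    {k l : Fin 3} (h : ∀ a, ![-(sgn R s * x + sgn R t * y), sgn R s * x, sgn R t * y, 0] (cycPos k a) =
      ![-(sgn R s' * x' + sgn R t' * y'), sgn R s' * x', sgn R t' * y', 0] (cycPos l a) + c) :
    k = l ∧ s = s' ∧ t = t' ∧ x = x' ∧ y = y' := by
  have h3 := h 3
  have hc : c = 0 := by
    fin_cases k <;> fin_cases l <;> simpa [cycPos, eq_comm] using h3
  simp only [hc, add_zero] at h
  have hs : ∀ b, φ (sgn R b) = 1 := fun b => by
    cases b
    · simp [sgn]
    · simp [sgn]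
  have hkl : k = l := by
    have h' := fun a => congrArg φ (h a)
    simp only [Fin.forall_fin_succ, cycPos] at h'
    fin_cases k <;> fin_cases l <;> simp [hs, hx, hy, hx', hy'] at h' ⊢
  subst hkl
  have h4 : sgn R s * x = sgn R s' * x' ∧ sgn R t * y = sgn R t' * y' := by
    simp only [Fin.forall_fin_succ, cycPos] at h
    fin_cases k <;> simp at h ⊢ <;> tauto
  have key : ∀ {s s' : Bool} {x x' : R}, x + x' ≠ 0 → sgn R s * x = sgn R s' * x' → s = s' ∧ x = x' := by
    intro s s' x x' h0 h
    cases s <;> cases s' <;> simp [sgn] at h ⊢ <;> grind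
  obtain ⟨h5, h6⟩ := key h1 h4.1
  obtain ⟨h7, h8⟩ := key h2 h4.2
  exact ⟨rfl, h5, h7, h6, h8⟩

lemma count_triple (hp : p.Prime) (h2 : p ≠ 2) (hq : 5 ≤ p ^ e)
    {m : (Fin 4 → ZMod (p ^ e - 1)) → ℕ} (hm : IsMult (p ^ e - 1) D m) :
    3 * (2 * sPath p e m + sFork p e m + sCofork p e m) ≤ D := by
  set V : (Bool × Bool) × (Fin e × Fin e) → Fin 4 → ZMod (p ^ e - 1) := fun x =>
    ![-(sgn (ZMod (p ^ e - 1)) x.1.1 * p ^ (x.2.1 : ℕ) + sgn (ZMod (p ^ e - 1)) x.1.2 * p ^ (x.2.2 : ℕ)),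
      sgn (ZMod (p ^ e - 1)) x.1.1 * p ^ (x.2.1 : ℕ), sgn (ZMod (p ^ e - 1)) x.1.2 * p ^ (x.2.2 : ℕ), 0]
    with hV
  have h := hm.count_perm cycPos (by decide) V ?_
  · have h1 : ∑ x, m (V ((true, true), x)) = sCofork p e m :=
      Finset.sum_congr rfl fun x _ => by simp [hV, sgn]
    have h3 : ∑ x, m (V ((false, false), x)) = sFork p e m :=
      Finset.sum_congr rfl fun x _ => by simp [hV, sgn, add_comm]
    have h4 : ∑ x, m (V ((true, false), x)) = sPath p e m :=
      Finset.sum_congr rfl fun x _ => by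
        rw [← hm.perm _ ![1, 0, 2, 3] (by decide)]
        congr 1; funext a; fin_cases a <;> simp [hV, sgn, sub_eq_add_neg]
    have h5 : ∑ x, m (V ((false, true), x)) = sPath p e m :=
      Fintype.sum_equiv (Equiv.prodComm _ _) _ _ fun x => by
        rw [← hm.perm _ ![2, 0, 1, 3] (by decide)]
        congr 1; funext a; fin_cases a <;> simp [hV, sgn, sub_eq_add_neg, add_comm]
    have h6 : ∑ b : Bool × Bool, ∑ x, m (V (b, x)) = sCofork p e m + sPath p e m + (sPath p e m + sFork p e m) := by
      rw [← h1, ← h3]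
      nth_rewrite 1 [← h4]
      rw [← h5]
      simp [Fintype.sum_prod_type]
    rw [Fintype.sum_prod_type, h6] at h
    omega
  · rintro k l ⟨⟨s, t⟩, i, j⟩ ⟨⟨s', t'⟩, i', j'⟩ c hc
    have hd : 2 ∣ p ^ e - 1 := by have := odd_pow hp h2 e; omega
    have hφ : ∀ i : ℕ, ZMod.castHom hd (ZMod 2) ((p : ZMod (p ^ e - 1)) ^ i) = 1 := fun i => by
      rw [← Nat.cast_pow, map_natCast, ← Nat.cast_one (R := ZMod 2), ZMod.natCast_eq_natCast_iff]
      exact odd_pow hp h2 i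
    obtain ⟨h3, h4, h5, h6, h7⟩ := triple_distinct (ZMod.castHom hd (ZMod 2)) (hφ _) (hφ _) (hφ _) (hφ _)
      (pow_add_pow_ne hp hq i.2 i'.2) (pow_add_pow_ne hp hq j.2 j'.2) hc
    refine ⟨h3, Prod.ext (Prod.ext h4 h5) (Prod.ext (Fin.ext (pow_inj hp (by omega) i.2 i'.2 h6))
      (Fin.ext (pow_inj hp (by omega) j.2 j'.2 h7)))⟩

end Counting

section Totals

variable {n D p e : ℕ}

/-- The total cost of a multiplicity function. -/
def total (p e : ℕ) {n : ℕ} (m : (Fin 4 → ZMod n) → ℕ) : ℕ :=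
  2 * sOrth p e m + 3 * sRoot p e m + 2 * sAlt p e m + 4 * sPath p e m +
    if p = 2 then 0 else 2 * sFork p e m + 2 * sCofork p e m

/-- The arrangements of the weight `(1, -1, 1, -1)`. -/
def altPos : Fin 6 → Fin 4 → Fin 4 :=
  ![![0, 1, 2, 3], ![0, 2, 1, 3], ![0, 1, 3, 2], ![1, 0, 3, 2], ![1, 3, 0, 2], ![1, 0, 2, 3]]

/-- The arrangements fixing the first coordinate. -/
def tailPos : Fin 6 → Fin 4 → Fin 4 :=
  ![![0, 1, 2, 3], ![0, 1, 3, 2], ![0, 2, 1, 3], ![0, 2, 3, 1], ![0, 3, 1, 2], ![0, 3, 2, 1]]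

lemma IsMult.count_rel {m : (Fin 4 → ZMod n) → ℕ} (hm : IsMult n D m) (ι : Type) [Fintype ι]
    (v : ι → Fin 4 → ZMod n) (h : ∀ i j, (∀ a, v i a - v i 3 = v j a - v j 3) → i = j) : ∑ i, m (v i) ≤ D :=
  hm.count ι v fun i j c hc => h i j fun a => by rw [hc, hc]; ring

lemma count_nine {m : (Fin 4 → ZMod 8) → ℕ} (hm : IsMult 8 D m) :
    6 * m ![1, -1, 0, 0] + (6 * m ![3, -3, 0, 0] + (3 * m ![4, 0, 4, 0] +
      (6 * m ![1, -1, 1, -1] + 6 * m ![1, -1, 3, -3]))) ≤ D := by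
  have h := hm.count_rel (Fin 6 ⊕ Fin 6 ⊕ Fin 3 ⊕ Fin 6 ⊕ Fin 6)
    (Sum.elim (fun k => ![1, -1, 0, 0] ∘ rootPos k) (Sum.elim (fun k => ![3, -3, 0, 0] ∘ rootPos k)
      (Sum.elim (fun k => ![4, 0, 4, 0] ∘ altPos (Fin.castLE (by norm_num) k))
        (Sum.elim (fun k => ![1, -1, 1, -1] ∘ altPos k) (fun k => ![1, -1, 3, -3] ∘ tailPos k)))))
    (by decide +kernel)
  simpa [Fintype.sum_sum_type, hm.perm _ (rootPos _) ((by decide : ∀ k, Function.Bijective (rootPos k)) _),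
    hm.perm _ (altPos _) ((by decide : ∀ k, Function.Bijective (altPos k)) _),
    hm.perm _ (tailPos _) ((by decide : ∀ k, Function.Bijective (tailPos k)) _)] using h

lemma total_nine {m : (Fin 4 → ZMod 8) → ℕ} (hm : IsMult 8 D m) (hD : 0 < D)
    (h3 : 3 * (2 * sPath 3 2 m + sFork 3 2 m + sCofork 3 2 m) ≤ D) : total 3 2 m < 2 * D := by
  have h := count_nine hm
  have h1 : sRoot 3 2 m = m ![1, -1, 0, 0] + m ![3, -3, 0, 0] := by simp [sRoot, Fin.sum_univ_two]
  have h2 : sAlt 3 2 m = m ![4, 0, 4, 0] := by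
    have : (Finset.univ : Finset {x : Fin 2 × Fin 2 // x.1 < x.2}) = {⟨(0, 1), by decide⟩} := by decide
    rw [sAlt, this, Finset.sum_singleton, ← hm.perm _ ![0, 2, 1, 3] (by decide)]
    congr 1; decide
  have h4 : sOrth 3 2 m = 2 * m ![1, -1, 1, -1] + 2 * m ![1, -1, 3, -3] := by
    have h5 : m ![3, -3, 1, -1] = m ![1, -1, 3, -3] := by
      rw [← hm.perm _ ![2, 3, 0, 1] (by decide)]; congr 1; decide
    have h6 : m ![3, -3, 3, -3] = m ![1, -1, 1, -1] := by
      rw [← hm.shift _ 4, ← hm.perm _ ![1, 0, 3, 2] (by decide)]; congr 1; decide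
    simp [sOrth, Fintype.sum_prod_type, Fin.sum_univ_two, h5, h6]
    ring
  simp only [total, if_neg (show 3 ≠ 2 by decide)]
  omega

lemma total_five {m : (Fin 4 → ZMod 4) → ℕ} (hm : IsMult 4 D m) (hD : 0 < D)
    (h3 : 3 * (2 * sPath 5 1 m + sFork 5 1 m + sCofork 5 1 m) ≤ D)
    (h6 : 6 * (sRoot 5 1 m + sAlt 5 1 m) ≤ D) : total 5 1 m < 2 * D := by
  have h := hm.count_rel (Fin 3) (fun k => ![1, -1, 1, -1] ∘ altPos (Fin.castLE (by norm_num) k)) (by decide)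
  have h4 : sOrth 5 1 m = m ![1, -1, 1, -1] := by
    simp [sOrth]
  simp only [hm.perm _ (altPos _) ((by decide : ∀ k, Function.Bijective (altPos k)) _)] at h
  simp only [total, if_neg (show 5 ≠ 2 by decide), Finset.sum_const, Finset.card_univ, Fintype.card_fin,
    smul_eq_mul] at h ⊢
  omega

/-- All arrangements of a root. -/
def rootPos' : Fin 12 → Fin 4 → Fin 4 :=
  ![![0, 1, 2, 3], ![0, 2, 1, 3], ![0, 2, 3, 1], ![2, 0, 1, 3], ![2, 0, 3, 1], ![2, 3, 0, 1],
    ![1, 0, 2, 3], ![1, 2, 0, 3], ![1, 2, 3, 0], ![2, 1, 0, 3], ![2, 1, 3, 0], ![2, 3, 1, 0]]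

/-- The arrangements of a weight supported at the last coordinate. -/
def lastPos : Fin 4 → Fin 4 → Fin 4 := ![![0, 1, 2, 3], ![0, 1, 3, 2], ![0, 3, 2, 1], ![3, 0, 1, 2]]

set_option synthInstance.maxHeartbeats 400000 in
set_option synthInstance.maxSize 2048 in
lemma total_four {m : (Fin 4 → ZMod 3) → ℕ} (hm : IsMult 3 D m) (hD : m 0 < D) : total 2 2 m < 2 * D := by
  have h := hm.count_rel (Fin 1 ⊕ Fin 12 ⊕ Fin 6 ⊕ Fin 4 ⊕ Fin 4)
    (Sum.elim (fun _ => 0) (Sum.elim (fun k => ![1, 2, 0, 0] ∘ rootPos' k) (Sum.elim (fun k => ![1, 2, 1, 2] ∘ altPos k) 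
      (Sum.elim (fun k => ![0, 0, 0, 1] ∘ lastPos k) (fun k => ![0, 0, 0, 2] ∘ lastPos k)))))
    (by decide +kernel)
  simp [Fintype.sum_sum_type, hm.perm _ (rootPos' _) ((by decide : ∀ k, Function.Bijective (rootPos' k)) _),
    hm.perm _ (altPos _) ((by decide : ∀ k, Function.Bijective (altPos k)) _),
    hm.perm _ (lastPos _) ((by decide : ∀ k, Function.Bijective (lastPos k)) _)] at h
  have h1 : sRoot 2 2 m = 2 * m ![1, 2, 0, 0] := by
    have h5 : m ![2, 1, 0, 0] = m ![1, 2, 0, 0] := by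
      rw [← hm.perm _ ![1, 0, 2, 3] (by decide)]; congr 1; decide
    rw [two_mul]
    nth_rewrite 1 [← h5]
    rw [add_comm]
    exact Fin.sum_univ_two _
  have h2 : sAlt 2 2 m = m 0 := by
    have : (Finset.univ : Finset {x : Fin 2 × Fin 2 // x.1 < x.2}) = {⟨(0, 1), by decide⟩} := by decide
    rw [sAlt, this, Finset.sum_singleton]
    congr 1; decide
  have h4 : sOrth 2 2 m = 4 * m ![1, 2, 1, 2] := by
    have hb : ∀ i j : Fin 2, ∃ f : Fin 4 → Fin 4, Function.Bijective f ∧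
      ![((2 : ℕ) : ZMod 3) ^ (i : ℕ), -((2 : ℕ) : ZMod 3) ^ (i : ℕ), ((2 : ℕ) : ZMod 3) ^ (j : ℕ),
        -((2 : ℕ) : ZMod 3) ^ (j : ℕ)] = ![1, 2, 1, 2] ∘ f := by decide +kernel
    have hc : ∀ x : Fin 2 × Fin 2, m ![((2 : ℕ) : ZMod 3) ^ (x.1 : ℕ), -((2 : ℕ) : ZMod 3) ^ (x.1 : ℕ), ((2 : ℕ) : ZMod 3) ^ (x.2 : ℕ),
        -((2 : ℕ) : ZMod 3) ^ (x.2 : ℕ)] =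
        m ![1, 2, 1, 2] := fun x => by
      obtain ⟨f, hf, h⟩ := hb x.1 x.2
      rw [h, hm.perm _ f hf]
    rw [sOrth, Finset.sum_congr rfl fun x _ => hc x]
    simp
  have h6 : sPath 2 2 m = 2 * m ![1, 2, 0, 0] + m ![0, 0, 0, 2] + m ![0, 0, 0, 1] := by
    have e1 : m ![1, 0, 2, 0] = m ![1, 2, 0, 0] := by
      rw [← hm.perm _ ![0, 2, 1, 3] (by decide)]; congr 1; decide
    have e2 : m ![2, 0, 1, 0] = m ![1, 2, 0, 0] := by
      rw [← hm.perm _ ![2, 0, 1, 3] (by decide)]; congr 1; decide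
    have e3 : m ![1, 1, 1, 0] = m ![0, 0, 0, 2] := by
      rw [← hm.shift _ 2]; congr 1; decide
    have e4 : m ![2, 2, 2, 0] = m ![0, 0, 0, 1] := by
      rw [← hm.shift _ 1]; congr 1; decide
    have : sPath 2 2 m = m ![1, 0, 2, 0] + m ![1, 1, 1, 0] + (m ![2, 2, 2, 0] + m ![2, 0, 1, 0]) := by
      rw [sPath, Fintype.sum_prod_type, Fin.sum_univ_two, Fin.sum_univ_two, Fin.sum_univ_two]
      rfl
    rw [this, e1, e2, e3, e4]
    ring
  simp only [total, if_pos]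
  omega

theorem total_lt (hp : p.Prime) (hq : 4 ≤ p ^ e) {m : (Fin 4 → ZMod (p ^ e - 1)) → ℕ}
    (hm : IsMult (p ^ e - 1) D m) (hD : 0 < D) (h4 : p ^ e = 4 → m 0 < D) : total p e m < 2 * D := by
  have key : ∀ {r f : ℕ}, r.Prime → p ^ e = r ^ (f + 1) → p = r ∧ e = f + 1 := fun {r f} hr h => by
    have h1 : p = r := (Nat.prime_dvd_prime_iff_eq hp hr).1 (hp.dvd_of_dvd_pow (n := f + 1) 
      (h ▸ dvd_pow_self p (by rintro rfl; simp at hq)))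
    exact ⟨h1, Nat.pow_right_injective hr.two_le (by simpa [h1] using h)⟩
  rcases eq_or_ne (p ^ e) 4 with hq4 | hq4
  · obtain ⟨rfl, rfl⟩ := key (r := 2) (f := 1) Nat.prime_two hq4
    exact total_four hm (h4 rfl)
  rcases eq_or_ne (p ^ e) 9 with hq9 | hq9
  · obtain ⟨rfl, rfl⟩ := key (r := 3) (f := 1) Nat.prime_three hq9
    exact total_nine hm hD (count_triple hp (by decide) (by decide) hm)
  have hr := count_root hp (by omega) hq9 hm
  rcases eq_or_ne (p ^ e) 5 with hq5 | hq5
  · obtain ⟨rfl, rfl⟩ := key (r := 5) (f := 0) Nat.prime_five hq5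
    exact total_five hm hD (count_triple hp (by decide) (by decide) hm) hr
  have hq7 : 7 ≤ p ^ e := by
    have : p ^ e ≠ 6 := fun h6 => by
      have h2 := Nat.prime_two.dvd_of_dvd_pow (m := p) (n := e) (h6 ▸ by norm_num)
      have h3 := Nat.prime_three.dvd_of_dvd_pow (m := p) (n := e) (h6 ▸ by norm_num)
      have h2' := (Nat.prime_dvd_prime_iff_eq Nat.prime_two hp).1 h2
      have h3' := (Nat.prime_dvd_prime_iff_eq Nat.prime_three hp).1 h3
      omega
    omega
  have ho := count_orth hp hq7 hq9 hm
  unfold total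
  split_ifs with h2
  · subst h2
    have := count_path_two (by omega) hm
    omega
  · have := count_triple hp h2 (by omega) hm
    omega

end Totals

section Weights

variable {K N : Type} [Field K] [Finite K] [AddCommGroup N] [Module K N] [FiniteDimensional K N]
  (p : ℕ) [Fact p.Prime] [Algebra (ZMod p) K] [CharP K p] (ρ : Representation K (G K) N)

lemma card_eq_pow_deg : Nat.card K = p ^ deg p K := by
  rw [Module.natCard_eq_pow_finrank (K := ZMod p), Nat.card_zmod]

/-- The multiplicity of a weight of the torus, as a function of its class. -/
noncomputable def nu (v : Fin 4 → ZMod (p ^ deg p K - 1)) : ℕ := mu tau ρ fun a => (v a).cast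

lemma cast_dvd_sub (n : ℕ) (x : ZMod n) (z : ℤ) (h : x = z) : (n : ℤ) ∣ x.cast - z := by
  rw [← ZMod.intCast_zmod_eq_zero_iff_dvd]
  simp [h]

lemma mu_eq_nu (v : Fin 4 → ℤ) : mu tau ρ v = nu p ρ fun a => (v a : ZMod (p ^ deg p K - 1)) := by
  rw [nu, mu, mu, chi_congr (c := 0) fun i => ?_]
  rw [add_zero, card_eq_pow_deg p, ← neg_sub, dvd_neg]
  exact cast_dvd_sub _ _ _ rfl

lemma isMult_nu : IsMult (p ^ deg p K - 1) (finrank K N) (nu p ρ) where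
  perm v f hf := mu_comp ρ (fun a => (v a).cast) (Equiv.ofBijective f hf)
  shift v c := by
    rw [nu, nu, mu, mu, chi_congr (c := (c.cast : ℤ)) fun i => ?_]
    rw [card_eq_pow_deg p]
    exact cast_dvd_sub _ _ _ (by simp)
  count ι _ v h := by
    refine sum_finrank_wt_le (ρ.comp tau) (fun i => chi fun a => (v i a).cast) fun i j hij => ?_
    refine h i j (v i 3 - v j 3) fun a => ?_
    have h1 := dvd_of_chi_eq hij a 3
    rw [card_eq_pow_deg p, ← ZMod.intCast_zmod_eq_zero_iff_dvd] at h1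
    simp at h1
    linear_combination h1

lemma cAdd_eq_sRoot (a b : Fin 4) (f : Fin 4 → Fin 4) (hf : Function.Bijective f) 
    (h : rt a b = ![1, -1, 0, 0] ∘ f) : cAdd p tau ρ a b = sRoot p (deg p K) (nu p ρ) := by
  refine Finset.sum_congr rfl fun i _ => ?_
  refine (mu_eq_nu p ρ _).trans (Eq.trans ?_ ((isMult_nu p ρ).perm _ f hf))
  congr 1
  funext c
  simp only [h, Pi.smul_apply, Function.comp]
  generalize f c = d
  fin_cases d <;> simp

lemma cAlt_eq_sAlt (a b : Fin 4) (f : Fin 4 → Fin 4) (hf : Function.Bijective f) 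
    (h : rt a b = ![1, -1, 0, 0] ∘ f) : cAlt p tau ρ a b = sAlt p (deg p K) (nu p ρ) := by
  refine Finset.sum_congr rfl fun i _ => ?_
  refine (mu_eq_nu p ρ _).trans (Eq.trans ?_ ((isMult_nu p ρ).perm _ f hf))
  congr 1
  funext c
  simp only [h, Pi.smul_apply, Pi.add_apply, Function.comp]
  generalize f c = d
  fin_cases d <;> simp [add_comm]

lemma cBi_eq (a b c d : Fin 4) (f : Fin 4 → Fin 4) (hf : Function.Bijective f) (r s : Fin 4 → ℤ)
    (h : rt a b = r ∘ f) (h' : rt c d = s ∘ f) :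
    cBi p tau ρ a b c d = ∑ x : Fin (deg p K) × Fin (deg p K), nu p ρ fun k =>
      (p ^ (x.1 : ℕ) * r k + p ^ (x.2 : ℕ) * s k : ZMod (p ^ deg p K - 1)) := by
  refine Finset.sum_congr rfl fun i _ => ?_
  refine (mu_eq_nu p ρ _).trans (Eq.trans ?_ ((isMult_nu p ρ).perm _ f hf))
  congr 1
  funext c
  simp [h, h']

lemma cBi_swap {H : Type} [Group H] (θ : Tor K →* H) (ρ : Representation K H N) (a b c d : Fin 4) :
    cBi p θ ρ a b c d = cBi p θ ρ c d a b :=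
  Fintype.sum_equiv (Equiv.prodComm _ _) _ _ fun x => by simp [add_comm]

lemma cBi_eq_sOrth (a b c d : Fin 4) (f : Fin 4 → Fin 4) (hf : Function.Bijective f) 
    (h : rt a b = ![1, -1, 0, 0] ∘ f) (h' : rt c d = ![0, 0, 1, -1] ∘ f) :
    cBi p tau ρ a b c d = sOrth p (deg p K) (nu p ρ) := by
  rw [cBi_eq p ρ a b c d f hf _ _ h h']
  refine Finset.sum_congr rfl fun x _ => congrArg _ (funext fun k => ?_)
  fin_cases k <;> simp

lemma cBi_eq_sPath (a b c d : Fin 4) (f : Fin 4 → Fin 4) (hf : Function.Bijective f) 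
    (h : rt a b = ![1, -1, 0, 0] ∘ f) (h' : rt c d = ![0, 1, -1, 0] ∘ f) :
    cBi p tau ρ a b c d = sPath p (deg p K) (nu p ρ) := by
  rw [cBi_eq p ρ a b c d f hf _ _ h h']
  refine Finset.sum_congr rfl fun x _ => congrArg _ (funext fun k => ?_)
  fin_cases k <;> simp [neg_add_eq_sub]

lemma cBi_eq_sFork (a b c d : Fin 4) (f : Fin 4 → Fin 4) (hf : Function.Bijective f) 
    (h : rt a b = ![1, -1, 0, 0] ∘ f) (h' : rt c d = ![1, 0, -1, 0] ∘ f) :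
    cBi p tau ρ a b c d = sFork p (deg p K) (nu p ρ) := by
  rw [cBi_eq p ρ a b c d f hf _ _ h h']
  refine Finset.sum_congr rfl fun x _ => congrArg _ (funext fun k => ?_)
  fin_cases k <;> simp

lemma cBi_eq_sCofork (a b c d : Fin 4) (f : Fin 4 → Fin 4) (hf : Function.Bijective f) 
    (h : rt a b = ![-1, 1, 0, 0] ∘ f) (h' : rt c d = ![-1, 0, 1, 0] ∘ f) :
    cBi p tau ρ a b c d = sCofork p (deg p K) (nu p ρ) := by
  rw [cBi_eq p ρ a b c d f hf _ _ h h']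
  refine Finset.sum_congr rfl fun x _ => congrArg _ (funext fun k => ?_)
  fin_cases k <;> simp [add_comm]

/-- The bound for the dimension of the second cohomology in terms of the total cost. -/
theorem relDim_le_total : relDim (Z2 ρ) (B2 ρ) ≤ total p (deg p K) (nu p ρ) := by
  refine (relDim_le_cost_SL p ρ).trans (le_of_eq ?_)
  rw [cBorel, cShort, cFork, cPath]
  rw [cBi_swap p tau ρ 2 3 0 2, cBi_swap p tau ρ 2 3 1 2]
  rw [cBi_eq_sOrth p ρ 0 3 1 2 ![0, 2, 3, 1] (by decide) (by decide) (by decide),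
    cBi_eq_sOrth p ρ 0 1 2 3 ![0, 1, 2, 3] (by decide) (by decide) (by decide),
    cAdd_eq_sRoot p ρ 0 3 ![0, 2, 3, 1] (by decide) (by decide),
    cAdd_eq_sRoot p ρ 0 1 ![0, 1, 2, 3] (by decide) (by decide),
    cAdd_eq_sRoot p ρ 2 3 ![2, 3, 0, 1] (by decide) (by decide),
    cAlt_eq_sAlt p ρ 0 1 ![0, 1, 2, 3] (by decide) (by decide),
    cAlt_eq_sAlt p ρ 2 3 ![2, 3, 0, 1] (by decide) (by decide),
    cBi_eq_sFork p ρ 0 1 0 2 ![0, 1, 2, 3] (by decide) (by decide) (by decide),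
    cBi_eq_sFork p ρ 0 1 0 3 ![0, 1, 3, 2] (by decide) (by decide) (by decide),
    cBi_eq_sCofork p ρ 2 3 1 3 ![3, 2, 1, 0] (by decide) (by decide) (by decide),
    cBi_eq_sCofork p ρ 2 3 0 3 ![2, 3, 1, 0] (by decide) (by decide) (by decide),
    cBi_eq_sPath p ρ 0 1 1 2 ![0, 1, 2, 3] (by decide) (by decide) (by decide),
    cBi_eq_sPath p ρ 0 1 1 3 ![0, 1, 3, 2] (by decide) (by decide) (by decide),
    cBi_eq_sPath p ρ 0 2 2 3 ![0, 3, 1, 2] (by decide) (by decide) (by decide),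
    cBi_eq_sPath p ρ 1 2 2 3 ![3, 0, 1, 2] (by decide) (by decide) (by decide), total]
  split_ifs <;> ring

include p in
/-- The bound for the dimension of the second cohomology over fields with at least four elements. -/
theorem relDim_lt_of_four_le [Nontrivial N] (hq : 4 ≤ Nat.card K)
    (h4 : Nat.card K = 4 → finrank K (wt (ρ.comp tau) 1) < finrank K N) :
    relDim (Z2 ρ) (B2 ρ) < 2 * finrank K N := by
  refine (relDim_le_total p ρ).trans_lt (total_lt Fact.out (by rwa [← card_eq_pow_deg p]) (isMult_nu p ρ)
    finrank_pos fun h => ?_)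
  have h0 : (chi fun _ : Fin 4 => (0 : ℤ)) = (1 : Tor K →* Kˣ) := by ext d; simp [chi_apply]
  have := h4 (by rw [card_eq_pow_deg p, h])
  rw [← h0] at this
  have hz : (fun a => ((0 : Fin 4 → ZMod (p ^ deg p K - 1)) a).cast : Fin 4 → ℤ) = fun _ => 0 :=
    funext fun _ => ZMod.cast_zero
  rw [nu, mu, hz]
  exact this

end Weights

section Generation

variable {K : Type} [Field K]

lemma transvection_eq_X {i j : Fin 4} (h : i ≠ j) (a : K) :
    Matrix.SpecialLinearGroup.transvection h a = X i j a := by rw [X, dif_pos h]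

lemma exists_tau_diag2n {i j : Fin 4} (h : i ≠ j) {c : K} (hc : c ≠ 0) :
    ∃ d : Tor K, tau d = Matrix.SpecialLinearGroup.diag2n h c hc ∧ d.1 i = Units.mk0 c hc ∧
      d.1 j = (Units.mk0 c hc)⁻¹ := by
  refine ⟨⟨fun k => if k = i then Units.mk0 c hc else if k = j then (Units.mk0 c hc)⁻¹ else 1, ?_⟩, ?_, ?_, ?_⟩
  · change ∏ k, _ = 1
    rw [Finset.prod_eq_mul i j h (fun k _ hk => by simp [hk.1, hk.2]) (by simp) (by simp)]
    simp [h.symm]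
  · apply Subtype.ext
    rw [tau_coe, Matrix.SpecialLinearGroup.diag2n_coe]
    congr 1
    funext k
    dsimp only
    split_ifs <;> simp
  · simp
  · simp [h.symm]

/-- A normal subgroup containing the torus is everything once there is a nontrivial unit. -/
lemma eq_top_of_tau_mem [Finite K] (H : Subgroup (G K)) [hH : H.Normal] (hd : ∀ d, tau d ∈ H) (hq : 3 ≤ Nat.card K) :
    H = ⊤ := by
  have hu : 1 < Nat.card Kˣ := by rw [Nat.card_units]; omega
  obtain ⟨c, hc⟩ : ∃ c : Kˣ, c ≠ 1 := by
    have : Nontrivial Kˣ := Finite.one_lt_card_iff_nontrivial.1 hu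
    exact exists_ne 1
  refine eq_top_iff.2 fun g _ => ?_
  refine Matrix.SpecialLinearGroup.diagonal_transvection_induction' (· ∈ H) g (fun i j hij c hc => ?_)
    (fun i j hij a => ?_) (fun A B => H.mul_mem)
  · obtain ⟨d, h, -⟩ := exists_tau_diag2n hij hc
    rw [← h]; exact hd d
  · obtain ⟨k, hki, hkj⟩ : ∃ k, k ≠ i ∧ k ≠ j := by revert i j; decide
    obtain ⟨d, -, h1, -⟩ := exists_tau_diag2n (K := K) hki.symm c.ne_zero
    have h2 : ∃ d : Tor K, chi (rt i j) d ≠ 1 := by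
      refine ⟨⟨fun l => if l = i then c else if l = k then c⁻¹ else 1, ?_⟩, ?_⟩
      · change ∏ k, _ = 1
        rw [Finset.prod_eq_mul i k hki.symm (fun k _ hk => by simp [hk.1, hk.2]) (by simp) (by simp)]
        simp [hki]
      · rw [chi_rt]; simpa [hij.symm, hkj.symm] using hc
    obtain ⟨d, hd1⟩ := h2
    have hne : ((chi (rt i j) d : Kˣ) : K) - 1 ≠ 0 := by
      rw [sub_ne_zero]; exact fun h => hd1 (Units.ext h)
    set s := a / (((chi (rt i j) d : Kˣ) : K) - 1) with hs
    have e : X i j a = tau d * (X i j s * (tau d)⁻¹ * (X i j s)⁻¹) := by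
      rw [← mul_assoc, ← mul_assoc, tau_conj_X, X_inv, ← X_add]
      congr 1
      rw [hs]; field_simp; ring
    rw [transvection_eq_X, e]
    exact H.mul_mem (hd d) (hH.conj_mem _ (H.inv_mem (hd d)) _)

end Generation

section Trivial

variable {K N : Type} [Field K] [Finite K] [AddCommGroup N] [Module K N] [FiniteDimensional K N]
  (p : ℕ) [Fact p.Prime] [Algebra (ZMod p) K] [CharP K p]

lemma le_of_relDim_eq_zero {k C : Type} [Field k] [AddCommGroup C] [Module k C] [FiniteDimensional k C]
    {Z B : Submodule k C} (h : relDim Z B = 0) : Z ≤ B := by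
  rw [relDim, Submodule.finrank_eq_zero, ← LinearMap.le_ker_iff_map, Submodule.ker_mkQ] at h
  exact h

variable {ρ : Representation K (G K) N} (hρ : ∀ g v, ρ g v = v)
include hρ

lemma mem_B2_of_trivial {c} (hc : c ∈ Z2 ρ) (h1 : ∀ s t, bet c (X 0 3 s) (X 1 2 t) = 0)
    (h2 : ∀ s t, bet c (X 0 1 s) (X 2 3 t) = 0) (h3 : ∀ s t, bet c (X 0 1 s) (X 0 1 t) = 0)
    (h4 : ∀ s t, bet c (X 2 3 s) (X 2 3 t) = 0) (h5 : ∀ s, pif p c (X 0 3 s) = 0)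
    (h6 : ∀ s, pif p c (X 0 1 s) = 0) (h7 : ∀ s, pif p c (X 2 3 s) = 0)
    (hpath : cPath p tau ρ = 0) (hfork : p = 2 ∨ cFork p tau ρ = 0) : c ∈ B2 ρ := by
  set ιP : (Par fP : Subgroup (G K)) →* G K := (Par fP : Subgroup (G K)).subtype
  set ι : (Par fB : Subgroup (G K)) →* (Par fP : Subgroup (G K)) := Subgroup.inclusion (Par_mono fP_fB)
  have hι : ι.comp (qP fB_mono) = qP fP_mono := MonoidHom.ext fun _ => Subtype.ext rfl
  have yP : ∀ a b, fP a ≤ fP b → ∀ s : K, ιP (Y fP a b s) = X a b s := fun a b h s => Y_coe h s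
  have yB : ∀ a b, fB a ≤ fB b → ∀ s : K, ιP (ι (Y fB a b s)) = X a b s := fun a b h s => Y_coe h s
  have hcP : pull K ιP c ∈ Zr (qP fP_mono) (ρ.comp ιP) := by
    refine ⟨pull_Z2 ιP hc, pull_qP_mem_B2 (p := p) (fun x v => hρ _ v) (pull_Z2 ιP hc) (fun s t => ?_) (fun s => ?_)⟩
    · have := h1 s t
      rw [← yP 0 3 (by decide), ← yP 1 2 (by decide)] at this
      simpa [bet, pull_apply] using this
    · have := h5 s
      rw [← yP 0 3 (by decide)] at this
      simpa [pif, pull_apply] using this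
  have hcB : pull K ι (pull K ιP c) ∈ Zr (qP fB_mono) ((ρ.comp ιP).comp ι) := by
    refine ⟨pull_Z2 ι hcP.1, ?_⟩
    have := hcP.2
    rw [← hι] at this
    exact this
  have hU : ∀ u : (Par fB : Subgroup (G K)), (u : G K) ∈ Uni K → ∀ v, (ρ.comp ιP).comp ι u v = v :=
    fun u _ v => hρ _ v
  have hs : pull K ι (pull K ιP c) ∈ Zr (sP fB_mono) ((ρ.comp ιP).comp ι) := by
    refine ⟨hcB.1, pull_sP_mem_B2 p fB_mono (fun x v => hρ _ v) hcB.1 ?_ ?_ ?_ ?_ ?_⟩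
    · intro s t
      have := h2 s t
      rw [← yB 0 1 (by decide), ← yB 2 3 (by decide)] at this
      simpa [bet, pull_apply] using this
    · intro s t
      have := h3 s t
      rw [← yB 0 1 (by decide), ← yB 0 1 (by decide)] at this
      simpa [bet, pull_apply] using this
    · intro s t
      have := h4 s t
      rw [← yB 2 3 (by decide), ← yB 2 3 (by decide)] at this
      simpa [bet, pull_apply] using this
    · intro s
      have := h6 s
      rw [← yB 0 1 (by decide)] at this
      simpa [pif, pull_apply] using this
    · intro s
      have := h7 s
      rw [← yB 2 3 (by decide)] at this
      simpa [pif, pull_apply] using this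
  have hZ : relDim (Z0 (qP fB_mono) (thP fB) ((ρ.comp ιP).comp ι) ⊓ Zr (sP fB_mono) ((ρ.comp ιP).comp ι))
      (B2 ((ρ.comp ιP).comp ι)) = 0 := by
    have e1 := relDim_le_ZA p hU
    have e2 := relDim_ZA_le p hU
    have e3 : cPath p (thP fB) ((ρ.comp ιP).comp ι) = 0 := hpath
    rw [cPath] at e3
    rcases hfork with rfl | hf
    · have h4 := relDim_le_of_le_sup (B := B2 ((ρ.comp ιP).comp ι)) ((le_ZA_of_char_two hU).trans le_sup_left)
      omega
    · have e4 : cFork p (thP fB) ((ρ.comp ιP).comp ι) = 0 := hf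
      rw [cFork] at e4
      omega
  have hle := Zr_inf_Zr_le (ρ := (ρ.comp ιP).comp ι) p ⟨hcB, hs⟩
  have hB : pull K ι (pull K ιP c) ∈ B2 ((ρ.comp ιP).comp ι) :=
    (sup_le (le_of_relDim_eq_zero hZ) le_rfl) hle
  refine mem_B2_of_restrict (ιP.comp ι) ?_ ?_ ρ hc hB
  · exact fun x y h => Subtype.ext h
  · have hr : (ιP.comp ι).range = Par fB := by
      have : ιP.comp ι = (Par fB : Subgroup (G K)).subtype := MonoidHom.ext fun _ => rfl
      rw [this, Subgroup.range_subtype]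
    rw [hr, Ne, CharP.cast_eq_zero_iff K p]
    exact fun hd => index_Uni (K := K) p (hd.trans (Subgroup.index_dvd_of_le (Uni_le_Par fB_mono)))

lemma mu_eq_zero {v : Fin 4 → ℤ} (a b : Fin 4) (h : ¬ ((Nat.card K - 1 : ℕ) : ℤ) ∣ v a - v b) :
    mu tau ρ v = 0 := by
  by_contra h0
  refine h ?_
  have h1 : (chi v : Tor K →* Kˣ) = chi 0 := by
    obtain ⟨x, hx, hx0⟩ := Submodule.exists_mem_ne_zero_of_ne_bot
      (fun h => h0 (by rw [mu, h, finrank_bot]) : wt (ρ.comp tau) (chi v) ≠ ⊥)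
    refine MonoidHom.ext fun d => Units.ext ?_
    have h2 := hx d
    rw [show (ρ.comp tau) d x = x from hρ _ x] at h2
    have h3 : (((chi v d : Kˣ) : K) - 1) • x = 0 := by rw [sub_smul, one_smul, sub_eq_zero]; exact h2.symm
    rw [smul_eq_zero, or_iff_left hx0, sub_eq_zero] at h3
    simpa [chi_apply] using h3
  simpa using dvd_of_chi_eq h1 a b

end Trivial

section WeylConj

variable {K : Type} [Field K]

lemma wey_conj_X (σ : Equiv.Perm (Fin 4)) {a b : Fin 4} (h : a ≠ b) (s : K) :
    ∃ s', wey σ * X a b s * (wey σ)⁻¹ = X (σ.symm a) (σ.symm b) s' := by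
  set D : Fin 4 → K := fun i => if i = 0 then ((Equiv.Perm.sign σ : ℤ) : K) else 1 with hD
  have hDD : ∀ i, D i * D i = 1 := fun i => by
    simp only [hD]
    split_ifs
    · rw [← Int.cast_mul, ← Units.val_mul, Int.units_mul_self]; simp
    · simp
  have h' : σ.symm a ≠ σ.symm b := fun e => h (σ.symm.injective e)
  refine ⟨D (σ.symm a) * s * D (σ.symm b), ?_⟩
  rw [mul_inv_eq_iff_eq_mul]
  apply Subtype.ext
  rw [Matrix.SpecialLinearGroup.coe_mul, Matrix.SpecialLinearGroup.coe_mul, X_coe h, X_coe h', mul_add, add_mul,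
    mul_one, one_mul, add_right_inj, wey_coe, ← hD]
  set W := Matrix.diagonal D * σ.permMatrix K with hW
  have hw : ∀ i j, W i j = if σ i = j then D i else 0 := fun i j => by
    rw [hW, Matrix.diagonal_mul, Equiv.Perm.permMatrix, PEquiv.toMatrix_apply, Equiv.toPEquiv_apply]
    simp only [Option.mem_some_iff, mul_ite, mul_one, mul_zero]
  ext i j
  have e1 : σ i = a ↔ i = σ.symm a := by rw [Equiv.eq_symm_apply]
  have e2 : (W * Matrix.single a b s) i j = if j = b then W i a * s else 0 := by
    split_ifs with hj
    · rw [hj, Matrix.mul_single_apply_same]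
    · rw [Matrix.mul_single_apply_of_ne _ _ _ _ _ hj]
  have e3 : (Matrix.single (σ.symm a) (σ.symm b) (D (σ.symm a) * s * D (σ.symm b)) * W) i j =
      if i = σ.symm a then D (σ.symm a) * s * D (σ.symm b) * W (σ.symm b) j else 0 := by
    split_ifs with hi
    · rw [hi, Matrix.single_mul_apply_same]
    · rw [Matrix.single_mul_apply_of_ne _ _ _ _ _ hi]
  rw [e2, e3, hw, hw]
  simp only [e1, Equiv.apply_symm_apply, eq_comm (a := b) (b := j)]
  by_cases hi : i = σ.symm a
  · by_cases hj : j = b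
    · simp only [hi, hj, if_true]
      rw [mul_assoc _ (D _), hDD, mul_one]
    · simp [hj]
  · simp [hi]

lemma exists_conj_X_X {a b c d a' b' c' d' : Fin 4} (h : a ≠ b) (h' : c ≠ d) (σ : Equiv.Perm (Fin 4))
    (ha : σ.symm a = a') (hb : σ.symm b = b') (hc : σ.symm c = c') (hd : σ.symm d = d') (s t : K) :
    ∃ g : G K, ∃ s' t', g * X a b s * g⁻¹ = X a' b' s' ∧ g * X c d t * g⁻¹ = X c' d' t' := by
  obtain ⟨s', hs⟩ := wey_conj_X σ h s
  obtain ⟨t', ht⟩ := wey_conj_X σ h' t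
  subst ha hb hc hd
  exact ⟨_, s', t', hs, ht⟩

end WeylConj

section Trivial

variable {K N : Type} [Field K] [Finite K] [AddCommGroup N] [Module K N] [FiniteDimensional K N]
  (p : ℕ) [Fact p.Prime] [Algebra (ZMod p) K] [CharP K p]

lemma X_pow_char (a b : Fin 4) (s : K) : X a b s ^ p = 1 := by
  have : ∀ n : ℕ, X a b s ^ n = X a b (n • s) := fun n => by
    induction n with
    | zero => simp
    | succ n ih => rw [pow_succ, ih, succ_nsmul, X_add]
  rw [this, ← Nat.cast_smul_eq_nsmul K, CharP.cast_eq_zero, zero_smul, X_zero]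

lemma X_rootFam (a b : Fin 4) : RootFam tau (X (K := K) a b) (chi (rt a b)) :=
  ⟨X_add a b, fun t s => tau_conj_X a b t s⟩

variable {ρ : Representation K (G K) N} (hρ : ∀ g v, ρ g v = v)
include hρ

lemma relDim_trivial_le (hadd : cAdd p tau ρ 0 1 = 0) (hpath : cPath p tau ρ = 0)
    (hfork : p = 2 ∨ cFork p tau ρ = 0) :
    relDim (Z2 ρ) (B2 ρ) ≤ cBi p tau ρ 0 1 2 3 + cAlt p tau ρ 0 1 := by
  refine (relDim_le_add_ker (betL K (X 0 1) (X 2 3)) _ _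
    (biW (ρ.comp tau) (chi (rt 0 1)) (chi (rt 2 3))) fun c hc => ?_).trans
    (add_le_add (finrank_biW_le_cBi p _ _ 0 1 2 3) ?_)
  · exact betL_mem hc (X_rootFam 0 1) (X_rootFam 2 3) (X_comm (by decide) (by decide)) (fun _ => hρ _) fun _ => hρ _
  refine (relDim_le_add_ker (betL K (X 0 1) (X 0 1)) _ _
    (altW (ρ.comp tau) (chi (rt 0 1))) fun c hc => ?_).trans
    ((add_le_add (finrank_altW_le_cAlt p _ _ 0 1) (le_of_eq (relDim_eq_zero ?_))).trans_eq (add_zero _))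
  · exact betL_mem_altW hc.1 (X_rootFam 0 1) fun _ => hρ _
  rintro c ⟨⟨hc, h2⟩, h3⟩
  replace h2 : ∀ s t, bet c (X 0 1 s) (X 2 3 t) = 0 := fun s t => congrFun (congrFun h2 s) t
  replace h3 : ∀ s t, bet c (X 0 1 s) (X 0 1 t) = 0 := fun s t => congrFun (congrFun h3 s) t
  have h6 : ∀ s, pif p c (X 0 1 s) = 0 := fun s => by
    have h := pifL_mem (p := p) hc (X_rootFam 0 1) (fun _ => hρ _) h3
    have h0 := (finrank_addW_le_cAdd p tau ρ 0 1).trans_eq hadd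
    rw [Nat.le_zero, Submodule.finrank_eq_zero] at h0
    rw [h0, Submodule.mem_bot] at h
    exact congrFun h s
  refine mem_B2_of_trivial p hρ hc (fun s t => ?_) h2 h3 (fun s t => ?_) (fun s => ?_) h6 (fun s => ?_) hpath hfork
  · obtain ⟨g, s', t', h, h'⟩ := exists_conj_X_X (a := 0) (b := 3) (c := 1) (d := 2) (by decide) (by decide)
      (⟨![0, 3, 1, 2], ![0, 2, 3, 1], by decide, by decide⟩ : Equiv.Perm (Fin 4)) rfl rfl rfl rfl s t
    rw [← hρ g (bet _ _ _), ← bet_conj hc (X_comm (by decide) (by decide) _ _) (hρ _) (hρ _), h, h']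
    exact h2 _ _
  · obtain ⟨g, s', t', h, h'⟩ := exists_conj_X_X (a := 2) (b := 3) (c := 2) (d := 3) (by decide) (by decide)
      (⟨![2, 3, 0, 1], ![2, 3, 0, 1], by decide, by decide⟩ : Equiv.Perm (Fin 4)) rfl rfl rfl rfl s t
    rw [← hρ g (bet _ _ _), ← bet_conj hc (X_comm (by decide) (by decide) _ _) (hρ _) (hρ _), h, h']
    exact h3 _ _
  · obtain ⟨g, s', t', h, -⟩ := exists_conj_X_X (a := 0) (b := 3) (c := 1) (d := 2) (by decide) (by decide)
      (⟨![0, 3, 1, 2], ![0, 2, 3, 1], by decide, by decide⟩ : Equiv.Perm (Fin 4)) rfl rfl rfl rfl s s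
    rw [← hρ g (pif _ _ _), ← pif_conj p hc (hρ _) (X_pow_char p _ _ _), h]
    exact h6 _
  · obtain ⟨g, s', t', h, -⟩ := exists_conj_X_X (a := 2) (b := 3) (c := 2) (d := 3) (by decide) (by decide)
      (⟨![2, 3, 0, 1], ![2, 3, 0, 1], by decide, by decide⟩ : Equiv.Perm (Fin 4)) rfl rfl rfl rfl s s
    rw [← hρ g (pif _ _ _), ← pif_conj p hc (hρ _) (X_pow_char p _ _ _), h]
    exact h6 _

lemma cBi_eq_zero {a b c d : Fin 4} (i j : Fin 4)
    (h : ∀ x < deg p K, ∀ y < deg p K, ¬ ((Nat.card K - 1 : ℕ) : ℤ) ∣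
      (p ^ x • rt a b + p ^ y • rt c d) i - (p ^ x • rt a b + p ^ y • rt c d) j) : cBi p tau ρ a b c d = 0 :=
  Finset.sum_eq_zero fun x _ => mu_eq_zero hρ i j (h _ x.1.2 _ x.2.2)

lemma cAdd_eq_zero {a b : Fin 4} (i j : Fin 4)
    (h : ∀ x < deg p K, ¬ ((Nat.card K - 1 : ℕ) : ℤ) ∣ (p ^ x • rt a b) i - (p ^ x • rt a b) j) :
    cAdd p tau ρ a b = 0 :=
  Finset.sum_eq_zero fun x _ => mu_eq_zero hρ i j (h _ x.2)

lemma relDim_trivial_le_of_card_eq_four (hp : p = 2) (hd : deg p K = 2) :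
    relDim (Z2 ρ) (B2 ρ) ≤ finrank K N := by
  have hcard : ((Nat.card K - 1 : ℕ) : ℤ) = 3 := by rw [card_eq_pow_deg p, hd, hp]; rfl
  subst hp
  refine (relDim_trivial_le 2 hρ ?_ ?_ (.inl rfl)).trans ?_
  · refine cAdd_eq_zero 2 hρ 0 1 ?_
    rw [hcard, hd]; decide
  · rw [cPath, cBi_eq_zero 2 hρ (a := 0) (b := 1) (c := 1) (d := 2) 0 3 (by rw [hcard, hd]; decide),
      cBi_eq_zero 2 hρ (a := 0) (b := 1) (c := 1) (d := 3) 0 2 (by rw [hcard, hd]; decide),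
      cBi_eq_zero 2 hρ (a := 2) (b := 3) (c := 0) (d := 2) 0 1 (by rw [hcard, hd]; decide),
      cBi_eq_zero 2 hρ (a := 2) (b := 3) (c := 1) (d := 2) 0 1 (by rw [hcard, hd]; decide)]
  · rw [cBi_eq_zero 2 hρ (a := 0) (b := 1) (c := 2) (d := 3) 0 1 (by rw [hcard, hd]; decide), zero_add, cAlt]
    refine (Finset.sum_le_card_nsmul _ _ (finrank K N) fun x _ => Submodule.finrank_le _).trans (le_of_eq ?_)
    have : Fintype.card {x : Fin (deg 2 K) × Fin (deg 2 K) // x.1 < x.2} = 1 := by rw [hd]; decide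
    rw [Finset.card_univ, this, one_smul]

lemma relDim_trivial_le_of_card_eq_three (hp : p = 3) (hd : deg p K = 1) :
    relDim (Z2 ρ) (B2 ρ) ≤ finrank K N := by
  have hcard : ((Nat.card K - 1 : ℕ) : ℤ) = 2 := by rw [card_eq_pow_deg p, hd, hp]; rfl
  subst hp
  refine (relDim_trivial_le 3 hρ ?_ ?_ (.inr ?_)).trans ?_
  · refine cAdd_eq_zero 3 hρ 0 2 ?_
    rw [hcard, hd]; decide
  · rw [cPath, cBi_eq_zero 3 hρ (a := 0) (b := 1) (c := 1) (d := 2) 0 3 (by rw [hcard, hd]; decide),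
      cBi_eq_zero 3 hρ (a := 0) (b := 1) (c := 1) (d := 3) 0 2 (by rw [hcard, hd]; decide),
      cBi_eq_zero 3 hρ (a := 2) (b := 3) (c := 0) (d := 2) 0 1 (by rw [hcard, hd]; decide),
      cBi_eq_zero 3 hρ (a := 2) (b := 3) (c := 1) (d := 2) 1 0 (by rw [hcard, hd]; decide)]
  · rw [cFork, cBi_eq_zero 3 hρ (a := 0) (b := 1) (c := 0) (d := 2) 0 1 (by rw [hcard, hd]; decide),
      cBi_eq_zero 3 hρ (a := 0) (b := 1) (c := 0) (d := 3) 0 1 (by rw [hcard, hd]; decide),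
      cBi_eq_zero 3 hρ (a := 2) (b := 3) (c := 1) (d := 3) 1 0 (by rw [hcard, hd]; decide),
      cBi_eq_zero 3 hρ (a := 2) (b := 3) (c := 0) (d := 3) 0 1 (by rw [hcard, hd]; decide)]
  · have h1 : Fintype.card {x : Fin (deg 3 K) × Fin (deg 3 K) // x.1 < x.2} = 0 := by rw [hd]; decide
    have h2 : Fintype.card (Fin (deg 3 K) × Fin (deg 3 K)) = 1 := by rw [hd]; decide
    rw [cBi, cAlt]
    refine (add_le_add (Finset.sum_le_card_nsmul _ _ (finrank K N) fun x _ => Submodule.finrank_le _)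
      (Finset.sum_le_card_nsmul _ _ (finrank K N) fun x _ => Submodule.finrank_le _)).trans (le_of_eq ?_)
    rw [Finset.card_univ, Finset.card_univ, h1, h2, zero_smul, one_smul, add_zero]

end Trivial

section Assembly

variable (p : ℕ) [hp : Fact p.Prime] {K : Type} [Field K] [Finite K] [Algebra (ZMod p) K] [CharP K p]
variable {M : Type} [AddCommGroup M] [Module (ZMod p) M] [FiniteDimensional (ZMod p) M]
variable (ρ : Representation (ZMod p) (G K) M)

lemma eq_of_bc_tmul_eq {k H : Type} [Field k] [Algebra k K] [Group H] {V : Type} [AddCommGroup V] [Module k V]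
    (ρ : Representation k H V) (g : H) (m : V) (h : bc K ρ g ((1 : K) ⊗ₜ m) = 1 ⊗ₜ m) : ρ g m = m := by
  obtain ⟨φ, hφ⟩ := Projective.exists_dual_eq_one k (one_ne_zero : (1 : K) ≠ 0)
  have h1 := congrArg (contr φ) h
  rwa [contr_bc, contr_tmul, hφ, one_smul] at h1

lemma trivial_of_wt (hq : 3 ≤ Nat.card K)
    (h : ¬ finrank K (wt ((bc K ρ).comp tau) 1) < finrank K (K ⊗[ZMod p] M)) (g : G K) (m : M) : ρ g m = m := by
  have htop : wt ((bc K ρ).comp tau) 1 = ⊤ :=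
    Submodule.eq_top_of_finrank_eq (le_antisymm (Submodule.finrank_le _) (not_lt.1 h))
  have hd : ∀ d, tau d ∈ ρ.ker := fun d => by
    rw [MonoidHom.mem_ker]
    ext m
    refine eq_of_bc_tmul_eq (K := K) ρ _ m ?_
    have h1 : (1 : K) ⊗ₜ[ZMod p] m ∈ wt ((bc K ρ).comp tau) 1 := htop ▸ Submodule.mem_top
    exact (h1 d).trans (one_smul _ _)
  have : g ∈ ρ.ker := (eq_top_of_tau_mem ρ.ker hd hq) ▸ Subgroup.mem_top g
  rw [MonoidHom.mem_ker] at this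
  rw [this]
  rfl

lemma bc_trivial (h : ∀ g m, ρ g m = m) (g : G K) (x : K ⊗[ZMod p] M) : bc K ρ g x = x := by
  induction x with
  | zero => simp
  | tmul a m => rw [bc_tmul, h]
  | add x y hx hy => rw [map_add, hx, hy]

lemma finrank_groupCohomology_lt_of_bc [Nontrivial M]
    (h : relDim (Z2 (bc K ρ)) (B2 (bc K ρ)) < 2 * finrank K (K ⊗[ZMod p] M)) :
    finrank (ZMod p) (groupCohomology (Rep.of ρ) 2) < 2 * finrank (ZMod p) M := by
  rw [finrank_baseChange] at h
  exact ((finrank_groupCohomology_le ρ).trans (relDim_le_bc ρ)).trans_lt h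

theorem finrank_lt_of_four_le [Nontrivial M] (hq : 4 ≤ Nat.card K) :
    finrank (ZMod p) (groupCohomology (Rep.of ρ) 2) < 2 * finrank (ZMod p) M := by
  refine finrank_groupCohomology_lt_of_bc p ρ ?_
  have hpos : 0 < finrank K (K ⊗[ZMod p] M) := by rw [finrank_baseChange]; exact finrank_pos
  have : Nontrivial (K ⊗[ZMod p] M) := Module.nontrivial_of_finrank_pos hpos
  by_cases h4 : Nat.card K = 4 → finrank K (wt ((bc K ρ).comp tau) 1) < finrank K (K ⊗[ZMod p] M)
  · exact relDim_lt_of_four_le p _ hq h4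
  · rw [Classical.not_imp] at h4
    have h1 := card_eq_pow_deg p (K := K)
    rw [h4.1] at h1
    have hp2 : p = 2 := by
      have : p ∣ 2 ^ 2 := by
        refine (dvd_pow_self p (n := deg p K) ?_).trans (h1 ▸ dvd_refl _)
        intro h0; rw [h0] at h1; simp at h1
      exact (Nat.prime_dvd_prime_iff_eq hp.out Nat.prime_two).1 (hp.out.dvd_of_dvd_pow this)
    have hdeg : deg p K = 2 := by
      generalize deg p K = d at h1
      subst hp2
      exact Nat.pow_right_injective le_rfl h1.symm
    have h2 := relDim_trivial_le_of_card_eq_four p (ρ := bc K ρ)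
      (bc_trivial p ρ (trivial_of_wt p ρ (by omega) h4.2)) hp2 hdeg
    omega

end Assembly

section Coprime

variable {k H N : Type} [Field k] [Group H] [AddCommGroup N] [Module k N] {ρ : Representation k H N}
  {c : H → H → N}

/-- A normal subgroup of invertible order without fixed points kills the cohomology. -/
lemma mem_B2_of_normal_average {R : Type} [Group R] [Fintype R] (θ : R →* H) (hR : (Fintype.card R : k) ≠ 0)
    (hθ : Function.Injective θ) (hn : ∀ g r, ∃ r', θ r' = g * θ r * g⁻¹)
    (h0 : ∀ v, ∑ r, ρ (θ r) v = 0) (hc : c ∈ Z2 ρ) : c ∈ B2 ρ := by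
  choose act hact using hn
  have hbij : ∀ g, Function.Bijective (act g) := fun g =>
    (Finite.injective_iff_bijective).1 fun a b hab => hθ (by
      have h := hact g b
      rw [← hab, hact] at h
      simpa using h)
  have hs : ∀ g (F : H → N), ∑ r, F (θ r * g) = ∑ r, F (g * θ r) := fun g F => by
    rw [← (Equiv.ofBijective _ (hbij g)).sum_comp]
    refine Finset.sum_congr rfl fun r _ => ?_
    rw [Equiv.ofBijective_apply, hact, inv_mul_cancel_right]
  set a : k := (Fintype.card R : k)⁻¹
  refine ⟨fun h => a • ((∑ r, c h (θ r)) - ∑ r, c (θ r) h), ?_⟩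
  ext h j
  have e1 : ∑ r, (ρ (θ r) (c h j) + c (θ r) (h * j)) = ∑ r, (c (θ r * h) j + c (θ r) h) :=
    Finset.sum_congr rfl fun r _ => hc (θ r) h j
  have e2 : ∑ r, (ρ h (c (θ r) j) + c h (θ r * j)) = ∑ r, (c (h * θ r) j + c h (θ r)) :=
    Finset.sum_congr rfl fun r _ => hc h (θ r) j
  have e3 : ∑ r, (ρ h (c j (θ r)) + c h (j * θ r)) = ∑ r, (c (h * j) (θ r) + c h j) :=
    Finset.sum_congr rfl fun r _ => hc h j (θ r)
  simp only [Finset.sum_add_distrib, Finset.sum_const, Finset.card_univ, ← map_sum] at e1 e2 e3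
  rw [h0, zero_add, hs h fun g => c g j] at e1
  rw [hs j fun g => c h g] at e2
  have e4 : c h j = a • (Fintype.card R • c h j) := by
    rw [← Nat.cast_smul_eq_nsmul k, smul_smul, inv_mul_cancel₀ hR, one_smul]
  simp only [d1_apply, map_smul, map_sub]
  rw [e4]
  linear_combination (norm := module) a • (e1 - e2 + e3)

lemma del_one (hc : c ∈ Z2 ρ) {u : H} (hu : ∀ n, ρ u n = n) : del c 1 u = 0 := by
  simp only [del, one_mul, mul_one, inv_one]
  rw [one_left hc u, one_right hc u, hu, sub_self]

lemma conj_conj (r l u : H) :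
    r * l * r⁻¹ * (r * u * r⁻¹) * (r * l * r⁻¹)⁻¹ = r * (l * u * l⁻¹) * r⁻¹ := by group

/-- Equivariance under an element of invertible order forces the mixed functional to vanish. -/
lemma del_eq_zero_of_equivariant {r : H} (hr : ∀ g h, c (r * g * r⁻¹) (r * h * r⁻¹) = ρ r (c g h)) {n : ℕ}
    (hn : r ^ n = 1) (hn0 : (n : k) ≠ 0) (hc : c ∈ Z2 ρ) {u : H} (hu : ∀ v, ρ u v = v) : del c r u = 0 := by
  obtain ⟨m, rfl⟩ : ∃ m, n = m + 1 := Nat.exists_eq_succ_of_ne_zero (by rintro rfl; simp at hn0)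
  have h1 : ∀ m, del c r (r ^ m * u * (r ^ m)⁻¹) = ρ (r ^ m) (del c r u) := fun m => by
    induction m with
    | zero => simp
    | succ m ih =>
      have e : del c (r * r * r⁻¹) (r * (r ^ m * u * (r ^ m)⁻¹) * r⁻¹) =
          ρ r (del c r (r ^ m * u * (r ^ m)⁻¹)) := by
        rw [del, conj_conj, hr, hr, del, map_sub]
      rw [mul_inv_cancel_right] at e
      rw [pow_succ', rho_mul, ← ih, ← e]
      congr 1
      group
  have h2 : ∀ m, del c (r ^ (m + 1)) u = (m + 1) • ρ (r ^ m) (del c r u) := fun m => by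
    induction m with
    | zero => simp
    | succ m ih =>
      rw [pow_succ' r (m + 1), del_mul_left hc hu, ih, h1, map_nsmul, ← rho_mul, ← pow_succ', succ_nsmul _ (m + 1)]
  have h3 := h2 m
  rw [hn, del_one hc hu, ← Nat.cast_smul_eq_nsmul k] at h3
  have h4 := (smul_eq_zero.1 h3.symm).resolve_left hn0
  have h5 := congrArg (ρ (r ^ m)⁻¹) h4
  rwa [← rho_mul, inv_mul_cancel, map_one, map_zero] at h5

/-- Equivariance of the mixed functional. -/
lemma del_conj_of_normalizes (hc : c ∈ Z2 ρ) {l r u : H} (hu : ∀ v, ρ u v = v) (h1 : del c r u = 0)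
    (h2 : del c (l * r * l⁻¹) (l * u * l⁻¹) = 0) :
    del c l (r * u * r⁻¹) = ρ (l * r * l⁻¹) (del c l u) := by
  have e1 := del_mul_left (l := l) (l' := r) hc hu
  have e2 := del_mul_left (l := l * r * l⁻¹) (l' := l) hc hu
  rw [h1, map_zero, zero_add] at e1
  rw [inv_mul_cancel_right, e1, h2, add_zero] at e2
  exact e2

/-- The Gaschütz criterion for the mixed functional on a semidirect product. -/
lemma mem_B2_of_semidirect_of_average {S L : Type} [Group S] [Group L] [Fintype L] (σ : S →* H) (lam : L →* H)
    (hdec : Function.Bijective fun x : S × L => σ x.1 * lam x.2)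
    (hσ : ∀ x v, ρ (σ x) v = v) (hn : ∀ l u, ∃ u', σ u' = lam l * σ u * (lam l)⁻¹)
    (hc : c ∈ Z2 ρ) (h0 : ∀ u v, c (σ u) (σ v) = 0) (hl : pull k lam c ∈ B2 (ρ.comp lam)) (A : N →ₗ[k] N)
    (hA : ∀ l u, ∑ g, ρ (lam g) (A (ρ (lam g)⁻¹ (del c (lam l) (σ u)))) = del c (lam l) (σ u)) : c ∈ B2 ρ := by
  let e := Equiv.ofBijective _ hdec
  have he : ∀ u l, e.symm (σ u * lam l) = (u, l) := fun u l => e.symm_apply_apply (u, l)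
  have heσ : ∀ u, e.symm (σ u) = (u, 1) := fun u => by rw [← he, map_one, mul_one]
  have heL : ∀ l, e.symm (lam l) = (1, l) := fun u => by rw [← he, map_one, one_mul]
  let f : H → N := fun u => ∑ g, ρ (lam g) (A (del c (lam g)⁻¹ u))
  have h0' : ∀ l u v, c (lam l * σ u * (lam l)⁻¹) (lam l * σ v * (lam l)⁻¹) = 0 := fun l u v => by
    obtain ⟨u', hu⟩ := hn l u
    obtain ⟨v', hv⟩ := hn l v
    rw [← hu, ← hv, h0]
  have hf : ∀ u v, f (σ u * σ v) = f (σ u) + f (σ v) := fun u v => by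
    simp only [f, ← map_inv]
    rw [← Finset.sum_add_distrib]
    refine Finset.sum_congr rfl fun g _ => ?_
    rw [del_mul_right hc (hσ u) (h0 _ _) (h0' _ _ _), map_add, map_add]
  have hfl : ∀ l u, ρ (lam l) (f (σ u)) = f (lam l * σ u * (lam l)⁻¹) + del c (lam l) (σ u) := fun l u => by
    have e1 : f (lam l * σ u * (lam l)⁻¹) =
        ∑ g, ρ (lam (l * g)) (A (del c (lam (l * g))⁻¹ (lam l * σ u * (lam l)⁻¹))) :=
      (Equiv.sum_comp (Equiv.mulLeft l) fun g => ρ (lam g) (A (del c (lam g)⁻¹ (lam l * σ u * (lam l)⁻¹)))).symm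
    have e2 : ∑ g, ρ (lam (l * g)) (A (ρ (lam (l * g))⁻¹ (del c (lam l) (σ u)))) = del c (lam l) (σ u) :=
      (Equiv.sum_comp (Equiv.mulLeft l) fun g => ρ (lam g) (A (ρ (lam g)⁻¹ (del c (lam l) (σ u))))).trans (hA l u)
    rw [e1, ← e2, ← Finset.sum_add_distrib]
    simp only [f, map_sum]
    refine Finset.sum_congr rfl fun g _ => ?_
    rw [map_mul, ← map_add, ← map_add, rho_mul]
    congr 3
    have e3 := del_mul_left (l := (lam l * lam g)⁻¹) (l' := lam l) hc (hσ u)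
    rw [mul_inv_rev, inv_mul_cancel_right, ← mul_inv_rev] at e3
    rw [e3, add_comm]
  let F : H → N := fun h => f (σ (e.symm h).1)
  have hFσ : ∀ u, F (σ u) = f (σ u) := fun u => by simp only [F, heσ]
  have hf1 : f 1 = 0 := by
    have := hf 1 1
    rw [map_one, mul_one] at this
    exact left_eq_add.1 this
  have hFL : ∀ l, F (lam l) = 0 := fun l => by simp only [F, heL, map_one, hf1]
  have key : c - d1 ρ F ∈ B2 ρ := by
    refine mem_B2_of_semidirect σ lam hdec hσ hn (sub_mem hc (B2_le_Z2 ρ (d1_mem_B2 ρ F))) ?_ ?_ ?_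
    · intro u v
      rw [Pi.sub_apply, Pi.sub_apply, h0, d1_apply, hσ, ← map_mul, hFσ, hFσ, hFσ, map_mul, hf]
      abel
    · rw [map_sub]
      refine sub_mem hl ?_
      refine ⟨0, ?_⟩
      ext l m
      rw [map_zero, pull_apply, d1_apply, ← map_mul, hFL, hFL, hFL]
      simp
    · intro l u
      obtain ⟨w, hw⟩ := hn l u
      have h3 := hfl l u
      have h4 : F (lam l * σ u) = f (lam l * σ u * (lam l)⁻¹) := by
        rw [← hw, show lam l * σ u = σ w * lam l by rw [hw]; group]
        simp only [F, he]
      have h5 : del c (lam l) (σ u) = c (lam l) (σ u) - c (lam l * σ u * (lam l)⁻¹) (lam l) := rfl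
      simp only [del, Pi.sub_apply, d1_apply, inv_mul_cancel_right]
      rw [h4, hFσ, hFL, h3, h5, ← hw, hFσ, hσ]
      abel
  simpa using add_mem key (d1_mem_B2 ρ F)

end Coprime

section Blocks

variable {K : Type} [Field K]

/-- The special linear group of degree two. -/
abbrev SL2 (K : Type) [Field K] := Matrix.SpecialLinearGroup (Fin 2) K

/-- Block diagonal matrices. -/
def blkM (A B : Matrix (Fin 2) (Fin 2) K) : Matrix (Fin 4) (Fin 4) K :=
  !![A 0 0, A 0 1, 0, 0; A 1 0, A 1 1, 0, 0; 0, 0, B 0 0, B 0 1; 0, 0, B 1 0, B 1 1]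

lemma blkM_one : blkM (1 : Matrix (Fin 2) (Fin 2) K) 1 = 1 := by
  ext i j
  fin_cases i <;> fin_cases j <;> simp [blkM]

lemma blkM_mul (A B C D : Matrix (Fin 2) (Fin 2) K) : blkM (A * C) (B * D) = blkM A B * blkM C D := by
  ext i j
  fin_cases i <;> fin_cases j <;> simp [blkM, Matrix.mul_apply, Fin.sum_univ_four]

lemma blkM_det (A B : Matrix (Fin 2) (Fin 2) K) : (blkM A B).det = A.det * B.det := by
  rw [Matrix.det_succ_row_zero]
  simp only [Fin.sum_univ_four, Matrix.det_fin_three, Matrix.det_fin_two, blkM, Matrix.submatrix_apply]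
  simp [Fin.succAbove]
  ring

/-- The block diagonal embedding. -/
def blkG : SL2 K × SL2 K →* G K where
  toFun x := ⟨blkM x.1.1 x.2.1, by rw [blkM_det, x.1.2, x.2.2, one_mul]⟩
  map_one' := Subtype.ext blkM_one
  map_mul' x y := Subtype.ext (blkM_mul _ _ _ _)

lemma blkG_coe (x : SL2 K × SL2 K) : (blkG x).1 = blkM x.1.1 x.2.1 := rfl

lemma blkM_lower (A B : Matrix (Fin 2) (Fin 2) K) {i j : Fin 4} (h : fP j < fP i) : blkM A B i j = 0 := by
  revert h
  fin_cases i <;> fin_cases j <;> simp [fP, blkM]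

lemma blkG_mem_Par (x : SL2 K × SL2 K) : blkG x ∈ Par fP := fun i j h =>
  ⟨blkM_lower _ _ h, by rw [← map_inv]; exact blkM_lower _ _ h⟩

/-- The derived Levi subgroup of the middle maximal parabolic. -/
def blk : SL2 K × SL2 K →* (Par fP : Subgroup (G K)) := blkG.codRestrict _ blkG_mem_Par

/-- Elementary unipotents in degree two. -/
def xe (s : K) : SL2 K := ⟨!![1, s; 0, 1], by simp [Matrix.det_fin_two]⟩

lemma sP_eq_blk (x : Multiplicative (K × K)) : sP fP_mono x = blk (xe x.toAdd.1, xe x.toAdd.2) := by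
  apply Subtype.ext
  apply Subtype.ext
  change (sS (.ofAdd (x.toAdd.1, x.toAdd.2))).1 = blkM _ _
  rw [sS_coe]
  ext i j
  fin_cases i <;> fin_cases j <;> simp [blkM, xe]

/-- The upper left block. -/
def ul : (Par fP : Subgroup (G K)) →* Matrix (Fin 2) (Fin 2) K where
  toFun g := !![g.1.1 0 0, g.1.1 0 1; g.1.1 1 0, g.1.1 1 1]
  map_one' := by
    ext i j
    fin_cases i <;> fin_cases j <;> simp
  map_mul' g h := by
    have e1 : ∀ i j, fP j < fP i → h.1.1 i j = 0 := fun i j hij => (h.2 i j hij).1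
    have h20 := e1 2 0 (by decide)
    have h21 := e1 2 1 (by decide)
    have h30 := e1 3 0 (by decide)
    have h31 := e1 3 1 (by decide)
    ext i j
    fin_cases i <;> fin_cases j <;>
      simp [Matrix.mul_apply, Fin.sum_univ_four, Fin.sum_univ_two, h20, h21, h30, h31]

/-- The lower right block. -/
def lr : (Par fP : Subgroup (G K)) →* Matrix (Fin 2) (Fin 2) K where
  toFun g := !![g.1.1 2 2, g.1.1 2 3; g.1.1 3 2, g.1.1 3 3]
  map_one' := by
    ext i j
    fin_cases i <;> fin_cases j <;> simp
  map_mul' g h := by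
    have e1 : ∀ i j, fP j < fP i → g.1.1 i j = 0 := fun i j hij => (g.2 i j hij).1
    have h20 := e1 2 0 (by decide)
    have h21 := e1 2 1 (by decide)
    have h30 := e1 3 0 (by decide)
    have h31 := e1 3 1 (by decide)
    ext i j
    fin_cases i <;> fin_cases j <;>
      simp [Matrix.mul_apply, Fin.sum_univ_four, Fin.sum_univ_two, h20, h21, h30, h31]

lemma ul_blk (x : SL2 K × SL2 K) : ul (blk x) = x.1.1 := by
  ext i j
  fin_cases i <;> fin_cases j <;> rfl

lemma lr_blk (x : SL2 K × SL2 K) : lr (blk x) = x.2.1 := by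
  ext i j
  fin_cases i <;> fin_cases j <;> rfl

lemma exists_qP_of_blocks_eq_one {g : (Par fP : Subgroup (G K))} (h1 : ul g = 1) (h2 : lr g = 1) :
    ∃ u, qP fP_mono u = g := by
  refine ⟨.ofAdd (g.1.1 0 2, g.1.1 0 3, g.1.1 1 2, g.1.1 1 3), Subtype.ext (Subtype.ext ?_)⟩
  change (sQ _).1 = _
  rw [sQ_coe]
  have e1 : ∀ i j, fP j < fP i → g.1.1 i j = 0 := fun i j hij => (g.2 i j hij).1
  have h20 := e1 2 0 (by decide)
  have h21 := e1 2 1 (by decide)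
  have h30 := e1 3 0 (by decide)
  have h31 := e1 3 1 (by decide)
  have h00 := congrFun (congrFun h1 0) 0
  have h01 := congrFun (congrFun h1 0) 1
  have h10 := congrFun (congrFun h1 1) 0
  have h11 := congrFun (congrFun h1 1) 1
  have h22 := congrFun (congrFun h2 0) 0
  have h23 := congrFun (congrFun h2 0) 1
  have h32 := congrFun (congrFun h2 1) 0
  have h33 := congrFun (congrFun h2 1) 1
  simp [ul, lr] at h00 h01 h10 h11 h22 h23 h32 h33
  ext i j
  fin_cases i <;> fin_cases j <;> simp [*]

lemma exists_qP_mul_blk {g : (Par fP : Subgroup (G K))} (h1 : (ul g).det = 1) (h2 : (lr g).det = 1) :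
    ∃ u x, g = qP fP_mono u * blk x := by
  obtain ⟨a, ha⟩ : ∃ a : SL2 K, a.1 = ul g := ⟨⟨_, h1⟩, rfl⟩
  obtain ⟨b, hb⟩ : ∃ b : SL2 K, b.1 = lr g := ⟨⟨_, h2⟩, rfl⟩
  obtain ⟨u, hu⟩ := exists_qP_of_blocks_eq_one (g := g * blk (a, b)⁻¹) (by
    rw [map_mul, ul_blk, ← ha]
    exact congrArg Subtype.val (mul_inv_cancel a)) (by
    rw [map_mul, lr_blk, ← hb]
    exact congrArg Subtype.val (mul_inv_cancel b))
  exact ⟨u, (a, b), by rw [hu, map_inv, inv_mul_cancel_right]⟩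

lemma exists_conj_blk (g : (Par fP : Subgroup (G K))) (x : SL2 K × SL2 K) :
    ∃ u y, g * blk x * g⁻¹ = qP fP_mono u * blk y := by
  have key : ∀ f : (Par fP : Subgroup (G K)) →* Matrix (Fin 2) (Fin 2) K, (f (blk x)).det = 1 →
      (f (g * blk x * g⁻¹)).det = 1 := fun f hf => by
    rw [map_mul, map_mul, Matrix.det_mul, Matrix.det_mul, hf, mul_one, ← Matrix.det_mul, ← map_mul,
      mul_inv_cancel, map_one, Matrix.det_one]
  exact exists_qP_mul_blk (key _ (by rw [ul_blk]; exact x.1.2)) (key _ (by rw [lr_blk]; exact x.2.2))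

end Blocks

section Complement

lemma xe_add {K : Type} [Field K] (s t : K) : xe (s + t) = xe s * xe t :=
  Subtype.ext (by
    rw [Matrix.SpecialLinearGroup.coe_mul]
    ext i j
    fin_cases i <;> fin_cases j <;> simp [xe, Matrix.mul_apply, Fin.sum_univ_two, add_comm])

lemma xe_zero {K : Type} [Field K] : xe (0 : K) = 1 :=
  Subtype.ext (by
    ext i j
    fin_cases i <;> fin_cases j <;> simp [xe])

/-- A normal complement to the unipotents in degree two, which is an `r`-group. -/
structure IsComplement2 {K : Type} [Field K] (r : ℕ) (R : Subgroup (SL2 K)) : Prop where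
  normal : R.Normal
  pow : ∃ m, ∀ A, A ∈ R ↔ A ^ m = 1
  pgroup : IsPGroup r R
  tor : IsPGroup r (Tor K)
  decomp : ∀ A : SL2 K, ∃ B ∈ R, ∃ a, A = B * xe a
  weyl : ∃ A ∈ R, A.1 0 0 = 0 ∧ A.1 0 1 = -1 ∧ A.1 1 0 = 1

lemma isComplement2_of_pow {K : Type} [Field K] {R : Subgroup (SL2 K)} {r m : ℕ}
    (hR : ∀ A, A ∈ R ↔ A ^ r ^ m = 1) (ht : ∀ a : Kˣ, a ^ r ^ m = 1)
    (hd : ∀ A : SL2 K, ∃ a, (A * xe a) ^ r ^ m = 1)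
    (hw : ∃ A : SL2 K, A ^ r ^ m = 1 ∧ A.1 0 0 = 0 ∧ A.1 0 1 = -1 ∧ A.1 1 0 = 1) : IsComplement2 r R where
  normal := ⟨fun A hA g => (hR _).2 (by rw [conj_pow, (hR A).1 hA, mul_one, mul_inv_cancel])⟩
  pow := ⟨_, hR⟩
  pgroup A := ⟨m, Subtype.ext ((hR _).1 A.2)⟩
  tor d := ⟨m, Subtype.ext (funext fun i => ht _)⟩
  decomp A := by
    obtain ⟨a, ha⟩ := hd A
    exact ⟨_, (hR _).2 ha, -a, by rw [mul_assoc, ← xe_add, add_neg_cancel, xe_zero, mul_one]⟩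
  weyl := by
    obtain ⟨A, h, hA⟩ := hw
    exact ⟨A, (hR A).2 h, hA⟩

/-- The subgroup of order three of `SL(2,2)`. -/
def C3 : Subgroup (SL2 (ZMod 2)) where
  carrier := {A | A ^ 3 = 1}
  one_mem' := one_pow _
  mul_mem' := by
    have : ∀ A B : SL2 (ZMod 2), A ^ 3 = 1 → B ^ 3 = 1 → (A * B) ^ 3 = 1 := by decide +kernel
    exact fun {A B} hA hB => this A B hA hB
  inv_mem' := fun {A} hA => (inv_pow A 3).trans (by rw [show A ^ 3 = 1 from hA, inv_one])

lemma mem_C3 {A : SL2 (ZMod 2)} : A ∈ C3 ↔ A ^ 3 = 1 := Iff.rfl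

lemma isComplement2_C3 : IsComplement2 3 C3 := by
  refine isComplement2_of_pow (m := 1) (fun A => Iff.rfl) (by decide) ?_ ?_
  · decide +kernel
  · exact ⟨⟨!![0, -1; 1, 1], by decide⟩, by decide +kernel, by decide, by decide, by decide⟩

lemma exists_isComplement2_three : ∃ R : Subgroup (SL2 (ZMod 3)), IsComplement2 2 R := by
  refine ⟨{ carrier := {A | A ^ 4 = 1}, one_mem' := one_pow _, mul_mem' := ?_, inv_mem' := ?_ }, ?_⟩
  · have : ∀ A B : SL2 (ZMod 3), A ^ 4 = 1 → B ^ 4 = 1 → (A * B) ^ 4 = 1 := by decide +kernel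
    exact fun {A B} hA hB => this A B hA hB
  · exact fun {A} hA => (inv_pow A 4).trans (by rw [show A ^ 4 = 1 from hA, inv_one])
  · refine isComplement2_of_pow (m := 2) (fun A => Iff.rfl) (by decide) ?_ ?_
    · decide +kernel
    · exact ⟨⟨!![0, -1; 1, 0], by decide⟩, by decide +kernel, by decide, by decide, by decide⟩

end Complement

section Levi

variable {K N : Type} [Field K] [Finite K] [AddCommGroup N] [Module K N] [FiniteDimensional K N]
  {p r : ℕ} [Fact p.Prime] [Fact r.Prime] [CharP K p] {R : Subgroup (SL2 K)}
  {ρ : Representation K (Par fP : Subgroup (G K)) N}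

/-- The complement in both blocks. -/
def blkR (R : Subgroup (SL2 K)) : R × R →* (Par fP : Subgroup (G K)) := blk.comp (R.subtype.prodMap R.subtype)

lemma blk_injective : Function.Injective (blk (K := K)) := by
  intro x y h
  have h1 := congrArg ul h
  have h2 := congrArg lr h
  rw [ul_blk, ul_blk] at h1
  rw [lr_blk, lr_blk] at h2
  exact Prod.ext (Subtype.ext h1) (Subtype.ext h2)

lemma natCast_ne_zero_of_pgroup (p : ℕ) [Fact p.Prime] [CharP K p] (hpr : r ≠ p) {A : Type} [Group A] [Finite A]
    (hA : IsPGroup r A) : (Nat.card A : K) ≠ 0 := by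
  obtain ⟨n, hn⟩ := IsPGroup.iff_card.1 hA
  rw [hn, Nat.cast_pow]
  refine pow_ne_zero _ fun h => ?_
  rw [CharP.cast_eq_zero_iff K p] at h
  exact hpr ((Nat.prime_dvd_prime_iff_eq Fact.out Fact.out).1 h).symm

include p in
/-- If the complement has no fixed points, the derived Levi subgroup has no cohomology. -/
lemma pull_blk_mem_B2 (hR : IsComplement2 r R) (hpr : r ≠ p) (h0 : Representation.invariants (ρ.comp (blkR R)) = ⊥)
    {c} (hc : c ∈ Z2 ρ) : pull K blk c ∈ B2 (ρ.comp blk) := by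
  have := Fintype.ofFinite (R × R)
  have hG : IsPGroup r (R × R) := fun x => by
    obtain ⟨m, hm⟩ := hR.pgroup x.1
    obtain ⟨n, hn⟩ := hR.pgroup x.2
    refine ⟨m + n, Prod.ext ?_ ?_⟩
    · rw [Prod.pow_fst, pow_add, pow_mul, hm, one_pow, Prod.fst_one]
    · rw [Prod.pow_snd, pow_add, mul_comm, pow_mul, hn, one_pow, Prod.snd_one]
  refine mem_B2_of_normal_average (R.subtype.prodMap R.subtype) ?_ ?_ ?_ ?_ (pull_Z2 blk hc)
  · rw [← Nat.card_eq_fintype_card]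
    exact natCast_ne_zero_of_pgroup p hpr hG
  · exact Function.Injective.prodMap R.subtype_injective R.subtype_injective
  · intro g x
    exact ⟨(⟨_, hR.normal.conj_mem _ x.1.2 g.1⟩, ⟨_, hR.normal.conj_mem _ x.2.2 g.2⟩), rfl⟩
  · intro v
    rw [← Submodule.mem_bot K, ← h0]
    intro y
    change ρ (blkR R y) (∑ x, ρ (blkR R x) v) = ∑ x, ρ (blkR R x) v
    rw [map_sum, ← Equiv.sum_comp (Equiv.mulLeft y) fun x => ρ (blkR R x) v]
    refine Finset.sum_congr rfl fun x _ => ?_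
    rw [← rho_mul, ← map_mul]
    rfl

include p in
lemma Z2_le_Zr_sP (hR : IsComplement2 r R) (hpr : r ≠ p) (h0 : Representation.invariants (ρ.comp (blkR R)) = ⊥) :
    Z2 ρ ≤ Zr (sP fP_mono) ρ := by
  intro c hc
  refine ⟨hc, ?_⟩
  let xx : Multiplicative (K × K) →* SL2 K × SL2 K :=
    { toFun := fun x => (xe x.toAdd.1, xe x.toAdd.2)
      map_one' := Prod.ext xe_zero xe_zero
      map_mul' := fun x y => Prod.ext (xe_add _ _) (xe_add _ _) }
  have hs : sP fP_mono = blk.comp xx := MonoidHom.ext sP_eq_blk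
  rw [hs]
  exact pull_B2 xx (pull_blk_mem_B2 hR hpr h0 hc)

include p in
/-- If the complement has fixed points, so has the derived Levi subgroup. -/
lemma invariants_blk_ne_bot (hR : IsComplement2 r R)
    (h0 : Representation.invariants (ρ.comp (blkR R)) ≠ ⊥) : Representation.invariants (ρ.comp blk) ≠ ⊥ := by
  have hW : ∀ x, Representation.invariants (ρ.comp (blkR R)) ≤
      (Representation.invariants (ρ.comp (blkR R))).comap (ρ (sP fP_mono x)) :=
    fun x v hv => by
      intro y
      have h1 : ∃ z, blkR R z = (sP fP_mono x)⁻¹ * blkR R y * sP fP_mono x := by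
        refine ⟨(⟨_, hR.normal.conj_mem _ y.1.2 (xe x.toAdd.1)⁻¹⟩, ⟨_, hR.normal.conj_mem _ y.2.2 (xe x.toAdd.2)⁻¹⟩), ?_⟩
        rw [sP_eq_blk]
        change blk _ = _ * blk _ * _
        rw [← map_inv, ← map_mul, ← map_mul]
        congr 1
        refine Prod.ext ?_ ?_
        · exact congrArg ((xe x.toAdd.1)⁻¹ * (y.1 : SL2 K) * ·) (inv_inv _)
        · exact congrArg ((xe x.toAdd.2)⁻¹ * (y.2 : SL2 K) * ·) (inv_inv _)
      obtain ⟨z, hz⟩ := h1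
      have h2 : ρ (blkR R z) v = v := hv z
      change ρ (blkR R y) (ρ (sP fP_mono x) v) = ρ (sP fP_mono x) v
      rw [← rho_mul, show blkR R y * sP fP_mono x = sP fP_mono x * blkR R z by rw [hz]; group, rho_mul, h2]
  have : Nontrivial (Representation.invariants (ρ.comp (blkR R))) := Submodule.nontrivial_iff_ne_bot.2 h0
  have h1 := invariants_ne_bot (isPGroup_qQ (K := K) p (A := K × K))
    (Representation.subrepresentation (ρ.comp (sP fP_mono)) (Representation.invariants (ρ.comp (blkR R))) hW)
  obtain ⟨v, hv, hne⟩ := (Submodule.ne_bot_iff _).1 h1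
  refine (Submodule.ne_bot_iff _).2 ⟨v.1, fun x => ?_, fun h => hne (Subtype.ext h)⟩
  obtain ⟨B, hB, a, h1⟩ := hR.decomp x.1
  obtain ⟨C, hC, b, h2⟩ := hR.decomp x.2
  have e : blk x = blkR R (⟨B, hB⟩, ⟨C, hC⟩) * sP fP_mono (.ofAdd (a, b)) := by
    rw [sP_eq_blk]
    change _ = blk (B, C) * _
    rw [← map_mul, show x = (B, C) * (xe a, xe b) from Prod.ext h1 h2]
    rfl
  have e1 : ρ (sP fP_mono (.ofAdd (a, b))) v.1 = v.1 := congrArg Subtype.val (hv (.ofAdd (a, b)))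
  change ρ (blk x) v.1 = v.1
  rw [e, rho_mul, e1]
  exact v.2 _

end Levi

section Layers

variable {K N : Type} [Field K] [Finite K] [AddCommGroup N] [Module K N] [FiniteDimensional K N]
  {p r : ℕ} [Fact p.Prime] [Fact r.Prime] [CharP K p] {R : Subgroup (SL2 K)}
  {ρ : Representation K (Par fP : Subgroup (G K)) N}

include p in
lemma relDim_Z2_le_of_layers (hR : IsComplement2 r R)
    (cost : ∀ (N : Type) [AddCommGroup N] [Module K N], Representation K (Par fP : Subgroup (G K)) N → ℕ)
    (hadd : ∀ (N : Type) [AddCommGroup N] [Module K N] [FiniteDimensional K N]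
      (ρ : Representation K (Par fP : Subgroup (G K)) N) (W : Submodule K N) (hW : ∀ g, W ≤ W.comap (ρ g)),
      cost _ (ρ.quotient W hW) + cost _ (ρ.subrepresentation W hW) ≤ cost N ρ)
    (h1 : ∀ (N : Type) [AddCommGroup N] [Module K N] [FiniteDimensional K N]
      (ρ : Representation K (Par fP : Subgroup (G K)) N), (∀ x v, ρ (qP fP_mono x) v = v) →
        (∀ x v, ρ (blk x) v = v) → relDim (Z2 ρ) (B2 ρ) ≤ cost N ρ)
    (h2 : ∀ (N : Type) [AddCommGroup N] [Module K N] [FiniteDimensional K N]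
      (ρ : Representation K (Par fP : Subgroup (G K)) N), (∀ x v, ρ (qP fP_mono x) v = v) →
        Representation.invariants (ρ.comp (blkR R)) = ⊥ → relDim (Z2 ρ) (B2 ρ) ≤ cost N ρ)
    (ρ : Representation K (Par fP : Subgroup (G K)) N) : relDim (Z2 ρ) (B2 ρ) ≤ cost N ρ := by
  have hn : ∀ (g : (Par fP : Subgroup (G K))) (x), ∃ y, qP fP_mono y = g * qP fP_mono x * g⁻¹ :=
    fun g x => qP_normal fP_mono (fun _ _ h => h) g x
  have h := relDim_le_cost (1 : Unit →* (Par fP : Subgroup (G K))) cost hadd ?_ ρ (fun s x => by simp)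
  · rwa [Zr_trivial] at h
  intro N _ _ _ _ ρ _
  suffices h : ∃ (W : Submodule K N) (hW : ∀ g, W ≤ W.comap (ρ g)), W ≠ ⊥ ∧
      relDim (Z2 (ρ.subrepresentation W hW)) (B2 (ρ.subrepresentation W hW)) ≤
        cost _ (ρ.subrepresentation W hW) by
    simpa only [Zr_trivial] using h
  have hQ := invariants_comp_le hn ρ
  by_cases h0 : Representation.invariants (ρ.comp (qP fP_mono)) ⊓ Representation.invariants (ρ.comp blk) = ⊥
  · refine ⟨_, hQ, invariants_ne_bot (isPGroup_qQ (K := K) p) _, h2 _ _ (fun r x => Subtype.ext (x.2 r)) ?_⟩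
    by_contra h
    obtain ⟨v, hv, hne⟩ := (Submodule.ne_bot_iff _).1 (invariants_blk_ne_bot (p := p) hR h)
    have h3 : v.1 ∈ Representation.invariants (ρ.comp (qP fP_mono)) ⊓ Representation.invariants (ρ.comp blk) :=
      Submodule.mem_inf.2 ⟨v.2, fun x => congrArg Subtype.val (hv x)⟩
    rw [h0] at h3
    exact hne (Subtype.ext ((Submodule.mem_bot K).1 h3))
  · refine ⟨_, fun g v hv => ?_, h0, h1 _ _ (fun r x => Subtype.ext ((Submodule.mem_inf.1 x.2).1 r))
      (fun r x => Subtype.ext ((Submodule.mem_inf.1 x.2).2 r))⟩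
    have hv' := Submodule.mem_inf.1 hv
    refine Submodule.mem_inf.2 ⟨hQ g hv'.1, fun x => ?_⟩
    obtain ⟨u, y, h⟩ := exists_conj_blk g⁻¹ x
    have e1 : blk x * g = g * (qP fP_mono u * blk y) := by rw [← h]; group
    have e2 : ρ (blk y) v = v := hv'.2 y
    have e3 : ρ (qP fP_mono u) v = v := hv'.1 u
    change ρ (blk x) (ρ g v) = ρ g v
    rw [← rho_mul, e1, rho_mul, rho_mul, e2, e3]

end Layers

section Theta

variable {K N : Type} [Field K] [Finite K] [AddCommGroup N] [Module K N] [FiniteDimensional K N]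
  {p r : ℕ} [Fact p.Prime] [Fact r.Prime] [CharP K p] {R : Subgroup (SL2 K)}
  {ρ : Representation K (Par fP : Subgroup (G K)) N} {c : ↥(Par fP : Subgroup (G K)) → ↥(Par fP : Subgroup (G K)) → N}

include p in
/-- Cocycles on the parabolic that vanish on the radical are controlled by the mixed functional. -/
lemma mem_B2_of_average (hρ : ∀ x v, ρ (qP fP_mono x) v = v) (hc : c ∈ Z2 ρ)
    (h0 : ∀ u v, c (qP fP_mono u) (qP fP_mono v) = 0)
    (hl : pull K (sP fP_mono) c ∈ B2 (ρ.comp (sP fP_mono))) [Fintype (Multiplicative (K × K))] (A : N →ₗ[K] N)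
    (hA : ∀ l u, ∑ g, ρ (sP fP_mono g) (A (ρ (sP fP_mono g)⁻¹ (del c (sP fP_mono l) (qP fP_mono u)))) =
      del c (sP fP_mono l) (qP fP_mono u)) : c ∈ B2 ρ := by
  set ι : Uni K →* (Par fP : Subgroup (G K)) := Subgroup.inclusion (Uni_le_Par fP_mono)
  refine mem_B2_of_restrict ι (Subgroup.inclusion_injective _)
    (index_ne_zero_of_Uni_le p le_rfl _) ρ hc ?_
  refine mem_B2_of_semidirect_of_average (sQ.codRestrict (Uni K) sQ_mem_Uni) (sS.codRestrict (Uni K) sS_mem_Uni)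
    sQ_sS_bijective (fun x v => hρ x v) (fun l u => ?_) (pull_Z2 ι hc) (fun u v => h0 u v) ?_ A
    (fun l u => hA l u)
  · obtain ⟨y, hy⟩ := sQ_normal (Uni_le_Par fP_mono (sS_mem_Uni l)) u
    exact ⟨y, Subtype.ext hy⟩
  · exact hl

lemma exists_torus_conj_blk (d : Tor K) (x : SL2 K × SL2 K) :
    ∃ y, blk y = thP fP d * blk x * (thP fP d)⁻¹ := by
  have e : ∀ f : (Par fP : Subgroup (G K)) →* Matrix (Fin 2) (Fin 2) K, (f (blk x)).det = 1 →
      (f (thP fP d * blk x * (thP fP d)⁻¹)).det = 1 := fun f hf => by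
    rw [map_mul, map_mul, Matrix.det_mul, Matrix.det_mul, hf, mul_one, ← Matrix.det_mul, ← map_mul,
      mul_inv_cancel, map_one, Matrix.det_one]
  obtain ⟨a, ha⟩ : ∃ a : SL2 K, a.1 = ul (thP fP d * blk x * (thP fP d)⁻¹) :=
    ⟨⟨_, e ul (by rw [ul_blk]; exact x.1.2)⟩, rfl⟩
  obtain ⟨b, hb⟩ : ∃ b : SL2 K, b.1 = lr (thP fP d * blk x * (thP fP d)⁻¹) :=
    ⟨⟨_, e lr (by rw [lr_blk]; exact x.2.2)⟩, rfl⟩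
  refine ⟨(a, b), ?_⟩
  have h1 : (thP fP d * blk x * (thP fP d)⁻¹).1.1 =
      Matrix.diagonal (fun i => (d.1 i : K)) * blkM x.1.1 x.2.1 * Matrix.diagonal fun i => ((d⁻¹).1 i : K) := by
    rw [← map_inv]
    rfl
  apply Subtype.ext
  apply Subtype.ext
  change blkM a.1 b.1 = _
  have hz : ∀ i j, blkM x.1.1 x.2.1 i j = 0 → (thP fP d * blk x * (thP fP d)⁻¹).1.1 i j = 0 := fun i j h => by
    rw [h1, Matrix.mul_diagonal, Matrix.diagonal_mul, h, mul_zero, zero_mul]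
  rw [ha, hb]
  ext i j
  fin_cases i <;> fin_cases j <;> first | rfl | exact (hz _ _ rfl).symm

/-- The torus together with the complements in both blocks. -/
def ThG (R : Subgroup (SL2 K)) : Subgroup (Par fP : Subgroup (G K)) := (thP fP).range ⊔ (blkR R).range

lemma thP_mem_ThG (d : Tor K) : thP fP d ∈ ThG R := Subgroup.mem_sup_left ⟨d, rfl⟩

lemma blkR_mem_ThG (x : R × R) : blkR R x ∈ ThG R := Subgroup.mem_sup_right ⟨x, rfl⟩

lemma exists_torus_conj_blkR (hR : IsComplement2 r R) (d : Tor K) (x : R × R) :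
    ∃ y, blkR R y = thP fP d * blkR R x * (thP fP d)⁻¹ := by
  obtain ⟨m, hm⟩ := hR.pow
  obtain ⟨y, hy⟩ := exists_torus_conj_blk d (x.1.1, x.2.1)
  have h1 : y ^ m = 1 := blk_injective (by
    rw [map_pow, hy, conj_pow, ← map_pow, map_one, show ((x.1.1, x.2.1) : SL2 K × SL2 K) ^ m = 1 from
      Prod.ext ((hm _).1 x.1.2) ((hm _).1 x.2.2), map_one, mul_one, mul_inv_cancel])
  exact ⟨(⟨y.1, (hm _).2 (congrArg Prod.fst h1)⟩, ⟨y.2, (hm _).2 (congrArg Prod.snd h1)⟩), hy⟩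

lemma isPGroup_prod (hR : IsComplement2 r R) : IsPGroup r (R × R) := fun x => by
  obtain ⟨m, hm⟩ := hR.pgroup x.1
  obtain ⟨n, hn⟩ := hR.pgroup x.2
  refine ⟨m + n, Prod.ext ?_ ?_⟩
  · rw [Prod.pow_fst, pow_add, pow_mul, hm, one_pow, Prod.fst_one]
  · rw [Prod.pow_snd, pow_add, mul_comm, pow_mul, hn, one_pow, Prod.snd_one]

lemma isPGroup_ThG (hR : IsComplement2 r R) : IsPGroup r (ThG R) := by
  have h1 : IsPGroup r (thP (K := K) fP).range := hR.tor.of_surjective _ (thP fP).rangeRestrict_surjective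
  have h2 : IsPGroup r (blkR R).range := (isPGroup_prod hR).of_surjective _ (blkR R).rangeRestrict_surjective
  refine h1.to_sup_of_normal_right' h2 ?_
  rintro _ ⟨d, rfl⟩
  have key : ∀ d : Tor K, ∀ h ∈ (blkR R).range, thP fP d * h * (thP fP d)⁻¹ ∈ (blkR R).range := by
    rintro d _ ⟨x, rfl⟩
    exact exists_torus_conj_blkR hR d x
  rw [Subgroup.mem_normalizer_iff]
  refine fun h => ⟨key d h, fun h' => ?_⟩
  have h3 := key d⁻¹ _ h'
  rwa [map_inv, show (thP fP d)⁻¹ * (thP fP d * h * (thP fP d)⁻¹) * (thP fP d)⁻¹⁻¹ = h by group] at h3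

include p in
lemma Zr_le_Z0_ThG (hR : IsComplement2 r R) (hpr : r ≠ p) (ρ : Representation K (Par fP : Subgroup (G K)) N) :
    Zr (qP fP_mono) ρ ≤ Z0 (qP fP_mono) (ThG R).subtype ρ ⊔ B2 ρ := by
  have hn : ∀ (t : ThG R) (x), ∃ y, qP fP_mono y = (ThG R).subtype t * qP fP_mono x * ((ThG R).subtype t)⁻¹ :=
    fun t x => qP_normal fP_mono (fun _ _ h => h) t.1 x
  refine Zr_le_Z0_sup_B2 (natCast_ne_zero_of_pgroup p hpr (isPGroup_ThG hR)) _ ?_ (ThG R).subtype ?_ ρ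
  · exact qP_injective fP_mono
  · exact hn

variable (hρ : ∀ x v, ρ (qP fP_mono x) v = v) (hc : c ∈ Z0 (qP fP_mono) (ThG R).subtype ρ)
include hρ hc

include p in
lemma del_blkR_eq_zero (hR : IsComplement2 r R) (hpr : r ≠ p) (x : R × R) (u) :
    del c (blkR R x) (qP fP_mono u) = 0 := by
  refine del_eq_zero_of_equivariant (fun g h => hc.2.1 ⟨_, blkR_mem_ThG x⟩ g h) (n := Nat.card (R × R)) ?_
    (natCast_ne_zero_of_pgroup p hpr (isPGroup_prod hR)) hc.1 (hρ u)
  change blkR R x ^ _ = 1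
  rw [← map_pow, pow_card_eq_one', map_one]

include p in
lemma del_blk_conj (hR : IsComplement2 r R) (hpr : r ≠ p) (l : SL2 K × SL2 K) (x : R × R) (u) :
    del c (blk l) (blkR R x * qP fP_mono u * (blkR R x)⁻¹) =
      ρ (blk l * blkR R x * (blk l)⁻¹) (del c (blk l) (qP fP_mono u)) := by
  have h1 : ∃ y, blkR R y = blk l * blkR R x * (blk l)⁻¹ :=
    ⟨(⟨_, hR.normal.conj_mem _ x.1.2 l.1⟩, ⟨_, hR.normal.conj_mem _ x.2.2 l.2⟩), by
      rw [← map_inv]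
      change _ = blk l * blk (x.1.1, x.2.1) * blk l⁻¹
      rw [← map_mul, ← map_mul]
      rfl⟩
  obtain ⟨y, hy⟩ := h1
  obtain ⟨v, hv⟩ := qP_normal fP_mono (fun _ _ h => h) (blk l) u
  refine del_conj_of_normalizes hc.1 (hρ u) (del_blkR_eq_zero (p := p) hρ hc hR hpr x u) ?_
  rw [← hy, ← hv]
  exact del_blkR_eq_zero (p := p) hρ hc hR hpr y v

end Theta

section Twisted

variable {k H N : Type} [Field k] [Group H] [AddCommGroup N] [Module k N] {ρ : Representation k H N}
  {c : H → H → N}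

lemma del_one_right (h0 : c 1 1 = 0) (hc : c ∈ Z2 ρ) (l : H) : del c l 1 = 0 := by
  simp [del, one_right hc l, one_left hc l, h0]

lemma del_inv_right (hc : c ∈ Z2 ρ) (h0 : c 1 1 = 0) {x u : H} (hu : ∀ v, ρ u v = v) (hxu : x * u * x⁻¹ = u)
    (hcu : c u u⁻¹ = 0) : del c x u⁻¹ = -del c x u := by
  have h1 : x * u⁻¹ * x⁻¹ = u⁻¹ := by rw [← conj_inv, hxu]
  have h2 := del_mul_right (l := x) (u := u) (v := u⁻¹) hc hu hcu (by rw [hxu, h1, hcu])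
  rw [mul_inv_cancel, del_one_right h0 hc] at h2
  exact (neg_eq_of_add_eq_zero_right h2.symm).symm

lemma del_inv_left (hc : c ∈ Z2 ρ) {x u : H} (hu : ∀ v, ρ u v = v) (hxu : x * u * x⁻¹ = u) :
    del c x⁻¹ u = -ρ x⁻¹ (del c x u) := by
  have h2 := del_mul_left (l := x⁻¹) (l' := x) hc hu
  rw [inv_mul_cancel, del_one hc hu, hxu] at h2
  exact (neg_eq_of_add_eq_zero_right h2.symm).symm

/-- The mixed functional, twisted by an element of order three, is a weight vector. -/
lemma twisted_weight (hc : c ∈ Z2 ρ) (h0 : c 1 1 = 0) {t x u : H}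
    (ht : ∀ g h, c (t * g * t⁻¹) (t * h * t⁻¹) = ρ t (c g h)) (hu : ∀ v, ρ u v = v) (hxu : x * u * x⁻¹ = u)
    (hx3 : x ^ 3 = 1) (hcu : c u u⁻¹ = 0) {a b : k} (ha : a = 1 ∧ t * x * t⁻¹ = x ∨ a = -1 ∧ t * x * t⁻¹ = x⁻¹)
    (hb : b = 1 ∧ t * u * t⁻¹ = u ∨ b = -1 ∧ t * u * t⁻¹ = u⁻¹) :
    ρ t (ρ x (del c x u)) = (a * b) • ρ x (del c x u) := by
  have h1 : ∀ y, del c (t * y * t⁻¹) (t * u * t⁻¹) = ρ t (del c y u) := fun y => by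
    rw [del, conj_conj, ht, ht, del, map_sub]
  have h2 : ∀ y, y * u * y⁻¹ = u → del c y (t * u * t⁻¹) = b • del c y u := fun y hy => by
    rcases hb with ⟨rfl, hb⟩ | ⟨rfl, hb⟩
    · rw [hb, one_smul]
    · rw [hb, del_inv_right hc h0 hu hy hcu, neg_one_smul]
  have h3 : x⁻¹ * u * x⁻¹⁻¹ = u := by
    nth_rewrite 1 [← hxu]
    group
  have h4 : x⁻¹ * x⁻¹ = x := by
    rw [← mul_inv_rev, inv_eq_iff_mul_eq_one, ← hx3, pow_three']
  have h5 : ρ t (ρ x (del c x u)) = ρ (t * x * t⁻¹) (del c (t * x * t⁻¹) (t * u * t⁻¹)) := by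
    rw [h1, ← rho_mul, ← rho_mul, inv_mul_cancel_right]
  rw [h5]
  rcases ha with ⟨rfl, ha⟩ | ⟨rfl, ha⟩
  · rw [ha, h2 _ hxu, map_smul, one_mul]
  · rw [ha, h2 _ h3, del_inv_left hc hu hxu, map_smul, map_neg, ← rho_mul, h4, smul_neg, neg_mul, one_mul, neg_smul]

end Twisted

section Weyl

variable {K : Type} [Field K]

lemma blk_left_conj {A : SL2 K} (h0 : A.1 0 0 = 0) (h2 : A.1 1 0 = 1) (a b : K) :
    blk (A, 1) * qP fP_mono (.ofAdd (a, b, 0, 0)) * (blk (A, 1))⁻¹ = qP fP_mono (.ofAdd (0, 0, a, b)) := by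
  rw [mul_inv_eq_iff_eq_mul]
  apply Subtype.ext
  apply Subtype.ext
  change blkM A.1 1 * (sQ _).1 = (sQ _).1 * blkM A.1 1
  rw [sQ_coe, sQ_coe]
  ext i j
  fin_cases i <;> fin_cases j <;> simp [blkM, Matrix.mul_apply, Fin.sum_univ_four, h0, h2]

lemma blk_right_conj {A : SL2 K} (h0 : A.1 0 0 = 0) (h1 : A.1 0 1 = -1) (h2 : A.1 1 0 = 1) (a b : K) :
    blk (1, A) * qP fP_mono (.ofAdd (0, a, 0, b)) * (blk (1, A))⁻¹ = qP fP_mono (.ofAdd (-a, 0, -b, 0)) := by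
  rw [mul_inv_eq_iff_eq_mul]
  apply Subtype.ext
  apply Subtype.ext
  change blkM 1 A.1 * (sQ _).1 = (sQ _).1 * blkM 1 A.1
  rw [sQ_coe, sQ_coe]
  ext i j
  fin_cases i <;> fin_cases j <;> simp [blkM, Matrix.mul_apply, Fin.sum_univ_four, h0, h1, h2]

lemma closure_singleton_of_prime_field (hK : ∀ a s : K, a ≠ 0 → ∃ n : ℕ, n • a = s) {a : K} (ha : a ≠ 0) :
    Submonoid.closure {(.ofAdd a : Multiplicative K)} = ⊤ := by
  refine eq_top_iff.2 fun s _ => ?_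
  obtain ⟨n, hn⟩ := hK a s.toAdd ha
  have h := pow_mem (Submonoid.subset_closure (Set.mem_singleton (.ofAdd a : Multiplicative K))) n
  rw [← ofAdd_nsmul, hn] at h
  exact h

end Weyl

section Mixed

variable {K N : Type} [Field K] [Finite K] [AddCommGroup N] [Module K N] [FiniteDimensional K N]
  {p r : ℕ} [Fact p.Prime] [Fact r.Prime] [CharP K p] {R : Subgroup (SL2 K)}
  {ρ : Representation K (Par fP : Subgroup (G K)) N} {c : ↥(Par fP : Subgroup (G K)) → ↥(Par fP : Subgroup (G K)) → N}
  (hρ : ∀ x v, ρ (qP fP_mono x) v = v) (hc : c ∈ Z0 (qP fP_mono) (ThG R).subtype ρ)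
include hρ hc

include p in
/-- The mixed functional is determined by its values on the highest root. -/
lemma del_eq_zero_of_highest (hR : IsComplement2 r R) (hpr : r ≠ p) (hK : ∀ a s : K, a ≠ 0 → ∃ n : ℕ, n • a = s)
    (h1 : del c (Y fP 0 1 1) (Y fP 0 3 1) = 0) (h2 : del c (Y fP 2 3 1) (Y fP 0 3 1) = 0) (l u) :
    del c (sP fP_mono l) (qP fP_mono u) = 0 := by
  have hn : ∀ l u, ∃ u', qP fP_mono u' = sP fP_mono l * qP fP_mono u * (sP (K := K) fP_mono l)⁻¹ :=
    fun l u => qP_normal fP_mono (fun _ _ h => h) (sP fP_mono l) u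
  obtain ⟨j, hj, j0, j1, j2⟩ := hR.weyl
  have one : Submonoid.closure {(.ofAdd 1 : Multiplicative K)} = ⊤ :=
    closure_singleton_of_prime_field hK one_ne_zero
  have neg : Submonoid.closure {(.ofAdd (-1) : Multiplicative K)} = ⊤ :=
    closure_singleton_of_prime_field hK (neg_ne_zero.2 one_ne_zero)
  have hb : ∀ l x u, del c (blk l) (qP fP_mono u) = 0 →
      del c (blk l) (blkR R x * qP fP_mono u * (blkR R x)⁻¹) = 0 := fun l x u h => by
    rw [del_blk_conj (p := p) hρ hc hR hpr, h, map_zero]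
  have e1 : ∀ a b, blkR R (⟨j, hj⟩, 1) * qP fP_mono (.ofAdd (a, b, 0, 0)) * (blkR R (⟨j, hj⟩, 1))⁻¹ =
      qP fP_mono (.ofAdd (0, 0, a, b)) := fun a b => blk_left_conj j0 j2 a b
  have e2 : ∀ a b, blkR R (1, ⟨j, hj⟩) * qP fP_mono (.ofAdd (0, a, 0, b)) * (blkR R (1, ⟨j, hj⟩))⁻¹ =
      qP fP_mono (.ofAdd (-a, 0, -b, 0)) := fun a b => blk_right_conj j0 j1 j2 a b
  have key : ∀ l : SL2 K × SL2 K, del c (blk l) (qP fP_mono (.ofAdd (0, 1, 0, 0))) = 0 →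
      del c (blk l) (qP fP_mono (.ofAdd (0, 0, 0, 1))) = 0 ∧
      del c (blk l) (qP fP_mono (.ofAdd (-1, 0, 0, 0))) = 0 ∧
      del c (blk l) (qP fP_mono (.ofAdd (0, 0, -1, 0))) = 0 := fun l h => by
    have f1 := hb l (⟨j, hj⟩, 1) _ h
    rw [e1] at f1
    have f2 := hb l (1, ⟨j, hj⟩) _ h
    rw [e2, neg_zero] at f2
    have f3 := hb l (⟨j, hj⟩, 1) _ f2
    rw [e1] at f3
    exact ⟨f1, f2, f3⟩
  rw [Y03 fP_mono, Y01 fP_mono, sP_eq_blk] at h1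
  rw [Y03 fP_mono, Y23 fP_mono, sP_eq_blk] at h2
  have k1 := key _ h1
  have k2 := key _ h2
  refine del_closure hρ hn hc.1 hc.2.2 _ (closure_prod _ _ one one) _
    (closure_prod _ _ neg (closure_prod _ _ one (closure_prod _ _ neg one))) ?_ l u
  rintro _ (⟨_, rfl, rfl⟩ | ⟨_, rfl, rfl⟩) _
    (⟨_, rfl, rfl⟩ | ⟨_, ⟨_, rfl, rfl⟩ | ⟨_, ⟨_, rfl, rfl⟩ | ⟨_, rfl, rfl⟩, rfl⟩, rfl⟩)
  all_goals rw [sP_eq_blk]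
  · exact k1.2.1
  · exact h1
  · exact k1.2.2
  · exact k1.1
  · exact k2.2.1
  · exact h2
  · exact k2.2.2
  · exact k2.1

end Mixed

section OrderThree

variable {K N : Type} [Field K] [Finite K] [AddCommGroup N] [Module K N] [FiniteDimensional K N]
  {p r : ℕ} [Fact p.Prime] [Fact r.Prime] [CharP K p] {R : Subgroup (SL2 K)}
  {ρ : Representation K (Par fP : Subgroup (G K)) N}

lemma twisted_mem {c : ↥(Par fP : Subgroup (G K)) → ↥(Par fP : Subgroup (G K)) → N}
    (hK3 : (3 : K) = 0) (hu : ∀ a : Kˣ, a = 1 ∨ a = -1)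
    (hρ : ∀ x v, ρ (qP fP_mono x) v = v) (hc : c ∈ Z0 (qP fP_mono) (ThG R).subtype ρ) {a b : Fin 4}
    (hab : fP a ≤ fP b) (h1 : b ≠ 0) (h2 : 3 ≠ a) :
    ρ (Y fP a b 1) (del c (Y fP a b 1) (Y fP 0 3 1)) ∈ wt (ρ.comp (thP fP)) (chi (rt a b + rt 0 3)) := by
  intro t
  have hinv : ∀ {i j : Fin 4}, fP i ≤ fP j → Y fP i j (-1 : K) = (Y fP i j 1)⁻¹ := fun {i j} hij => by
    rw [eq_inv_iff_mul_eq_one, ← (Y_rootFam hij).add, neg_add_cancel, (Y_rootFam hij).zero]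
  have hsgn : ∀ {i j : Fin 4}, fP i ≤ fP j →
      ((chi (rt i j) t : Kˣ) : K) = 1 ∧ thP fP t * Y fP i j 1 * (thP fP t)⁻¹ = Y fP i j 1 ∨
      ((chi (rt i j) t : Kˣ) : K) = -1 ∧ thP fP t * Y fP i j 1 * (thP fP t)⁻¹ = (Y fP i j 1)⁻¹ :=
    fun {i j} hij => by
      rw [(Y_rootFam hij).conj, mul_one, ← hinv hij]
      rcases hu (chi (rt i j) t) with h | h <;> rw [h]
      · exact .inl ⟨rfl, rfl⟩
      · exact .inr ⟨rfl, by rw [Units.val_neg, Units.val_one]⟩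
  rw [chi_add]
  refine twisted_weight hc.1 (c_one_one hc) (fun g h => hc.2.1 ⟨_, thP_mem_ThG t⟩ g h) (fun v => ?_) ?_ ?_ ?_
    (hsgn hab) (hsgn (by decide))
  · rw [Y03 fP_mono, hρ]
  · rw [Y_comm hab (by decide) h1 h2, mul_inv_cancel_right]
  · rw [(Y_rootFam hab).pow, nsmul_one, Nat.cast_ofNat, hK3, (Y_rootFam hab).zero]
  · rw [← hinv (by decide), Y03 fP_mono, Y03 fP_mono]
    exact hc.2.2 _ _

include p in
lemma relDim_Zr_inf_Zr_le (hR : IsComplement2 r R) (hpr : r ≠ p) (hK : ∀ a s : K, a ≠ 0 → ∃ n : ℕ, n • a = s)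
    (hK3 : (3 : K) = 0) (hu : ∀ a : Kˣ, a = 1 ∨ a = -1) (hρ : ∀ x v, ρ (qP fP_mono x) v = v) :
    relDim (Zr (qP fP_mono) ρ ⊓ Zr (sP fP_mono) ρ) (B2 ρ) ≤
      mu (thP fP) ρ (rt 0 1 + rt 0 3) + mu (thP fP) ρ (rt 2 3 + rt 0 3) := by
  let Φ : Fin 4 → Fin 4 → (↥(Par fP : Subgroup (G K)) → ↥(Par fP : Subgroup (G K)) → N) →ₗ[K] N := fun a b =>
    (ρ (Y fP a b 1)).comp ((LinearMap.proj 1).comp ((LinearMap.proj (φ := fun _ : K => K → N) 1).comp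
      (delL K (Y fP a b) (Y fP 0 3))))
  have hΦ : ∀ a b c, Φ a b c = ρ (Y fP a b 1) (del c (Y fP a b 1) (Y fP 0 3 1)) := fun _ _ _ => rfl
  have hΦ0 : ∀ a b c, Φ a b c = 0 → del c (Y fP a b 1) (Y fP 0 3 1) = 0 := fun a b c h => by
    have e : ρ (Y fP a b 1)⁻¹ (Φ a b c) = del c (Y fP a b 1) (Y fP 0 3 1) := by
      rw [hΦ, ← rho_mul, inv_mul_cancel, map_one]
      rfl
    rw [← e, h, map_zero]
  refine (relDim_le_of_le_sup (inf_le_inf_sup (Zr_le_Z0_ThG (p := p) hR hpr ρ) (B2_le_Zr _ ρ))).trans ?_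
  refine (relDim_le_add_ker (Φ 0 1) _ _ (wt (ρ.comp (thP fP)) (chi (rt 0 1 + rt 0 3))) fun c hc => ?_).trans
    (add_le_add_right ?_ _)
  · rw [hΦ]
    exact twisted_mem hK3 hu hρ (Submodule.mem_inf.1 hc).1 (by decide) (by decide) (by decide)
  refine (relDim_le_add_ker (Φ 2 3) _ _ (wt (ρ.comp (thP fP)) (chi (rt 2 3 + rt 0 3))) fun c hc => ?_).trans
    (le_of_eq ?_)
  · rw [hΦ]
    exact twisted_mem hK3 hu hρ (Submodule.mem_inf.1 (Submodule.mem_inf.1 hc).1).1 (by decide) (by decide) (by decide)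
  rw [mu, relDim_eq_zero, add_zero]
  intro c hc
  obtain ⟨hc, h2⟩ := Submodule.mem_inf.1 hc
  obtain ⟨hc, h1⟩ := Submodule.mem_inf.1 hc
  obtain ⟨hc, hs⟩ := Submodule.mem_inf.1 hc
  have hd := del_eq_zero_of_highest (p := p) hρ hc hR hpr hK (hΦ0 0 1 c h1) (hΦ0 2 3 c h2)
  have := Fintype.ofFinite (Multiplicative (K × K))
  refine mem_B2_of_average (p := p) hρ hc.1 hc.2.2 hs.2 0 fun l u => ?_
  simp [hd]

variable [Algebra (ZMod p) K]

include p in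
lemma relDim_Zr_le_of_blk_trivial (hd : deg p K = 1) (hρ : ∀ x v, ρ (blk x) v = v) :
    relDim (Zr (qP fP_mono) ρ) (B2 ρ) ≤
      cBi p (thP fP) ρ 0 1 2 3 + cAdd p (thP fP) ρ 0 1 + cAdd p (thP fP) ρ 2 3 +
        relDim (Zr (qP fP_mono) ρ ⊓ Zr (sP fP_mono) ρ) (B2 ρ) := by
  have hs : ∀ x v, ρ (sP fP_mono x) v = v := fun x v => by rw [sP_eq_blk, hρ]
  have t01 : ∀ a v, ρ (Y fP 0 1 a) v = v := fun a v => by rw [Y01 fP_mono, hs]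
  have t23 : ∀ a v, ρ (Y fP 2 3 a) v = v := fun a v => by rw [Y23 fP_mono, hs]
  have r01 := Y_rootFam (K := K) (f := fP) (a := 0) (b := 1) (by decide)
  have r23 := Y_rootFam (K := K) (f := fP) (a := 2) (b := 3) (by decide)
  have alt : ∀ a b, cAlt p (thP fP) ρ a b = 0 := fun a b => by
    rw [cAlt]
    refine Finset.sum_eq_zero fun x _ => ?_
    have h1 := x.1.1.2
    have h2 := x.1.2.2
    have h3 : (x.1.1 : ℕ) < x.1.2 := x.2
    omega
  have balt : ∀ {a b : Fin 4} {c}, RootFam (thP fP) (Y fP a b) (chi (rt a b) : Tor K →* Kˣ) → c ∈ Z2 ρ →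
      (∀ s v, ρ (Y fP a b s) v = v) → ∀ s t, bet c (Y fP a b s) (Y fP a b t) = 0 :=
    fun {a b c} hr hc ht s t => by
      have h1 := betL_mem_altW (K := K) hc hr ht
      have h2 := finrank_altW_le_cAlt p (thP fP) ρ a b
      rw [alt, Nat.le_zero, Submodule.finrank_eq_zero] at h2
      rw [h2, Submodule.mem_bot] at h1
      exact congrFun (congrFun h1 s) t
  rw [add_assoc, add_assoc]
  refine (relDim_le_add_ker (betL K (Y fP 0 1) (Y fP 2 3)) _ _
    (biW (ρ.comp (thP fP)) (chi (rt 0 1)) (chi (rt 2 3))) fun c hc => ?_).trans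
    (add_le_add (finrank_biW_le_cBi p _ _ 0 1 2 3) ?_)
  · exact betL_mem hc.1 r01 r23 (Y_comm (by decide) (by decide) (by decide) (by decide)) t01 t23
  refine (relDim_le_add_ker (pifL p K (Y fP 0 1)) _ _
    (addW (ρ.comp (thP fP)) (chi (rt 0 1))) fun c hc => ?_).trans
    (add_le_add (finrank_addW_le_cAdd p _ _ 0 1) ?_)
  · have hz := (Submodule.mem_inf.1 hc).1
    exact pifL_mem hz.1 r01 t01 (balt r01 hz.1 t01)
  refine (relDim_le_add_ker (pifL p K (Y fP 2 3)) _ _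
    (addW (ρ.comp (thP fP)) (chi (rt 2 3))) fun c hc => ?_).trans
    (add_le_add (finrank_addW_le_cAdd p _ _ 2 3) ?_)
  · have hz := (Submodule.mem_inf.1 (Submodule.mem_inf.1 hc).1).1
    exact pifL_mem hz.1 r23 t23 (balt r23 hz.1 t23)
  refine relDim_le_of_le_sup (le_trans (fun c hc => ?_) le_sup_left)
  obtain ⟨hc, h3⟩ := Submodule.mem_inf.1 hc
  obtain ⟨hc, h2⟩ := Submodule.mem_inf.1 hc
  obtain ⟨hc, h1⟩ := Submodule.mem_inf.1 hc
  refine Submodule.mem_inf.2 ⟨hc, hc.1, ?_⟩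
  exact pull_sP_mem_B2 p fP_mono hs hc.1 (fun s t => congrFun (congrFun h1 s) t) (balt r01 hc.1 t01)
    (balt r23 hc.1 t23) (fun s => congrFun h2 s) (fun s => congrFun h3 s)

end OrderThree

section ThreeElements

variable {N : Type} [AddCommGroup N] [Module (ZMod 3) N] [FiniteDimensional (ZMod 3) N]

instance factPrimeThree : Fact (Nat.Prime 3) := ⟨Nat.prime_three⟩

lemma deg_three : deg 3 (ZMod 3) = 1 := Module.finrank_self _

lemma card_sub_one_three : ((Nat.card (ZMod 3) - 1 : ℕ) : ℤ) = 2 := by rw [Nat.card_zmod]; rfl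

lemma chi_three {v w : Fin 4 → ℤ} (c : ℤ) (h : ∀ i, (2 : ℤ) ∣ v i - (w i + c)) :
    (chi v : Tor (ZMod 3) →* (ZMod 3)ˣ) = chi w :=
  chi_congr (c := c) (by rwa [card_sub_one_three])

lemma mu_congr {H : Type} [Group H] (θ : Tor (ZMod 3) →* H) (ρ : Representation (ZMod 3) H N) {v w : Fin 4 → ℤ}
    (c : ℤ) (h : ∀ i, (2 : ℤ) ∣ v i - (w i + c)) : mu θ ρ v = mu θ ρ w := by
  rw [mu, chi_three c h, mu]

lemma cAdd_three {H : Type} [Group H] (θ : Tor (ZMod 3) →* H) (ρ : Representation (ZMod 3) H N) (a b) :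
    cAdd 3 θ ρ a b = mu θ ρ (rt a b) := by
  rw [cAdd]
  have : ∀ i : Fin (deg 3 (ZMod 3)), i = ⟨0, by rw [deg_three]; decide⟩ := fun i =>
    Fin.ext (Nat.lt_one_iff.1 (i.2.trans_eq deg_three))
  rw [Fintype.sum_eq_single ⟨0, by rw [deg_three]; decide⟩ fun x hx => absurd (this x) hx]
  simp

lemma cBi_three {H : Type} [Group H] (θ : Tor (ZMod 3) →* H) (ρ : Representation (ZMod 3) H N) (a b c d) :
    cBi 3 θ ρ a b c d = mu θ ρ (rt a b + rt c d) := by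
  rw [cBi]
  have : ∀ i : Fin (deg 3 (ZMod 3)), i = ⟨0, by rw [deg_three]; decide⟩ := fun i =>
    Fin.ext (Nat.lt_one_iff.1 (i.2.trans_eq deg_three))
  rw [Fintype.sum_eq_single (⟨0, by rw [deg_three]; decide⟩, ⟨0, by rw [deg_three]; decide⟩)
    fun x hx => absurd (Prod.ext (this x.1) (this x.2)) hx]
  simp

lemma relDim_Z2_le_three (ρ : Representation (ZMod 3) (Par fP : Subgroup (G (ZMod 3))) N) :
    relDim (Z2 ρ) (B2 ρ) ≤ cBi 3 (thP fP) ρ 0 3 1 2 + cAdd 3 (thP fP) ρ 0 3 +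
      (cBi 3 (thP fP) ρ 0 1 2 3 + cAdd 3 (thP fP) ρ 0 1 + cAdd 3 (thP fP) ρ 2 3 +
        (mu (thP fP) ρ (rt 0 1 + rt 0 3) + mu (thP fP) ρ (rt 2 3 + rt 0 3))) := by
  obtain ⟨R, hR⟩ := exists_isComplement2_three
  have : Fact (Nat.Prime 2) := ⟨Nat.prime_two⟩
  have hK : ∀ a s : ZMod 3, a ≠ 0 → ∃ n : ℕ, n • a = s := fun a s ha => by
    have h : ∀ a s : ZMod 3, a ≠ 0 → (s * a).val • a = s := by decide
    exact ⟨_, h a s ha⟩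
  have hu : ∀ a : (ZMod 3)ˣ, a = 1 ∨ a = -1 := by decide
  refine relDim_Z2_le_of_layers (p := 3) hR (fun N _ _ ρ => cBi 3 (thP fP) ρ 0 3 1 2 + cAdd 3 (thP fP) ρ 0 3 +
      (cBi 3 (thP fP) ρ 0 1 2 3 + cAdd 3 (thP fP) ρ 0 1 + cAdd 3 (thP fP) ρ 2 3 +
        (mu (thP fP) ρ (rt 0 1 + rt 0 3) + mu (thP fP) ρ (rt 2 3 + rt 0 3)))) ?_ ?_ ?_ ρ
  · intro N _ _ _ ρ W hW
    have e1 := cBi_add 3 (thP fP) ρ W hW 0 3 1 2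
    have e2 := cAdd_add 3 (thP fP) ρ W hW 0 3
    have e3 := cBi_add 3 (thP fP) ρ W hW 0 1 2 3
    have e4 := cAdd_add 3 (thP fP) ρ W hW 0 1
    have e5 := cAdd_add 3 (thP fP) ρ W hW 2 3
    have e6 := mu_add 3 (thP fP) ρ W hW (rt 0 1 + rt 0 3)
    have e7 := mu_add 3 (thP fP) ρ W hW (rt 2 3 + rt 0 3)
    omega
  · intro N _ _ _ ρ hQ hb
    have e1 := relDim_Z2_le_of_radical_trivial 3 hQ
    have e2 := relDim_Zr_le_of_blk_trivial (p := 3) deg_three hb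
    have e3 := relDim_Zr_inf_Zr_le (p := 3) hR (by decide) hK (by decide) hu hQ
    omega
  · intro N _ _ _ ρ hQ h0
    have e1 := relDim_Z2_le_of_radical_trivial 3 hQ
    have hle : Z2 ρ ≤ Zr (sP fP_mono) ρ := Z2_le_Zr_sP (p := 3) hR (by decide) h0
    have e2 : relDim (Zr (qP fP_mono) ρ) (B2 ρ) ≤ relDim (Zr (qP fP_mono) ρ ⊓ Zr (sP fP_mono) ρ) (B2 ρ) :=
      relDim_le_of_le_sup (le_trans (le_inf le_rfl fun c hc => hle hc.1) le_sup_left)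
    have e3 := relDim_Zr_inf_Zr_le (p := 3) hR (by decide) hK (by decide) hu hQ
    omega

variable (ρ : Representation (ZMod 3) (G (ZMod 3)) N)

lemma mu_rt (a b c d : Fin 4) (hab : a ≠ b) (hcd : c ≠ d) : mu tau ρ (rt a b) = mu tau ρ (rt c d) := by
  obtain ⟨σ, h1, h2⟩ : ∃ σ : Equiv.Perm (Fin 4), σ a = c ∧ σ b = d := by
    revert a b c d; decide +kernel
  rw [← mu_comp ρ (rt c d) σ]
  congr 1
  ext i
  subst h1 h2
  simp [rt, Pi.single_apply]

lemma relDim_lt_three [Nontrivial N] : relDim (Z2 ρ) (B2 ρ) < 2 * finrank (ZMod 3) N := by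
  have hpos : 0 < finrank (ZMod 3) N := finrank_pos
  by_cases htop : wt (ρ.comp tau) (chi (0 : Fin 4 → ℤ)) = ⊤
  · have hd : ∀ d, tau d ∈ ρ.ker := fun d => by
      rw [MonoidHom.mem_ker]
      ext v
      have h1 : v ∈ wt (ρ.comp tau) (chi (0 : Fin 4 → ℤ)) := htop ▸ Submodule.mem_top
      have h2 := h1 d
      rw [chi_apply] at h2
      simpa using h2
    have h := eq_top_of_tau_mem ρ.ker hd (by rw [Nat.card_zmod])
    have h1 := relDim_trivial_le_of_card_eq_three 3 (ρ := ρ) (fun g v => by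
      have : g ∈ ρ.ker := h ▸ Subgroup.mem_top g
      rw [MonoidHom.mem_ker] at this
      rw [this]; rfl) rfl deg_three
    omega
  have h0 : mu tau ρ 0 < finrank (ZMod 3) N := Submodule.finrank_lt htop
  have h1 := (relDim_le_parabolic 3 ρ).trans (relDim_Z2_le_three _)
  rw [cBi_three, cBi_three, cAdd_three, cAdd_three, cAdd_three] at h1
  have hm : ∀ v, mu (thP fP) (ρ.comp (Par fP : Subgroup (G (ZMod 3))).subtype) v = mu tau ρ v := fun _ => rfl
  simp only [hm] at h1
  rw [mu_congr tau ρ (v := rt 0 3 + rt 1 2) (w := 0) 1 (by decide),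
    mu_congr tau ρ (v := rt 0 1 + rt 2 3) (w := 0) 1 (by decide),
    mu_congr tau ρ (v := rt 0 1 + rt 0 3) (w := rt 1 3) 0 (by decide),
    mu_congr tau ρ (v := rt 2 3 + rt 0 3) (w := rt 0 2) 0 (by decide),
    mu_rt ρ 0 3 0 1 (by decide) (by decide), mu_rt ρ 2 3 0 1 (by decide) (by decide),
    mu_rt ρ 1 3 0 1 (by decide) (by decide), mu_rt ρ 0 2 0 1 (by decide) (by decide)] at h1
  have h2 := sum_finrank_wt_le (ρ.comp tau) (fun i : Fin 4 => (chi (rt 0 i) : Tor (ZMod 3) →* (ZMod 3)ˣ)) ?_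
  · have h3 : ∀ v, finrank (ZMod 3) (wt (ρ.comp tau) (chi v)) = mu tau ρ v := fun _ => rfl
    simp only [h3, Fin.sum_univ_four] at h2
    have h4 : rt (0 : Fin 4) 0 = 0 := by decide
    rw [h4, mu_rt ρ 0 3 0 1 (by decide) (by decide), mu_rt ρ 0 2 0 1 (by decide) (by decide)] at h2
    omega
  · intro i j h
    have h3 : ∀ a b, (2 : ℤ) ∣ _ := fun a b => card_sub_one_three ▸ dvd_of_chi_eq h a b
    clear h
    revert i j
    decide

end ThreeElements

section TwoElements

instance factPrimeTwo : Fact (Nat.Prime 2) := ⟨Nat.prime_two⟩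

/-- An element of order three of `SL(2,2)`. -/
def jm : SL2 (ZMod 2) := ⟨!![0, -1; 1, 1], by decide⟩

lemma jm_pow : jm ^ 3 = 1 := by decide +kernel

/-- The element `jm` as a generator of `C3`. -/
def jj : C3 := ⟨jm, mem_C3.2 jm_pow⟩

lemma blk_conj {K : Type} [Field K] {a b a' b' a'' b'' : SL2 K} (h1 : a * a' * a⁻¹ = a'') (h2 : b * b' * b⁻¹ = b'') :
    blk (a, b) * blk (a', b') * (blk (a, b))⁻¹ = blk (a'', b'') := by
  subst h1 h2
  rw [← map_inv, ← map_mul, ← map_mul]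
  rfl

lemma blkR_mk (A B : C3) : blkR C3 (A, B) = blk (A.1, B.1) := rfl

lemma blkR_jj_one : blkR C3 (jj, 1) = blk (jm, 1) := blkR_mk jj 1

lemma blkR_one_jj : blkR C3 (1, jj) = blk (1, jm) := blkR_mk 1 jj

lemma blkR_jj_jj : blkR C3 (jj, jj) = blk (jm, jm) := blkR_mk jj jj

lemma xe_zero_conj : xe 0 * jm * (xe 0)⁻¹ = jm := by decide +kernel

lemma xe_one_conj : xe 1 * jm * (xe 1)⁻¹ = jm * jm := by decide +kernel

lemma cube_eq_one (a b c d : ZMod 2) :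
    (∀ u : Matrix (Fin 4) (Fin 4) (ZMod 2), u = !![1, 0, a, b; 0, 1, c, d; 0, 0, 1, 0; 0, 0, 0, 1] →
      (u * blkM jm.1 1) ^ 3 = 1) ∧
    ∀ u : Matrix (Fin 4) (Fin 4) (ZMod 2), u = !![1, 0, a, b; 0, 1, c, d; 0, 0, 1, 0; 0, 0, 0, 1] →
      (u * blkM 1 jm.1) ^ 3 = 1 := by
  simp only [forall_eq]
  revert a b c d
  decide +kernel

lemma norm_qP_eq_one (u : Multiplicative (ZMod 2 × ZMod 2 × ZMod 2 × ZMod 2)) (x : C3 × C3)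
    (hx : x = (jj, 1) ∨ x = (1, jj)) :
    qP fP_mono u * (blkR C3 x * qP fP_mono u * (blkR C3 x)⁻¹) *
      (blkR C3 (x * x) * qP fP_mono u * (blkR C3 (x * x))⁻¹) = 1 := by
  have h1 : (qP fP_mono u * blkR C3 x) ^ 3 = 1 := by
    apply Subtype.ext
    apply Subtype.ext
    obtain rfl | rfl := hx
    · rw [blkR_jj_one]
      exact (cube_eq_one u.toAdd.1 u.toAdd.2.1 u.toAdd.2.2.1 u.toAdd.2.2.2).1 _ (sQ_coe _ _ _ _)
    · rw [blkR_one_jj]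
      exact (cube_eq_one u.toAdd.1 u.toAdd.2.1 u.toAdd.2.2.1 u.toAdd.2.2.2).2 _ (sQ_coe _ _ _ _)
  have h2 : blkR C3 x ^ 3 = 1 := by
    obtain rfl | rfl := hx
    · rw [blkR_jj_one, ← map_pow, Prod.pow_mk, jm_pow, one_pow, Prod.mk_one_one, map_one]
    · rw [blkR_one_jj, ← map_pow, Prod.pow_mk, jm_pow, one_pow, Prod.mk_one_one, map_one]
  rw [map_mul]
  generalize blkR C3 x = b at h1 h2
  generalize qP fP_mono u = a at h1
  calc _ = (a * b) ^ 3 * (b ^ 3)⁻¹ := by simp [pow_succ, mul_assoc]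
    _ = 1 := by rw [h1, h2, inv_one, one_mul]

variable {N : Type} [AddCommGroup N] [Module (ZMod 2) N] [FiniteDimensional (ZMod 2) N]
  {ρ : Representation (ZMod 2) (Par fP : Subgroup (G (ZMod 2))) N}
  {c : ↥(Par fP : Subgroup (G (ZMod 2))) → ↥(Par fP : Subgroup (G (ZMod 2))) → N}

lemma del_norm_eq_zero (hρ : ∀ x v, ρ (qP fP_mono x) v = v) (hc : c ∈ Z0 (qP fP_mono) (ThG C3).subtype ρ)
    (l : SL2 (ZMod 2) × SL2 (ZMod 2)) (x : C3 × C3) (hx : x = (jj, 1) ∨ x = (1, jj)) (u) :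
    del c (blk l) (qP fP_mono u) + ρ (blk l * blkR C3 x * (blk l)⁻¹) (del c (blk l) (qP fP_mono u)) +
      ρ (blk l * blkR C3 (x * x) * (blk l)⁻¹) (del c (blk l) (qP fP_mono u)) = 0 := by
  have hn : ∀ (g : (Par fP : Subgroup (G (ZMod 2)))) (x), ∃ y, qP fP_mono y = g * qP fP_mono x * g⁻¹ :=
    fun g x => qP_normal fP_mono (fun _ _ h => h) g x
  rw [← del_blk_conj (p := 2) hρ hc isComplement2_C3 (by decide), ← del_blk_conj (p := 2) hρ hc isComplement2_C3 (by decide)]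
  have key : ∀ u v, del c (blk l) (qP fP_mono u * qP fP_mono v) =
      del c (blk l) (qP fP_mono u) + del c (blk l) (qP fP_mono v) := fun u v => by
    refine del_mul_right hc.1 (hρ u) (hc.2.2 u v) ?_
    obtain ⟨u', hu⟩ := hn (blk l) u
    obtain ⟨v', hv⟩ := hn (blk l) v
    rw [← hu, ← hv]
    exact hc.2.2 u' v'
  have h1 := norm_qP_eq_one u x hx
  obtain ⟨v, hv⟩ := hn (blkR C3 x) u
  obtain ⟨w, hw⟩ := hn (blkR C3 (x * x)) u
  rw [← hv, ← hw] at h1 ⊢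
  rw [← key, ← map_mul, ← key, map_mul, h1]
  exact del_one_right (c_one_one hc) hc.1 _

lemma sum_multiplicative {A : Type} [AddCommMonoid A] [Fintype (Multiplicative (ZMod 2 × ZMod 2))]
    (f : Multiplicative (ZMod 2 × ZMod 2) → A) :
    ∑ g, f g = f (.ofAdd (0, 0)) + f (.ofAdd (0, 1)) + f (.ofAdd (1, 0)) + f (.ofAdd (1, 1)) := by
  have e : ∑ g, f g = ∑ x : ZMod 2 × ZMod 2, f (.ofAdd x) :=
    Fintype.sum_equiv Multiplicative.toAdd _ _ fun _ => rfl
  rw [e, Fintype.sum_prod_type]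
  have h2 : ∀ g : ZMod 2 → A, ∑ x, g x = g 0 + g 1 := fun g => Fin.sum_univ_two g
  rw [h2, h2, h2]
  abel

lemma conj_sum_eq (D : N)
    (hD : ∀ x : C3 × C3, x = (jj, 1) ∨ x = (1, jj) →
      D + ρ (blkR C3 x) D + ρ (blkR C3 (x * x)) D = 0) [Fintype (Multiplicative (ZMod 2 × ZMod 2))] :
    ∑ g, ρ (sP fP_mono g) (ρ (blkR C3 (jj, jj)) (ρ (sP fP_mono g)⁻¹ D)) = D := by
  have h1 : ∀ g, ρ (sP fP_mono g) (ρ (blkR C3 (jj, jj)) (ρ (sP fP_mono g)⁻¹ D)) =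
      ρ (sP fP_mono g * blkR C3 (jj, jj) * (sP fP_mono g)⁻¹) D := fun g => by rw [rho_mul, rho_mul]
  have c00 : sP fP_mono (.ofAdd (0, 0)) * blkR C3 (jj, jj) * (sP fP_mono (.ofAdd (0, 0)))⁻¹ =
      blkR C3 ((1, jj) * (jj, 1)) := by
    rw [sP_eq_blk, blkR_jj_jj, map_mul, blkR_one_jj, blkR_jj_one]
    refine (blk_conj xe_zero_conj xe_zero_conj).trans ?_
    rw [← map_mul, Prod.mk_mul_mk, one_mul, mul_one]
  have c01 : sP fP_mono (.ofAdd (0, 1)) * blkR C3 (jj, jj) * (sP fP_mono (.ofAdd (0, 1)))⁻¹ =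
      blkR C3 ((1, jj) * (1, jj) * (jj, 1)) := by
    rw [sP_eq_blk, blkR_jj_jj, map_mul, map_mul, blkR_one_jj, blkR_jj_one]
    refine (blk_conj xe_zero_conj xe_one_conj).trans ?_
    simp only [← map_mul, Prod.mk_mul_mk, one_mul, mul_one]
  have c10 : sP fP_mono (.ofAdd (1, 0)) * blkR C3 (jj, jj) * (sP fP_mono (.ofAdd (1, 0)))⁻¹ =
      blkR C3 ((1, jj) * ((jj, 1) * (jj, 1))) := by
    rw [sP_eq_blk, blkR_jj_jj, map_mul, map_mul, blkR_one_jj, blkR_jj_one]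
    refine (blk_conj xe_one_conj xe_zero_conj).trans ?_
    simp only [← map_mul, Prod.mk_mul_mk, one_mul, mul_one]
  have c11 : sP fP_mono (.ofAdd (1, 1)) * blkR C3 (jj, jj) * (sP fP_mono (.ofAdd (1, 1)))⁻¹ =
      blkR C3 ((1, jj) * (1, jj) * ((jj, 1) * (jj, 1))) := by
    rw [sP_eq_blk, blkR_jj_jj, map_mul, map_mul, map_mul, blkR_one_jj, blkR_jj_one]
    refine (blk_conj xe_one_conj xe_one_conj).trans ?_
    simp only [← map_mul, Prod.mk_mul_mk, one_mul, mul_one]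
  have hm : ∀ x y, ρ (blkR C3 (x * y)) D = ρ (blkR C3 x) (ρ (blkR C3 y) D) := fun x y => by
    rw [map_mul, rho_mul]
  rw [sum_multiplicative, h1, h1, h1, h1, c00, c01, c10, c11, hm, hm (_ * _), hm _ (_ * _), hm (_ * _)]
  have hA := hD (jj, 1) (.inl rfl)
  have hB := hD (1, jj) (.inr rfl)
  have e1 := congrArg (ρ (blkR C3 (1, jj))) hA
  have e2 := congrArg (ρ (blkR C3 ((1, jj) * (1, jj)))) hA
  simp only [map_add, map_zero] at e1 e2
  linear_combination (norm := abel) e1 + e2 - hB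

lemma conj_blkR_C3 (l : Multiplicative (ZMod 2 × ZMod 2)) (x : C3 × C3) (hx : x = (jj, 1) ∨ x = (1, jj)) :
    sP fP_mono l * blkR C3 (x * x) * (sP fP_mono l)⁻¹ = blkR C3 (x * x) ∧
        sP fP_mono l * blkR C3 x * (sP fP_mono l)⁻¹ = blkR C3 x ∨
      sP fP_mono l * blkR C3 (x * x) * (sP fP_mono l)⁻¹ = blkR C3 x ∧
        sP fP_mono l * blkR C3 x * (sP fP_mono l)⁻¹ = blkR C3 (x * x) := by
  have key : ∀ a : ZMod 2, xe a * (jm * jm) * (xe a)⁻¹ = jm * jm ∧ xe a * jm * (xe a)⁻¹ = jm ∨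
      xe a * (jm * jm) * (xe a)⁻¹ = jm ∧ xe a * jm * (xe a)⁻¹ = jm * jm := by decide +kernel
  have one : ∀ a : ZMod 2, xe a * 1 * (xe a)⁻¹ = 1 := fun a => by rw [mul_one, mul_inv_cancel]
  rw [sP_eq_blk]
  obtain rfl | rfl := hx
  · rw [map_mul, blkR_jj_one, ← map_mul, Prod.mk_mul_mk, one_mul]
    obtain ⟨h1, h2⟩ | ⟨h1, h2⟩ := key l.toAdd.1
    · exact .inl ⟨blk_conj h1 (one _), blk_conj h2 (one _)⟩
    · exact .inr ⟨blk_conj h1 (one _), blk_conj h2 (one _)⟩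
  · rw [map_mul, blkR_one_jj, ← map_mul, Prod.mk_mul_mk, one_mul]
    obtain ⟨h1, h2⟩ | ⟨h1, h2⟩ := key l.toAdd.2
    · exact .inl ⟨blk_conj (one _) h1, blk_conj (one _) h2⟩
    · exact .inr ⟨blk_conj (one _) h1, blk_conj (one _) h2⟩

lemma mem_B2_of_mem_Z0 (hρ : ∀ x v, ρ (qP fP_mono x) v = v) (hc : c ∈ Z0 (qP fP_mono) (ThG C3).subtype ρ)
    (hs : c ∈ Zr (sP fP_mono) ρ) : c ∈ B2 ρ := by
  have := Fintype.ofFinite (Multiplicative (ZMod 2 × ZMod 2))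
  refine mem_B2_of_average (p := 2) hρ hc.1 hc.2.2 hs.2 (ρ (blkR C3 (jj, jj))) fun l u => ?_
  refine conj_sum_eq _ fun x hx => ?_
  have h1 := del_norm_eq_zero hρ hc (xe l.toAdd.1, xe l.toAdd.2) x hx u
  rw [← sP_eq_blk] at h1
  obtain ⟨e1, e2⟩ | ⟨e1, e2⟩ := conj_blkR_C3 l x hx
  · rwa [e1, e2] at h1
  · rw [e1, e2] at h1
    rw [← h1]
    abel

lemma Zr_inf_Zr_le_B2 (hρ : ∀ x v, ρ (qP fP_mono x) v = v) :
    Zr (qP fP_mono) ρ ⊓ Zr (sP fP_mono) ρ ≤ B2 ρ := by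
  refine (inf_le_inf_sup (Zr_le_Z0_ThG (p := 2) isComplement2_C3 (by decide) ρ) (B2_le_Zr _ ρ)).trans ?_
  refine sup_le (fun c hc => ?_) le_rfl
  exact mem_B2_of_mem_Z0 hρ (Submodule.mem_inf.1 hc).1 (Submodule.mem_inf.1 hc).2

end TwoElements

section TwoFunctionals

lemma C3_cases (A : C3) : A = 1 ∨ A = jj ∨ A = jj * jj := by
  have h : ∀ A : SL2 (ZMod 2), A ^ 3 = 1 → A = 1 ∨ A = jm ∨ A = jm * jm := by decide +kernel
  obtain h | h | h := h A.1 (mem_C3.1 A.2)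
  · exact .inl (Subtype.ext h)
  · exact .inr (.inl (Subtype.ext h))
  · exact .inr (.inr (Subtype.ext h))

lemma rho_C3_eq {H N : Type} [Group H] [AddCommGroup N] [Module (ZMod 2) N] {ρ : Representation (ZMod 2) H N}
    (θ : C3 →* H) {v : N} (h : ρ (θ jj) v = v) (A : C3) : ρ (θ A) v = v := by
  obtain rfl | rfl | rfl := C3_cases A
  · rw [map_one, map_one]; rfl
  · exact h
  · rw [map_mul, rho_mul, h, h]

lemma mem_invariants_blkR_C3 {N : Type} [AddCommGroup N] [Module (ZMod 2) N]
    {ρ : Representation (ZMod 2) (Par fP : Subgroup (G (ZMod 2))) N} {v : N}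
    (ha : ρ (blk (jm, 1)) v = v) (hb : ρ (blk (1, jm)) v = v) : v ∈ Representation.invariants (ρ.comp (blkR C3)) := by
  rw [← blkR_jj_one] at ha
  rw [← blkR_one_jj] at hb
  have hA := rho_C3_eq (ρ := ρ) ((blkR C3).comp (MonoidHom.inl C3 C3)) ha
  have hB := rho_C3_eq (ρ := ρ) ((blkR C3).comp (MonoidHom.inr C3 C3)) hb
  rintro ⟨A, B⟩
  have hA' : ρ (blkR C3 (A, 1)) v = v := hA A
  have hB' : ρ (blkR C3 (1, B)) v = v := hB B
  change ρ (blkR C3 (A, B)) v = v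
  rw [← mul_one A, ← one_mul B, ← Prod.mk_mul_mk, map_mul, rho_mul, hB', hA']

lemma pif_two_mul {H N : Type} [Group H] [AddCommGroup N] [Module (ZMod 2) N] {ρ : Representation (ZMod 2) H N}
    {c : H → H → N} (hc : c ∈ Z2 ρ) {x y : H} (hxy : x * y = y * x) (hx : ∀ v, ρ x v = v) (hy : ∀ v, ρ y v = v)
    (hx2 : x * x = 1) : pif 2 c (x * y) = pif 2 c x + pif 2 c y + bet c x y := by
  have e0 : ∀ z, pif 2 c z = c 1 1 + c z z := fun z => by
    rw [pif, Finset.sum_range_succ, Finset.sum_range_one, pow_zero, pow_one, one_left hc]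
  have e1 := hc (x * y) x y
  have e2 := hc y x x
  have hy1 : c y 1 = c 1 1 := by rw [one_right hc, hy]
  rw [rho_mul, hy, hx, hxy, mul_assoc, hx2, mul_one, ← hxy] at e1
  rw [hx2, hy, hy1, ← hxy] at e2
  rw [e0, e0, e0, bet]
  have e3 : ∀ v : N, v + v = 0 := fun v => by rw [← two_smul (ZMod 2) v]; exact zero_smul _ v
  linear_combination (norm := abel) e1 - e2 - e3 (c x y)

variable {N : Type} [AddCommGroup N] [Module (ZMod 2) N] [FiniteDimensional (ZMod 2) N]
  {ρ : Representation (ZMod 2) (Par fP : Subgroup (G (ZMod 2))) N}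
  {c : ↥(Par fP : Subgroup (G (ZMod 2))) → ↥(Par fP : Subgroup (G (ZMod 2))) → N}

lemma blk_conj_qP {K : Type} [Field K] {A B : SL2 K} {a b c d a' b' c' d' : K}
    (h1 : A.1 0 0 * a + A.1 0 1 * c = a' * B.1 0 0 + b' * B.1 1 0)
    (h2 : A.1 0 0 * b + A.1 0 1 * d = a' * B.1 0 1 + b' * B.1 1 1)
    (h3 : A.1 1 0 * a + A.1 1 1 * c = c' * B.1 0 0 + d' * B.1 1 0)
    (h4 : A.1 1 0 * b + A.1 1 1 * d = c' * B.1 0 1 + d' * B.1 1 1) :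
    blk (A, B) * qP fP_mono (.ofAdd (a, b, c, d)) * (blk (A, B))⁻¹ = qP fP_mono (.ofAdd (a', b', c', d')) := by
  rw [mul_inv_eq_iff_eq_mul]
  apply Subtype.ext
  apply Subtype.ext
  change blkM _ _ * (sQ _).1 = (sQ _).1 * blkM _ _
  rw [sQ_coe, sQ_coe]
  ext i j
  fin_cases i <;> fin_cases j <;>
    simp [blkM, Matrix.mul_apply, Fin.sum_univ_four, h1, h2, h3, h4]

lemma qP_mul (m n : ZMod 2 × ZMod 2 × ZMod 2 × ZMod 2) :
    qP (K := ZMod 2) fP_mono (.ofAdd m) * qP fP_mono (.ofAdd n) = qP fP_mono (.ofAdd (m + n)) := by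
  rw [← map_mul]; rfl

lemma qP_comm (m n : ZMod 2 × ZMod 2 × ZMod 2 × ZMod 2) :
    qP (K := ZMod 2) fP_mono (.ofAdd m) * qP fP_mono (.ofAdd n) =
      qP fP_mono (.ofAdd n) * qP fP_mono (.ofAdd m) := by
  rw [qP_mul, qP_mul, add_comm]

lemma qP_mul_self (m : ZMod 2 × ZMod 2 × ZMod 2 × ZMod 2) :
    qP (K := ZMod 2) fP_mono (.ofAdd m) * qP fP_mono (.ofAdd m) = 1 := by
  rw [qP_mul, CharTwo.add_self_eq_zero]
  exact map_one _

/-- The square functional on the unipotent radical. -/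
def sqQ (c : ↥(Par fP : Subgroup (G (ZMod 2))) → ↥(Par fP : Subgroup (G (ZMod 2))) → N)
    (m : ZMod 2 × ZMod 2 × ZMod 2 × ZMod 2) : N := pif 2 c (qP fP_mono (.ofAdd m))

/-- The commutator functional on the unipotent radical. -/
def beQ (c : ↥(Par fP : Subgroup (G (ZMod 2))) → ↥(Par fP : Subgroup (G (ZMod 2))) → N)
    (m n : ZMod 2 × ZMod 2 × ZMod 2 × ZMod 2) : N :=
  bet c (qP fP_mono (.ofAdd m)) (qP fP_mono (.ofAdd n))

variable (hρ : ∀ x v, ρ (qP fP_mono x) v = v) (hc : c ∈ Z2 ρ)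
include hρ hc

lemma sqQ_add (m n) : sqQ c (m + n) = sqQ c m + sqQ c n + beQ c m n := by
  rw [sqQ, ← qP_mul, pif_two_mul hc (qP_comm m n) (hρ _) (hρ _) (qP_mul_self m)]
  rfl

lemma beQ_add_left (m m' n) : beQ c (m + m') n = beQ c m n + beQ c m' n := by
  rw [beQ, ← qP_mul, bet_mul_left hc (qP_comm _ _) (qP_comm _ _) (hρ _) (hρ _)]
  rfl

omit hρ hc in
lemma beQ_swap (m n) : beQ c m n = beQ c n m := by
  have e3 : ∀ v : N, v + v = 0 := fun v => by rw [← two_smul (ZMod 2) v]; exact zero_smul _ v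
  rw [beQ, bet_swap, neg_eq_of_add_eq_zero_left (e3 _)]
  rfl

lemma beQ_add_right (m n n') : beQ c m (n + n') = beQ c m n + beQ c m n' := by
  rw [beQ_swap, beQ_add_left hρ hc, beQ_swap, beQ_swap n']

lemma sqQ_conj {A B : SL2 (ZMod 2)} {m m'}
    (h : blk (A, B) * qP fP_mono (.ofAdd m) * (blk (A, B))⁻¹ = qP fP_mono (.ofAdd m')) :
    sqQ c m' = ρ (blk (A, B)) (sqQ c m) := by
  rw [sqQ, ← h, pif_conj 2 hc (hρ _) (by rw [pow_two, qP_mul_self])]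
  rfl

lemma beQ_conj {A B : SL2 (ZMod 2)} {m m' n n'}
    (h : blk (A, B) * qP fP_mono (.ofAdd m) * (blk (A, B))⁻¹ = qP fP_mono (.ofAdd m'))
    (h' : blk (A, B) * qP fP_mono (.ofAdd n) * (blk (A, B))⁻¹ = qP fP_mono (.ofAdd n')) :
    beQ c m' n' = ρ (blk (A, B)) (beQ c m n) := by
  rw [beQ, ← h, ← h', bet_conj hc (qP_comm _ _) (hρ _) (hρ _)]
  rfl

omit hρ hc in
lemma exists_blk_rank_one (a b c d : ZMod 2) (h0 : (a, b, c, d) ≠ 0) (hd : a * d = b * c) :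
    ∃ A B : SL2 (ZMod 2), blk (A, B) * qP fP_mono (.ofAdd (0, 1, 0, 0)) * (blk (A, B))⁻¹ =
      qP fP_mono (.ofAdd (a, b, c, d)) := by
  have h : ∀ a b c d : ZMod 2, (a, b, c, d) ≠ 0 → a * d = b * c → ∃ A B : SL2 (ZMod 2),
      (0 = a * B.1 0 0 + b * B.1 1 0 ∧ A.1 0 0 = a * B.1 0 1 + b * B.1 1 1) ∧
      (0 = c * B.1 0 0 + d * B.1 1 0 ∧ A.1 1 0 = c * B.1 0 1 + d * B.1 1 1) := by decide +kernel
  obtain ⟨A, B, ⟨h1, h2⟩, h3, h4⟩ := h a b c d h0 hd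
  refine ⟨A, B, blk_conj_qP ?_ ?_ ?_ ?_⟩ <;> simpa

lemma exists_sqQ_eq (a b d e : ZMod 2) (h0 : (a, b, d, e) ≠ 0) (hd : a * e = b * d) :
    ∃ A B : SL2 (ZMod 2), sqQ c (a, b, d, e) = ρ (blk (A, B)) (sqQ c (0, 1, 0, 0)) := by
  obtain ⟨A, B, h⟩ := exists_blk_rank_one a b d e h0 hd
  exact ⟨A, B, sqQ_conj hρ hc h⟩

omit hρ hc in
lemma zmod_two_cases (s : ZMod 2) : s = 0 ∨ s = 1 := by revert s; decide

lemma pull_qP_mem_B2_two (h1 : beQ c (0, 1, 0, 0) (0, 0, 1, 0) = 0) (h2 : sqQ c (0, 1, 0, 0) = 0) :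
    pull (ZMod 2) (qP fP_mono) c ∈ B2 (ρ.comp (qP fP_mono)) := by
  have e0 : qP (K := ZMod 2) fP_mono (.ofAdd (0, 0, 0, 0)) = 1 := map_one _
  refine pull_qP_mem_B2 (p := 2) hρ hc (fun s t => ?_) (fun s => ?_)
  · rw [Y03, Y12]
    obtain rfl | rfl := zmod_two_cases s
    · rw [e0, bet_one_left hc (hρ _)]
    · obtain rfl | rfl := zmod_two_cases t
      · rw [e0, bet_swap, bet_one_left hc (hρ _), neg_zero]
      · exact h1
  · rw [Y03]
    obtain rfl | rfl := zmod_two_cases s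
    · have h3 := sqQ_add hρ hc (0, 1, 0, 0) (0, 1, 0, 0)
      rwa [beQ, bet_self, h2, CharTwo.add_self_eq_zero, add_zero, add_zero] at h3
    · exact h2

omit hρ in
lemma pull_sP_mem_B2_two (hs : ∀ x v, ρ (sP fP_mono x) v = v) (h1 : bet c (Y fP 0 1 1) (Y fP 2 3 1) = 0)
    (h2 : pif 2 c (Y fP 0 1 1) = 0) (h3 : pif 2 c (Y fP 2 3 1) = 0) :
    pull (ZMod 2) (sP fP_mono) c ∈ B2 (ρ.comp (sP fP_mono)) := by
  have e0 : sP (K := ZMod 2) fP_mono (.ofAdd (0, 0)) = 1 := map_one _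
  have t1 : ∀ s v, ρ (Y fP 0 1 s) v = v := fun s v => by rw [Y01 fP_mono, hs]
  have t2 : ∀ s v, ρ (Y fP 2 3 s) v = v := fun s v => by rw [Y23 fP_mono, hs]
  have z1 : Y (K := ZMod 2) fP 0 1 0 = 1 := by rw [Y01 fP_mono, e0]
  have z2 : Y (K := ZMod 2) fP 2 3 0 = 1 := by rw [Y23 fP_mono, e0]
  have p1 : pif 2 c 1 = 0 := by
    have := pif_two_mul hc (x := 1) (y := 1) rfl (fun v => by simp) (fun v => by simp) (mul_one 1)
    rwa [mul_one, bet_self, add_zero, left_eq_add] at this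
  refine pull_sP_mem_B2 2 fP_mono hs hc (fun s t => ?_) (fun s t => ?_) (fun s t => ?_) (fun s => ?_) (fun s => ?_)
  · obtain rfl | rfl := zmod_two_cases s
    · rw [z1, bet_one_left hc (t2 _)]
    · obtain rfl | rfl := zmod_two_cases t
      · rw [z2, bet_swap, bet_one_left hc (t1 _), neg_zero]
      · exact h1
  · obtain rfl | rfl := zmod_two_cases s
    · rw [z1, bet_one_left hc (t1 _)]
    · obtain rfl | rfl := zmod_two_cases t
      · rw [z1, bet_swap, bet_one_left hc (t1 _), neg_zero]
      · exact bet_self _ _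
  · obtain rfl | rfl := zmod_two_cases s
    · rw [z2, bet_one_left hc (t2 _)]
    · obtain rfl | rfl := zmod_two_cases t
      · rw [z2, bet_swap, bet_one_left hc (t2 _), neg_zero]
      · exact bet_self _ _
  · obtain rfl | rfl := zmod_two_cases s
    · rw [z1, p1]
    · exact h2
  · obtain rfl | rfl := zmod_two_cases s
    · rw [z2, p1]
    · exact h3

lemma sqQ_eq_of_blk_trivial (hb : ∀ x v, ρ (blk x) v = v) (a b d e : ZMod 2) (h0 : (a, b, d, e) ≠ 0)
    (hd : a * e = b * d) : sqQ c (a, b, d, e) = sqQ c (0, 1, 0, 0) := by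
  obtain ⟨A, B, h⟩ := exists_sqQ_eq hρ hc a b d e h0 hd
  rw [h, hb]

lemma sqQ_eq_zero_of_blk_trivial (hb : ∀ x v, ρ (blk x) v = v) : sqQ c (0, 1, 0, 0) = 0 := by
  have hx : (xe (1 : ZMod 2)).1 = !![1, 1; 0, 1] := by decide +kernel
  have a1 : blk (xe (1 : ZMod 2), 1) * qP fP_mono (.ofAdd (0, 0, 1, 0)) * (blk (xe 1, 1))⁻¹ =
      qP fP_mono (.ofAdd (1, 0, 1, 0)) := by apply blk_conj_qP <;> simp [hx]
  have a2 : blk (xe (1 : ZMod 2), 1) * qP fP_mono (.ofAdd (0, 1, 0, 0)) * (blk (xe 1, 1))⁻¹ =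
      qP fP_mono (.ofAdd (0, 1, 0, 0)) := by apply blk_conj_qP <;> simp [hx]
  have h1 := beQ_conj hρ hc a1 a2
  have e1 : ((1, 0, 1, 0) : ZMod 2 × ZMod 2 × ZMod 2 × ZMod 2) = (1, 0, 0, 0) + (0, 0, 1, 0) := by decide
  rw [hb, e1, beQ_add_left hρ hc, add_eq_right] at h1
  have h2 := sqQ_add hρ hc (1, 0, 0, 0) (0, 1, 0, 0)
  have e2 : ((1, 0, 0, 0) + (0, 1, 0, 0) : ZMod 2 × ZMod 2 × ZMod 2 × ZMod 2) = (1, 1, 0, 0) := by decide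
  have h3 := sqQ_eq_of_blk_trivial hρ hc hb 1 0 0 0 (by decide) (by decide)
  have h4 := sqQ_eq_of_blk_trivial hρ hc hb 1 1 0 0 (by decide) (by decide)
  rw [e2, h1, h3, h4, add_zero] at h2
  exact left_eq_add.1 h2

lemma beQ_eq_zero_of_invariants (h0 : Representation.invariants (ρ.comp (blkR C3)) = ⊥)
    (hP : sqQ c (0, 1, 0, 0) = 0) : beQ c (0, 1, 0, 0) (0, 0, 1, 0) = 0 := by
  have hP' : ∀ a b d e : ZMod 2, (a, b, d, e) ≠ 0 → a * e = b * d → sqQ c (a, b, d, e) = 0 :=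
    fun a b d e h1 h2 => by
      obtain ⟨A, B, h⟩ := exists_sqQ_eq hρ hc a b d e h1 h2
      rw [h, hP, map_zero]
  have p1 := hP' 1 0 0 0 (by decide) (by decide)
  have p3 := hP' 0 0 1 0 (by decide) (by decide)
  have p4 := hP' 0 0 0 1 (by decide) (by decide)
  have p12 := hP' 1 1 0 0 (by decide) (by decide)
  have p13 := hP' 1 0 1 0 (by decide) (by decide)
  have p24 := hP' 0 1 0 1 (by decide) (by decide)
  have p34 := hP' 0 0 1 1 (by decide) (by decide)
  have pa := hP' 1 1 1 1 (by decide) (by decide)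
  have s12 : ((1, 1, 0, 0) : ZMod 2 × ZMod 2 × ZMod 2 × ZMod 2) = (1, 0, 0, 0) + (0, 1, 0, 0) := by decide
  have s13 : ((1, 0, 1, 0) : ZMod 2 × ZMod 2 × ZMod 2 × ZMod 2) = (1, 0, 0, 0) + (0, 0, 1, 0) := by decide
  have s24 : ((0, 1, 0, 1) : ZMod 2 × ZMod 2 × ZMod 2 × ZMod 2) = (0, 1, 0, 0) + (0, 0, 0, 1) := by decide
  have s34 : ((0, 0, 1, 1) : ZMod 2 × ZMod 2 × ZMod 2 × ZMod 2) = (0, 0, 1, 0) + (0, 0, 0, 1) := by decide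
  have sa : ((1, 1, 1, 1) : ZMod 2 × ZMod 2 × ZMod 2 × ZMod 2) = (1, 1, 0, 0) + (0, 0, 1, 1) := by decide
  rw [sa, sqQ_add hρ hc, p12, p34, s12, s34, beQ_add_left hρ hc, beQ_add_right hρ hc, beQ_add_right hρ hc] at pa
  rw [s12, sqQ_add hρ hc, p1, hP] at p12
  rw [s13, sqQ_add hρ hc, p1, p3] at p13
  rw [s24, sqQ_add hρ hc, p4, hP] at p24
  rw [s34, sqQ_add hρ hc, p3, p4] at p34
  rw [zero_add, zero_add] at p12 p13 p24 p34
  rw [p24, p13, zero_add, zero_add, zero_add, add_zero] at pa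
  have e3 : ∀ v : N, v + v = 0 := fun v => by rw [← two_smul (ZMod 2) v]; exact zero_smul _ v
  have h14 : beQ c (1, 0, 0, 0) (0, 0, 0, 1) = beQ c (0, 1, 0, 0) (0, 0, 1, 0) := by
    rw [eq_neg_of_add_eq_zero_left pa, neg_eq_of_add_eq_zero_left (e3 _)]
  have hj : jm.1 = !![0, 1; 1, 1] := by decide +kernel
  have a1 : blk (jm, 1) * qP fP_mono (.ofAdd (0, 1, 0, 0)) * (blk (jm, 1))⁻¹ =
      qP fP_mono (.ofAdd (0, 0, 0, 1)) := by apply blk_conj_qP <;> simp [hj]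
  have a2 : blk (jm, 1) * qP fP_mono (.ofAdd (0, 0, 1, 0)) * (blk (jm, 1))⁻¹ =
      qP fP_mono (.ofAdd (1, 0, 1, 0)) := by apply blk_conj_qP <;> simp [hj]
  have b1 : blk (1, jm) * qP fP_mono (.ofAdd (0, 1, 0, 0)) * (blk (1, jm))⁻¹ =
      qP fP_mono (.ofAdd (1, 0, 0, 0)) := by apply blk_conj_qP <;> simp [hj]
  have b2 : blk (1, jm) * qP fP_mono (.ofAdd (0, 0, 1, 0)) * (blk (1, jm))⁻¹ =
      qP fP_mono (.ofAdd (0, 0, 1, 1)) := by apply blk_conj_qP <;> simp [hj, CharTwo.add_self_eq_zero]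
  have ra := beQ_conj hρ hc a1 a2
  have rb := beQ_conj hρ hc b1 b2
  rw [s13, beQ_add_right hρ hc, beQ_swap _ (1, 0, 0, 0), beQ_swap _ (0, 0, 1, 0), p34, add_zero, h14] at ra
  rw [s34, beQ_add_right hρ hc, p13, zero_add, h14] at rb
  generalize beQ c (0, 1, 0, 0) (0, 0, 1, 0) = b at ra rb
  have := mem_invariants_blkR_C3 (ρ := ρ) ra.symm rb.symm
  rwa [h0, Submodule.mem_bot] at this

lemma rho_sP_sqQ (x) : ρ (sP fP_mono x) (sqQ c (0, 1, 0, 0)) = sqQ c (0, 1, 0, 0) := by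
  have hx : ∀ s : ZMod 2, (xe s).1 = !![1, s; 0, 1] := by decide +kernel
  rw [sP_eq_blk]
  exact (sqQ_conj hρ hc (blk_conj_qP (by simp [hx]) (by simp [hx]) (by simp [hx]) (by simp [hx]))).symm

end TwoFunctionals

section TwoLayers

variable {N : Type} [AddCommGroup N] [Module (ZMod 2) N] [FiniteDimensional (ZMod 2) N]

/-- The value of the commutator functional at a pair of elements, as a linear map on cochains. -/
def betN {H : Type} [Group H] (x y : H) : (H → H → N) →ₗ[ZMod 2] N where
  toFun c := bet c x y
  map_add' c c' := by simp only [bet, Pi.add_apply]; abel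
  map_smul' r c := by simp [bet, smul_sub]

/-- The value of the square functional at an element, as a linear map on cochains. -/
def pifN {H : Type} [Group H] (x : H) : (H → H → N) →ₗ[ZMod 2] N where
  toFun c := pif 2 c x
  map_add' c c' := by simp [pif, Finset.sum_add_distrib]
  map_smul' r c := by simp [pif, Finset.smul_sum]

lemma relDim_le_add_finrank {C : Type} [AddCommGroup C] [Module (ZMod 2) C] [FiniteDimensional (ZMod 2) C]
    (Φ : C →ₗ[ZMod 2] N) (Z B : Submodule (ZMod 2) C) :
    relDim Z B ≤ finrank (ZMod 2) N + relDim (Z ⊓ LinearMap.ker Φ) B := by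
  have := relDim_le_add_ker Φ Z B ⊤ fun _ _ => Submodule.mem_top
  rwa [finrank_top] at this

variable {ρ : Representation (ZMod 2) (Par fP : Subgroup (G (ZMod 2))) N} 

lemma relDim_le_of_blk_trivial (hρ : ∀ x v, ρ (qP fP_mono x) v = v) (hb : ∀ x v, ρ (blk x) v = v) :
    relDim (Z2 ρ) (B2 ρ) ≤ 4 * finrank (ZMod 2) N := by
  have h1 := relDim_le_add_finrank (betN (N := N) (qP (K := ZMod 2) fP_mono (.ofAdd (0, 1, 0, 0)))
    (qP fP_mono (.ofAdd (0, 0, 1, 0)))) (Z2 ρ) (B2 ρ)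
  have h2 := relDim_le_add_finrank (betN (N := N) (Y (K := ZMod 2) fP 0 1 1) (Y fP 2 3 1))
    (Z2 ρ ⊓ LinearMap.ker (betN (N := N) (qP (K := ZMod 2) fP_mono (.ofAdd (0, 1, 0, 0)))
    (qP fP_mono (.ofAdd (0, 0, 1, 0))))) (B2 ρ)
  have h3 := relDim_le_add_finrank (pifN (N := N) (Y (K := ZMod 2) fP 0 1 1))
    (Z2 ρ ⊓ LinearMap.ker (betN (N := N) (qP (K := ZMod 2) fP_mono (.ofAdd (0, 1, 0, 0)))
    (qP fP_mono (.ofAdd (0, 0, 1, 0)))) ⊓ LinearMap.ker (betN (N := N) (Y (K := ZMod 2) fP 0 1 1) (Y fP 2 3 1)))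
    (B2 ρ)
  have h4 := relDim_le_add_finrank (pifN (N := N) (Y (K := ZMod 2) fP 2 3 1))
    (Z2 ρ ⊓ LinearMap.ker (betN (N := N) (qP (K := ZMod 2) fP_mono (.ofAdd (0, 1, 0, 0)))
    (qP fP_mono (.ofAdd (0, 0, 1, 0)))) ⊓ LinearMap.ker (betN (N := N) (Y (K := ZMod 2) fP 0 1 1) (Y fP 2 3 1)) ⊓
    LinearMap.ker (pifN (N := N) (Y (K := ZMod 2) fP 0 1 1))) (B2 ρ)
  have h5 : relDim (Z2 ρ ⊓ LinearMap.ker (betN (N := N) (qP (K := ZMod 2) fP_mono (.ofAdd (0, 1, 0, 0)))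
    (qP fP_mono (.ofAdd (0, 0, 1, 0)))) ⊓ LinearMap.ker (betN (N := N) (Y (K := ZMod 2) fP 0 1 1) (Y fP 2 3 1)) ⊓
    LinearMap.ker (pifN (N := N) (Y (K := ZMod 2) fP 0 1 1)) ⊓
      LinearMap.ker (pifN (N := N) (Y (K := ZMod 2) fP 2 3 1))) (B2 ρ) = 0 := by
    refine relDim_eq_zero ?_
    intro c h
    obtain ⟨h, k4⟩ := Submodule.mem_inf.1 h
    obtain ⟨h, k3⟩ := Submodule.mem_inf.1 h
    obtain ⟨h, k2⟩ := Submodule.mem_inf.1 h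
    obtain ⟨hc, k1⟩ := Submodule.mem_inf.1 h
    have hq := pull_qP_mem_B2_two hρ hc k1 (sqQ_eq_zero_of_blk_trivial hρ hc hb)
    have hs := pull_sP_mem_B2_two hc (fun x v => by rw [sP_eq_blk, hb]) k2 k3 k4
    exact Zr_inf_Zr_le_B2 hρ (Submodule.mem_inf.2 ⟨mem_Zr.2 ⟨hc, hq⟩, mem_Zr.2 ⟨hc, hs⟩⟩)
  omega

lemma relDim_le_of_invariants_eq_bot (hρ : ∀ x v, ρ (qP fP_mono x) v = v)
    (h0 : Representation.invariants (ρ.comp (blkR C3)) = ⊥) :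
    relDim (Z2 ρ) (B2 ρ) ≤ finrank (ZMod 2) (Representation.invariants (ρ.comp (sP fP_mono))) := by
  have h1 := relDim_le_add_ker (pifN (N := N) (qP (K := ZMod 2) fP_mono (.ofAdd (0, 1, 0, 0)))) (Z2 ρ) (B2 ρ)
    (Representation.invariants (ρ.comp (sP fP_mono))) fun c hc x => rho_sP_sqQ hρ hc x
  have h2 : relDim (Z2 ρ ⊓ LinearMap.ker (pifN (N := N) (qP (K := ZMod 2) fP_mono (.ofAdd (0, 1, 0, 0)))))
      (B2 ρ) = 0 := by
    refine relDim_eq_zero ?_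
    intro c h
    obtain ⟨hc, k1⟩ := Submodule.mem_inf.1 h
    have hq := pull_qP_mem_B2_two hρ hc (beQ_eq_zero_of_invariants hρ hc h0 k1) k1
    exact Zr_inf_Zr_le_B2 hρ (Submodule.mem_inf.2 ⟨mem_Zr.2 ⟨hc, hq⟩,
      Z2_le_Zr_sP (p := 2) isComplement2_C3 (by decide) h0 hc⟩)
  omega

end TwoLayers

section FixedSpaces

variable {H N : Type} [Group H] [AddCommGroup N] [Module (ZMod 2) N]

/-- The vectors fixed by every element of a list. -/
def fx (ρ : Representation (ZMod 2) H N) (L : List H) : Submodule (ZMod 2) N where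
  carrier := {v | ∀ g ∈ L, ρ g v = v}
  zero_mem' := by simp
  add_mem' {a b} ha hb g hg := by rw [map_add, ha g hg, hb g hg]
  smul_mem' r a ha g hg := by rw [map_smul, ha g hg]

variable {ρ : Representation (ZMod 2) H N}

lemma mem_fx {L : List H} {v : N} : v ∈ fx ρ L ↔ ∀ g ∈ L, ρ g v = v := Iff.rfl

lemma mem_fx_one {g : H} {v : N} : v ∈ fx ρ [g] ↔ ρ g v = v := by simp [mem_fx]

lemma mem_fx_two {g h : H} {v : N} : v ∈ fx ρ [g, h] ↔ ρ g v = v ∧ ρ h v = v := by simp [mem_fx]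

lemma add_self_zmod_two (v : N) : v + v = 0 := by rw [← two_smul (ZMod 2) v]; exact zero_smul _ v

variable [FiniteDimensional (ZMod 2) N]

lemma finrank_add_le_of_le {A B C : Submodule (ZMod 2) N} (h1 : A ≤ C) (h2 : B ≤ C) :
    finrank (ZMod 2) A + finrank (ZMod 2) B ≤ finrank (ZMod 2) C + finrank (ZMod 2) (A ⊓ B : Submodule (ZMod 2) N) := by
  rw [← Submodule.finrank_sup_add_finrank_inf_eq]
  exact Nat.add_le_add_right (Submodule.finrank_mono (sup_le h1 h2)) _

lemma rho_injective (g : H) : Function.Injective (ρ g) := fun v w h => by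
  have := congrArg (ρ g⁻¹) h
  rwa [← rho_mul, ← rho_mul, inv_mul_cancel, map_one] at this

lemma finrank_map_rho (g : H) (A : Submodule (ZMod 2) N) :
    finrank (ZMod 2) (A.map (ρ g)) = finrank (ZMod 2) A :=
  (Submodule.equivMapOfInjective (ρ g) (rho_injective g) A).finrank_eq.symm

lemma two_mul_finrank_le {T A : Submodule (ZMod 2) N} (g : H) (h1 : T ≤ A) (h2 : ∀ v ∈ T, ρ g v ∈ A)
    (h3 : ∀ v ∈ T, ρ g v ∈ T → v = 0) : 2 * finrank (ZMod 2) T ≤ finrank (ZMod 2) A := by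
  have h := finrank_add_le_of_le (A := T) (B := T.map (ρ g)) h1 (by rintro _ ⟨v, hv, rfl⟩; exact h2 v hv)
  have h0 : T ⊓ T.map (ρ g) = ⊥ := by
    rw [eq_bot_iff]
    intro w hw
    obtain ⟨hw, v, hv, rfl⟩ := Submodule.mem_inf.1 hw
    rw [h3 v hv hw, map_zero]
    exact Submodule.zero_mem _
  rw [finrank_map_rho, h0, finrank_bot] at h
  omega

lemma finrank_le_add_ker {T W : Submodule (ZMod 2) N} (f : N →ₗ[ZMod 2] N) (h : ∀ v ∈ T, f v ∈ W) :
    finrank (ZMod 2) T ≤ finrank (ZMod 2) W + finrank (ZMod 2) (T ⊓ LinearMap.ker f : Submodule (ZMod 2) N) := by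
  have h1 := relDim_le_add_ker f T (⊥ : Submodule (ZMod 2) N) W h
  have h2 : ∀ Z : Submodule (ZMod 2) N, relDim Z (⊥ : Submodule (ZMod 2) N) = finrank (ZMod 2) Z := fun Z =>
    (Submodule.equivMapOfInjective (⊥ : Submodule (ZMod 2) N).mkQ
      (LinearMap.ker_eq_bot.1 (Submodule.ker_mkQ _)) Z).finrank_eq.symm
  rwa [h2, h2] at h1

/-- The sum over the subgroup of order three generated by `g`. -/
def tr (ρ : Representation (ZMod 2) H N) (g : H) : N →ₗ[ZMod 2] N := LinearMap.id + ρ g + ρ (g * g)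

lemma tr_apply (g : H) (v : N) : tr ρ g v = v + ρ g v + ρ (g * g) v := rfl

lemma rho_tr {g : H} (hg : g * g * g = 1) (v : N) : ρ g (tr ρ g v) = tr ρ g v := by
  rw [tr_apply, map_add, map_add, ← rho_mul, ← rho_mul, ← mul_assoc, hg, map_one]
  change _ + _ + v = _
  abel

lemma rho_tr_eq {g h s : H} (hs : s * g = h * s) {v : N} (hv : ρ s v = v) : ρ s (tr ρ g v) = tr ρ h v := by
  rw [tr_apply, tr_apply, map_add, map_add, ← rho_mul, ← rho_mul, ← mul_assoc, hs, mul_assoc h, hs, ← mul_assoc,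
    rho_mul ρ h s, rho_mul ρ (h * h) s, hv]

lemma tr_of_rho_eq {g : H} {v : N} (h : ρ g v = v) : tr ρ g v = v := by
  rw [tr_apply, rho_mul, h, h, add_self_zmod_two, zero_add]

/-- The sum over the group generated by `a` and `b`. -/
def trr (ρ : Representation (ZMod 2) H N) (a b : H) : N →ₗ[ZMod 2] N := tr ρ a ∘ₗ tr ρ b

lemma sum_tr {a b : H} (hb : b * b * b = 1) (hab : a * b = b * a) (v : N) :
    tr ρ a v + tr ρ b v + tr ρ (a * b) v + tr ρ (a * (b * b)) v = v + trr ρ a b v := by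
  have hc : Commute a b := hab
  have e1 : a * b * (a * b) = a * a * (b * b) := hc.symm.mul_mul_mul_comm a b
  have hb' : b * b * (b * b) = b := by rw [← mul_assoc, hb, one_mul]
  have e2 : a * (b * b) * (a * (b * b)) = a * a * b := by
    rw [(hc.symm.mul_left hc.symm).mul_mul_mul_comm a (b * b), hb']
  rw [trr, LinearMap.comp_apply, tr_apply b]
  simp only [map_add, tr_apply, ← rho_mul, e1, e2]
  have := add_self_zmod_two v
  linear_combination (norm := abel) this

lemma trr_eq {a b : H} (hab : a * b = b * a) (v : N) : trr ρ a b v = trr ρ b a v := by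
  have hc : Commute a b := hab
  have h1 : a * a * b = b * (a * a) := hc.mul_left hc
  have h2 : a * (b * b) = b * b * a := hc.mul_right hc
  have h3 : a * a * (b * b) = b * b * (a * a) := (hc.mul_left hc).mul_right (hc.mul_left hc)
  rw [trr, trr, LinearMap.comp_apply, LinearMap.comp_apply]
  simp only [map_add, tr_apply, ← rho_mul, hab, h1, h2, h3]
  abel

lemma trr_mem {a b : H} (ha : a * a * a = 1) (hb : b * b * b = 1) (hab : a * b = b * a) (v : N) :
    trr ρ a b v ∈ fx ρ [a, b] := by
  refine mem_fx_two.2 ⟨rho_tr ha _, ?_⟩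
  rw [trr_eq hab]
  exact rho_tr hb _

lemma two_mul_finrank_fx_le {a b s t : H} (ha : a * a * a = 1) (hb : b * b * b = 1) (hab : a * b = b * a)
    (hsa : s * a = a * a * s) (hsb : s * b = b * s) (hta : t * a = a * t) (htb : t * b = b * b * t)
    (h0 : fx ρ [a, b] = ⊥) : 2 * finrank (ZMod 2) (fx ρ [s, t]) ≤
      finrank (ZMod 2) (fx ρ [a]) + finrank (ZMod 2) (fx ρ [b]) + finrank (ZMod 2) (fx ρ [a * b]) := by
  have hc : Commute a b := hab
  have h0' : ∀ v, ρ a v = v → ρ b v = v → v = 0 := fun v h1 h2 => by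
    have : v ∈ fx ρ [a, b] := mem_fx_two.2 ⟨h1, h2⟩
    rwa [h0, Submodule.mem_bot] at this
  have hsq : ∀ {g : H}, g * g * g = 1 → ∀ v, ρ (g * g) v = ρ g v → ρ g v = v := fun {g} hg v h => by
    rw [rho_mul] at h
    exact rho_injective g h
  have hab3 : a * b * (a * b) * (a * b) = 1 := by
    rw [hc.symm.mul_mul_mul_comm, (hc.symm.mul_left hc.symm).mul_mul_mul_comm, ha, hb, one_mul]
  have hst : s * t * (a * b) = a * b * (a * b) * (s * t) := by
    have hsb2 : s * (b * b) = b * b * s := ((show Commute s b from hsb).mul_right hsb).eq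
    rw [hc.symm.mul_mul_mul_comm, mul_assoc s, ← mul_assoc t, hta, mul_assoc a, htb, ← mul_assoc s, hsa, mul_assoc,
      ← mul_assoc s, hsb2, mul_assoc (b * b), ← mul_assoc (a * a)]
  have t1 : 2 * finrank (ZMod 2) (fx ρ [a, t]) ≤ finrank (ZMod 2) (fx ρ [a]) := by
    refine two_mul_finrank_le (ρ := ρ) b (fun v hv => mem_fx_one.2 (mem_fx_two.1 hv).1) (fun v hv => mem_fx_one.2 ?_)
      fun v hv hw => ?_
    · rw [← rho_mul, hab, rho_mul ρ b a, (mem_fx_two.1 hv).1]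
    · have h1 := (mem_fx_two.1 hw).2
      rw [← rho_mul, htb, rho_mul, (mem_fx_two.1 hv).2] at h1
      exact h0' v (mem_fx_two.1 hv).1 (hsq hb v h1)
  have t2 : 2 * finrank (ZMod 2) (fx ρ [b, s]) ≤ finrank (ZMod 2) (fx ρ [b]) := by
    refine two_mul_finrank_le (ρ := ρ) a (fun v hv => mem_fx_one.2 (mem_fx_two.1 hv).1) (fun v hv => mem_fx_one.2 ?_)
      fun v hv hw => ?_
    · rw [← rho_mul, ← hab, rho_mul, (mem_fx_two.1 hv).1]
    · have h1 := (mem_fx_two.1 hw).2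
      rw [← rho_mul, hsa, rho_mul, (mem_fx_two.1 hv).2] at h1
      exact h0' v (hsq ha v h1) (mem_fx_two.1 hv).1
  have hsta : s * t * a = a * a * (s * t) := by rw [mul_assoc, hta, ← mul_assoc, hsa, mul_assoc]
  have t3 : 2 * finrank (ZMod 2) (fx ρ [a * b, s * t]) ≤ finrank (ZMod 2) (fx ρ [a * b]) := by
    refine two_mul_finrank_le (ρ := ρ) a (fun v hv => mem_fx_one.2 (mem_fx_two.1 hv).1) (fun v hv => mem_fx_one.2 ?_)
      fun v hv hw => ?_
    · rw [← rho_mul, ((Commute.refl a).mul_left hc.symm).eq, rho_mul, (mem_fx_two.1 hv).1]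
    · have h1 := (mem_fx_two.1 hw).2
      rw [← rho_mul, hsta, rho_mul, (mem_fx_two.1 hv).2] at h1
      have h2 := hsq ha v h1
      have h3 := (mem_fx_two.1 hv).1
      rw [hab, rho_mul, h2] at h3
      exact h0' v h2 h3
  have u1 := finrank_le_add_ker (T := fx ρ [s, t]) (W := fx ρ [a, t]) (tr ρ a) fun v hv =>
    mem_fx_two.2 ⟨rho_tr ha v, rho_tr_eq hta (mem_fx_two.1 hv).2⟩
  have u2 := finrank_le_add_ker (T := fx ρ [s, t] ⊓ LinearMap.ker (tr ρ a)) (W := fx ρ [b, s]) (tr ρ b) fun v hv =>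
    mem_fx_two.2 ⟨rho_tr hb v, rho_tr_eq hsb (mem_fx_two.1 (Submodule.mem_inf.1 hv).1).1⟩
  have u3 := finrank_le_add_ker (T := fx ρ [s, t] ⊓ LinearMap.ker (tr ρ a) ⊓ LinearMap.ker (tr ρ b))
    (W := fx ρ [a * b, s * t]) (tr ρ (a * b)) fun v hv => by
      have h := mem_fx_two.1 (Submodule.mem_inf.1 (Submodule.mem_inf.1 hv).1).1
      refine mem_fx_two.2 ⟨rho_tr hab3 v, ?_⟩
      have h1 : ρ (s * t) (tr ρ (a * b) v) = tr ρ (a * b * (a * b)) v :=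
        rho_tr_eq hst (by rw [rho_mul, h.2, h.1])
      have h2 : a * b * (a * b) * (a * b * (a * b)) = a * b := by rw [← mul_assoc, hab3, one_mul]
      rw [h1, tr_apply, tr_apply, h2]
      abel
  have u4 : fx ρ [s, t] ⊓ LinearMap.ker (tr ρ a) ⊓ LinearMap.ker (tr ρ b) ⊓ LinearMap.ker (tr ρ (a * b)) = ⊥ := by
    rw [eq_bot_iff]
    intro v hv
    obtain ⟨hv, h3⟩ := Submodule.mem_inf.1 hv
    obtain ⟨hv, h2⟩ := Submodule.mem_inf.1 hv
    obtain ⟨hv, h1⟩ := Submodule.mem_inf.1 hv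
    rw [LinearMap.mem_ker] at h1 h2 h3
    have h4 : tr ρ (a * (b * b)) v = 0 := by
      have e : t * (a * b) = a * (b * b) * t := by rw [← mul_assoc, hta, mul_assoc, htb, ← mul_assoc]
      rw [← rho_tr_eq e (mem_fx_two.1 hv).2, h3, map_zero]
    have h5 := sum_tr (ρ := ρ) hb hab v
    rw [h1, h2, h3, h4, add_zero, add_zero, add_zero] at h5
    have h6 : v = trr ρ a b v := by
      have := add_self_zmod_two (trr ρ a b v)
      linear_combination (norm := abel) -h5 - this
    have h7 := trr_mem (ρ := ρ) ha hb hab v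
    rw [h0, ← h6] at h7
    exact h7
  rw [u4, finrank_bot] at u3
  omega

end FixedSpaces

section TwoCost

variable {N : Type} [AddCommGroup N] [Module (ZMod 2) N] [FiniteDimensional (ZMod 2) N]

/-- The four homomorphisms whose fixed spaces enter the bound. -/
def thA : C3 →* (Par fP : Subgroup (G (ZMod 2))) := (blkR C3).comp (MonoidHom.inl C3 C3)

def thB : C3 →* (Par fP : Subgroup (G (ZMod 2))) := (blkR C3).comp (MonoidHom.inr C3 C3)

def thC : C3 →* (Par fP : Subgroup (G (ZMod 2))) :=
  (blkR C3).comp ((MonoidHom.id C3).prod (MonoidHom.id C3))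

lemma thA_jj : thA jj = blk (jm, 1) := blkR_jj_one

lemma thB_jj : thB jj = blk (1, jm) := blkR_one_jj

lemma thC_jj : thC jj = blk (jm, jm) := blkR_jj_jj

lemma blk_jm_jm : blk (jm, jm) = blk (jm, 1) * blk (1, jm) := by
  rw [← map_mul, Prod.mk_mul_mk, mul_one, one_mul]

lemma wt_eq_fx {H : Type} [Group H] (θ : C3 →* H) (ρ : Representation (ZMod 2) H N) :
    wt (ρ.comp θ) (1 : C3 →* (ZMod 2)ˣ) = fx ρ [θ jj] := by
  ext v
  rw [mem_wt, mem_fx_one]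
  refine ⟨fun h => (h jj).trans (one_smul _ v), fun h A => ?_⟩
  exact (rho_C3_eq θ h A).trans (one_smul _ v).symm

lemma invariants_eq_fx (ρ : Representation (ZMod 2) (Par fP : Subgroup (G (ZMod 2))) N) :
    Representation.invariants (ρ.comp (blkR C3)) = fx ρ [blk (jm, 1), blk (1, jm)] := by
  ext v
  refine ⟨fun h => mem_fx_two.2 ⟨?_, ?_⟩, fun h => mem_invariants_blkR_C3 (mem_fx_two.1 h).1 (mem_fx_two.1 h).2⟩
  · rw [← blkR_jj_one]; exact h (jj, 1)
  · rw [← blkR_one_jj]; exact h (1, jj)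

lemma wt_one_eq_invariants {H : Type} [Group H] (ρ : Representation (ZMod 2) H N) :
    wt ρ (1 : H →* (ZMod 2)ˣ) = Representation.invariants ρ := by
  ext v
  rw [mem_wt, Representation.mem_invariants]
  exact forall_congr' fun g => by rw [MonoidHom.one_apply, Units.val_one, one_smul]

/-- The sum of dimensions of fixed spaces bounding the cohomology of the parabolic subgroup. -/
noncomputable def cst (ρ : Representation (ZMod 2) (Par fP : Subgroup (G (ZMod 2))) N) : ℕ :=
  (finrank (ZMod 2) (wt (ρ.comp thA) (1 : C3 →* (ZMod 2)ˣ)) +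
    finrank (ZMod 2) (wt (ρ.comp thB) (1 : C3 →* (ZMod 2)ˣ)) +
    finrank (ZMod 2) (wt (ρ.comp thC) (1 : C3 →* (ZMod 2)ˣ)) +
    5 * finrank (ZMod 2) (wt (ρ.comp (blkR C3)) (1 : C3 × C3 →* (ZMod 2)ˣ))) / 2

lemma cst_add (ρ : Representation (ZMod 2) (Par fP : Subgroup (G (ZMod 2))) N) (W : Submodule (ZMod 2) N)
    (hW : ∀ g, W ≤ W.comap (ρ g)) : cst (ρ.quotient W hW) + cst (ρ.subrepresentation W hW) ≤ cst ρ := by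
  have h3 : IsPGroup 3 C3 := fun A => ⟨1, Subtype.ext (mem_C3.1 A.2)⟩
  have hC : (Nat.card C3 : ZMod 2) ≠ 0 := natCast_ne_zero_of_pgroup 2 (by decide) h3
  have hCC : (Nat.card (C3 × C3) : ZMod 2) ≠ 0 := by
    rw [Nat.card_prod, Nat.cast_mul]
    exact mul_ne_zero hC hC
  have e1 := wt_superadditive hC thA 1 ρ W hW
  have e2 := wt_superadditive hC thB 1 ρ W hW
  have e3 := wt_superadditive hC thC 1 ρ W hW
  have e4 := wt_superadditive hCC (blkR C3) 1 ρ W hW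
  simp only [cst]
  omega

lemma jm_mul : jm * jm * jm = 1 := by decide +kernel

lemma xe_mul_jm : xe 1 * jm = jm * jm * xe 1 := by decide +kernel

lemma relDim_Z2_le_cst (ρ : Representation (ZMod 2) (Par fP : Subgroup (G (ZMod 2))) N) :
    relDim (Z2 ρ) (B2 ρ) ≤ cst ρ := by
  refine relDim_Z2_le_of_layers (p := 2) isComplement2_C3 (fun N _ _ ρ => cst ρ) ?_ ?_ ?_ ρ
  · intro N _ _ _ ρ W hW
    exact cst_add ρ W hW
  · intro N _ _ _ ρ hQ hb
    have h := relDim_le_of_blk_trivial hQ hb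
    have e : ∀ {S : Type} [Group S] (θ : S →* (Par fP : Subgroup (G (ZMod 2)))) (_ : ∀ s, ∃ x, θ s = blk x),
        wt (ρ.comp θ) (1 : S →* (ZMod 2)ˣ) = ⊤ := fun θ h => by
      rw [eq_top_iff]
      intro v _ s
      obtain ⟨x, hx⟩ := h s
      change ρ (θ s) v = _
      rw [hx, hb]
      exact (one_smul _ v).symm
    have e1 := e thA fun A => ⟨_, blkR_mk A 1⟩
    have e2 := e thB fun A => ⟨_, blkR_mk 1 A⟩
    have e3 := e thC fun A => ⟨_, blkR_mk A A⟩
    have e4 := e (blkR C3) fun A => ⟨_, blkR_mk A.1 A.2⟩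
    rw [cst, e1, e2, e3, e4, finrank_top]
    omega
  · intro N _ _ _ ρ hQ h0
    have h := relDim_le_of_invariants_eq_bot hQ h0
    have h1 : Representation.invariants (ρ.comp (sP fP_mono)) ≤ fx ρ [blk (xe 1, 1), blk (1, xe 1)] := fun v hv => by
      refine mem_fx_two.2 ⟨?_, ?_⟩
      · have := hv (.ofAdd (1, 0))
        change ρ (sP fP_mono (.ofAdd (1, 0))) v = v at this
        rwa [sP_eq_blk, show xe (Multiplicative.toAdd (Multiplicative.ofAdd ((1 : ZMod 2), (0 : ZMod 2)))).2 = 1 from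
          xe_zero] at this
      · have := hv (.ofAdd (0, 1))
        change ρ (sP fP_mono (.ofAdd (0, 1))) v = v at this
        rwa [sP_eq_blk, show xe (Multiplicative.toAdd (Multiplicative.ofAdd ((0 : ZMod 2), (1 : ZMod 2)))).1 = 1 from
          xe_zero] at this
    have h2 := Submodule.finrank_mono h1
    rw [invariants_eq_fx] at h0
    have h3 := two_mul_finrank_fx_le (ρ := ρ) (a := blk (jm, 1)) (b := blk (1, jm)) (s := blk (xe 1, 1))
      (t := blk (1, xe 1)) (by simp only [← map_mul, Prod.mk_mul_mk, mul_one, jm_mul]; exact map_one blk)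
      (by simp only [← map_mul, Prod.mk_mul_mk, mul_one, jm_mul]; exact map_one blk)
      (by simp only [← map_mul, Prod.mk_mul_mk, mul_one, one_mul])
      (by simp only [← map_mul, Prod.mk_mul_mk, mul_one, xe_mul_jm])
      (by simp only [← map_mul, Prod.mk_mul_mk, mul_one, one_mul])
      (by simp only [← map_mul, Prod.mk_mul_mk, mul_one, one_mul])
      (by simp only [← map_mul, Prod.mk_mul_mk, mul_one, xe_mul_jm]) h0
    rw [cst, wt_eq_fx, wt_eq_fx, wt_eq_fx, thA_jj, thB_jj, thC_jj, blk_jm_jm]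
    omega

lemma cst_eq (ρ : Representation (ZMod 2) (Par fP : Subgroup (G (ZMod 2))) N) : cst ρ =
    (finrank (ZMod 2) (fx ρ [blk (jm, 1)]) + finrank (ZMod 2) (fx ρ [blk (1, jm)]) +
      finrank (ZMod 2) (fx ρ [blk (jm, 1) * blk (1, jm)]) +
      5 * finrank (ZMod 2) (fx ρ [blk (jm, 1), blk (1, jm)])) / 2 := by
  rw [cst, wt_eq_fx, wt_eq_fx, wt_eq_fx, wt_one_eq_invariants, invariants_eq_fx, thA_jj, thB_jj, thC_jj, blk_jm_jm]

end TwoCost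

section Stabilizer

variable {N : Type} [AddCommGroup N] [Module (ZMod 2) N]

/-- The stabilizer of a vector. -/
def stb {H : Type} [Group H] (ρ : Representation (ZMod 2) H N) (v : N) : Subgroup H where
  carrier := {g | ρ g v = v}
  one_mem' := by change ρ 1 v = v; rw [map_one]; rfl
  mul_mem' {a b} ha hb := by change ρ (a * b) v = v; rw [rho_mul, hb, ha]
  inv_mem' {a} ha := by
    change ρ a⁻¹ v = v
    conv_lhs => rw [← show ρ a v = v from ha]
    rw [← rho_mul, inv_mul_cancel, map_one]
    rfl

lemma mem_stb {H : Type} [Group H] {ρ : Representation (ZMod 2) H N} {v : N} {g : H} : g ∈ stb ρ v ↔ ρ g v = v :=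
  Iff.rfl

/-- The cyclic permutation of coordinates `0 → 2 → 1 → 3 → 0`. -/
def cyc4 : Equiv.Perm (Fin 4) := ⟨![2, 3, 1, 0], ![3, 2, 0, 1], by decide, by decide⟩

variable {ρ : Representation (ZMod 2) (G (ZMod 2)) N} {v : N}

/-- Some element with the given underlying matrix fixes `v`. -/
def Fxs (ρ : Representation (ZMod 2) (G (ZMod 2)) N) (v : N) (A : Matrix (Fin 4) (Fin 4) (ZMod 2)) : Prop :=
  ∃ g : G (ZMod 2), g.1 = A ∧ ρ g v = v

lemma Fxs.mul {A B C : Matrix (Fin 4) (Fin 4) (ZMod 2)} (hA : Fxs ρ v A) (hB : Fxs ρ v B) (h : A * B = C) :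
    Fxs ρ v C := by
  obtain ⟨a, rfl, ha⟩ := hA
  obtain ⟨b, rfl, hb⟩ := hB
  exact ⟨a * b, h, by rw [rho_mul, hb, ha]⟩

lemma Fxs.rho_eq {g : G (ZMod 2)} {A : Matrix (Fin 4) (Fin 4) (ZMod 2)} (h : Fxs ρ v A) (hg : g.1 = A) :
    ρ g v = v := by
  obtain ⟨a, ha, h⟩ := h
  rwa [Subtype.ext (ha.trans hg.symm)] at h

lemma X_mem_of_mem {L : Subgroup (G (ZMod 2))} {a b c : Fin 4} (h1 : a ≠ b) (h2 : b ≠ c) (h3 : a ≠ c)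
    (hab : X a b (1 : ZMod 2) ∈ L) (hbc : X b c (1 : ZMod 2) ∈ L) : X a c (1 : ZMod 2) ∈ L := by
  have h := X_conj_right h1 h2 h3 (1 : ZMod 2) 1
  rw [show -((1 : ZMod 2) * 1) = 1 by decide] at h
  rw [eq_mul_inv_of_mul_eq h.symm]
  exact L.mul_mem (L.mul_mem (L.mul_mem hbc hab) (L.inv_mem hbc)) (L.inv_mem hab)

lemma eq_top_of_X_mem {L : Subgroup (G (ZMod 2))} (h : ∀ a b, a ≠ b → X a b (1 : ZMod 2) ∈ L) : L = ⊤ := by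
  have hX : ∀ (i j : Fin 4) (_ : i ≠ j) (a : ZMod 2), X i j a ∈ L := fun i j hij a => by
    obtain rfl | rfl := zmod_two_cases a
    · rw [X_zero]; exact L.one_mem
    · exact h i j hij
  refine eq_top_iff.2 fun g _ => ?_
  refine Matrix.SpecialLinearGroup.diagonal_transvection_induction' (· ∈ L) g (fun i j hij c hc => ?_)
    (fun i j hij a => ?_) (fun A B => L.mul_mem)
  · obtain ⟨d, h, -⟩ := exists_tau_diag2n hij hc
    have : d = 1 := Subtype.ext (funext fun i => Subsingleton.elim _ _)
    rw [← h, this, map_one]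
    exact L.one_mem
  · rw [transvection_eq_X]; exact hX i j hij a

lemma eq_top_of_cyc4 {L : Subgroup (G (ZMod 2))} {p : G (ZMod 2)}
    (hp : p.1 = !![0,0,0,1;0,0,1,0;1,0,0,0;0,1,0,0]) (hpL : p ∈ L) (hX : X 3 0 (1 : ZMod 2) ∈ L) : L = ⊤ := by
  have hc : ∀ a b, a ≠ b → p * X a b 1 = X (cyc4 a) (cyc4 b) 1 * p := fun a b h => by
    apply Subtype.ext
    rw [Matrix.SpecialLinearGroup.coe_mul, Matrix.SpecialLinearGroup.coe_mul, X_coe h,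
      X_coe (cyc4.injective.ne h), hp]
    clear hX hpL hp
    revert a b
    decide +kernel
  have hs : ∀ a b, a ≠ b → X a b (1 : ZMod 2) ∈ L → X (cyc4 a) (cyc4 b) (1 : ZMod 2) ∈ L := fun a b h hm => by
    rw [eq_mul_inv_of_mul_eq (hc a b h).symm]
    exact L.mul_mem (L.mul_mem hpL hm) (L.inv_mem hpL)
  have h1 : ∀ a, X a (cyc4 a) (1 : ZMod 2) ∈ L := by
    have k0 : X 0 2 (1 : ZMod 2) ∈ L := hs 3 0 (by decide) hX
    have k2 : X 2 1 (1 : ZMod 2) ∈ L := hs 0 2 (by decide) k0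
    have k1 : X 1 3 (1 : ZMod 2) ∈ L := hs 2 1 (by decide) k2
    intro a
    fin_cases a <;> assumption
  have h2 : ∀ a, X a (cyc4 (cyc4 a)) (1 : ZMod 2) ∈ L := fun a =>
    X_mem_of_mem (b := cyc4 a) (by revert a; decide) (by revert a; decide) (by revert a; decide) (h1 a) (h1 _)
  have h3 : ∀ a, X a (cyc4 (cyc4 (cyc4 a))) (1 : ZMod 2) ∈ L := fun a =>
    X_mem_of_mem (b := cyc4 a) (by revert a; decide) (by revert a; decide) (by revert a; decide) (h1 a) (h2 _)
  refine eq_top_of_X_mem fun a b h => ?_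
  obtain rfl | rfl | rfl : b = cyc4 a ∨ b = cyc4 (cyc4 a) ∨ b = cyc4 (cyc4 (cyc4 a)) := by
    revert a b; decide
  exacts [h1 a, h2 a, h3 a]

end Stabilizer

section Alternating

/-! The matrices `m…` are the images of permutations of `{1,…,8}`, written by their cycles, under an isomorphism
from the alternating group of degree eight onto the matrix group. -/

abbrev m123 : Matrix (Fin 4) (Fin 4) (ZMod 2) := !![0,1,0,0;1,1,0,0;0,0,0,1;0,0,1,1]

abbrev m234 : Matrix (Fin 4) (Fin 4) (ZMod 2) := !![0,1,1,1;0,1,0,1;1,1,1,0;0,1,0,0]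

abbrev m456 : Matrix (Fin 4) (Fin 4) (ZMod 2) := !![0,1,0,0;1,1,0,0;0,0,1,1;0,0,1,0]

abbrev m345 : Matrix (Fin 4) (Fin 4) (ZMod 2) := !![1,0,1,0;0,0,0,1;1,0,0,0;0,1,0,1]

abbrev m12_34 : Matrix (Fin 4) (Fin 4) (ZMod 2) := !![0,1,0,1;0,0,1,0;0,1,0,0;1,0,1,0]

abbrev m12_3564 : Matrix (Fin 4) (Fin 4) (ZMod 2) := !![0,0,1,0;0,1,1,1;1,1,1,0;0,1,0,0]

abbrev m12_3654 : Matrix (Fin 4) (Fin 4) (ZMod 2) := !![0,1,1,1;0,1,0,1;1,0,1,0;1,1,1,0]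

abbrev m148 : Matrix (Fin 4) (Fin 4) (ZMod 2) := !![1,0,1,1;1,1,1,0;1,1,1,1;0,1,1,1]

abbrev m14823 : Matrix (Fin 4) (Fin 4) (ZMod 2) := !![1,1,1,0;0,1,0,1;0,1,1,1;1,0,0,0]

abbrev m18234 : Matrix (Fin 4) (Fin 4) (ZMod 2) := !![0,0,0,1;1,1,0,0;0,1,0,0;1,0,1,0]

abbrev m145 : Matrix (Fin 4) (Fin 4) (ZMod 2) := !![0,0,1,0;1,1,0,1;1,0,1,0;0,1,1,0]

abbrev m14523 : Matrix (Fin 4) (Fin 4) (ZMod 2) := !![1,1,0,1;1,1,1,1;0,1,1,0;1,1,0,0]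

abbrev m15234 : Matrix (Fin 4) (Fin 4) (ZMod 2) := !![0,1,1,0;1,1,1,0;1,0,1,1;1,0,0,1]

abbrev m14532 : Matrix (Fin 4) (Fin 4) (ZMod 2) := !![1,1,1,1;0,0,1,0;1,1,0,0;1,0,1,0]

abbrev m567 : Matrix (Fin 4) (Fin 4) (ZMod 2) := !![1,1,1,1;1,0,1,0;0,0,0,1;0,0,1,1]

abbrev m678 : Matrix (Fin 4) (Fin 4) (ZMod 2) := !![1,0,1,0;0,1,0,1;1,0,0,0;0,1,0,0]

abbrev m34567 : Matrix (Fin 4) (Fin 4) (ZMod 2) := !![1,1,1,0;0,0,1,1;1,1,1,1;1,0,0,1]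

abbrev m34675 : Matrix (Fin 4) (Fin 4) (ZMod 2) := !![0,1,1,0;0,0,1,0;0,1,0,1;1,1,0,1]

abbrev m35476 : Matrix (Fin 4) (Fin 4) (ZMod 2) := !![0,0,0,1;1,0,0,0;1,1,0,0;1,0,1,1]

abbrev m148_567 : Matrix (Fin 4) (Fin 4) (ZMod 2) := !![1,1,0,1;0,1,0,0;0,1,1,1;1,0,0,0]

abbrev m1548_67 : Matrix (Fin 4) (Fin 4) (ZMod 2) := !![0,1,0,0;1,0,0,1;1,1,1,1;0,1,1,1]

abbrev m16584 : Matrix (Fin 4) (Fin 4) (ZMod 2) := !![1,0,1,0;1,0,0,1;0,0,0,1;0,1,0,0]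

abbrev m1524_36 : Matrix (Fin 4) (Fin 4) (ZMod 2) := !![0,0,0,1;0,0,1,0;1,0,0,0;0,1,0,0]

abbrev m13_27_45_68 : Matrix (Fin 4) (Fin 4) (ZMod 2) := !![1,0,0,0;0,1,0,0;0,0,1,0;1,0,0,1]

abbrev m132 : Matrix (Fin 4) (Fin 4) (ZMod 2) := !![1,1,0,0;1,0,0,0;0,0,1,1;0,0,1,0]

abbrev m465 : Matrix (Fin 4) (Fin 4) (ZMod 2) := !![1,1,0,0;1,0,0,0;0,0,0,1;0,0,1,1]

abbrev m24_35 : Matrix (Fin 4) (Fin 4) (ZMod 2) := !![1,0,0,1;0,1,0,0;0,1,1,1;0,0,0,1]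

abbrev m15342 : Matrix (Fin 4) (Fin 4) (ZMod 2) := !![1,1,1,0;1,0,0,0;1,0,0,1;0,0,1,0]

abbrev m152_346 : Matrix (Fin 4) (Fin 4) (ZMod 2) := !![0,1,0,1;1,1,0,0;1,1,1,1;0,0,0,1]

abbrev m23456 : Matrix (Fin 4) (Fin 4) (ZMod 2) := !![1,1,0,1;1,1,1,0;1,0,1,1;1,1,0,0]

abbrev m2345678 : Matrix (Fin 4) (Fin 4) (ZMod 2) := !![1,0,1,1;0,1,1,1;0,1,1,0;1,1,1,1]

abbrev m23478 : Matrix (Fin 4) (Fin 4) (ZMod 2) := !![1,1,1,0;1,0,1,0;1,0,0,1;0,1,1,0]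

abbrev m2378_45 : Matrix (Fin 4) (Fin 4) (ZMod 2) := !![0,0,1,1;0,0,1,0;1,1,1,1;1,0,0,1]

abbrev m13_278_45 : Matrix (Fin 4) (Fin 4) (ZMod 2) := !![0,0,1,0;0,0,0,1;1,0,1,0;0,1,1,1]

abbrev m687 : Matrix (Fin 4) (Fin 4) (ZMod 2) := !![0,0,1,0;0,0,0,1;1,0,1,0;0,1,0,1]

abbrev m478 : Matrix (Fin 4) (Fin 4) (ZMod 2) := !![1,0,1,1;0,1,1,0;0,1,0,0;1,1,0,0]

def cjA : G (ZMod 2) := ⟨!![1,1,1,0;1,0,0,1;1,1,1,1;1,0,1,0], by decide +kernel⟩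

def cjB : G (ZMod 2) := ⟨!![0,1,1,0;1,1,1,1;1,1,0,0;1,0,0,0], by decide +kernel⟩

def cjC : G (ZMod 2) := ⟨!![1,0,0,1;0,1,1,0;0,1,1,1;1,1,0,1], by decide +kernel⟩

variable {N : Type} [AddCommGroup N] [Module (ZMod 2) N] {ρ : Representation (ZMod 2) (G (ZMod 2)) N} {v : N}

lemma fxs_345 (h123 : Fxs ρ v m123) (h234 : Fxs ρ v m234) (h456 : Fxs ρ v m456) :
    Fxs ρ v m345 := by
  have h12_34 := h123.mul h234 (C := m12_34) (by decide +kernel)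
  have h12_3564 := h456.mul h12_34 (C := m12_3564) (by decide +kernel)
  have h12_3654 := h456.mul h12_3564 (C := m12_3654) (by decide +kernel)
  have h345 := h12_3564.mul h12_3654 (C := m345) (by decide +kernel)
  exact h345

lemma fxs_234 (h123 : Fxs ρ v m123) (h148 : Fxs ρ v m148) :
    Fxs ρ v m234 := by
  have h14823 := h123.mul h148 (C := m14823) (by decide +kernel)
  have h18234 := h148.mul h14823 (C := m18234) (by decide +kernel)
  have h234 := h18234.mul h148 (C := m234) (by decide +kernel)
  exact h234

lemma fxs_234_345 (h123 : Fxs ρ v m123) (h145 : Fxs ρ v m145) :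
    Fxs ρ v m234 ∧ Fxs ρ v m345 := by
  have h14523 := h123.mul h145 (C := m14523) (by decide +kernel)
  have h15234 := h145.mul h14523 (C := m15234) (by decide +kernel)
  have h234 := h15234.mul h145 (C := m234) (by decide +kernel)
  have h14532 := h123.mul h14523 (C := m14532) (by decide +kernel)
  have h345 := h14532.mul h123 (C := m345) (by decide +kernel)
  exact ⟨h234, h345⟩

lemma fxs_456_678 (h345 : Fxs ρ v m345) (h567 : Fxs ρ v m567) (h148 : Fxs ρ v m148) :
    Fxs ρ v m456 ∧ Fxs ρ v m678 := by
  have h34567 := h345.mul h567 (C := m34567) (by decide +kernel)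
  have h34675 := h567.mul h345 (C := m34675) (by decide +kernel)
  have h35476 := h34567.mul h34675 (C := m35476) (by decide +kernel)
  have h456 := h34675.mul h35476 (C := m456) (by decide +kernel)
  have h148_567 := h567.mul h148 (C := m148_567) (by decide +kernel)
  have h1548_67 := h456.mul h148_567 (C := m1548_67) (by decide +kernel)
  have h16584 := h148_567.mul h1548_67 (C := m16584) (by decide +kernel)
  have h678 := h16584.mul h148_567 (C := m678) (by decide +kernel)
  exact ⟨h456, h678⟩

lemma fxs_generators (h123 : Fxs ρ v m123) (h234 : Fxs ρ v m234) (h345 : Fxs ρ v m345) (h456 : Fxs ρ v m456) (h678 : Fxs ρ v m678) :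
    Fxs ρ v m1524_36 ∧ Fxs ρ v m13_27_45_68 := by
  have h132 := h123.mul h123 (C := m132) (by decide +kernel)
  have h465 := h456.mul h456 (C := m465) (by decide +kernel)
  have h24_35 := h345.mul h234 (C := m24_35) (by decide +kernel)
  have h15342 := h24_35.mul h132 (C := m15342) (by decide +kernel)
  have h152_346 := h15342.mul h465 (C := m152_346) (by decide +kernel)
  have h1524_36 := h152_346.mul h234 (C := m1524_36) (by decide +kernel)
  have h23456 := h234.mul h456 (C := m23456) (by decide +kernel)
  have h2345678 := h23456.mul h678 (C := m2345678) (by decide +kernel)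
  have h23478 := h2345678.mul h465 (C := m23478) (by decide +kernel)
  have h2378_45 := h23478.mul h345 (C := m2378_45) (by decide +kernel)
  have h13_278_45 := h2378_45.mul h123 (C := m13_278_45) (by decide +kernel)
  have h13_27_45_68 := h13_278_45.mul h678 (C := m13_27_45_68) (by decide +kernel)
  exact ⟨h1524_36, h13_27_45_68⟩

lemma rho_eq_of_fxs (h123 : Fxs ρ v m123) (h234 : Fxs ρ v m234) (h345 : Fxs ρ v m345) (h456 : Fxs ρ v m456)
    (h678 : Fxs ρ v m678) (g : G (ZMod 2)) : ρ g v = v := by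
  obtain ⟨⟨p, hp, hpv⟩, hX⟩ := fxs_generators h123 h234 h345 h456 h678
  have hXv : ρ (X 3 0 1) v = v := hX.rho_eq (by rw [X_coe (by decide)]; decide +kernel)
  have h := eq_top_of_cyc4 (L := stb ρ v) hp hpv hXv
  exact mem_stb.1 (h ▸ Subgroup.mem_top g)

end Alternating

section Counting

variable {N : Type} [AddCommGroup N] [Module (ZMod 2) N]

/-- The vectors fixed by the elements with matrices in a list. -/
def fxm (ρ : Representation (ZMod 2) (G (ZMod 2)) N) (L : List (Matrix (Fin 4) (Fin 4) (ZMod 2))) :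
    Submodule (ZMod 2) N where
  carrier := {v | ∀ g : G (ZMod 2), g.1 ∈ L → ρ g v = v}
  zero_mem' g _ := map_zero _
  add_mem' {a b} ha hb g hg := by rw [map_add, ha g hg, hb g hg]
  smul_mem' r a ha g hg := by rw [map_smul, ha g hg]

variable {ρ : Representation (ZMod 2) (G (ZMod 2)) N}

lemma mem_fxm_cons {A : Matrix (Fin 4) (Fin 4) (ZMod 2)} {L : List (Matrix (Fin 4) (Fin 4) (ZMod 2))} (hd : A.det = 1)
    {v : N} : v ∈ fxm ρ (A :: L) ↔ Fxs ρ v A ∧ v ∈ fxm ρ L := by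
  refine ⟨fun h => ⟨⟨⟨A, hd⟩, rfl, h ⟨A, hd⟩ (.head _)⟩, fun g hg => h g (.tail _ hg)⟩, fun h g hg => ?_⟩
  obtain hg | hg := List.mem_cons.1 hg
  · exact h.1.rho_eq hg
  · exact h.2 g hg

lemma mem_fxm_one {A : Matrix (Fin 4) (Fin 4) (ZMod 2)} (hA : A.det = 1) {v : N} : v ∈ fxm ρ [A] ↔ Fxs ρ v A := by
  rw [mem_fxm_cons hA]
  exact and_iff_left fun g hg => absurd hg List.not_mem_nil

lemma mem_fxm_two {A B : Matrix (Fin 4) (Fin 4) (ZMod 2)} (hA : A.det = 1) (hB : B.det = 1) {v : N} :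
    v ∈ fxm ρ [A, B] ↔ Fxs ρ v A ∧ Fxs ρ v B := by
  rw [mem_fxm_cons hA, mem_fxm_one hB]

lemma mem_fxm_three {A B C : Matrix (Fin 4) (Fin 4) (ZMod 2)} (hA : A.det = 1) (hB : B.det = 1) (hC : C.det = 1)
    {v : N} : v ∈ fxm ρ [A, B, C] ↔ Fxs ρ v A ∧ Fxs ρ v B ∧ Fxs ρ v C := by
  rw [mem_fxm_cons hA, mem_fxm_two hB hC]

variable [FiniteDimensional (ZMod 2) N]

lemma finrank_fxm_le {L L' : List (Matrix (Fin 4) (Fin 4) (ZMod 2))} (h : G (ZMod 2))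
    (hL : ∀ A ∈ L', ∃ B ∈ L, h.1 * B = A * h.1) :
    finrank (ZMod 2) (fxm ρ L) ≤ finrank (ZMod 2) (fxm ρ L') := by
  rw [← finrank_map_rho (ρ := ρ) h]
  refine Submodule.finrank_mono ?_
  rintro _ ⟨v, hv, rfl⟩ g hg
  obtain ⟨B, hB, e⟩ := hL g.1 hg
  have h1 : (h⁻¹ * (g * h)).1 = B := by
    have h2 : (h⁻¹ * h).1 = 1 := by rw [inv_mul_cancel]; rfl
    rw [Matrix.SpecialLinearGroup.coe_mul] at h2
    rw [Matrix.SpecialLinearGroup.coe_mul, Matrix.SpecialLinearGroup.coe_mul, ← e, ← Matrix.mul_assoc, h2, Matrix.one_mul]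
  have h3 : ρ (h⁻¹ * (g * h)) v = v := hv _ (by rw [h1]; exact hB)
  rw [← rho_mul]
  conv_rhs => rw [← h3]
  rw [← rho_mul, mul_inv_cancel_left]

lemma finrank_fxm_two_le {A B A' B' : Matrix (Fin 4) (Fin 4) (ZMod 2)} (h : G (ZMod 2)) (hA : h.1 * A = A' * h.1)
    (hB : h.1 * B = B' * h.1) : finrank (ZMod 2) (fxm ρ [A, B]) ≤ finrank (ZMod 2) (fxm ρ [A', B']) := by
  refine finrank_fxm_le h fun M hM => ?_
  obtain rfl | hM := List.mem_cons.1 hM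
  · exact ⟨A, .head _, hA⟩
  obtain rfl := List.mem_singleton.1 hM
  exact ⟨B, .tail _ (.head _), hB⟩

lemma finrank_fxm_three_le {A B C A' B' C' : Matrix (Fin 4) (Fin 4) (ZMod 2)} (h : G (ZMod 2))
    (hA : h.1 * A = A' * h.1) (hB : h.1 * B = B' * h.1) (hC : h.1 * C = C' * h.1) :
    finrank (ZMod 2) (fxm ρ [A, B, C]) ≤ finrank (ZMod 2) (fxm ρ [A', B', C']) := by
  refine finrank_fxm_le h fun M hM => ?_
  obtain rfl | hM := List.mem_cons.1 hM
  · exact ⟨A, .head _, hA⟩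
  obtain rfl | hM := List.mem_cons.1 hM
  · exact ⟨B, .tail _ (.head _), hB⟩
  obtain rfl := List.mem_singleton.1 hM
  exact ⟨C, .tail _ (.tail _ (.head _)), hC⟩

lemma five_mul_finrank_le (h0 : ∀ v, (∀ g, ρ g v = v) → v = 0) :
    5 * finrank (ZMod 2) (fxm ρ [m123, m456]) ≤ 3 * finrank (ZMod 2) (fxm ρ [m123]) := by
  have d123 : m123.det = 1 := by decide +kernel
  have d234 : m234.det = 1 := by decide +kernel
  have d345 : m345.det = 1 := by decide +kernel
  have d456 : m456.det = 1 := by decide +kernel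
  have d148 : m148.det = 1 := by decide +kernel
  have d145 : m145.det = 1 := by decide +kernel
  have d567 : m567.det = 1 := by decide +kernel
  have d687 : m687.det = 1 := by decide +kernel
  have d478 : m478.det = 1 := by decide +kernel
  have cA : finrank (ZMod 2) (fxm ρ [m123, m456]) ≤ finrank (ZMod 2) (fxm ρ [m123, m478]) :=
    finrank_fxm_two_le cjA (by decide +kernel) (by decide +kernel)
  have cB : finrank (ZMod 2) (fxm ρ [m123, m456, m478]) ≤ finrank (ZMod 2) (fxm ρ [m567, m123, m148]) :=
    finrank_fxm_three_le cjB (by decide +kernel) (by decide +kernel) (by decide +kernel)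
  have cC : finrank (ZMod 2) (fxm ρ [m123, m456, m478]) ≤ finrank (ZMod 2) (fxm ρ [m687, m123, m145]) :=
    finrank_fxm_three_le cjC (by decide +kernel) (by decide +kernel) (by decide +kernel)
  have e1 := finrank_add_le_of_le (A := fxm ρ [m123, m456]) (B := fxm ρ [m123, m478]) (C := fxm ρ [m123])
    (fun v hv => (mem_fxm_one d123).2 ((mem_fxm_two d123 d456).1 hv).1)
    fun v hv => (mem_fxm_one d123).2 ((mem_fxm_two d123 d478).1 hv).1
  have e1' : fxm ρ [m123, m456] ⊓ fxm ρ [m123, m478] ≤ fxm ρ [m123, m456, m478] := fun v hv => by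
    obtain ⟨h1, h2⟩ := Submodule.mem_inf.1 hv
    rw [mem_fxm_two d123 d456] at h1
    exact (mem_fxm_three d123 d456 d478).2 ⟨h1.1, h1.2, ((mem_fxm_two d123 d478).1 h2).2⟩
  have e2 := finrank_add_le_of_le (A := fxm ρ [m123, m456]) (B := fxm ρ [m123, m234]) (C := fxm ρ [m123])
    (fun v hv => (mem_fxm_one d123).2 ((mem_fxm_two d123 d456).1 hv).1)
    fun v hv => (mem_fxm_one d123).2 ((mem_fxm_two d123 d234).1 hv).1
  have e2' : fxm ρ [m123, m456] ⊓ fxm ρ [m123, m234] ≤ fxm ρ [m123, m234, m456] := fun v hv => by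
    obtain ⟨h1, h2⟩ := Submodule.mem_inf.1 hv
    rw [mem_fxm_two d123 d456] at h1
    exact (mem_fxm_three d123 d234 d456).2 ⟨h1.1, ((mem_fxm_two d123 d234).1 h2).2, h1.2⟩
  have e3 := finrank_add_le_of_le (A := fxm ρ [m123, m234, m345]) (B := fxm ρ [m567, m123, m148])
    (C := fxm ρ [m123, m234]) (fun v hv => by
      have h := (mem_fxm_three d123 d234 d345).1 hv
      exact (mem_fxm_two d123 d234).2 ⟨h.1, h.2.1⟩) fun v hv => by
      have h := (mem_fxm_three d567 d123 d148).1 hv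
      exact (mem_fxm_two d123 d234).2 ⟨h.2.1, fxs_234 h.2.1 h.2.2⟩
  have e3' : fxm ρ [m123, m234, m345] ⊓ fxm ρ [m567, m123, m148] = ⊥ := by
    rw [eq_bot_iff]
    intro v hv
    obtain ⟨h1, h2⟩ := Submodule.mem_inf.1 hv
    rw [mem_fxm_three d123 d234 d345] at h1
    rw [mem_fxm_three d567 d123 d148] at h2
    obtain ⟨k1, k2⟩ := fxs_456_678 h1.2.2 h2.1 h2.2.2
    exact (Submodule.mem_bot _).2 (h0 v (rho_eq_of_fxs h1.1 h1.2.1 h1.2.2 k1 k2))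
  have e4 := finrank_add_le_of_le (A := fxm ρ [m687, m123, m145]) (B := fxm ρ [m123, m234, m456])
    (C := fxm ρ [m123, m234, m345]) (fun v hv => by
      have h := (mem_fxm_three d687 d123 d145).1 hv
      exact (mem_fxm_three d123 d234 d345).2 ⟨h.2.1, fxs_234_345 h.2.1 h.2.2⟩) fun v hv => by
      have h := (mem_fxm_three d123 d234 d456).1 hv
      exact (mem_fxm_three d123 d234 d345).2 ⟨h.1, h.2.1, fxs_345 h.1 h.2.1 h.2.2⟩
  have e4' : fxm ρ [m687, m123, m145] ⊓ fxm ρ [m123, m234, m456] = ⊥ := by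
    rw [eq_bot_iff]
    intro v hv
    obtain ⟨h1, h2⟩ := Submodule.mem_inf.1 hv
    rw [mem_fxm_three d687 d123 d145] at h1
    rw [mem_fxm_three d123 d234 d456] at h2
    exact (Submodule.mem_bot _).2 (h0 v (rho_eq_of_fxs h2.1 h2.2.1 (fxs_345 h2.1 h2.2.1 h2.2.2) h2.2.2
      (h1.1.mul h1.1 (C := m678) (by decide +kernel))))
  replace e1' := Submodule.finrank_mono e1'
  replace e2' := Submodule.finrank_mono e2'
  rw [e3', finrank_bot] at e3
  rw [e4', finrank_bot] at e4
  omega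

section Commuting

variable {H : Type} [Group H] {σ : Representation (ZMod 2) H N}

lemma rho_tr_of_commute {g h : H} (hc : Commute g h) {v : N} (hv : σ g v = v) : σ g (tr σ h v) = tr σ h v :=
  rho_tr_eq hc.eq hv

lemma tr_mem_fx {a b g h : H} (hg : ∀ v, σ g v = v → σ h v = v → v ∈ fx σ [a, b]) (h3 : h * h * h = 1)
    (hc : Commute g h) {v : N} (hv : v ∈ fx σ [g]) : tr σ h v ∈ fx σ [a, b] :=
  hg _ (rho_tr_of_commute hc (mem_fx_one.1 hv)) (rho_tr h3 v)

/-- Lower bounds for the dimension in terms of two commuting elements of order three. -/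
lemma sum_finrank_fx_le {a b : H} (ha : a * a * a = 1) (hb : b * b * b = 1) (hab : a * b = b * a) :
    finrank (ZMod 2) (fx σ [a]) + finrank (ZMod 2) (fx σ [b]) + finrank (ZMod 2) (fx σ [a * b]) +
      finrank (ZMod 2) (fx σ [a * (b * b)]) ≤ finrank (ZMod 2) N + 3 * finrank (ZMod 2) (fx σ [a, b]) ∧
    finrank (ZMod 2) (fx σ [a * b]) + finrank (ZMod 2) (fx σ [a * (b * b)]) ≤
      finrank (ZMod 2) N + finrank (ZMod 2) (fx σ [a, b]) := by
  have hc : Commute a b := hab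
  have ca : Commute a (a * b) := (Commute.refl a).mul_right hc
  have cb : Commute b (a * b) := hc.symm.mul_right (Commute.refl b)
  have cbb : Commute b (b * b) := (Commute.refl b).mul_right (Commute.refl b)
  have cabb : Commute a (a * (b * b)) := (Commute.refl a).mul_right (hc.mul_right hc)
  have cbbb : Commute b (a * (b * b)) := hc.symm.mul_right cbb
  have hcube : ∀ {x y : H}, Commute x y → x * x * x = 1 → y * y * y = 1 → x * y * (x * y) * (x * y) = 1 := by
    intro x y h hx hy
    rw [h.symm.mul_mul_mul_comm, (h.symm.mul_left h.symm).mul_mul_mul_comm, hx, hy, one_mul]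
  have h3 := hcube hc ha hb
  have hbb : b * b * (b * b) * (b * b) = 1 := hcube (Commute.refl b) hb hb
  have h4 := hcube (hc.mul_right hc) ha hbb
  have hsq : ∀ {v : N} {x : H}, x * x * x = 1 → σ (x * x) v = v → σ x v = v := fun {v x} hx h => by
    conv_lhs => rw [← h]
    rw [← rho_mul, ← mul_assoc, hx, map_one]
    rfl
  have hmul : ∀ {v : N} {x y : H}, σ x v = v → σ (x * y) v = v → σ y v = v := fun {v x y} hx h =>
    rho_injective (ρ := σ) x (by rw [← rho_mul, h, hx])
  have k12 : ∀ v, σ a v = v → σ b v = v → v ∈ fx σ [a, b] := fun v h1 h2 => mem_fx_two.2 ⟨h1, h2⟩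
  have k13 : ∀ v, σ a v = v → σ (a * b) v = v → v ∈ fx σ [a, b] := fun v h1 h2 => k12 v h1 (hmul h1 h2)
  have k23 : ∀ v, σ b v = v → σ (a * b) v = v → v ∈ fx σ [a, b] := fun v h1 h2 =>
    k12 v (hmul h1 (by rwa [← hab])) h1
  have k14 : ∀ v, σ a v = v → σ (a * (b * b)) v = v → v ∈ fx σ [a, b] := fun v h1 h2 =>
    k12 v h1 (hsq hb (hmul h1 h2))
  have k24 : ∀ v, σ b v = v → σ (a * (b * b)) v = v → v ∈ fx σ [a, b] := fun v h1 h2 => by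
    have : σ (b * b) v = v := by rw [rho_mul, h1, h1]
    refine k12 v (hmul this ?_) h1
    rwa [← (hc.mul_right hc).eq]
  have k34 : ∀ v, σ (a * b) v = v → σ (a * (b * b)) v = v → v ∈ fx σ [a, b] := fun v h1 h2 => by
    rw [← mul_assoc] at h2
    exact k23 v (hmul h1 h2) h1
  have i12 : fx σ [a] ⊓ fx σ [b] ≤ fx σ [a, b] := fun v hv => by
    obtain ⟨h1, h2⟩ := Submodule.mem_inf.1 hv
    exact k12 v (mem_fx_one.1 h1) (mem_fx_one.1 h2)
  have i3 : (fx σ [a] ⊔ fx σ [b]) ⊓ fx σ [a * b] ≤ fx σ [a, b] := fun v hv => by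
    obtain ⟨h1, h2⟩ := Submodule.mem_inf.1 hv
    rw [← tr_of_rho_eq (mem_fx_one.1 h2)]
    obtain ⟨x, hx, y, hy, rfl⟩ := Submodule.mem_sup.1 h1
    rw [map_add]
    exact add_mem (tr_mem_fx k13 h3 ca hx) (tr_mem_fx k23 h3 cb hy)
  have i4 : (fx σ [a] ⊔ fx σ [b] ⊔ fx σ [a * b]) ⊓ fx σ [a * (b * b)] ≤ fx σ [a, b] := fun v hv => by
    obtain ⟨h1, h2⟩ := Submodule.mem_inf.1 hv
    rw [← tr_of_rho_eq (mem_fx_one.1 h2)]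
    obtain ⟨w, hw, z, hz, rfl⟩ := Submodule.mem_sup.1 h1
    obtain ⟨x, hx, y, hy, rfl⟩ := Submodule.mem_sup.1 hw
    rw [map_add, map_add]
    exact add_mem (add_mem (tr_mem_fx k14 h4 cabb hx) (tr_mem_fx k24 h4 cbbb hy))
      (tr_mem_fx k34 h4 (cabb.mul_left cbbb) hz)
  have e1 := Submodule.finrank_sup_add_finrank_inf_eq (fx σ [a]) (fx σ [b])
  have e2 := Submodule.finrank_sup_add_finrank_inf_eq (fx σ [a] ⊔ fx σ [b]) (fx σ [a * b])
  have e3 := Submodule.finrank_sup_add_finrank_inf_eq (fx σ [a] ⊔ fx σ [b] ⊔ fx σ [a * b]) (fx σ [a * (b * b)])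
  have e4 := Submodule.finrank_le (fx σ [a] ⊔ fx σ [b] ⊔ fx σ [a * b] ⊔ fx σ [a * (b * b)])
  have i34 : fx σ [a * b] ⊓ fx σ [a * (b * b)] ≤ fx σ [a, b] := fun v hv => by
    obtain ⟨h1, h2⟩ := Submodule.mem_inf.1 hv
    exact k34 v (mem_fx_one.1 h1) (mem_fx_one.1 h2)
  have e5 := Submodule.finrank_sup_add_finrank_inf_eq (fx σ [a * b]) (fx σ [a * (b * b)])
  have e6 := Submodule.finrank_le (fx σ [a * b] ⊔ fx σ [a * (b * b)])
  replace i34 := Submodule.finrank_mono i34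
  replace i12 := Submodule.finrank_mono i12
  replace i3 := Submodule.finrank_mono i3
  replace i4 := Submodule.finrank_mono i4
  exact ⟨by omega, by omega⟩

end Commuting

end Counting

section TwoFinal

variable {N : Type} [AddCommGroup N] [Module (ZMod 2) N] [FiniteDimensional (ZMod 2) N]

lemma coe_blk_jm_jm : (blk (jm, jm) : (Par fP : Subgroup (G (ZMod 2)))).1.1 = m123 := by
  rw [show (blk (jm, jm) : (Par fP : Subgroup (G (ZMod 2)))).1 = blkG (jm, jm) from rfl, blkG_coe]
  decide +kernel

lemma coe_blk_jm_jm_sq : (blk (jm, jm * jm) : (Par fP : Subgroup (G (ZMod 2)))).1.1 = m456 := by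
  rw [show (blk (jm, jm * jm) : (Par fP : Subgroup (G (ZMod 2)))).1 = blkG (jm, jm * jm) from rfl, blkG_coe]
  decide +kernel

lemma relDim_lt_of_no_fixed [Nontrivial N] (ρ : Representation (ZMod 2) (G (ZMod 2)) N)
    (h0 : ∀ v, (∀ g, ρ g v = v) → v = 0) : relDim (Z2 ρ) (B2 ρ) < 2 * finrank (ZMod 2) N := by
  have k1 := relDim_le_parabolic 2 ρ
  have k2 := relDim_Z2_le_cst (ρ.comp (Par fP).subtype)
  have k3 := cst_eq (ρ.comp (Par fP).subtype)
  have k4 := five_mul_finrank_le h0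
  have ha : blk (jm, 1) * blk (jm, 1) * blk (jm, 1) = 1 := by
    rw [← map_mul, ← map_mul, Prod.mk_mul_mk, Prod.mk_mul_mk, jm_mul, one_mul, one_mul]; exact map_one _
  have hb : blk (1, jm) * blk (1, jm) * blk (1, jm) = 1 := by
    rw [← map_mul, ← map_mul, Prod.mk_mul_mk, Prod.mk_mul_mk, jm_mul, one_mul, one_mul]; exact map_one _
  have hab : blk (jm, 1) * blk (1, jm) = blk (1, jm) * blk (jm, 1) := by
    simp only [← map_mul, Prod.mk_mul_mk, one_mul, mul_one]
  have hsq : blk (jm, 1) * (blk (1, jm) * blk (1, jm)) = blk (jm, jm * jm) := by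
    simp only [← map_mul, Prod.mk_mul_mk, one_mul, mul_one]
  obtain ⟨k5, k6⟩ := sum_finrank_fx_le (σ := ρ.comp (Par fP).subtype) ha hb hab
  have k7 : finrank (ZMod 2) (fx (ρ.comp (Par fP).subtype) [blk (jm, 1) * blk (1, jm)]) ≤
      finrank (ZMod 2) (fx (ρ.comp (Par fP).subtype) [blk (jm, 1) * (blk (1, jm) * blk (1, jm))]) := by
    rw [← finrank_map_rho (ρ := ρ.comp (Par fP).subtype) (blk (1, xe 1)), hsq, ← blk_jm_jm]
    refine Submodule.finrank_mono ?_
    rintro _ ⟨v, hv, rfl⟩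
    have e : blk (jm, jm * jm) * blk (1, xe 1) = blk (1, xe 1) * blk (jm, jm) := by
      rw [← map_mul, ← map_mul, Prod.mk_mul_mk, Prod.mk_mul_mk, one_mul, mul_one, xe_mul_jm]
    rw [mem_fx_one, ← rho_mul, e, rho_mul, mem_fx_one.1 hv]
  have d123 : m123.det = 1 := by decide +kernel
  have d456 : m456.det = 1 := by decide +kernel
  have k8 : fxm ρ [m123] ≤ fx (ρ.comp (Par fP).subtype) [blk (jm, 1) * blk (1, jm)] := fun v hv => by
    rw [← blk_jm_jm, mem_fx_one]
    exact ((mem_fxm_one d123).1 hv).rho_eq coe_blk_jm_jm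
  have k9 : fx (ρ.comp (Par fP).subtype) [blk (jm, 1), blk (1, jm)] ≤ fxm ρ [m123, m456] := fun v hv => by
    obtain ⟨h1, h2⟩ := mem_fx_two.1 hv
    refine (mem_fxm_two d123 d456).2 ⟨⟨(blk (jm, jm)).1, coe_blk_jm_jm, ?_⟩,
      ⟨(blk (jm, jm * jm)).1, coe_blk_jm_jm_sq, ?_⟩⟩
    · change (ρ.comp (Par fP).subtype) (blk (jm, jm)) v = v
      rw [blk_jm_jm, rho_mul, h2, h1]
    · change (ρ.comp (Par fP).subtype) (blk (jm, jm * jm)) v = v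
      rw [← hsq, rho_mul, rho_mul, h2, h2, h1]
  replace k8 := Submodule.finrank_mono k8
  replace k9 := Submodule.finrank_mono k9
  have k10 : 0 < finrank (ZMod 2) N := finrank_pos
  omega

end TwoFinal

section TwoTrivial

variable {N : Type} [AddCommGroup N] [Module (ZMod 2) N]

lemma pif_two_one {H : Type} [Group H] (c : H → H → N) : pif 2 c 1 = 0 := by
  rw [pif, Finset.sum_range_succ, Finset.sum_range_one, one_pow, one_pow, add_self_zmod_two]

variable {ρ : Representation (ZMod 2) (G (ZMod 2)) N} {c : G (ZMod 2) → G (ZMod 2) → N}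

lemma mem_B2_of_trivial_two [FiniteDimensional (ZMod 2) N] (hρ : ∀ g v, ρ g v = v) (hc : c ∈ Z2 ρ)
    (hp : pif 2 c (X 0 1 1 * X 2 3 1) = 0) : c ∈ B2 ρ := by
  have y : ∀ a b, fP a ≤ fP b → ∀ s : ZMod 2, (Par fP).subtype (Y fP a b s) = X a b s := fun a b h s => Y_coe h s
  have hc' : pull (ZMod 2) (Par fP : Subgroup (G (ZMod 2))).subtype c ∈ Z2 (ρ.comp (Par fP).subtype) := pull_Z2 _ hc
  have hq' : ∀ x v, ρ.comp (Par fP).subtype (qP fP_mono x) v = v := fun x v => hρ _ v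
  have hpif : ∀ x, pif 2 (pull (ZMod 2) (Par fP).subtype c) x = pif 2 c ((Par fP).subtype x) := fun x => by
    simp only [pif, pull_apply, map_pow]
  have hbet : ∀ x y, bet (pull (ZMod 2) (Par fP).subtype c) x y = bet c ((Par fP).subtype x) ((Par fP).subtype y) :=
    fun x y => rfl
  have h03 : ∀ s : ZMod 2, pif 2 c (X 0 3 s) = 0 := fun s => by
    obtain rfl | rfl := zmod_two_cases s
    · rw [X_zero, pif_two_one]
    · have h := sqQ_eq_zero_of_blk_trivial hq' hc' (fun x v => hρ _ v)
      rwa [sqQ, ← Y03, hpif, y 0 3 (by decide)] at h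
  have hconj : ∀ g {x : G (ZMod 2)}, x ^ 2 = 1 → pif 2 c x = pif 2 c (g * x * g⁻¹) := fun g {x} hx => by
    rw [pif_conj 2 hc (hρ _) hx, hρ]
  have h01 : ∀ s : ZMod 2, pif 2 c (X 0 1 s) = 0 := fun s => by
    obtain ⟨g, s', t', h, -⟩ := exists_conj_X_X (a := 0) (b := 1) (c := 0) (d := 1) (a' := 0) (b' := 3)
      (by decide) (by decide) (Equiv.swap (1 : Fin 4) 3) (by decide) (by decide) rfl rfl s s
    rw [hconj g (X_pow_char 2 _ _ _), h]
    exact h03 _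
  have h23 : ∀ s : ZMod 2, pif 2 c (X 2 3 s) = 0 := fun s => by
    obtain ⟨g, s', t', h, -⟩ := exists_conj_X_X (a := 2) (b := 3) (c := 2) (d := 3) (a' := 0) (b' := 3)
      (by decide) (by decide) (Equiv.swap (0 : Fin 4) 2) (by decide) (by decide) rfl rfl s s
    rw [hconj g (X_pow_char 2 _ _ _), h]
    exact h03 _
  have h12 : ∀ s : ZMod 2, pif 2 c (X 1 2 s) = 0 := fun s => by
    obtain ⟨g, s', t', h, -⟩ := exists_conj_X_X (a := 1) (b := 2) (c := 1) (d := 2) (a' := 0) (b' := 3)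
      (by decide) (by decide) (⟨![1, 0, 3, 2], ![1, 0, 3, 2], by decide, by decide⟩ : Equiv.Perm (Fin 4))
      (by decide) (by decide) rfl rfl s s
    rw [hconj g (X_pow_char 2 _ _ _), h]
    exact h03 _
  have hst : ∀ s t : ZMod 2, pif 2 c (X 0 1 s * X 2 3 t) = 0 := fun s t => by
    obtain rfl | rfl := zmod_two_cases s
    · rw [X_zero, one_mul, h23]
    obtain rfl | rfl := zmod_two_cases t
    · rw [X_zero, mul_one, h01]
    · exact hp
  have hsq : ∀ a b, X a b (1 : ZMod 2) * X a b 1 = 1 := fun a b => by rw [← sq]; exact X_pow_char 2 a b _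
  have b1 : bet c (X 0 1 1) (X 2 3 1) = 0 := by
    have h := pif_two_mul hc (X_comm (by decide) (by decide) (1 : ZMod 2) 1) (hρ (X 0 1 1)) (hρ (X 2 3 1)) (hsq 0 1)
    rwa [hp, h01, h23, zero_add, zero_add, eq_comm] at h
  have b2 : bet c (X 0 3 1) (X 1 2 1) = 0 := by
    have hcm := X_comm (K := ZMod 2) (a := 0) (b := 3) (c := 1) (d := 2) (by decide) (by decide) 1 1
    have h := pif_two_mul hc hcm (hρ (X 0 3 1)) (hρ (X 1 2 1)) (hsq 0 3)
    obtain ⟨g, s', t', e1, e2⟩ := exists_conj_X_X (a := 0) (b := 3) (c := 1) (d := 2) (a' := 0) (b' := 1) (c' := 2)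
      (d' := 3) (by decide) (by decide)
      (⟨![0, 3, 1, 2], ![0, 2, 3, 1], by decide, by decide⟩ : Equiv.Perm (Fin 4)) rfl rfl rfl rfl (1 : ZMod 2) 1
    have e : g * (X 0 3 1 * X 1 2 1) * g⁻¹ = X 0 1 s' * X 2 3 t' := by
      rw [← e2, ← e1]
      group
    have h2 : (X 0 3 (1 : ZMod 2) * X 1 2 1) ^ 2 = 1 := by
      rw [sq, (show Commute _ _ from hcm.symm).mul_mul_mul_comm, hsq, hsq, one_mul]
    rwa [hconj g h2, e, hst, h03, h12, zero_add, zero_add, eq_comm] at h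
  refine mem_B2_of_restrict (Par fP : Subgroup (G (ZMod 2))).subtype (Subgroup.subtype_injective _) ?_ ρ hc ?_
  · rw [Subgroup.range_subtype, Ne, CharP.cast_eq_zero_iff (ZMod 2) 2]
    exact fun hd => index_Uni (K := ZMod 2) 2 (hd.trans (Subgroup.index_dvd_of_le (Uni_le_Par fP_mono)))
  have hq := pull_qP_mem_B2_two hq' hc' (by
    rw [beQ, ← Y03, ← Y12, hbet, y 0 3 (by decide), y 1 2 (by decide), b2])
    (by rw [sqQ, ← Y03, hpif, y 0 3 (by decide), h03])
  have hs := pull_sP_mem_B2_two hc' (fun x v => hρ _ v)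
    (by rw [hbet, y 0 1 (by decide), y 2 3 (by decide), b1])
    (by rw [hpif, y 0 1 (by decide), h01]) (by rw [hpif, y 2 3 (by decide), h23])
  exact Zr_inf_Zr_le_B2 hq' (Submodule.mem_inf.2 ⟨mem_Zr.2 ⟨hc', hq⟩, mem_Zr.2 ⟨hc', hs⟩⟩)

lemma relDim_le_of_trivial_two [FiniteDimensional (ZMod 2) N] (hρ : ∀ g v, ρ g v = v) :
    relDim (Z2 ρ) (B2 ρ) ≤ finrank (ZMod 2) N := by
  let Φ : (G (ZMod 2) → G (ZMod 2) → N) →ₗ[ZMod 2] N :=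
    { toFun := fun c => pif 2 c (X 0 1 1 * X 2 3 1)
      map_add' := fun c d => Finset.sum_add_distrib
      map_smul' := fun r c => by simp only [pif, Pi.smul_apply, RingHom.id_apply, Finset.smul_sum] }
  have h := relDim_le_add_ker Φ (Z2 ρ) (B2 ρ) ⊤ fun _ _ => Submodule.mem_top
  have h0 : relDim (Z2 ρ ⊓ LinearMap.ker Φ) (B2 ρ) = 0 := relDim_eq_zero fun c hc =>
    mem_B2_of_trivial_two hρ (Submodule.mem_inf.1 hc).1 (Submodule.mem_inf.1 hc).2
  rwa [h0, finrank_top] at h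

/-- The bound over the field with two elements. -/
lemma relDim_lt_two [FiniteDimensional (ZMod 2) N] [Nontrivial N]
    (hirr : ∀ P : Submodule (ZMod 2) N, (∀ g, ∀ x ∈ P, ρ g x ∈ P) → P = ⊥ ∨ P = ⊤) :
    relDim (Z2 ρ) (B2 ρ) < 2 * finrank (ZMod 2) N := by
  have hpos : 0 < finrank (ZMod 2) N := finrank_pos
  rcases hirr (Representation.invariants ρ) (fun g x hx => by rwa [hx g]) with h | h
  · refine relDim_lt_of_no_fixed ρ fun v hv => ?_
    have : v ∈ Representation.invariants ρ := hv
    rwa [h, Submodule.mem_bot] at this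
  · have := relDim_le_of_trivial_two (ρ := ρ) fun g v => by
      have : v ∈ Representation.invariants ρ := h ▸ Submodule.mem_top
      exact this g
    omega

end TwoTrivial

section Transport

variable {K M : Type} [Field K] [Finite K] [AddCommGroup M] (p : ℕ) [Fact p.Prime] [Module (ZMod p) M]
  [FiniteDimensional (ZMod p) M]

/-- Bounds over the prime field carry over to every field of prime order. -/
lemma exists_relDim_le_prime (ρ : Representation (ZMod p) (G K) M) (hK : Nat.card K = p) :
    ∃ f : G (ZMod p) →* G K, Function.Surjective f ∧
      relDim (Z2 ρ) (B2 ρ) ≤ relDim (Z2 (ρ.comp f)) (B2 (ρ.comp f)) := by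
  have : Fintype K := Fintype.ofFinite K
  have hc : CharP K p := charP_of_card_eq_prime (by rw [← Nat.card_eq_fintype_card, hK])
  let e : ZMod p ≃+* K := ZMod.ringEquiv K (by rw [← Nat.card_eq_fintype_card, hK])
  let f : G (ZMod p) →* G K := Matrix.SpecialLinearGroup.map e.toRingHom
  have hs : Function.Surjective f := fun g => ⟨Matrix.SpecialLinearGroup.map e.symm.toRingHom g, by
    ext i j
    exact e.apply_symm_apply _⟩
  have hi : Function.Injective f := fun g h hgh => by
    ext i j
    exact e.injective (congrArg (fun x : G K => x.1 i j) hgh)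
  refine ⟨f, hs, relDim_le_of_restrict f hi ?_ ρ⟩
  rw [MonoidHom.range_eq_top.2 hs, Subgroup.index_top, Nat.cast_one]
  exact one_ne_zero

end Transport

end SL4

/-- Let `q = pᵉ`, `G = SL(4,q)`, `F = 𝔽ₚ` the field with `p` elements, and `M` a
finite-dimensional irreducible `FG`-module.  Then `dim H²(G,M) < 2 · dim M`. -/
theorem stmt_11 (p e q : ℕ) [hp : Fact p.Prime] (he : 0 < e) (hq : q = p ^ e)
    (K : Type) [Field K] [Fintype K] (hK : Fintype.card K = q)
    (M : Type) [AddCommGroup M] [Module (ZMod p) M] [FiniteDimensional (ZMod p) M]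
    (ρ : Representation (ZMod p) (Matrix.SpecialLinearGroup (Fin 4) K) M)
    (hnontrivial : Nontrivial M)
    (hirred : ∀ P : Submodule (ZMod p) M,
      (∀ (g : Matrix.SpecialLinearGroup (Fin 4) K) (x : M), x ∈ P → ρ g x ∈ P) →
        P = ⊥ ∨ P = ⊤) :
    Module.finrank (ZMod p) (groupCohomology (Rep.of ρ) 2) <
      2 * Module.finrank (ZMod p) M := by
  rcases le_or_gt 4 q with h4 | h4
  · have hchar : CharP K p := charP_of_card_eq_prime_pow (f := e) (by rw [hK, hq])
    let : Algebra (ZMod p) K := ZMod.algebra K p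
    exact SL4.finrank_lt_of_four_le p ρ (by rwa [Nat.card_eq_fintype_card, hK])
  have hp2 := hp.out.two_le
  have hp4 : p < 4 := (Nat.le_self_pow he.ne' p).trans_lt (hq ▸ h4)
  have he1 : e = 1 := by
    by_contra h1
    have h2 : 2 ^ 2 ≤ p ^ e := (Nat.pow_le_pow_left hp2 2).trans (Nat.pow_le_pow_right (by omega) (by omega))
    omega
  have hKp : Nat.card K = p := by rw [Nat.card_eq_fintype_card, hK, hq, he1, pow_one]
  refine (SL4.finrank_groupCohomology_le ρ).trans_lt ?_
  obtain ⟨f, hf, h⟩ := SL4.exists_relDim_le_prime p ρ hKp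
  refine h.trans_lt ?_
  clear h4 hq
  interval_cases p
  · refine SL4.relDim_lt_two fun P hP => hirred P fun g x hx => ?_
    obtain ⟨g, rfl⟩ := hf g
    exact hP g x hx
  · exact SL4.relDim_lt_three _
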